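/- Let c_n^{(6)} denote the n-th Fourier coefficient of the hauptmodul j₆(τ) = (η(2τ)η(3τ)³/(η(τ)η(6τ)³))³ - 3 of Γ₀(6). Then for every integer n ≥ -1, one has 2n·c_n^{(6)} = Σ_{r∈ℤ} t₂^{(6*)}(4n - r²) + 7σ₁^{(6)}(n) + 26σ₁^{(3)}(n/2) - 3σ₁^{(2)}(n/3), where the sum over r is finite. -/

import Mathlib

open Complex Matrix

noncomputable section

/-- `SL(2, ℝ)`. -/
abbrev SL2R := Matrix.SpecialLinearGroup (Fin 2) ℝ

/-- `q = e^{2πiz}` (also used as `ζ = e^{2πiz}`). -/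
def qc (z : ℂ) : ℂ := Complex.exp (2 * Real.pi * Complex.I * z)

/-- The Dedekind eta function `η(z) = q^{1/24} ∏_{n ≥ 1} (1 - q^n)` (intended for `Im z > 0`). -/
def dedekindEta (z : ℂ) : ℂ :=
  Complex.exp (Real.pi * Complex.I * z / 12) *
    ∏' n : ℕ, (1 - Complex.exp (2 * Real.pi * Complex.I * ((n : ℂ) + 1) * z))

/-- The hauptmodul `j_N` of `Γ₀(N)` for `N ∈ {2, 3, 5, 7, 13, 6, 10}`. -/
def jn (N : ℕ) (z : ℂ) : ℂ :=
  if N = 6 then (dedekindEta (2 * z) * dedekindEta (3 * z) ^ 3 / (dedekindEta z * dedekindEta (6 * z) ^ 3)) ^ 3 - 3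
  else if N = 10 then dedekindEta (2 * z) * dedekindEta (5 * z) ^ 5 / (dedekindEta z * dedekindEta (10 * z) ^ 5) - 1
  else (dedekindEta z / dedekindEta ((N : ℂ) * z)) ^ (24 / (N - 1)) + 24 / ((N : ℂ) - 1)

/-- The hauptmodul `j_N^*` of the Fricke group `Γ₀^*(N)` for `N ∈ {2, 3, 5, 7, 13, 6, 10}`. -/
def jnStar (N : ℕ) (z : ℂ) : ℂ :=
  if N = 6 then
    (dedekindEta z * dedekindEta (3 * z) / (dedekindEta (2 * z) * dedekindEta (6 * z))) ^ 6 + 6 +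
      2 ^ 6 * (dedekindEta (2 * z) * dedekindEta (6 * z) / (dedekindEta z * dedekindEta (3 * z))) ^ 6
  else if N = 10 then
    (dedekindEta z * dedekindEta (5 * z) / (dedekindEta (2 * z) * dedekindEta (10 * z))) ^ 4 + 4 +
      2 ^ 4 * (dedekindEta (2 * z) * dedekindEta (10 * z) / (dedekindEta z * dedekindEta (5 * z))) ^ 4
  else
    (dedekindEta z / dedekindEta ((N : ℂ) * z)) ^ (24 / (N - 1)) + 24 / ((N : ℂ) - 1) +
      (N : ℂ) ^ (12 / (N - 1)) * (dedekindEta ((N : ℂ) * z) / dedekindEta z) ^ (24 / (N - 1))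

/-- `f` has the `q`-expansion `f(τ) = Σ_{n ≥ n₀} (a n) q^n` on the upper half-plane. -/
def HasQExp (f : ℂ → ℂ) (a : ℤ → ℂ) (n₀ : ℤ) : Prop :=
  (∀ n < n₀, a n = 0) ∧
    ∀ τ : ℂ, 0 < τ.im →
      HasSum (fun m : ℕ => a (n₀ + m) * qc τ ^ (n₀ + (m : ℤ))) (f τ)

/-- `Γ₀(N)` viewed as a subgroup of `SL(2, ℝ)`. -/
def Gamma0SL2R (N : ℕ) : Subgroup SL2R :=
  (CongruenceSubgroup.Gamma0 N).map
    (Matrix.SpecialLinearGroup.map (Int.castRingHom ℝ))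

/-- The set of Atkin–Lehner matrices `W_e` of level `N`:
`W_e = e^{-1/2} [[xe, y], [zN, we]]`, `x, y, z, w ∈ ℤ` (determinant `1` being automatic). -/
def atkinLehnerSet (N e : ℕ) : Set SL2R :=
  { g | ∃ x y z w : ℤ,
      g.1 = (Real.sqrt e)⁻¹ • !![(x : ℝ) * e, (y : ℝ); (z : ℝ) * N, (w : ℝ) * e] }

/-- The Fricke group `Γ₀^*(N)`, generated by `Γ₀(N)` and all Atkin–Lehner involutions `W_e`
for `e ∣ N` with `gcd(e, N/e) = 1`. -/
def FrickeGroup (N : ℕ) : Subgroup SL2R :=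
  Subgroup.closure
    ((Gamma0SL2R N : Set SL2R) ∪
      ⋃ e ∈ {e : ℕ | e ∣ N ∧ Nat.Coprime e (N / e)}, atkinLehnerSet N e)

/-- The Gram matrix of the integral binary quadratic form `[a, b, c]`. -/
def formMat (a b c : ℤ) : Matrix (Fin 2) (Fin 2) ℝ :=
  !![(a : ℝ), (b : ℝ) / 2; (b : ℝ) / 2, (c : ℝ)]

/-- `𝒬_{d,N}`: positive definite integral binary quadratic forms `[a, b, c]` of
discriminant `-d` with `N ∣ a`. -/
def QdN (d : ℤ) (N : ℕ) : Set (Matrix (Fin 2) (Fin 2) ℝ) :=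
  { M | ∃ a b c : ℤ, M = formMat a b c ∧ 0 < a ∧ b ^ 2 - 4 * a * c = -d ∧ (N : ℤ) ∣ a }

/-- `𝒬_{d,N,h}`: members of `𝒬_{d,N}` with `b ≡ h (mod 2N)`. -/
def QdNh (d : ℤ) (N : ℕ) (h : ℤ) : Set (Matrix (Fin 2) (Fin 2) ℝ) :=
  { M | ∃ a b c : ℤ, M = formMat a b c ∧ 0 < a ∧ b ^ 2 - 4 * a * c = -d ∧ (N : ℤ) ∣ a ∧
      (b : ZMod (2 * N)) = (h : ZMod (2 * N)) }

/-- Orbit relation of the (right) action `Q ↦ Q ∘ g`, i.e. `M ↦ gᵀ M g`, of `Γ ≤ SL(2, ℝ)`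
on a set `S` of Gram matrices of quadratic forms. -/
def formRel (Γ : Subgroup SL2R) (S : Set (Matrix (Fin 2) (Fin 2) ℝ)) (Q Q' : S) : Prop :=
  ∃ g ∈ Γ, Q'.1 = (g.1)ᵀ * Q.1 * g.1

/-- The CM point `α_Q` of a positive definite form (as a point of `ℂ`; it lies in the upper
half-plane): `α_Q = (-b + i √d) / (2a) = (-(b/2) + i √(det M)) / a`. -/
def cmPointC (M : Matrix (Fin 2) (Fin 2) ℝ) : ℂ :=
  ((-(M 0 1) : ℝ) + Complex.I * Real.sqrt M.det) / ((M 0 0 : ℝ) : ℂ)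

/-- The order of the stabilizer of the form `M` in `Γ/{±1}` (the stabilizer in `Γ` contains
`±1` and has twice the cardinality). -/
def stabOrder (Γ : Subgroup SL2R) (M : Matrix (Fin 2) (Fin 2) ℝ) : ℕ :=
  Nat.card { g : SL2R // g ∈ Γ ∧ (g.1)ᵀ * M * g.1 = M } / 2

/-- The modular trace `Σ_{Q ∈ S/Γ} f(α_Q) / |Γ̄_Q|`. -/
def classTrace (Γ : Subgroup SL2R) (f : ℂ → ℂ)
    (S : Set (Matrix (Fin 2) (Fin 2) ℝ)) : ℂ :=
  ∑ᶠ O : Quot (formRel Γ S),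
    f (cmPointC (Quot.out O).1) / (stabOrder Γ (Quot.out O).1 : ℂ)

/-- `t₂^{(N*)}(d)`, where `P` is the polynomial with `φ₂(j_N^*) = P(j_N^*)`;
includes the paper's conventions at nonpositive indices. -/
def t2Star (N : ℕ) (P : Polynomial ℂ) (d : ℤ) : ℂ :=
  if 0 < d then
    classTrace (FrickeGroup N) (fun z => Polynomial.eval (jnStar N z) P) (QdN d N)
  else if d = 0 then (if N = 2 then 5 else if N = 6 ∨ N = 10 then 5 / 2 else 3)
  else if d = -1 then -1
  else if d = -4 then -2
  else 0

/-- `σ₁^{(N)}(x) = Σ_{d ∣ x, N ∤ d} d` for `x ∈ ℤ_{>0}`, `(N-1)/24` at `x = 0`, and `0`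
off `ℤ_{≥0}`. -/
def sigmaN (N : ℕ) (x : ℚ) : ℂ :=
  if x = 0 then ((N : ℂ) - 1) / 24
  else if 0 < x ∧ x.den = 1 then
    ∑ d ∈ (Nat.divisors x.num.toNat).filter (fun d => ¬ N ∣ d), (d : ℂ)
  else 0

/-- `σ₁(x) = Σ_{d ∣ x} d` for `x ∈ ℤ_{>0}` and `0` otherwise. -/
def sigmaQ (x : ℚ) : ℂ :=
  if 0 < x ∧ x.den = 1 then ∑ d ∈ Nat.divisors x.num.toNat, (d : ℂ) else 0

/-- A weakly holomorphic Jacobi form of weight `k` and index `m`. -/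
structure WeakJacobiForm (k : ℤ) (m : ℕ) where
  toFun : ℂ → ℂ → ℂ
  holo : DifferentiableOn ℂ (fun p : ℂ × ℂ => toFun p.1 p.2)
      ({τ : ℂ | 0 < τ.im} ×ˢ (Set.univ : Set ℂ))
  slash_inv : ∀ a b c d : ℤ, a * d - b * c = 1 → ∀ τ z : ℂ, 0 < τ.im →
    ((c : ℂ) * τ + d) ^ (-k) *
        Complex.exp (-(2 * Real.pi * Complex.I * m * c * z ^ 2) / ((c : ℂ) * τ + d)) *
        toFun (((a : ℂ) * τ + b) / ((c : ℂ) * τ + d)) (z / ((c : ℂ) * τ + d)) =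
      toFun τ z
  elliptic : ∀ lm mu : ℤ, ∀ τ z : ℂ, 0 < τ.im →
    Complex.exp (2 * Real.pi * Complex.I * m * ((lm : ℂ) ^ 2 * τ + 2 * lm * z)) *
        toFun τ (z + lm * τ + mu) = toFun τ z
  coeff : ℤ → ℤ → ℂ
  coeff_neg_finite : {n : ℤ | n < 0 ∧ ∃ r : ℤ, coeff n r ≠ 0}.Finite
  expansion : ∀ τ z : ℂ, 0 < τ.im →
    HasSum (fun p : ℤ × ℤ => coeff p.1 p.2 * qc τ ^ p.1 * qc z ^ p.2) (toFun τ z)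

/-- Meromorphy of weight `k` at all cusps: at each cusp `γ∞`, the function `F|_k γ` has a
Fourier expansion in fractional powers of `q` with only finitely many negative terms. -/
def MeromAtCusps (k : ℤ) (F : ℂ → ℂ) : Prop :=
  ∀ a b c d : ℤ, a * d - b * c = 1 →
    ∃ (M : ℕ) (cs : ℤ → ℂ) (n₀ : ℤ), 0 < M ∧
      ∀ τ : ℂ, 0 < τ.im →
        HasSum
          (fun j : ℕ => cs (n₀ + j) *
            Complex.exp (2 * Real.pi * Complex.I * τ / M) ^ (n₀ + (j : ℤ)))
          (((c : ℂ) * τ + d) ^ (-k) * F (((a : ℂ) * τ + b) / ((c : ℂ) * τ + d)))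

/-- The Möbius action of an element of `SL(2, ℝ)` on `ℂ`. -/
def moebius (g : SL2R) (z : ℂ) : ℂ :=
  ((g.1 0 0 : ℝ) * z + ((g.1 0 1 : ℝ) : ℂ)) / ((g.1 1 0 : ℝ) * z + ((g.1 1 1 : ℝ) : ℂ))

/-- A weakly holomorphic modular function on `Γ`: holomorphic on the upper half-plane,
`Γ`-invariant, with poles only at the cusps. -/
def IsWeaklyHolModularFn (Γ : Subgroup SL2R) (f : ℂ → ℂ) : Prop :=
  DifferentiableOn ℂ f {z : ℂ | 0 < z.im} ∧
    (∀ g ∈ Γ, ∀ z : ℂ, 0 < z.im → f (moebius g z) = f z) ∧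
    MeromAtCusps 0 f

/-- The set `L_{h, d/4N}` of vectors
`X = [[b + h/2N, c/N], [-a, -(b + h/2N)]]`, `a, b, c ∈ ℤ`, of norm `q(X) = d/4N`. -/
def LhSet (N : ℕ) (h d : ℤ) : Set (Matrix (Fin 2) (Fin 2) ℝ) :=
  { X | ∃ a b c : ℤ,
      X = !![(b : ℝ) + (h : ℝ) / (2 * N), (c : ℝ) / N;
             -(a : ℝ), -((b : ℝ) + (h : ℝ) / (2 * N))] ∧
      (2 * b * N + h) ^ 2 - 4 * a * c * N = -d }

/-- The map `X ↦ N ⬝ [[0,-1],[1,0]] ⬝ X` from vectors to Gram matrices of quadratic forms. -/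
def vecToForm (N : ℕ) (X : Matrix (Fin 2) (Fin 2) ℝ) : Matrix (Fin 2) (Fin 2) ℝ :=
  (N : ℝ) • (!![(0 : ℝ), -1; 1, 0] * X)

/-- Orbit relation of `Γ` acting by conjugation `g.X = g X g⁻¹` on a set `S` of vectors. -/
def vecRel (Γ : Subgroup SL2R) (S : Set (Matrix (Fin 2) (Fin 2) ℝ)) (X X' : S) : Prop :=
  ∃ g ∈ Γ, X'.1 = g.1 * X.1 * (g⁻¹).1

/-- The Heegner point `D_X ∈ ℍ` of a vector `X` of positive norm. -/
def heegnerC (X : Matrix (Fin 2) (Fin 2) ℝ) : ℂ :=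
  ((X 0 0 / X 1 0 : ℝ) : ℂ) + Complex.I * Real.sqrt (X.det / (X 1 0) ^ 2)

/-- The order of the stabilizer of the vector `X` in `Γ/{±1}`. -/
def vecStabOrder (Γ : Subgroup SL2R) (X : Matrix (Fin 2) (Fin 2) ℝ) : ℕ :=
  Nat.card { g : SL2R // g ∈ Γ ∧ g.1 * X * (g⁻¹).1 = X } / 2

/-- The modular trace `t_f(h, m) = Σ_{X ∈ Γ\L_{h,m}} f(D_X) / |Γ̄_X|`. -/
def vecTrace (Γ : Subgroup SL2R) (f : ℂ → ℂ) (S : Set (Matrix (Fin 2) (Fin 2) ℝ)) : ℂ :=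
  ∑ᶠ O : Quot (vecRel Γ S), f (heegnerC (Quot.out O).1) / (vecStabOrder Γ (Quot.out O).1 : ℂ)

/-- The weight-2 Eisenstein series `E₂(z) = 1 - 24 Σ_{n ≥ 1} σ₁(n) qⁿ`. -/
def E2 (z : ℂ) : ℂ :=
  1 - 24 * ∑' n : ℕ, (∑ d ∈ Nat.divisors (n + 1), (d : ℂ)) * qc z ^ (n + 1)

/-- `E₂^{(N)}(z) = N E₂(Nz) - E₂(z)`. -/
def E2N (N : ℕ) (z : ℂ) : ℂ := (N : ℂ) * E2 ((N : ℂ) * z) - E2 z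

end

namespace FrickeSix

open scoped Topology

/-- The Euler product `∏ (1 - x^n)`. -/
noncomputable def eulerProd (x : ℂ) : ℂ := ∏' n : ℕ, (1 - x ^ (n + 1))

lemma qc_ne_zero (z : ℂ) : qc z ≠ 0 := Complex.exp_ne_zero _

lemma qc_add (z w : ℂ) : qc (z + w) = qc z * qc w := by
  simp only [qc, ← Complex.exp_add]; ring_nf

lemma qc_natCast_mul (k : ℕ) (z : ℂ) : qc (k * z) = qc z ^ k := by
  simp only [qc, ← Complex.exp_nat_mul]; ring_nf

lemma qc_intCast (k : ℤ) : qc k = 1 := by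
  rw [qc, Complex.exp_eq_one_iff]; exact ⟨k, by ring⟩

lemma norm_qc (z : ℂ) : ‖qc z‖ = Real.exp (-(2 * Real.pi * z.im)) := by
  rw [qc, Complex.norm_exp]
  congr 1
  simp

lemma norm_qc_lt_one {z : ℂ} (hz : 0 < z.im) : ‖qc z‖ < 1 := by
  rw [norm_qc, Real.exp_lt_one_iff]
  have := Real.pi_pos
  nlinarith [mul_pos this hz]

lemma differentiable_qc : Differentiable ℂ qc := by
  unfold qc; fun_prop

lemma hasDerivAt_qc (z : ℂ) : HasDerivAt qc (2 * Real.pi * I * qc z) z := by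
  have h : HasDerivAt (fun z : ℂ => 2 * Real.pi * I * z) (2 * Real.pi * I) z := by
    simpa using (hasDerivAt_id z).const_mul (2 * Real.pi * I : ℂ)
  have := h.cexp
  rwa [mul_comm (cexp _)] at this

/-- Every nonzero point of the unit disc is `q` of a point of the upper half-plane. -/
lemma exists_qc_eq {x : ℂ} (hx : x ≠ 0) (hx1 : ‖x‖ < 1) : ∃ z : ℂ, 0 < z.im ∧ qc z = x := by
  have hp : (2 * Real.pi * I : ℂ) ≠ 0 := by simp [Real.pi_ne_zero]
  have hq : qc (Complex.log x / (2 * Real.pi * I)) = x := by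
    rw [qc, mul_div_cancel₀ _ hp, Complex.exp_log hx]
  refine ⟨_, ?_, hq⟩
  rw [← hq, norm_qc, Real.exp_lt_one_iff] at hx1
  have := Real.pi_pos
  by_contra h
  push Not at h
  nlinarith [mul_nonneg this.le (neg_nonneg.2 h)]

lemma eulerProd_ne_zero {x : ℂ} (hx : ‖x‖ < 1) : eulerProd x ≠ 0 := by
  rcases eq_or_ne x 0 with rfl | h0
  · simp [eulerProd]
  · obtain ⟨z, hz, rfl⟩ := exists_qc_eq h0 hx
    have := ModularForm.eta_tprod_ne_zero (z := z) hz
    simpa [eulerProd, ModularForm.eta_q_eq_pow, qc] using this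

lemma dedekindEta_eq (z : ℂ) :
    dedekindEta z = Complex.exp (Real.pi * I * z / 12) * eulerProd (qc z) := by
  unfold dedekindEta eulerProd qc
  congr 2
  ext n
  rw [← Complex.exp_nat_mul]
  push_cast
  ring_nf

lemma dedekindEta_eq_eta (z : ℂ) : dedekindEta z = ModularForm.eta z := by
  rw [dedekindEta_eq]
  simp only [ModularForm.eta, eulerProd, ModularForm.eta_q_eq_pow, qc, Function.Periodic.qParam]
  congr 2
  push_cast; ring

lemma dedekindEta_ne_zero {z : ℂ} (hz : 0 < z.im) : dedekindEta z ≠ 0 := by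
  rw [dedekindEta_eq_eta]
  exact ModularForm.eta_ne_zero hz

lemma dedekindEta_S : ∀ z : ℂ, 0 < z.im → ∃ ρ : ℂ, ρ ≠ 0 ∧ ρ ^ 2 = z / I ∧
    ∀ k : ℝ, 0 < k → dedekindEta (-1 / (k * z)) = ρ * (Real.sqrt k : ℂ) * dedekindEta (k * z) := by
  intro z hz
  have hz0 : z ≠ 0 := by rintro rfl; simp at hz
  have sq : ∀ w : ℂ, Complex.sqrt w ^ 2 = w := fun w => by
    rcases eq_or_ne w 0 with rfl | h
    · simp [Complex.sqrt]
    · rw [_root_.sqrt_eq_exp h, ← Complex.exp_nat_mul]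
      push_cast
      rw [mul_div_cancel₀ _ (by norm_num), Complex.exp_log h]
  refine ⟨(Complex.sqrt I)⁻¹ * Complex.sqrt z, ?_, ?_, ?_⟩
  · intro h
    have h2 := congrArg (fun w => w ^ 2) h
    simp only [mul_pow, inv_pow, sq] at h2
    simp [hz0] at h2
  · rw [mul_pow, inv_pow, sq, sq]; field_simp
  · intro k hk
    have h1 := ModularForm.eta_comp_eq_csqrt_I_inv (x := k * z) (by
      show 0 < (k * z : ℂ).im
      simp only [Complex.im_ofReal_mul]; positivity)
    simp only [Function.comp, Pi.smul_apply, Pi.mul_apply, smul_eq_mul] at h1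
    rw [dedekindEta_eq_eta, dedekindEta_eq_eta, h1]
    have : Complex.sqrt (k * z) = (Real.sqrt k : ℂ) * Complex.sqrt z := by
      have hk0 : (k : ℂ) * z ≠ 0 := by simp [hk.ne', hz0]
      rw [_root_.sqrt_eq_exp hk0, _root_.sqrt_eq_exp hz0, Complex.log_ofReal_mul hk hz0, add_div,
        Complex.exp_add]
      congr 1
      rw [Real.sqrt_eq_rpow, Real.rpow_def_of_pos hk]
      push_cast
      ring_nf
    rw [this]; ring

lemma multipliable_odd_factors {x : ℂ} (hx : ‖x‖ < 1) :
    Multipliable fun n : ℕ => 1 - x ^ (2 * n + 1) := by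
  simp_rw [sub_eq_add_neg]
  apply multipliable_one_add_of_summable
  have h : Summable fun n : ℕ => ‖x‖ ^ n := summable_geometric_of_lt_one (norm_nonneg _) hx
  refine Summable.of_nonneg_of_le (fun _ => norm_nonneg _) (fun n => ?_) h
  rw [norm_neg, norm_pow]
  exact pow_le_pow_of_le_one (norm_nonneg _) hx.le (by lia)

lemma eulerProd_eq_odd_mul {x : ℂ} (hx : ‖x‖ < 1) :
    eulerProd x = (∏' n : ℕ, (1 - x ^ (2 * n + 1))) * eulerProd (x ^ 2) := by
  have hx2 : ‖x ^ 2‖ < 1 := by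
    rw [norm_pow]; exact pow_lt_one₀ (norm_nonneg _) hx (by norm_num)
  have h2 := ModularForm.multipliable_one_sub_pow hx2
  have := tprod_even_mul_odd (f := fun n : ℕ => 1 - x ^ (n + 1)) (multipliable_odd_factors hx)
    (by simpa only [← pow_mul, show ∀ k : ℕ, 2 * (k + 1) = 2 * k + 1 + 1 by intro k; ring] using h2)
  simp only [eulerProd]
  rw [← this]
  congr 1
  simp only [← pow_mul, show ∀ k : ℕ, 2 * (k + 1) = 2 * k + 1 + 1 by intro k; ring]

/-- `E(-x) E(x) E(x⁴) = E(x²)³` for the Euler product `E`. -/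
lemma eulerProd_neg {x : ℂ} (hx : ‖x‖ < 1) :
    eulerProd (-x) = eulerProd (x ^ 2) ^ 3 / (eulerProd x * eulerProd (x ^ 4)) := by
  have hx2 : ‖x ^ 2‖ < 1 := by
    rw [norm_pow]; exact pow_lt_one₀ (norm_nonneg _) hx (by norm_num)
  have hx4 : ‖x ^ 4‖ < 1 := by
    rw [norm_pow]; exact pow_lt_one₀ (norm_nonneg _) hx (by norm_num)
  have hnx : ‖-x‖ < 1 := by rwa [norm_neg]
  have h1 := eulerProd_eq_odd_mul hx
  have h2 := eulerProd_eq_odd_mul hnx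
  have h3 := eulerProd_eq_odd_mul hx2
  have h4 : (∏' n : ℕ, (1 - x ^ (2 * n + 1))) * (∏' n : ℕ, (1 - (-x) ^ (2 * n + 1))) =
      ∏' n : ℕ, (1 - (x ^ 2) ^ (2 * n + 1)) := by
    rw [← (multipliable_odd_factors hx).tprod_mul (multipliable_odd_factors hnx)]
    congr 1; ext n
    rw [Odd.neg_pow ⟨n, rfl⟩]; ring
  have e1 := eulerProd_ne_zero hx
  have e4 := eulerProd_ne_zero hx4
  rw [← pow_mul] at h3
  norm_num at h3
  rw [neg_sq] at h2
  rw [eq_div_iff (mul_ne_zero e1 e4), h2]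
  rw [← h4] at h3
  linear_combination (∏' n : ℕ, (1 - (-x) ^ (2 * n + 1))) * eulerProd (x ^ 2) * eulerProd (x ^ 4) * h1
     - eulerProd (x ^ 2) ^ 2 * h3

/-- The function `f` on the unit disc is the sum of the power series with coefficients `a`. -/
def HasPS (f : ℂ → ℂ) (a : ℕ → ℂ) : Prop :=
  ∀ x : ℂ, ‖x‖ < 1 → HasSum (fun k : ℕ => a k * x ^ k) (f x)

/-- The divisor sum `σ₁`. -/
noncomputable def sig (k : ℕ) : ℂ := ∑ d ∈ k.divisors, (d : ℂ)

/-- The logarithm of the Euler product. -/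
noncomputable def logEuler (x : ℂ) : ℂ := ∑' k : ℕ, -(sig k / k) * x ^ k

lemma sig_div (k : ℕ+) : sig k / (k : ℕ) = ∑ p : Nat.divisorsAntidiagonal k, (1 : ℂ) / (p.1.2 : ℂ) := by
  rw [Finset.sum_coe_sort (Nat.divisorsAntidiagonal k) (fun p => (1 : ℂ) / (p.2 : ℂ)), sig,
    Finset.sum_div, Nat.sum_divisorsAntidiagonal (f := fun _ b => (1 : ℂ) / (b : ℂ))]
  refine Finset.sum_congr rfl fun d hd => ?_
  have hd' := Nat.dvd_of_mem_divisors hd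
  have : (d : ℂ) ≠ 0 := by
    have := Nat.pos_of_mem_divisors hd
    exact_mod_cast this.ne'
  rw [Nat.cast_div hd' this]
  field_simp

lemma logEuler_spec {x : ℂ} (hx : ‖x‖ < 1) :
    HasSum (fun k : ℕ => -(sig k / k) * x ^ k) (logEuler x) ∧ eulerProd x = Complex.exp (logEuler x) := by
  set F : ℕ+ × ℕ+ → ℂ := fun c => x ^ (c.1 * c.2 : ℕ) / (c.2 : ℕ) with hF
  have hsum : Summable F := by
    have h := summable_prod_mul_pow (𝕜 := ℝ) 0 (r := ‖x‖) (by simpa using hx)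
    refine Summable.of_norm_bounded h fun c => ?_
    simp only [hF, norm_div, norm_pow, pow_zero, one_mul, Complex.norm_natCast]
    apply div_le_self (by positivity)
    exact_mod_cast c.2.2
  obtain ⟨S, hS⟩ := hsum
  have h1 : HasSum (fun k : ℕ+ => sig k / (k : ℕ) * x ^ (k : ℕ)) S := by
    have h2 := (sigmaAntidiagonalEquivProd.hasSum_iff).2 hS
    refine h2.sigma fun k => ?_
    have h3 := hasSum_fintype (fun c : Nat.divisorsAntidiagonal k => (F ∘ sigmaAntidiagonalEquivProd) ⟨k, c⟩)
    convert h3 using 1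
    rw [sig_div, Finset.sum_mul]
    refine Finset.sum_congr rfl fun c _ => ?_
    have hc := Nat.mem_divisorsAntidiagonal.1 c.2
    simp only [hF, Function.comp, sigmaAntidiagonalEquivProd, divisorsAntidiagonalFactors,
      Equiv.coe_fn_mk, PNat.mk_coe]
    rw [hc.1]; ring
  have h4 : HasSum (fun k : ℕ => -(sig k / k) * x ^ k) (-S) := by
    have h5 : HasSum (fun k : ℕ => (sig k / k) * x ^ k) S := by
      rw [← PNat.coe_injective.hasSum_iff] 
      · exact h1
      · intro k hk
        have : k = 0 := by
          by_contra h
          exact hk ⟨⟨k, Nat.pos_of_ne_zero h⟩, rfl⟩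
        simp [this]
    simpa using h5.neg
  have hl : logEuler x = -S := h4.tsum_eq
  refine ⟨hl ▸ h4, ?_⟩
  have h6 : HasSum (fun a : ℕ+ => -Complex.log (1 - x ^ (a : ℕ))) S := by
    refine hS.prod_fiberwise fun a => ?_
    have hxa : ‖x ^ (a : ℕ)‖ < 1 := by
      rw [norm_pow]; exact pow_lt_one₀ (norm_nonneg _) hx a.ne_zero
    have := Complex.hasSum_taylorSeries_neg_log hxa
    rw [← PNat.coe_injective.hasSum_iff] at this
    · convert this using 2 with b
      simp [hF, pow_mul]
    · intro k hk
      have : k = 0 := by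
        by_contra h
        exact hk ⟨⟨k, Nat.pos_of_ne_zero h⟩, rfl⟩
      simp [this]
  have h7 := h6.neg.cexp
  rw [← hl] at h7
  have h8 : (cexp ∘ fun a : ℕ+ => - -Complex.log (1 - x ^ (a : ℕ))) = fun a : ℕ+ => 1 - x ^ (a : ℕ) := by
    ext a
    have hxa : ‖x ^ (a : ℕ)‖ < 1 := by
      rw [norm_pow]; exact pow_lt_one₀ (norm_nonneg _) hx a.ne_zero
    simp only [Function.comp, neg_neg]
    apply Complex.exp_log
    intro h0
    rw [sub_eq_zero] at h0
    rw [← h0] at hxa; simp at hxa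
  rw [h8] at h7
  have h9 := (Equiv.pnatEquivNat.symm.hasProd_iff).2 h7
  rw [← h9.tprod_eq, eulerProd]
  rfl

lemma hasPS_logEuler : HasPS logEuler fun k => -(sig k / k) := fun _ hx => (logEuler_spec hx).1

lemma eulerProd_eq_exp {x : ℂ} (hx : ‖x‖ < 1) : eulerProd x = Complex.exp (logEuler x) :=
  (logEuler_spec hx).2

/-- The eta quotient `j₆ + 3`. -/
noncomputable def u2 (z : ℂ) : ℂ :=
  (dedekindEta (2 * z) * dedekindEta (3 * z) ^ 3 / (dedekindEta z * dedekindEta (6 * z) ^ 3)) ^ 3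

/-- The eta quotient `j₆ + 4`. -/
noncomputable def u3 (z : ℂ) : ℂ :=
  dedekindEta (2 * z) ^ 8 * dedekindEta (3 * z) ^ 4 / (dedekindEta z ^ 4 * dedekindEta (6 * z) ^ 8)

/-- The eta quotient `j₆ - 5`. -/
noncomputable def u6 (z : ℂ) : ℂ :=
  dedekindEta z ^ 5 * dedekindEta (3 * z) / (dedekindEta (2 * z) * dedekindEta (6 * z) ^ 5)

lemma dedekindEta_mul_ne_zero {z : ℂ} (hz : 0 < z.im) (k : ℕ) (hk : 0 < k) :
    dedekindEta (k * z) ≠ 0 := by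
  apply dedekindEta_ne_zero
  rw [← Complex.ofReal_natCast, Complex.im_ofReal_mul]
  positivity

lemma dedekindEta_ne_zeros {z : ℂ} (hz : 0 < z.im) : dedekindEta z ≠ 0 ∧ dedekindEta (2 * z) ≠ 0 ∧
    dedekindEta (3 * z) ≠ 0 ∧ dedekindEta (4 * z) ≠ 0 ∧ dedekindEta (6 * z) ≠ 0 ∧
    dedekindEta (12 * z) ≠ 0 :=
  ⟨dedekindEta_ne_zero hz, by simpa using dedekindEta_mul_ne_zero hz 2,
    by simpa using dedekindEta_mul_ne_zero hz 3, by simpa using dedekindEta_mul_ne_zero hz 4,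
    by simpa using dedekindEta_mul_ne_zero hz 6, by simpa using dedekindEta_mul_ne_zero hz 12⟩

lemma u2_ne_zero {z : ℂ} (hz : 0 < z.im) : u2 z ≠ 0 := by
  obtain ⟨h1, h2, h3, -, h6, -⟩ := dedekindEta_ne_zeros hz
  unfold u2; positivity

lemma u3_ne_zero {z : ℂ} (hz : 0 < z.im) : u3 z ≠ 0 := by
  obtain ⟨h1, h2, h3, -, h6, -⟩ := dedekindEta_ne_zeros hz
  unfold u3; positivity

lemma u6_ne_zero {z : ℂ} (hz : 0 < z.im) : u6 z ≠ 0 := by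
  obtain ⟨h1, h2, h3, -, h6, -⟩ := dedekindEta_ne_zeros hz
  unfold u6; positivity

lemma jn_six (z : ℂ) : jn 6 z = u2 z - 3 := by simp [jn, u2]

lemma jnStar_six {z : ℂ} (hz : 0 < z.im) :
    jnStar 6 z = u6 z * u2 z / u3 z + 6 + 64 * (u3 z / (u6 z * u2 z)) := by
  obtain ⟨h1, h2, h3, -, h6, -⟩ := dedekindEta_ne_zeros hz
  simp only [jnStar, if_true, u2, u3, u6]
  field_simp
  ring

lemma u_W6 {z : ℂ} (hz : 0 < z.im) :
    u2 (-1 / (6 * z)) = 8 * u3 z / u6 z ∧ u3 (-1 / (6 * z)) = 9 * u2 z / u6 z ∧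
    u6 (-1 / (6 * z)) = 72 / u6 z := by
  obtain ⟨h1, h2, h3, -, h6, -⟩ := dedekindEta_ne_zeros hz
  have hz0 : z ≠ 0 := by rintro rfl; simp at hz
  obtain ⟨ρ, hρ, -, hS⟩ := dedekindEta_S z hz
  have e1 := hS 1 (by norm_num)
  have e2 := hS 2 (by norm_num)
  have e3 := hS 3 (by norm_num)
  have e6 := hS 6 (by norm_num)
  rw [show (6 : ℝ) = 2 * 3 by norm_num, Real.sqrt_mul (by norm_num)] at e6
  have s2 : (Real.sqrt 2 : ℂ) ^ 2 = 2 := by norm_cast; simp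
  have s3 : (Real.sqrt 3 : ℂ) ^ 2 = 3 := by norm_cast; simp
  push_cast at e1 e2 e3 e6
  simp only [one_mul, Real.sqrt_one, Complex.ofReal_one, mul_one] at e1
  have n2 : (Real.sqrt 2 : ℂ) ≠ 0 := by intro h; simp [h] at s2
  have n3 : (Real.sqrt 3 : ℂ) ≠ 0 := by intro h; simp [h] at s3
  norm_num at e6
  have r6 : (6 : ℂ) * (-1 / (6 * z)) = -1 / z := by field_simp
  have r3 : (3 : ℂ) * (-1 / (6 * z)) = -1 / (2 * z) := by field_simp; norm_num
  have r2 : (2 : ℂ) * (-1 / (6 * z)) = -1 / (3 * z) := by field_simp; norm_num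
  generalize (Real.sqrt 2 : ℂ) = a at *
  generalize (Real.sqrt 3 : ℂ) = b at *
  have a4 : a ^ 4 = 4 := by linear_combination (a ^ 2 + 2) * s2
  have a6 : a ^ 6 = 8 := by linear_combination (a ^ 4 + 2 * a ^ 2 + 4) * s2
  have b4 : b ^ 4 = 9 := by linear_combination (b ^ 2 + 3) * s3
  refine ⟨?_, ?_, ?_⟩ 
  · rw [u2, r6, r3, r2, e1, e2, e3, e6, u3, u6]
    field_simp
    rw [a6]; ring
  · rw [u3, r6, r3, r2, e1, e2, e3, e6, u2, u6]
    field_simp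
    rw [b4]; ring
  · rw [u6, r6, r3, r2, e1, e2, e3, e6, u6]
    field_simp
    rw [a6, b4]; ring

lemma dedekindEta_shift {w s : ℂ} (hw : 0 < w.im) (hs : qc s = -1) (k : ℕ) (hk : Odd k) :
    dedekindEta (k * (w + s)) = Complex.exp (Real.pi * I * s / 12) ^ k *
      (dedekindEta ((2 * k : ℕ) * w) ^ 3 / (dedekindEta (k * w) * dedekindEta ((4 * k : ℕ) * w))) := by
  have hq : ‖qc w ^ k‖ < 1 := by
    rw [norm_pow]
    exact pow_lt_one₀ (norm_nonneg _) (norm_qc_lt_one hw) (by rintro rfl; simp at hk)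
  have h4 : ‖(qc w ^ k) ^ 4‖ < 1 := by
    rw [norm_pow]
    exact pow_lt_one₀ (norm_nonneg _) hq (by norm_num)
  simp only [dedekindEta_eq, qc_natCast_mul, qc_add, hs, mul_neg_one, hk.neg_pow]
  rw [eulerProd_neg hq]
  have E : ∀ (m : ℕ) (v : ℂ), cexp (Real.pi * I * (m * v) / 12) = cexp (Real.pi * I * v / 12) ^ m := by
    intro m v; rw [← Complex.exp_nat_mul]; ring_nf
  simp only [E]
  rw [show Real.pi * I * (w + s) / 12 = Real.pi * I * w / 12 + Real.pi * I * s / 12 by ring, Complex.exp_add]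
  have e1 := eulerProd_ne_zero hq
  have e4 := eulerProd_ne_zero h4
  rw [← pow_mul, ← pow_mul, mul_comm k 2, mul_comm k 4] at *
  have hE := Complex.exp_ne_zero (Real.pi * I * w / 12)
  field_simp
  ring

lemma dedekindEta_shift_even {w s : ℂ} (hs : qc s = -1) (k : ℕ) (hk : Even k) :
    dedekindEta (k * (w + s)) = Complex.exp (Real.pi * I * s / 12) ^ k * dedekindEta (k * w) := by
  simp only [dedekindEta_eq, qc_natCast_mul, qc_add, mul_pow, hs, hk.neg_one_pow, mul_one]
  rw [← Complex.exp_nat_mul, ← mul_assoc (cexp _) (cexp _), ← Complex.exp_add]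
  ring_nf

lemma u_shift {w s : ℂ} (hw : 0 < w.im) (hs : qc s = -1) :
    u2 (w + s) = -(dedekindEta w * dedekindEta (4 * w) * dedekindEta (6 * w) ^ 6 /
      (dedekindEta (2 * w) ^ 2 * dedekindEta (3 * w) ^ 3 * dedekindEta (12 * w) ^ 3)) ^ 3 ∧
    u3 (w + s) = -(dedekindEta w * dedekindEta (4 * w) * dedekindEta (6 * w) /
      (dedekindEta (2 * w) * dedekindEta (3 * w) * dedekindEta (12 * w))) ^ 4 ∧
    u6 (w + s) = -(dedekindEta (2 * w) ^ 14 / (dedekindEta w ^ 5 * dedekindEta (4 * w) ^ 5 *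
      dedekindEta (3 * w) * dedekindEta (12 * w) * dedekindEta (6 * w) ^ 2)) := by
  obtain ⟨h1, h2, h3, h4, h6, h12⟩ := dedekindEta_ne_zeros hw
  have e1 := dedekindEta_shift hw hs 1 (by decide)
  have e2 := dedekindEta_shift_even (w := w) hs 2 (by decide)
  have e3 := dedekindEta_shift hw hs 3 (by decide)
  have e6 := dedekindEta_shift_even (w := w) hs 6 (by decide)
  norm_num at e1 e2 e3 e6
  have hε : Complex.exp (Real.pi * I * s / 12) ^ 24 = -1 := by
    rw [← hs, qc, ← Complex.exp_nat_mul]; congr 1; push_cast; ring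
  have hε0 := Complex.exp_ne_zero (Real.pi * I * s / 12)
  generalize Complex.exp (Real.pi * I * s / 12) = ε at *
  refine ⟨?_, ?_, ?_⟩
  · rw [u2, e1, e2, e3, e6]
    field_simp
    rw [hε]; ring
  · rw [u3, e1, e2, e3, e6]
    field_simp
    rw [hε]; ring
  · rw [u6, e1, e2, e3, e6]
    field_simp
    rw [hε]; ring

lemma qc_half : qc (1 / 2) = -1 ∧ qc (-1 / 2) = -1 := by
  constructor
  · rw [qc, ← Complex.exp_pi_mul_I]; congr 1; ring
  · rw [qc, show 2 * (Real.pi : ℂ) * I * (-1 / 2) = -(Real.pi * I) by ring, Complex.exp_neg,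
      Complex.exp_pi_mul_I]; norm_num

lemma im_neg_one_div {k : ℝ} (hk : 0 < k) {z : ℂ} (hz : 0 < z.im) : 0 < (-1 / (k * z)).im := by
  have hz0 : z ≠ 0 := by rintro rfl; simp at hz
  rw [neg_div, one_div, Complex.neg_im, Complex.inv_im, Complex.im_ofReal_mul]
  have : 0 < normSq (k * z) := Complex.normSq_pos.2 (by simp [hk.ne', hz0])
  have : 0 < k * z.im := by positivity
  rw [neg_div, neg_neg]; positivity

lemma u_W3 {z : ℂ} (hz : 0 < z.im) :
    u2 ((3 * z + 1) / (6 * z + 3)) = -u6 z / u3 z ∧ u3 ((3 * z + 1) / (6 * z + 3)) = 9 / u3 z ∧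
    u6 ((3 * z + 1) / (6 * z + 3)) = -9 * u2 z / u3 z := by
  obtain ⟨w, rfl⟩ : ∃ w, z = w + -1 / 2 := ⟨z + 1 / 2, by ring⟩
  have hw : 0 < w.im := by simpa using hz
  have hw0 : w ≠ 0 := by rintro rfl; simp at hw
  have hw' : 0 < (-1 / (12 * w)).im := by simpa using im_neg_one_div (k := 12) (by norm_num) hw
  have : (3 * (w + -1 / 2) + 1) / (6 * (w + -1 / 2) + 3) = -1 / (12 * w) + 1 / 2 := by
    have : 6 * (w + -1 / 2) + 3 = 6 * w := by ring
    rw [this]; field_simp; ring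
  rw [this]
  obtain ⟨a2, a3, a6⟩ := u_shift hw qc_half.2
  obtain ⟨b2, b3, b6⟩ := u_shift hw' qc_half.1
  obtain ⟨h1, h2, h3, h4, h6, h12⟩ := dedekindEta_ne_zeros hw
  obtain ⟨ρ, hρ, -, hS⟩ := dedekindEta_S w hw
  have e1 := hS 1 (by norm_num)
  have e2 := hS 2 (by norm_num)
  have e3 := hS 3 (by norm_num)
  have e4 := hS 4 (by norm_num)
  have e6 := hS 6 (by norm_num)
  have e12 := hS 12 (by norm_num)
  rw [show (6 : ℝ) = 2 * 3 by norm_num, Real.sqrt_mul (by norm_num)] at e6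
  rw [show (4 : ℝ) = 2 * 2 by norm_num, Real.sqrt_mul (by norm_num)] at e4
  rw [show (12 : ℝ) = 2 * 2 * 3 by norm_num, Real.sqrt_mul (by norm_num), Real.sqrt_mul (by norm_num)] at e12
  have s2 : (Real.sqrt 2 : ℂ) ^ 2 = 2 := by norm_cast; simp
  have s3 : (Real.sqrt 3 : ℂ) ^ 2 = 3 := by norm_cast; simp
  push_cast at e1 e2 e3 e4 e6 e12
  simp only [one_mul, Real.sqrt_one, Complex.ofReal_one, mul_one] at e1
  have n2 : (Real.sqrt 2 : ℂ) ≠ 0 := by intro h; simp [h] at s2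
  have n3 : (Real.sqrt 3 : ℂ) ≠ 0 := by intro h; simp [h] at s3
  rw [show (2 : ℂ) * 3 = 6 by norm_num] at e6
  rw [show (2 : ℂ) * 2 = 4 by norm_num] at e4
  rw [show (2 : ℂ) * 2 * 3 = 12 by norm_num] at e12
  have r12 : (12 : ℂ) * (-1 / (12 * w)) = -1 / w := by field_simp
  have r6 : (6 : ℂ) * (-1 / (12 * w)) = -1 / (2 * w) := by field_simp; norm_num
  have r4 : (4 : ℂ) * (-1 / (12 * w)) = -1 / (3 * w) := by field_simp; norm_num
  have r3 : (3 : ℂ) * (-1 / (12 * w)) = -1 / (4 * w) := by field_simp; norm_num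
  have r2 : (2 : ℂ) * (-1 / (12 * w)) = -1 / (6 * w) := by field_simp; norm_num
  rw [r2, r3, r4, r6, r12, e1, e2, e3, e4, e6, e12] at b2 b3 b6
  generalize (Real.sqrt 2 : ℂ) = a at *
  generalize (Real.sqrt 3 : ℂ) = b at *
  have b4 : b ^ 4 = 9 := by linear_combination (b ^ 2 + 3) * s3
  refine ⟨?_, ?_, ?_⟩ 
  · rw [b2, a6, a3]
    field_simp
  · rw [b3, a3]
    field_simp
    rw [b4]; ring
  · rw [b6, a2, a3]
    field_simp
    rw [b4]

lemma norm_pow_lt_one {x : ℂ} (hx : ‖x‖ < 1) {k : ℕ} (hk : k ≠ 0) : ‖x ^ k‖ < 1 := by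
  rw [norm_pow]; exact pow_lt_one₀ (norm_nonneg _) hx hk

namespace HasPS

variable {f g : ℂ → ℂ} {a b : ℕ → ℂ}

lemma add (hf : HasPS f a) (hg : HasPS g b) : HasPS (fun x => f x + g x) (fun k => a k + b k) :=
  fun x hx => by simpa [add_mul] using (hf x hx).add (hg x hx)

lemma const_mul (hf : HasPS f a) (c : ℂ) : HasPS (fun x => c * f x) (fun k => c * a k) :=
  fun x hx => by simpa [mul_assoc] using (hf x hx).mul_left c

lemma comp_pow (hf : HasPS f a) {m : ℕ} (hm : 0 < m) :
    HasPS (fun x => f (x ^ m)) (fun k => if m ∣ k then a (k / m) else 0) := by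
  intro x hx
  have h := hf _ (norm_pow_lt_one hx hm.ne')
  have hinj : Function.Injective (fun k : ℕ => m * k) := fun i j h => by simpa [hm.ne'] using h
  rw [← hinj.hasSum_iff]
  · convert h using 2 with k
    simp [Function.comp, Nat.mul_div_cancel_left _ hm, pow_mul]
  · intro k hk
    have : ¬ m ∣ k := fun ⟨j, hj⟩ => hk ⟨j, hj.symm⟩
    simp [this]

lemma differentiableOn (hf : HasPS f a) : DifferentiableOn ℂ f (Metric.ball 0 1) := by
  have h1 : HasFPowerSeriesOnBall f (FormalMultilinearSeries.ofScalars ℂ a) 0 1 := by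
    refine ⟨?_, by norm_num, ?_⟩
    · refine ENNReal.le_of_forall_nnreal_lt fun r hr => ?_
      apply FormalMultilinearSeries.le_radius_of_summable
      have hr' : ‖((r : ℝ) : ℂ)‖ < 1 := by
        have : (r : ENNReal) < 1 := hr
        simpa using this
      have := (hf _ hr').summable.norm
      simpa [FormalMultilinearSeries.ofScalars_norm] using this
    · intro y hy
      have hy' : ‖y‖ < 1 := by
        simpa [Metric.mem_eball, edist_eq_enorm_sub, enorm_eq_nnnorm, ← NNReal.coe_lt_coe] using hy
      simpa [FormalMultilinearSeries.ofScalars_apply_eq, smul_eq_mul, mul_comm] using hf y hy'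
  intro x hx
  refine (h1.analyticAt_of_mem ?_).differentiableAt.differentiableWithinAt
  have : ‖x‖ < 1 := by simpa using hx
  simpa [Metric.mem_eball, edist_eq_enorm_sub, enorm_eq_nnnorm, ← NNReal.coe_lt_coe] using this

lemma apply_zero (hf : HasPS f a) : f 0 = a 0 := by
  have := hf 0 (by simp)
  refine this.unique ?_
  convert hasSum_ite_eq 0 (a 0) using 2 with k
  split_ifs with h <;> simp [h]

/-- Removing the constant term and dividing by `x`. -/
lemma exists_shift (hf : HasPS f a) :
    ∃ g, HasPS g (fun k => a (k + 1)) ∧ ∀ x, ‖x‖ < 1 → f x = a 0 + x * g x := by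
  refine ⟨fun x => ∑' k, a (k + 1) * x ^ k, fun x hx => ?_, fun x hx => ?_⟩
  · rcases eq_or_ne x 0 with rfl | h0
    · refine (summable_of_ne_finset_zero (s := {0}) ?_).hasSum
      intro b hb; simp at hb; simp [hb]
    · have h := ((hasSum_nat_add_iff' 1).2 (hf x hx)).summable
      refine Summable.hasSum ?_
      have h2 := h.mul_left x⁻¹
      refine h2.congr fun k => ?_
      rw [pow_succ]; field_simp
  · rcases eq_or_ne x 0 with rfl | h0
    · rw [hf.apply_zero]; simp
    · have h := (hasSum_nat_add_iff' 1).2 (hf x hx)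
      simp at h
      have := h.mul_left x⁻¹
      have h3 : (fun k => a (k + 1) * x ^ k) = fun k => x⁻¹ * (a (k + 1) * x ^ (k + 1)) := by
        ext k; rw [pow_succ]; field_simp
      simp only [h3]
      rw [this.tsum_eq]; field_simp; ring

lemma continuousAt_zero (hf : HasPS f a) : ContinuousAt f 0 :=
  (hf.differentiableOn.differentiableAt (Metric.ball_mem_nhds _ one_pos)).continuousAt

end HasPS

/-- The logarithm of the (normalised) eta quotient with exponents `r₁, r₂, r₃, r₆`. -/
noncomputable def logU (r₁ r₂ r₃ r₆ : ℂ) (x : ℂ) : ℂ :=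
  r₁ * logEuler x + r₂ * logEuler (x ^ 2) + r₃ * logEuler (x ^ 3) + r₆ * logEuler (x ^ 6)

/-- `σ₁(k/m)`, zero unless `m ∣ k`. -/
noncomputable def sigd (m k : ℕ) : ℂ := if m ∣ k then sig (k / m) else 0

/-- The coefficients of `logU`. -/
noncomputable def logUc (r₁ r₂ r₃ r₆ : ℂ) (k : ℕ) : ℂ :=
  -(r₁ * sig k + 2 * r₂ * sigd 2 k + 3 * r₃ * sigd 3 k + 6 * r₆ * sigd 6 k) / k

lemma hasPS_logU (r₁ r₂ r₃ r₆ : ℂ) : HasPS (logU r₁ r₂ r₃ r₆) (logUc r₁ r₂ r₃ r₆) := by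
  have h := (((hasPS_logEuler.const_mul r₁).add ((hasPS_logEuler.comp_pow two_pos).const_mul r₂)).add
    ((hasPS_logEuler.comp_pow three_pos).const_mul r₃)).add
    ((hasPS_logEuler.comp_pow (m := 6) (by norm_num)).const_mul r₆)
  have key : ∀ m k : ℕ, 0 < m → (if m ∣ k then -(sig (k / m) / (k / m : ℕ)) else 0) =
      -(m * sigd m k) / k := by
    intro m k hm
    have hm' : (m : ℂ) ≠ 0 := by exact_mod_cast hm.ne'
    unfold sigd
    split_ifs with h
    · rw [Nat.cast_div h hm']
      rcases eq_or_ne k 0 with rfl | hk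
      · simp
      · have : (k : ℂ) ≠ 0 := by exact_mod_cast hk
        field_simp
    · simp
  intro x hx
  have : HasSum _ (logU r₁ r₂ r₃ r₆ x) := h x hx
  convert this using 3 with k
  beta_reduce
  rw [key 2 k (by norm_num), key 3 k (by norm_num), key 6 k (by norm_num), logUc]
  push_cast
  ring

lemma eta_mul_eq {z : ℂ} (hz : 0 < z.im) (k : ℕ) (hk : 0 < k) :
    dedekindEta (k * z) = cexp (Real.pi * I * z / 12) ^ k * cexp (logEuler (qc z ^ k)) := by
  rw [dedekindEta_eq, qc_natCast_mul, eulerProd_eq_exp (norm_pow_lt_one (norm_qc_lt_one hz) hk.ne'),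
    ← Complex.exp_nat_mul]
  ring_nf

lemma u_eq_exp {z : ℂ} (hz : 0 < z.im) :
    u2 z = (qc z)⁻¹ * cexp (logU (-3) 3 9 (-9) (qc z)) ∧
    u3 z = (qc z)⁻¹ * cexp (logU (-4) 8 4 (-8) (qc z)) ∧
    u6 z = (qc z)⁻¹ * cexp (logU 5 (-1) 1 (-5) (qc z)) := by
  have e1 := eta_mul_eq hz 1 (by norm_num)
  have e2 := eta_mul_eq hz 2 (by norm_num)
  have e3 := eta_mul_eq hz 3 (by norm_num)
  have e6 := eta_mul_eq hz 6 (by norm_num)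
  have hq : qc z = cexp (Real.pi * I * z / 12) ^ 24 := by
    rw [qc, ← Complex.exp_nat_mul]; congr 1; push_cast; ring
  have hE := Complex.exp_ne_zero (Real.pi * I * z / 12)
  simp only [logU]
  norm_num at e1 e2 e3 e6
  have P : ∀ (n : ℕ) (w : ℂ), cexp (n * w) = cexp w ^ n := fun n w => Complex.exp_nat_mul w n
  have N : ∀ (n : ℕ) (w : ℂ), cexp (-n * w) = (cexp w ^ n)⁻¹ := fun n w => by
    rw [neg_mul, Complex.exp_neg, P]
  have n1 := Complex.exp_ne_zero (logEuler (qc z))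
  have n2 := Complex.exp_ne_zero (logEuler (qc z ^ 2))
  have n3 := Complex.exp_ne_zero (logEuler (qc z ^ 3))
  have n6 := Complex.exp_ne_zero (logEuler (qc z ^ 6))
  simp only [Complex.exp_add]
  have P1 := fun w => P 1 w
  have P3 := fun w => P 3 w
  have P4 := fun w => P 4 w
  have P5 := fun w => P 5 w
  have P8 := fun w => P 8 w
  have P9 := fun w => P 9 w
  have N1 := fun w => N 1 w
  have N3 := fun w => N 3 w
  have N4 := fun w => N 4 w
  have N5 := fun w => N 5 w
  have N8 := fun w => N 8 w
  have N9 := fun w => N 9 w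
  push_cast at P1 P3 P4 P5 P8 P9 N1 N3 N4 N5 N8 N9
  rw [u2, u3, u6, e1, e2, e3, e6]
  simp only [P1, P3, P4, P5, P8, P9, N1, N3, N4, N5, N8, N9]
  generalize cexp (logEuler (qc z)) = a at *
  generalize cexp (logEuler (qc z ^ 2)) = b at *
  generalize cexp (logEuler (qc z ^ 3)) = c at *
  generalize cexp (logEuler (qc z ^ 6)) = d at *
  rw [hq]
  refine ⟨?_, ?_, ?_⟩ <;> field_simp

/-- The Fricke involution. -/
noncomputable def w6 (z : ℂ) : ℂ := -1 / (6 * z)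

/-- An Atkin–Lehner involution `W₃`. -/
noncomputable def w3 (z : ℂ) : ℂ := (3 * z + 1) / (6 * z + 3)

lemma im_w6 (z : ℂ) : (w6 z).im = z.im / (6 * normSq z) := by
  rw [w6, neg_div, one_div, Complex.neg_im, Complex.inv_im, map_mul, Complex.mul_im]
  simp
  rw [neg_div, neg_neg, mul_assoc, mul_div_mul_left _ _ (by norm_num)]

lemma im_w3 {z : ℂ} (hz : 0 < z.im) : (w3 z).im = z.im / (12 * normSq (z + 1 / 2)) := by
  have h0 : z + 1 / 2 ≠ 0 := by
    intro h; have := congrArg Complex.im h; simp at this; linarith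
  have : w3 z = -1 / (12 * (z + 1 / 2)) + 1 / 2 := by
    obtain ⟨w, rfl⟩ : ∃ w, z = w - 1 / 2 := ⟨z + 1 / 2, by ring⟩
    simp only [sub_add_cancel] at h0 ⊢
    have h2 : 6 * (w - 1 / 2) + 3 = 6 * w := by ring
    rw [w3, h2]; field_simp; ring
  have e : -1 / (12 * (z + 1 / 2)) = w6 (2 * (z + 1 / 2)) := by
    rw [w6]; congr 1; ring
  rw [this, e, Complex.add_im, im_w6, map_mul]
  rw [show normSq 2 = 4 by rw [Complex.normSq_apply]; norm_num]
  have : 0 < normSq (z + 1 / 2) := Complex.normSq_pos.2 h0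
  simp
  field_simp
  norm_num

lemma im_w6_pos {z : ℂ} (hz : 0 < z.im) : 0 < (w6 z).im := by
  have hz0 : z ≠ 0 := by rintro rfl; simp at hz
  have : 0 < normSq z := Complex.normSq_pos.2 hz0
  rw [im_w6]; positivity

lemma im_w3_pos {z : ℂ} (hz : 0 < z.im) : 0 < (w3 z).im := by
  have h0 : z + 1 / 2 ≠ 0 := by
    intro h; have := congrArg Complex.im h; simp at this; linarith
  have : 0 < normSq (z + 1 / 2) := Complex.normSq_pos.2 h0
  rw [im_w3 hz]; positivity

/-- Every point of the upper half-plane is brought to `Im ≥ 1/5` by translations, `w6` and `w3`. -/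
lemma reduction (p : ℂ → Prop) (hT : ∀ z : ℂ, ∀ n : ℤ, 0 < z.im → p (z + n) → p z)
    (h6 : ∀ z : ℂ, 0 < z.im → p (w6 z) → p z) (h3 : ∀ z : ℂ, 0 < z.im → p (w3 z) → p z)
    (h : ∀ z : ℂ, 1 / 5 ≤ z.im → p z) {z : ℂ} (hz : 0 < z.im) : p z := by
  have key : ∀ k : ℕ, ∀ z : ℂ, 0 < z.im → 1 / 5 ≤ z.im * (11 / 10) ^ k → p z := by
    intro k
    induction k with
    | zero => intro z _ h'; exact h z (by simpa using h')
    | succ k ih =>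
      intro z hz h'
      set n : ℤ := ⌊z.re + 2 / 3⌋
      have hn1 := Int.floor_le (z.re + 2 / 3)
      have hn2 := Int.lt_floor_add_one (z.re + 2 / 3)
      apply hT z (-n) hz
      set w : ℂ := z + ((-n : ℤ) : ℂ) with hw
      have him : w.im = z.im := by simp [hw]
      have hre : w.re = z.re - n := by simp [hw]; ring
      rw [← him] at hz h'
      have hx1 : -(2 / 3) ≤ w.re := by rw [hre]; linarith
      have hx2 : w.re ≤ 1 / 3 := by rw [hre]; linarith
      by_cases h5 : 1 / 5 ≤ w.im
      · exact h w h5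
      push Not at h5
      have step : ∀ s : ℝ, 0 < s → s ≤ 10 / 11 → 1 / 5 ≤ w.im / s * (11 / 10) ^ k := by
        intro s hs hs'
        refine h'.trans ?_
        rw [pow_succ, div_mul_eq_mul_div, le_div_iff₀ hs]
        have : 0 < w.im * (11 / 10) ^ k := by positivity
        nlinarith
      by_cases hc : -(1 / 3) ≤ w.re
      · apply h6 w hz
        apply ih _ (im_w6_pos hz)
        rw [im_w6]
        have hz0 : w ≠ 0 := by intro h0; rw [h0] at hz; simp at hz
        have : 0 < normSq w := Complex.normSq_pos.2 hz0
        apply step _ (by positivity)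
        rw [Complex.normSq_apply]
        nlinarith
      · push Not at hc
        apply h3 w hz
        apply ih _ (im_w3_pos hz)
        rw [im_w3 hz]
        have h0 : w + 1 / 2 ≠ 0 := by
          intro h; have := congrArg Complex.im h; simp at this; linarith
        have : 0 < normSq (w + 1 / 2) := Complex.normSq_pos.2 h0
        apply step _ (by positivity)
        rw [Complex.normSq_apply]
        simp
        nlinarith
  obtain ⟨k, hk⟩ := pow_unbounded_of_one_lt (1 / 5 / z.im) (show (1 : ℝ) < 11 / 10 by norm_num)
  refine key k z hz ?_
  rw [div_lt_iff₀ hz] at hk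
  linarith

/-- Liouville principle: a finite family of functions holomorphic in `q` on the unit disc whose
norms are permuted by `w6` and `w3` attains its maximum at a constant member. -/
lemma liouville {ι : Type*} [Finite ι] [Nonempty ι] (F G : ι → ℂ → ℂ)
    (hG : ∀ i, DifferentiableOn ℂ (G i) (Metric.ball 0 1))
    (hF : ∀ i z, 0 < z.im → F i z = G i (qc z))
    (h6 : ∀ i, ∃ j, ∀ z, 0 < z.im → ‖F i z‖ ≤ ‖F j (w6 z)‖)
    (h3 : ∀ i, ∃ j, ∀ z, 0 < z.im → ‖F i z‖ ≤ ‖F j (w3 z)‖) :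
    ∃ i₀, (∀ i x, ‖x‖ < 1 → ‖G i x‖ ≤ ‖G i₀ 0‖) ∧ ∀ x, ‖x‖ < 1 → G i₀ x = G i₀ 0 := by
  set r : ℝ := Real.exp (-(2 * Real.pi * (1 / 5))) with hr
  have hr1 : r < 1 := by
    rw [hr, Real.exp_lt_one_iff]; have := Real.pi_pos; linarith
  have hr0 : 0 ≤ r := (Real.exp_pos _).le
  have hsub : Metric.closedBall (0 : ℂ) r ⊆ Metric.ball 0 1 := Metric.closedBall_subset_ball hr1
  have hmax : ∀ i, ∃ x ∈ Metric.closedBall (0 : ℂ) r, IsMaxOn (fun x => ‖G i x‖) (Metric.closedBall (0 : ℂ) r) x :=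
    fun i => (isCompact_closedBall (0 : ℂ) r).exists_isMaxOn ⟨0, by simpa using hr0⟩
      (((hG i).mono hsub).continuousOn.norm)
  choose x hx hxm using hmax
  obtain ⟨i₀, hi₀⟩ := Finite.exists_max fun i => ‖G i (x i)‖
  have hb : ∀ i y, ‖y‖ ≤ r → ‖G i y‖ ≤ ‖G i₀ (x i₀)‖ := fun i y hy =>
    (hxm i (by simpa using hy)).trans (hi₀ i)
  have hall : ∀ z : ℂ, 0 < z.im → ∀ i, ‖F i z‖ ≤ ‖G i₀ (x i₀)‖ := by
    intro z hz
    have h := reduction (fun z => 0 < z.im → ∀ i, ‖F i z‖ ≤ ‖G i₀ (x i₀)‖) ?_ ?_ ?_ ?_ hz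
    · exact h hz
    · intro z n hz h _ i
      have h' := h (by simpa using hz) i
      rw [hF i _ (by simpa using hz), qc_add, qc_intCast, mul_one] at h'
      rwa [hF i z hz]
    · intro z hz h _ i
      obtain ⟨j, hj⟩ := h6 i
      exact (hj z hz).trans (h (im_w6_pos hz) j)
    · intro z hz h _ i
      obtain ⟨j, hj⟩ := h3 i
      exact (hj z hz).trans (h (im_w3_pos hz) j)
    · intro z hz hz' i
      rw [hF i z hz']
      apply hb
      rw [norm_qc, hr, Real.exp_le_exp]
      have := Real.pi_pos
      nlinarith
  have hall' : ∀ i y, ‖y‖ < 1 → ‖G i y‖ ≤ ‖G i₀ (x i₀)‖ := by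
    intro i y hy
    rcases eq_or_ne y 0 with rfl | h0
    · exact hb i 0 (by simpa using hr0)
    · obtain ⟨z, hz, rfl⟩ := exists_qc_eq h0 hy
      rw [← hF i z hz]; exact hall z hz i
  have hconst : Set.EqOn (G i₀) (Function.const ℂ (G i₀ (x i₀))) (Metric.ball 0 1) := by
    apply Complex.eqOn_of_isPreconnected_of_isMaxOn_norm
      (convex_ball (0 : ℂ) 1).isPreconnected Metric.isOpen_ball (hG i₀) (hsub (hx i₀))
    intro y hy
    exact hall' i₀ y (by simpa using hy)
  have h0 : G i₀ 0 = G i₀ (x i₀) := hconst (Metric.mem_ball_self one_pos)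
  refine ⟨i₀, fun i y hy => h0 ▸ hall' i y hy, fun y hy => ?_⟩
  rw [h0]; exact hconst (by simpa using hy)

lemma HasPS.hasDerivAt_zero {f : ℂ → ℂ} {a : ℕ → ℂ} (hf : HasPS f a) : HasDerivAt f (a 1) 0 := by
  obtain ⟨g, hg, hfg⟩ := hf.exists_shift
  have hd : HasDerivAt g (deriv g 0) 0 :=
    (hg.differentiableOn.differentiableAt (Metric.ball_mem_nhds _ one_pos)).hasDerivAt
  have h := ((hasDerivAt_id (0 : ℂ)).mul hd).const_add (a 0)
  simp only [id, one_mul, zero_mul, add_zero, hg.apply_zero, zero_add] at h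
  refine h.congr_of_eventuallyEq ?_
  filter_upwards [Metric.ball_mem_nhds (0 : ℂ) one_pos] with x hx
  exact hfg x (by simpa using hx)

lemma sig_one : sig 1 = 1 := by simp [sig]
lemma sig_two : sig 2 = 3 := by
  rw [sig, show Nat.divisors 2 = {1, 2} by decide]; norm_num

lemma logU_zero (r₁ r₂ r₃ r₆ : ℂ) : logU r₁ r₂ r₃ r₆ 0 = 0 := by
  rw [(hasPS_logU r₁ r₂ r₃ r₆).apply_zero]; simp [logUc]

lemma logUc_one (r₁ r₂ r₃ r₆ : ℂ) : logUc r₁ r₂ r₃ r₆ 1 = -r₁ := by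
  simp [logUc, sigd, sig_one]

lemma logUc_two (r₁ r₂ r₃ r₆ : ℂ) : logUc r₁ r₂ r₃ r₆ 2 = -(3 * r₁ + 2 * r₂) / 2 := by
  simp [logUc, sigd, sig_one, sig_two]; ring

lemma differentiableOn_expU (r₁ r₂ r₃ r₆ : ℂ) :
    DifferentiableOn ℂ (fun x => cexp (logU r₁ r₂ r₃ r₆ x)) (Metric.ball 0 1) :=
  (hasPS_logU r₁ r₂ r₃ r₆).differentiableOn.cexp

lemma u_relations {z : ℂ} (hz : 0 < z.im) : u3 z = u2 z + 1 ∧ u6 z = u2 z - 8 := by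
  set E2 : ℂ → ℂ := fun x => cexp (logU (-3) 3 9 (-9) x) with hE2
  set E3 : ℂ → ℂ := fun x => cexp (logU (-4) 8 4 (-8) x) with hE3
  set E6 : ℂ → ℂ := fun x => cexp (logU 5 (-1) 1 (-5) x) with hE6
  have d2 : DifferentiableOn ℂ E2 (Metric.ball 0 1) := differentiableOn_expU _ _ _ _
  have d3 : DifferentiableOn ℂ E3 (Metric.ball 0 1) := differentiableOn_expU _ _ _ _
  have d6 : DifferentiableOn ℂ E6 (Metric.ball 0 1) := differentiableOn_expU _ _ _ _
  have z2 : E2 0 = 1 := by simp [hE2, logU_zero]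
  have z3 : E3 0 = 1 := by simp [hE3, logU_zero]
  have z6 : E6 0 = 1 := by simp [hE6, logU_zero]
  have n2 : ∀ x, E2 x ≠ 0 := fun x => Complex.exp_ne_zero _
  have n3 : ∀ x, E3 x ≠ 0 := fun x => Complex.exp_ne_zero _
  have n6 : ∀ x, E6 x ≠ 0 := fun x => Complex.exp_ne_zero _
  have hds : HasDerivAt (fun x => E3 x - E2 x) 1 0 := by
    have h := ((hasPS_logU (-4) 8 4 (-8)).hasDerivAt_zero.cexp).sub
      ((hasPS_logU (-3) 3 9 (-9)).hasDerivAt_zero.cexp)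
    simp only [logU_zero, logUc_one] at h
    norm_num at h
    exact h
  set G : Fin 4 → ℂ → ℂ := ![fun x => dslope (fun x => E3 x - E2 x) 0 x - 1,
    fun x => (9 * E2 x - 8 * E3 x - E6 x) / E6 x, fun x => (9 * x + E6 x - E3 x) / E3 x,
    fun x => (E6 x + 8 * x - E2 x) / E2 x] with hG
  set F : Fin 4 → ℂ → ℂ := ![fun z => u3 z - u2 z - 1,
    fun z => (9 * u2 z - 8 * u3 z - u6 z) / u6 z, fun z => (9 + u6 z - u3 z) / u3 z,
    fun z => (u6 z + 8 - u2 z) / u2 z] with hF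
  have hGd : ∀ i, DifferentiableOn ℂ (G i) (Metric.ball 0 1) := by
    intro i
    fin_cases i
    · exact ((Complex.differentiableOn_dslope (Metric.ball_mem_nhds _ one_pos)).2 (d3.sub d2)).sub_const 1
    · exact (((d2.const_mul 9).sub (d3.const_mul 8)).sub d6).div d6 fun x _ => n6 x
    · exact ((((differentiableOn_id).const_mul 9).add d6).sub d3).div d3 fun x _ => n3 x
    · exact ((d6.add ((differentiableOn_id).const_mul 8)).sub d2).div d2 fun x _ => n2 x
  have hFG : ∀ i z, 0 < z.im → F i z = G i (qc z) := by
    intro i z hz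
    obtain ⟨e2, e3, e6⟩ := u_eq_exp hz
    have hq := qc_ne_zero z
    have m2 := n2 (qc z)
    have m3 := n3 (qc z)
    have m6 := n6 (qc z)
    change _ = _ * E2 (qc z) at e2
    change _ = _ * E3 (qc z) at e3
    change _ = _ * E6 (qc z) at e6
    fin_cases i
    · change u3 z - u2 z - 1 = dslope (fun x => E3 x - E2 x) 0 (qc z) - 1
      rw [dslope_of_ne _ hq, slope_def_field, e2, e3, z2, z3]
      field_simp
      ring
    · change (9 * u2 z - 8 * u3 z - u6 z) / u6 z = (9 * E2 (qc z) - 8 * E3 (qc z) - E6 (qc z)) / E6 (qc z)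
      rw [e2, e3, e6]; field_simp
    · change (9 + u6 z - u3 z) / u3 z = (9 * qc z + E6 (qc z) - E3 (qc z)) / E3 (qc z)
      rw [e3, e6]; field_simp
    · change (u6 z + 8 - u2 z) / u2 z = (E6 (qc z) + 8 * qc z - E2 (qc z)) / E2 (qc z)
      rw [e2, e6]; field_simp
  have h6 : ∀ i, ∃ j, ∀ z, 0 < z.im → ‖F i z‖ ≤ ‖F j (w6 z)‖ := by
    have key : ∀ z : ℂ, 0 < z.im → F 0 z = F 1 (w6 z) ∧ F 1 z = F 0 (w6 z) ∧ F 2 z = F 3 (w6 z) ∧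
        F 3 z = F 2 (w6 z) := by
      intro z hz
      obtain ⟨a2, a3, a6⟩ := u_W6 hz
      change u2 (w6 z) = _ at a2
      change u3 (w6 z) = _ at a3
      change u6 (w6 z) = _ at a6
      have m2 := u2_ne_zero hz
      have m3 := u3_ne_zero hz
      have m6 := u6_ne_zero hz
      simp only [hF, Matrix.cons_val, a2, a3, a6]
      refine ⟨?_, ?_, ?_, ?_⟩ <;> field_simp <;> ring
    intro i
    fin_cases i
    · exact ⟨1, fun z hz => (congrArg norm (key z hz).1).le⟩
    · exact ⟨0, fun z hz => (congrArg norm (key z hz).2.1).le⟩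
    · exact ⟨3, fun z hz => (congrArg norm (key z hz).2.2.1).le⟩
    · exact ⟨2, fun z hz => (congrArg norm (key z hz).2.2.2).le⟩
  have h3 : ∀ i, ∃ j, ∀ z, 0 < z.im → ‖F i z‖ ≤ ‖F j (w3 z)‖ := by
    have key : ∀ z : ℂ, 0 < z.im → F 0 z = F 2 (w3 z) ∧ F 1 z = F 3 (w3 z) ∧ F 2 z = F 0 (w3 z) ∧
        F 3 z = F 1 (w3 z) := by
      intro z hz
      obtain ⟨a2, a3, a6⟩ := u_W3 hz
      change u2 (w3 z) = _ at a2
      change u3 (w3 z) = _ at a3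
      change u6 (w3 z) = _ at a6
      have m2 := u2_ne_zero hz
      have m3 := u3_ne_zero hz
      have m6 := u6_ne_zero hz
      simp only [hF, Matrix.cons_val, a2, a3, a6]
      refine ⟨?_, ?_, ?_, ?_⟩ <;> field_simp <;> ring
    intro i
    fin_cases i
    · exact ⟨2, fun z hz => (congrArg norm (key z hz).1).le⟩
    · exact ⟨3, fun z hz => (congrArg norm (key z hz).2.1).le⟩
    · exact ⟨0, fun z hz => (congrArg norm (key z hz).2.2.1).le⟩
    · exact ⟨1, fun z hz => (congrArg norm (key z hz).2.2.2).le⟩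
  obtain ⟨i₀, hb, -⟩ := liouville F G hGd hFG h6 h3
  have hG0 : ∀ i, G i 0 = 0 := by
    intro i
    fin_cases i
    · change dslope (fun x => E3 x - E2 x) 0 0 - 1 = 0
      rw [dslope_same, hds.deriv]; norm_num
    · change (9 * E2 0 - 8 * E3 0 - E6 0) / E6 0 = 0
      rw [z2, z3, z6]; norm_num
    · change (9 * 0 + E6 0 - E3 0) / E3 0 = 0
      rw [z3, z6]; norm_num
    · change (E6 0 + 8 * 0 - E2 0) / E2 0 = 0
      rw [z2, z6]; norm_num
  have hzero : ∀ i, F i z = 0 := by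
    intro i
    rw [hFG i z hz]
    have := hb i (qc z) (norm_qc_lt_one hz)
    rw [hG0 i₀, norm_zero] at this
    exact norm_le_zero_iff.1 this
  constructor
  · have h : u3 z - u2 z - 1 = 0 := hzero 0
    linear_combination h
  · have h : (u6 z + 8 - u2 z) / u2 z = 0 := hzero 3
    rw [div_eq_zero_iff, or_iff_left (u2_ne_zero hz)] at h
    linear_combination h

/-- The hauptmodul `j₆`. -/
noncomputable def tt (z : ℂ) : ℂ := u2 z - 3

/-- The product `(j₆+3)(j₆+4)(j₆-5)`. -/
noncomputable def Om (z : ℂ) : ℂ := (tt z + 3) * (tt z + 4) * (tt z - 5)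

lemma u2_eq (z : ℂ) : u2 z = tt z + 3 := by simp [tt]
lemma u3_eq {z : ℂ} (hz : 0 < z.im) : u3 z = tt z + 4 := by rw [(u_relations hz).1, tt]; ring
lemma u6_eq {z : ℂ} (hz : 0 < z.im) : u6 z = tt z - 5 := by rw [(u_relations hz).2, tt]; ring

lemma tt_add_three_ne {z : ℂ} (hz : 0 < z.im) : tt z + 3 ≠ 0 := u2_eq z ▸ u2_ne_zero hz
lemma tt_add_four_ne {z : ℂ} (hz : 0 < z.im) : tt z + 4 ≠ 0 := u3_eq hz ▸ u3_ne_zero hz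
lemma tt_sub_five_ne {z : ℂ} (hz : 0 < z.im) : tt z - 5 ≠ 0 := u6_eq hz ▸ u6_ne_zero hz
lemma Om_ne_zero {z : ℂ} (hz : 0 < z.im) : Om z ≠ 0 :=
  mul_ne_zero (mul_ne_zero (tt_add_three_ne hz) (tt_add_four_ne hz)) (tt_sub_five_ne hz)

lemma tt_w6 {z : ℂ} (hz : 0 < z.im) : tt (w6 z) = 5 + 72 / (tt z - 5) := by
  have h := (u_W6 hz).2.2
  change u6 (w6 z) = _ at h
  rw [u6_eq (im_w6_pos hz), u6_eq hz] at h
  rw [← h]; ring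

lemma tt_w3 {z : ℂ} (hz : 0 < z.im) : tt (w3 z) = -4 + 9 / (tt z + 4) := by
  have h := (u_W3 hz).2.1
  change u3 (w3 z) = _ at h
  rw [u3_eq (im_w3_pos hz), u3_eq hz] at h
  rw [← h]; ring

lemma tt_add_int {z : ℂ} (hz : 0 < z.im) (n : ℤ) : tt (z + n) = tt z := by
  rw [tt, tt, (u_eq_exp hz).1, (u_eq_exp (z := z + n) (by simpa using hz)).1, qc_add, qc_intCast, mul_one]

lemma Om_w6 {z : ℂ} (hz : 0 < z.im) : Om (w6 z) = 72 ^ 2 * Om z / (tt z - 5) ^ 4 := by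
  have h5 := tt_sub_five_ne hz
  rw [Om, tt_w6 hz, Om]; field_simp; ring

lemma Om_w3 {z : ℂ} (hz : 0 < z.im) : Om (w3 z) = 9 ^ 2 * Om z / (tt z + 4) ^ 4 := by
  have h5 := tt_add_four_ne hz
  rw [Om, tt_w3 hz, Om]; field_simp; ring

lemma isOpen_im_pos : IsOpen {z : ℂ | 0 < z.im} := isOpen_lt continuous_const Complex.continuous_im

lemma tt_eq {z : ℂ} (hz : 0 < z.im) : tt z = (qc z)⁻¹ * cexp (logU (-3) 3 9 (-9) (qc z)) - 3 := by
  rw [tt, (u_eq_exp hz).1]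

/-- The `q`-derivative of `j₆`, as a function on the disc, times `q`. -/
noncomputable def thetaG (x : ℂ) : ℂ :=
  cexp (logU (-3) 3 9 (-9) x) * (-1 + x * deriv (logU (-3) 3 9 (-9)) x)

lemma hasDerivAt_tt {z : ℂ} (hz : 0 < z.im) :
    HasDerivAt tt (2 * Real.pi * I * ((qc z)⁻¹ * thetaG (qc z))) z := by
  have hL : HasDerivAt (logU (-3) 3 9 (-9)) (deriv (logU (-3) 3 9 (-9)) (qc z)) (qc z) :=
    ((hasPS_logU _ _ _ _).differentiableOn.differentiableAt
      (Metric.isOpen_ball.mem_nhds (by simpa using norm_qc_lt_one hz))).hasDerivAt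
  have h1 : HasDerivAt (fun x => x⁻¹ * cexp (logU (-3) 3 9 (-9) x) - 3) ((qc z) ⁻¹ ^ 2 * thetaG (qc z)) (qc z) := by
    have := ((hasDerivAt_inv (qc_ne_zero z)).mul hL.cexp).sub_const 3
    refine this.congr_deriv ?_
    have := qc_ne_zero z
    rw [thetaG]; field_simp
  have h2 := h1.comp z (hasDerivAt_qc z)
  have h3 : HasDerivAt tt ((qc z)⁻¹ ^ 2 * thetaG (qc z) * (2 * Real.pi * I * qc z)) z := by
    refine h2.congr_of_eventuallyEq ?_
    filter_upwards [isOpen_im_pos.mem_nhds hz] with w hw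
    rw [tt_eq hw]; rfl
  refine h3.congr_deriv ?_
  have := qc_ne_zero z
  field_simp

lemma differentiableAt_tt {z : ℂ} (hz : 0 < z.im) : DifferentiableAt ℂ tt z :=
  (hasDerivAt_tt hz).differentiableAt

/-- An auxiliary eta quotient of weight two. -/
noncomputable def etaE (z : ℂ) : ℂ :=
  dedekindEta z ^ 2 * dedekindEta (6 * z) ^ 12 / (dedekindEta (2 * z) ^ 4 * dedekindEta (3 * z) ^ 6)

lemma etaE_ne_zero {z : ℂ} (hz : 0 < z.im) : etaE z ≠ 0 := by
  obtain ⟨h1, h2, h3, -, h6, -⟩ := dedekindEta_ne_zeros hz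
  unfold etaE; positivity

lemma etaE_w6 {z : ℂ} (hz : 0 < z.im) : etaE (w6 z) = -(z ^ 2 / 12) * u6 z ^ 2 * etaE z := by
  obtain ⟨h1, h2, h3, -, h6, -⟩ := dedekindEta_ne_zeros hz
  have hz0 : z ≠ 0 := by rintro rfl; simp at hz
  obtain ⟨ρ, hρ, hρ2, hS⟩ := dedekindEta_S z hz
  have hρ4 : ρ ^ 4 = -z ^ 2 := by
    rw [show ρ ^ 4 = (ρ ^ 2) ^ 2 by ring, hρ2, div_pow, I_sq]; ring
  have e1 := hS 1 (by norm_num)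
  have e2 := hS 2 (by norm_num)
  have e3 := hS 3 (by norm_num)
  have e6 := hS 6 (by norm_num)
  rw [show (6 : ℝ) = 2 * 3 by norm_num, Real.sqrt_mul (by norm_num)] at e6
  have s2 : (Real.sqrt 2 : ℂ) ^ 2 = 2 := by norm_cast; simp
  have s3 : (Real.sqrt 3 : ℂ) ^ 2 = 3 := by norm_cast; simp
  push_cast at e1 e2 e3 e6
  simp only [one_mul, Real.sqrt_one, Complex.ofReal_one, mul_one] at e1
  have n2 : (Real.sqrt 2 : ℂ) ≠ 0 := by intro h; simp [h] at s2
  have n3 : (Real.sqrt 3 : ℂ) ≠ 0 := by intro h; simp [h] at s3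
  norm_num at e6
  have r6 : (6 : ℂ) * (-1 / (6 * z)) = -1 / z := by field_simp
  have r3 : (3 : ℂ) * (-1 / (6 * z)) = -1 / (2 * z) := by field_simp; norm_num
  have r2 : (2 : ℂ) * (-1 / (6 * z)) = -1 / (3 * z) := by field_simp; norm_num
  generalize (Real.sqrt 2 : ℂ) = a at *
  generalize (Real.sqrt 3 : ℂ) = b at *
  have a4 : a ^ 4 = 4 := by linear_combination (a ^ 2 + 2) * s2
  rw [etaE, w6, r6, r3, r2, e1, e2, e3, e6, u6, etaE]
  have : ρ ^ 4 * 12 = -z ^ 2 * (a ^ 4 * b ^ 2) := by rw [hρ4, a4, s3]; norm_num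
  generalize dedekindEta z = x1 at *
  generalize dedekindEta (2 * z) = x2 at *
  generalize dedekindEta (3 * z) = x3 at *
  generalize dedekindEta (6 * z) = x6 at *
  field_simp
  linear_combination this

lemma etaE_shift {w s : ℂ} (hw : 0 < w.im) (hs : qc s = -1) :
    etaE (w + s) = dedekindEta (2 * w) ^ 2 * dedekindEta (3 * w) ^ 6 * dedekindEta (12 * w) ^ 6 /
      (dedekindEta w ^ 2 * dedekindEta (4 * w) ^ 2 * dedekindEta (6 * w) ^ 6) := by
  obtain ⟨h1, h2, h3, h4, h6, h12⟩ := dedekindEta_ne_zeros hw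
  have e1 := dedekindEta_shift hw hs 1 (by decide)
  have e2 := dedekindEta_shift_even (w := w) hs 2 (by decide)
  have e3 := dedekindEta_shift hw hs 3 (by decide)
  have e6 := dedekindEta_shift_even (w := w) hs 6 (by decide)
  norm_num at e1 e2 e3 e6
  have hε : Complex.exp (Real.pi * I * s / 12) ^ 48 = 1 := by
    have : Complex.exp (Real.pi * I * s / 12) ^ 24 = -1 := by
      rw [← hs, qc, ← Complex.exp_nat_mul]; congr 1; push_cast; ring
    rw [show 48 = 24 * 2 by norm_num, pow_mul, this]; norm_num
  have hε0 := Complex.exp_ne_zero (Real.pi * I * s / 12)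
  generalize Complex.exp (Real.pi * I * s / 12) = ε at *
  rw [etaE, e1, e2, e3, e6]
  field_simp
  rw [hε, one_mul]

lemma etaE_w3 {z : ℂ} (hz : 0 < z.im) :
    etaE (w3 z) = -(4 / 3 * (z + 1 / 2) ^ 2) * u3 z ^ 2 * etaE z := by
  obtain ⟨w, rfl⟩ : ∃ w, z = w + -1 / 2 := ⟨z + 1 / 2, by ring⟩
  have hw : 0 < w.im := by simpa using hz
  have hw0 : w ≠ 0 := by rintro rfl; simp at hw
  have hw' : 0 < (-1 / (12 * w)).im := by simpa using im_neg_one_div (k := 12) (by norm_num) hw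
  have : w3 (w + -1 / 2) = -1 / (12 * w) + 1 / 2 := by
    have : 6 * (w + -1 / 2) + 3 = 6 * w := by ring
    rw [w3, this]; field_simp; ring
  rw [this]
  obtain ⟨-, a3, -⟩ := u_shift hw qc_half.2
  have aE := etaE_shift hw qc_half.2
  have bE := etaE_shift hw' qc_half.1
  obtain ⟨h1, h2, h3, h4, h6, h12⟩ := dedekindEta_ne_zeros hw
  obtain ⟨ρ, hρ, hρ2, hS⟩ := dedekindEta_S w hw
  have hρ4 : ρ ^ 4 = -w ^ 2 := by
    rw [show ρ ^ 4 = (ρ ^ 2) ^ 2 by ring, hρ2, div_pow, I_sq]; ring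
  have e1 := hS 1 (by norm_num)
  have e2 := hS 2 (by norm_num)
  have e3 := hS 3 (by norm_num)
  have e4 := hS 4 (by norm_num)
  have e6 := hS 6 (by norm_num)
  have e12 := hS 12 (by norm_num)
  rw [show (6 : ℝ) = 2 * 3 by norm_num, Real.sqrt_mul (by norm_num)] at e6
  rw [show (4 : ℝ) = 2 * 2 by norm_num, Real.sqrt_mul (by norm_num)] at e4
  rw [show (12 : ℝ) = 2 * 2 * 3 by norm_num, Real.sqrt_mul (by norm_num), Real.sqrt_mul (by norm_num)] at e12
  have s2 : (Real.sqrt 2 : ℂ) ^ 2 = 2 := by norm_cast; simp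
  have s3 : (Real.sqrt 3 : ℂ) ^ 2 = 3 := by norm_cast; simp
  push_cast at e1 e2 e3 e4 e6 e12
  simp only [one_mul, Real.sqrt_one, Complex.ofReal_one, mul_one] at e1
  have n2 : (Real.sqrt 2 : ℂ) ≠ 0 := by intro h; simp [h] at s2
  have n3 : (Real.sqrt 3 : ℂ) ≠ 0 := by intro h; simp [h] at s3
  rw [show (2 : ℂ) * 3 = 6 by norm_num] at e6
  rw [show (2 : ℂ) * 2 = 4 by norm_num] at e4
  rw [show (2 : ℂ) * 2 * 3 = 12 by norm_num] at e12
  have r12 : (12 : ℂ) * (-1 / (12 * w)) = -1 / w := by field_simp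
  have r6 : (6 : ℂ) * (-1 / (12 * w)) = -1 / (2 * w) := by field_simp; norm_num
  have r4 : (4 : ℂ) * (-1 / (12 * w)) = -1 / (3 * w) := by field_simp; norm_num
  have r3 : (3 : ℂ) * (-1 / (12 * w)) = -1 / (4 * w) := by field_simp; norm_num
  have r2 : (2 : ℂ) * (-1 / (12 * w)) = -1 / (6 * w) := by field_simp; norm_num
  rw [r2, r3, r4, r6, r12, e1, e2, e3, e4, e6, e12] at bE
  generalize (Real.sqrt 2 : ℂ) = a at *
  generalize (Real.sqrt 3 : ℂ) = b at *
  have a4 : a ^ 4 = 4 := by linear_combination (a ^ 2 + 2) * s2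
  rw [bE, aE, a3, show w + -1 / 2 + 1 / 2 = w by ring]
  have : ρ ^ 4 * a ^ 4 * 3 = -w ^ 2 * b ^ 2 * 4 := by rw [hρ4, a4, s3]; ring
  generalize dedekindEta w = x1 at *
  generalize dedekindEta (2 * w) = x2 at *
  generalize dedekindEta (3 * w) = x3 at *
  generalize dedekindEta (4 * w) = x4 at *
  generalize dedekindEta (6 * w) = x6 at *
  generalize dedekindEta (12 * w) = x12 at *
  field_simp
  linear_combination this

/-- The `q`-derivative of `j₆`. -/
noncomputable def Dt (z : ℂ) : ℂ := (qc z)⁻¹ * thetaG (qc z)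

lemma hasDerivAt_w6 {z : ℂ} (hz : 0 < z.im) : HasDerivAt w6 (1 / (6 * z ^ 2)) z := by
  have hz0 : z ≠ 0 := by rintro rfl; simp at hz
  have h := (hasDerivAt_inv hz0).const_mul (-1 / 6)
  refine (h.congr_of_eventuallyEq (.of_forall fun w => ?_)).congr_deriv ?_
  · simp only [w6]; rw [div_mul_eq_div_div]; ring
  · field_simp

lemma two_mul_add_one_ne {z : ℂ} (hz : 0 < z.im) : z + 1 / 2 ≠ 0 := by
  intro h; have := congrArg Complex.im h; simp at this; linarith

lemma hasDerivAt_w3 {z : ℂ} (hz : 0 < z.im) : HasDerivAt w3 (1 / (12 * (z + 1 / 2) ^ 2)) z := by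
  have h0 : 6 * z + 3 ≠ 0 := by
    have := two_mul_add_one_ne hz
    intro h; apply this; linear_combination h / 6
  have h := (((hasDerivAt_id z).const_mul 3).add_const 1).div
    (((hasDerivAt_id z).const_mul 6).add_const 3) h0
  refine h.congr_deriv ?_
  have e : z + 1 / 2 = (6 * z + 3) / 6 := by ring
  rw [e]
  simp only [id]
  field_simp
  ring

lemma Dt_w6 {z : ℂ} (hz : 0 < z.im) : Dt (w6 z) = -432 * z ^ 2 * Dt z / (tt z - 5) ^ 2 := by
  have hz0 : z ≠ 0 := by rintro rfl; simp at hz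
  have h5 := tt_sub_five_ne hz
  have h1 := (hasDerivAt_tt (im_w6_pos hz)).comp z (hasDerivAt_w6 hz)
  have h2 : HasDerivAt (tt ∘ w6) _ z :=
    ((((hasDerivAt_tt hz).sub_const 5).inv h5).const_mul 72 |>.const_add 5).congr_of_eventuallyEq (by
      filter_upwards [isOpen_im_pos.mem_nhds hz] with w hw
      simp only [Function.comp, tt_w6 hw, div_eq_mul_inv, Pi.inv_apply])
  have h := h1.unique h2
  change 2 * Real.pi * I * Dt (w6 z) * _ = 72 * (-(2 * Real.pi * I * Dt z) / _) at h
  have : (2 * Real.pi * I : ℂ) ≠ 0 := Complex.two_pi_I_ne_zero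
  generalize (2 * Real.pi * I : ℂ) = c at *
  generalize Dt (w6 z) = d at *
  generalize Dt z = d' at *
  field_simp at h ⊢
  linear_combination h

lemma Dt_w3 {z : ℂ} (hz : 0 < z.im) : Dt (w3 z) = -108 * (z + 1 / 2) ^ 2 * Dt z / (tt z + 4) ^ 2 := by
  have hz0 := two_mul_add_one_ne hz
  have h5 := tt_add_four_ne hz
  have h1 := (hasDerivAt_tt (im_w3_pos hz)).comp z (hasDerivAt_w3 hz)
  have h2 : HasDerivAt (tt ∘ w3) _ z :=
    ((((hasDerivAt_tt hz).add_const 4).inv h5).const_mul 9 |>.const_add (-4)).congr_of_eventuallyEq (by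
      filter_upwards [isOpen_im_pos.mem_nhds hz] with w hw
      simp only [Function.comp, tt_w3 hw, div_eq_mul_inv, Pi.inv_apply])
  have h := h1.unique h2
  change 2 * Real.pi * I * Dt (w3 z) * _ = 9 * (-(2 * Real.pi * I * Dt z) / _) at h
  have : (2 * Real.pi * I : ℂ) ≠ 0 := Complex.two_pi_I_ne_zero
  generalize (2 * Real.pi * I : ℂ) = c at *
  generalize Dt (w3 z) = d at *
  generalize Dt z = d' at *
  generalize z + 1 / 2 = y at *
  field_simp at h ⊢
  linear_combination h

lemma Om_eq {z : ℂ} (hz : 0 < z.im) :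
    Om z = (qc z)⁻¹ ^ 3 * cexp (logU (-2) 10 14 (-22) (qc z)) := by
  rw [Om, ← u2_eq, ← u3_eq hz, ← u6_eq hz, (u_eq_exp hz).1, (u_eq_exp hz).2.1, (u_eq_exp hz).2.2]
  have : cexp (logU (-2) 10 14 (-22) (qc z)) = cexp (logU (-3) 3 9 (-9) (qc z)) *
      cexp (logU (-4) 8 4 (-8) (qc z)) * cexp (logU 5 (-1) 1 (-5) (qc z)) := by
    rw [← Complex.exp_add, ← Complex.exp_add]; congr 1; simp only [logU]; ring
  rw [this]; ring

lemma etaE_eq {z : ℂ} (hz : 0 < z.im) :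
    etaE z = (qc z) ^ 2 * cexp (logU 2 (-4) (-6) 12 (qc z)) := by
  have e1 := eta_mul_eq hz 1 (by norm_num)
  have e2 := eta_mul_eq hz 2 (by norm_num)
  have e3 := eta_mul_eq hz 3 (by norm_num)
  have e6 := eta_mul_eq hz 6 (by norm_num)
  have hq : qc z = cexp (Real.pi * I * z / 12) ^ 24 := by
    rw [qc, ← Complex.exp_nat_mul]; congr 1; push_cast; ring
  have hE := Complex.exp_ne_zero (Real.pi * I * z / 12)
  norm_num at e1 e2 e3 e6
  have key : cexp (logU 2 (-4) (-6) 12 (qc z)) * (cexp (logEuler (qc z ^ 2)) ^ 4 * cexp (logEuler (qc z ^ 3)) ^ 6)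
      = cexp (logEuler (qc z)) ^ 2 * cexp (logEuler (qc z ^ 6)) ^ 12 := by
    simp only [← Complex.exp_nat_mul, ← Complex.exp_add]
    congr 1; simp only [logU]; push_cast; ring
  have n2 := Complex.exp_ne_zero (logEuler (qc z ^ 2))
  have n3 := Complex.exp_ne_zero (logEuler (qc z ^ 3))
  rw [etaE, e1, e2, e3, e6, div_eq_iff (by positivity)]
  generalize cexp (logU 2 (-4) (-6) 12 (qc z)) = a at *
  generalize cexp (logEuler (qc z)) = x1 at *
  generalize cexp (logEuler (qc z ^ 2)) = x2 at *
  generalize cexp (logEuler (qc z ^ 3)) = x3 at *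
  generalize cexp (logEuler (qc z ^ 6)) = x6 at *
  rw [hq]
  linear_combination (-cexp (Real.pi * I * z / 12) ^ 74) * key

lemma Dt_ne_zero {z : ℂ} (hz : 0 < z.im) : Dt z ≠ 0 := by
  have hE : ∀ z : ℂ, 0 < z.im → Om z * etaE z = (qc z)⁻¹ * cexp (logU 0 6 8 (-10) (qc z)) := by
    intro z hz
    have hq := qc_ne_zero z
    have : cexp (logU 0 6 8 (-10) (qc z)) = cexp (logU (-2) 10 14 (-22) (qc z)) *
        cexp (logU 2 (-4) (-6) 12 (qc z)) := by
      rw [← Complex.exp_add]; congr 1; simp only [logU]; ring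
    rw [Om_eq hz, etaE_eq hz, this]; field_simp
  have hdiff := (hasPS_logU (-3) 3 9 (-9)).differentiableOn
  have hd : DifferentiableOn ℂ (fun x => thetaG x / cexp (logU 0 6 8 (-10) x)) (Metric.ball 0 1) := by
    refine DifferentiableOn.div ?_ (differentiableOn_expU _ _ _ _) fun x _ => Complex.exp_ne_zero _
    refine (differentiableOn_expU _ _ _ _).mul ((differentiableOn_const _).add
      (differentiableOn_id.mul (hdiff.deriv Metric.isOpen_ball)))
  obtain ⟨-, -, h⟩ := liouville (ι := Unit) (fun _ z => Dt z / (Om z * etaE z))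
    (fun _ x => thetaG x / cexp (logU 0 6 8 (-10) x)) (fun _ => hd)
    (fun _ z hz => by
      have hq := qc_ne_zero z
      simp only [hE z hz, Dt]
      rw [mul_div_mul_left _ _ (inv_ne_zero hq)])
    (fun _ => ⟨(), fun z hz => le_of_eq (congrArg _ (by
      have hz0 : z ≠ 0 := by rintro rfl; simp at hz
      have h1 := tt_sub_five_ne hz
      have h2 := Om_ne_zero hz
      have h3 := etaE_ne_zero hz
      simp only [Dt_w6 hz, Om_w6 hz, etaE_w6 hz, u6_eq hz]
      field_simp
      ring))⟩)
    (fun _ => ⟨(), fun z hz => le_of_eq (congrArg _ (by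
      have hz0 := two_mul_add_one_ne hz
      have h1 := tt_add_four_ne hz
      have h2 := Om_ne_zero hz
      have h3 := etaE_ne_zero hz
      simp only [Dt_w3 hz, Om_w3 hz, etaE_w3 hz, u3_eq hz]
      generalize z + 1 / 2 = y at *
      field_simp
      ring))⟩)
  have h := h (qc z) (norm_qc_lt_one hz)
  simp only [logU_zero, thetaG] at h
  norm_num at h
  rw [div_eq_iff (Complex.exp_ne_zero _)] at h
  rw [Dt, thetaG, h]
  exact mul_ne_zero (inv_ne_zero (qc_ne_zero z)) (by simp)

lemma deriv_tt_ne_zero {z : ℂ} (hz : 0 < z.im) : deriv tt z ≠ 0 := by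
  rw [(hasDerivAt_tt hz).deriv]
  exact mul_ne_zero Complex.two_pi_I_ne_zero (Dt_ne_zero hz)

/-- `j₆*` as a function on the upper half plane. -/
noncomputable def js (z : ℂ) : ℂ :=
  (tt z - 5) * (tt z + 3) / (tt z + 4) + 6 + 64 * ((tt z + 4) / ((tt z - 5) * (tt z + 3)))

lemma jnStar_eq_js {z : ℂ} (hz : 0 < z.im) : jnStar 6 z = js z := by
  rw [jnStar_six hz, u2_eq, u3_eq hz, u6_eq hz, js]

lemma js_w6 {z : ℂ} (hz : 0 < z.im) : js (w6 z) = js z := by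
  have h3 := tt_add_three_ne hz
  have h4 := tt_add_four_ne hz
  have h5 := tt_sub_five_ne hz
  have e3 : 5 + 72 / (tt z - 5) + 3 = 8 * (tt z + 4) / (tt z - 5) := by field_simp; ring
  have e4 : 5 + 72 / (tt z - 5) + 4 = 9 * (tt z + 3) / (tt z - 5) := by field_simp; ring
  have e5 : 5 + 72 / (tt z - 5) - 5 = 72 / (tt z - 5) := by ring
  rw [js, js, tt_w6 hz, e3, e4, e5]
  field_simp
  ring

lemma js_w3 {z : ℂ} (hz : 0 < z.im) : js (w3 z) = js z := by
  have h3 := tt_add_three_ne hz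
  have h4 := tt_add_four_ne hz
  have h5 := tt_sub_five_ne hz
  have e3 : -4 + 9 / (tt z + 4) + 3 = -(tt z - 5) / (tt z + 4) := by field_simp; ring
  have e4 : -4 + 9 / (tt z + 4) + 4 = 9 / (tt z + 4) := by ring
  have e5 : -4 + 9 / (tt z + 4) - 5 = -9 * (tt z + 3) / (tt z + 4) := by field_simp; ring
  rw [js, js, tt_w3 hz, e3, e4, e5]
  field_simp

/-- The function `q j₆*` on the unit disc. -/
noncomputable def jd (x : ℂ) : ℂ :=
  cexp (logU 6 (-6) 6 (-6) x) + 6 * x + 64 * x ^ 2 * cexp (logU (-6) 6 (-6) 6 x)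

lemma js_eq {z : ℂ} (hz : 0 < z.im) : js z = (qc z)⁻¹ * jd (qc z) := by
  have hq := qc_ne_zero z
  rw [js, ← u2_eq, ← u3_eq hz, ← u6_eq hz, (u_eq_exp hz).1, (u_eq_exp hz).2.1, (u_eq_exp hz).2.2, jd]
  have e1 : cexp (logU 6 (-6) 6 (-6) (qc z)) = cexp (logU 5 (-1) 1 (-5) (qc z)) *
      cexp (logU (-3) 3 9 (-9) (qc z)) / cexp (logU (-4) 8 4 (-8) (qc z)) := by
    rw [← Complex.exp_add, ← Complex.exp_sub]; congr 1; simp only [logU]; ring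
  have e2 : cexp (logU (-6) 6 (-6) 6 (qc z)) = (cexp (logU 6 (-6) 6 (-6) (qc z)))⁻¹ := by
    rw [← Complex.exp_neg]; congr 1; simp only [logU]; ring
  rw [e2, e1]
  have n2 := Complex.exp_ne_zero (logU (-3) 3 9 (-9) (qc z))
  have n3 := Complex.exp_ne_zero (logU (-4) 8 4 (-8) (qc z))
  have n6 := Complex.exp_ne_zero (logU 5 (-1) 1 (-5) (qc z))
  generalize cexp (logU (-3) 3 9 (-9) (qc z)) = a at *
  generalize cexp (logU (-4) 8 4 (-8) (qc z)) = b at *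
  generalize cexp (logU 5 (-1) 1 (-5) (qc z)) = c at *
  generalize qc z = q at *
  field_simp

lemma jd_zero : jd 0 = 1 := by simp [jd, logU_zero]

lemma differentiableOn_jd : DifferentiableOn ℂ jd (Metric.ball 0 1) :=
  ((differentiableOn_expU _ _ _ _).add (differentiableOn_id.const_mul 6)).add
    (((differentiableOn_id.pow 2).const_mul 64).mul (differentiableOn_expU _ _ _ _))

/-- A function on the upper half plane invariant under `w6` and `w3` which is a Laurent series in `q`
is a polynomial in `j₆*`. -/
lemma exists_polynomial (D : ℕ) : ∀ F G : ℂ → ℂ, DifferentiableOn ℂ G (Metric.ball 0 1) →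
    (∀ z, 0 < z.im → F z = (qc z)⁻¹ ^ D * G (qc z)) → (∀ z, 0 < z.im → F (w6 z) = F z) →
    (∀ z, 0 < z.im → F (w3 z) = F z) →
    ∃ p : Polynomial ℂ, ∀ z, 0 < z.im → F z = p.eval (js z) := by
  induction D with
  | zero =>
    intro F G hG hF h6 h3
    obtain ⟨-, -, h⟩ := liouville (ι := Unit) (fun _ => F) (fun _ => G) (fun _ => hG)
      (fun _ z hz => by rw [hF z hz]; simp)
      (fun _ => ⟨(), fun z hz => by rw [h6 z hz]⟩) (fun _ => ⟨(), fun z hz => by rw [h3 z hz]⟩)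
    exact ⟨Polynomial.C (G 0), fun z hz => by
      rw [hF z hz, pow_zero, one_mul, h _ (norm_qc_lt_one hz), Polynomial.eval_C]⟩
  | succ D ih =>
    intro F G hG hF h6 h3
    set H : ℂ → ℂ := fun x => G x - G 0 * jd x ^ (D + 1) with hH
    have hHd : DifferentiableOn ℂ H (Metric.ball 0 1) :=
      hG.sub ((differentiableOn_jd.pow _).const_mul _)
    have hH0 : H 0 = 0 := by simp [hH, jd_zero]
    obtain ⟨p, hp⟩ := ih (fun z => F z - G 0 * js z ^ (D + 1)) (dslope H 0)
      ((Complex.differentiableOn_dslope (Metric.ball_mem_nhds _ one_pos)).2 hHd)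
      (fun z hz => by
        have hq := qc_ne_zero z
        rw [dslope_of_ne _ hq, slope_def_field, hH0, sub_zero, sub_zero, hF z hz, js_eq hz, hH, mul_pow, pow_succ (qc z)⁻¹ D]
        field_simp)
      (fun z hz => by simp only [h6 z hz, js_w6 hz]) (fun z hz => by simp only [h3 z hz, js_w3 hz])
    exact ⟨p + Polynomial.C (G 0) * Polynomial.X ^ (D + 1), fun z hz => by
      rw [Polynomial.eval_add, ← hp z hz]; simp⟩

lemma exists_js_eq (X : ℂ) : ∃ z : ℂ, 0 < z.im ∧ js z = X := by
  by_contra! hne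
  have hn : ∀ x ∈ Metric.ball (0 : ℂ) 1, jd x - X * x ≠ 0 := by
    intro x hx
    rcases eq_or_ne x 0 with rfl | h0
    · simp [jd_zero]
    · obtain ⟨z, hz, rfl⟩ := exists_qc_eq h0 (by simpa using hx)
      intro h
      apply hne z hz
      rw [js_eq hz, inv_mul_eq_iff_eq_mul₀ h0]
      linear_combination h
  obtain ⟨-, -, h⟩ := liouville (ι := Unit) (fun _ z => 1 / (js z - X)) (fun _ x => x / (jd x - X * x))
    (fun _ => differentiableOn_id.div (differentiableOn_jd.sub (differentiableOn_id.const_mul X)) hn)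
    (fun _ z hz => by
      have hq := qc_ne_zero z
      have := hn (qc z) (by simpa using norm_qc_lt_one hz)
      have h2 : js z - X ≠ 0 := sub_ne_zero.2 (hne z hz)
      rw [div_eq_div_iff h2 this, js_eq hz]; field_simp)
    (fun _ => ⟨(), fun z hz => by simp only [js_w6 hz, le_refl]⟩)
    (fun _ => ⟨(), fun z hz => by simp only [js_w3 hz, le_refl]⟩)
  have h := h (1 / 2) (by norm_num)
  rw [zero_div, div_eq_zero_iff] at h
  rcases h with h | h
  · norm_num at h
  · exact hn (1 / 2) (by norm_num) h

/-- Integral `2 × 2` matrices. -/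
abbrev Mat2 := Matrix (Fin 2) (Fin 2) ℤ

/-- The Möbius action of an integral matrix. -/
noncomputable def mact (M : Mat2) (z : ℂ) : ℂ := (M 0 0 * z + M 0 1) / (M 1 0 * z + M 1 1)

/-- The automorphy factor of an integral matrix. -/
noncomputable def mden (M : Mat2) (z : ℂ) : ℂ := M 1 0 * z + M 1 1

lemma mact_of (a b c d : ℤ) (z : ℂ) : mact !![a, b; c, d] z = (a * z + b) / (c * z + d) := by
  simp [mact]

lemma mden_ne_zero {M : Mat2} (hM : 0 < M.det) {z : ℂ} (hz : 0 < z.im) : mden M z ≠ 0 := by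
  intro h
  have him := congrArg Complex.im h
  have hre := congrArg Complex.re h
  simp [mden] at him hre
  rw [det_fin_two] at hM
  rcases him with h0 | h0
  · rw [h0] at hre hM
    simp at hre
    rw [hre] at hM
    simp at hM
  · exact hz.ne' h0

lemma im_mact {M : Mat2} (hM : 0 < M.det) {z : ℂ} (hz : 0 < z.im) :
    (mact M z).im = M.det * z.im / normSq (mden M z) := by
  have h0 : normSq (mden M z) ≠ 0 := by simpa using mden_ne_zero hM hz
  rw [mact, ← mden, Complex.div_im, det_fin_two]
  field_simp
  simp [mden]
  ring

lemma im_mact_pos {M : Mat2} (hM : 0 < M.det) {z : ℂ} (hz : 0 < z.im) : 0 < (mact M z).im := by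
  rw [im_mact hM hz]
  have : 0 < normSq (mden M z) := Complex.normSq_pos.2 (mden_ne_zero hM hz)
  have : (0 : ℝ) < M.det := by exact_mod_cast hM
  positivity

lemma mact_mul (M : Mat2) {N : Mat2} (hN : 0 < N.det) {z : ℂ} (hz : 0 < z.im) :
    mact (M * N) z = mact M (mact N z) := by
  have h : (N 1 0 : ℂ) * z + N 1 1 ≠ 0 := mden_ne_zero hN hz
  rw [mact, mact, mact]
  simp only [mul_apply, Fin.sum_univ_two]
  push_cast
  rw [mul_div_assoc', mul_div_assoc', div_add' _ _ _ h, div_add' _ _ _ h, div_div_div_cancel_right₀ h]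
  congr 1 <;> ring

lemma mden_mul (M : Mat2) {N : Mat2} (hN : 0 < N.det) {z : ℂ} (hz : 0 < z.im) :
    mden (M * N) z = mden M (mact N z) * mden N z := by
  have h : mden N z ≠ 0 := mden_ne_zero hN hz
  rw [mact, ← mden, mden, mden, add_mul, mul_assoc, div_mul_cancel₀ _ h, mden]
  simp only [mul_apply, Fin.sum_univ_two]
  push_cast
  ring

lemma mact_one (z : ℂ) : mact 1 z = z := by simp [mact]

lemma mact_smul (M : Mat2) {k : ℤ} (hk : k ≠ 0) (z : ℂ) : mact (k • M) z = mact M z := by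
  have : (k : ℂ) ≠ 0 := by exact_mod_cast hk
  simp only [mact, Matrix.smul_apply, smul_eq_mul]
  push_cast
  rw [mul_assoc, mul_assoc, ← mul_add, ← mul_add, mul_div_mul_left _ _ this]

lemma mact_neg (M : Mat2) (z : ℂ) : mact (-M) z = mact M z := by
  rw [← mact_smul M (k := -1) (by norm_num), neg_one_smul]

lemma hasDerivAt_mact {M : Mat2} (hM : 0 < M.det) {z : ℂ} (hz : 0 < z.im) :
    HasDerivAt (mact M) (M.det / mden M z ^ 2) z := by
  have h := (((hasDerivAt_id z).const_mul (M 0 0 : ℂ)).add_const (M 0 1 : ℂ)).div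
    (((hasDerivAt_id z).const_mul (M 1 0 : ℂ)).add_const (M 1 1 : ℂ)) (mden_ne_zero hM hz)
  refine h.congr_deriv ?_
  simp only [id, det_fin_two, mden]
  push_cast
  ring_nf

/-- Integral matrices of determinant `n` with lower left entry divisible by `6`. -/
def R (n : ℤ) : Set Mat2 := {M | M.det = n ∧ 6 ∣ M 1 0}

lemma R_mul {m n : ℤ} {M N : Mat2} (hM : M ∈ R m) (hN : N ∈ R n) : M * N ∈ R (m * n) := by
  refine ⟨by rw [det_mul, hM.1, hN.1], ?_⟩
  rw [mul_apply, Fin.sum_univ_two]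
  exact dvd_add (hM.2.mul_right _) (hN.2.mul_left _)

lemma one_mem_R : (1 : Mat2) ∈ R 1 := by simp [R]

lemma neg_mem_R {n : ℤ} {M : Mat2} (hM : M ∈ R n) : -M ∈ R n := by
  refine ⟨by rw [det_fin_two, ← hM.1, det_fin_two]; simp, by simpa using hM.2⟩

lemma adj_mem_R {n : ℤ} {M : Mat2} (hM : M ∈ R n) : M.adjugate ∈ R n := by
  refine ⟨?_, ?_⟩
  · rw [← hM.1, adjugate_fin_two, det_fin_two, det_fin_two]; simp; ring
  · rw [adjugate_fin_two]; simpa using hM.2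

lemma mul_adj {M : Mat2} (hM : M ∈ R 1) : M * M.adjugate = 1 := by
  rw [mul_adjugate, hM.1, one_smul]

lemma adj_mul {M : Mat2} (hM : M ∈ R 1) : M.adjugate * M = 1 := by
  rw [adjugate_mul, hM.1, one_smul]

lemma det_pos_of_mem {n : ℤ} (hn : 0 < n) {M : Mat2} (hM : M ∈ R n) : 0 < M.det := hM.1 ▸ hn

lemma mact_adj {M : Mat2} (hM : M ∈ R 1) {z : ℂ} (hz : 0 < z.im) :
    mact M.adjugate (mact M z) = z := by
  rw [← mact_mul _ (det_pos_of_mem one_pos hM) hz, adj_mul hM, mact_one]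

lemma w6_eq (z : ℂ) : w6 z = mact !![0, -1; 6, 0] z := by rw [mact_of, w6]; simp
lemma w3_eq (z : ℂ) : w3 z = mact !![3, 1; 6, 3] z := by rw [mact_of, w3]; simp

lemma tt_w6_w6 {z : ℂ} (hz : 0 < z.im) (k : ℤ) : tt (w6 (w6 z + k)) = tt z := by
  have h1 : 0 < (w6 z + k).im := by simpa using im_w6_pos hz
  have := tt_sub_five_ne hz
  rw [tt_w6 h1, tt_add_int (im_w6_pos hz), tt_w6 hz]
  field_simp
  ring

lemma tt_w3_w3' {z : ℂ} (hz : 0 < z.im) (k : ℤ) : tt (w3 (w3 z + k)) = tt z := by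
  have h1 : 0 < (w3 z + k).im := by simpa using im_w3_pos hz
  have := tt_add_four_ne hz
  rw [tt_w3 h1, tt_add_int (im_w3_pos hz), tt_w3 hz]
  field_simp
  ring

lemma tt_upper {z : ℂ} (hz : 0 < z.im) (k : ℤ) : tt (mact !![1, k; 0, 1] z) = tt z := by
  rw [mact_of]; simpa using tt_add_int hz k

lemma add_int_eq_mact (z : ℂ) (k : ℤ) : z + k = mact !![1, k; 0, 1] z := by simp [mact_of]

lemma tt_lower {z : ℂ} (hz : 0 < z.im) (k : ℤ) : tt (mact !![1, 0; 6 * k, 1] z) = tt z := by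
  rw [← tt_w6_w6 hz (-k)]
  congr 1
  rw [w6_eq, w6_eq, add_int_eq_mact, ← mact_mul _ (by simp) hz, ← mact_mul _ (by simp) hz]
  rw [← mact_smul !![1, 0; 6 * k, 1] (k := -6) (by norm_num)]
  congr 1
  ext i j; fin_cases i <;> fin_cases j <;> simp [Matrix.mul_apply, Fin.sum_univ_two]
  ring

lemma tt_third {z : ℂ} (hz : 0 < z.im) : tt (mact !![5, 2; 12, 5] z) = tt z := by
  rw [← tt_w3_w3' hz 0]
  congr 1
  rw [w3_eq, w3_eq, add_int_eq_mact, ← mact_mul _ (by simp) hz, ← mact_mul _ (by simp) hz]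
  rw [← mact_smul !![5, 2; 12, 5] (k := 3) (by norm_num)]
  congr 1
  ext i j; fin_cases i <;> fin_cases j <;> simp [Matrix.mul_apply, Fin.sum_univ_two]

lemma tt_third' {z : ℂ} (hz : 0 < z.im) : tt (mact !![5, -2; -12, 5] z) = tt z := by
  have hd : 0 < (!![5, -2; -12, 5] : Mat2).det := by simp
  rw [← tt_third (im_mact_pos hd hz), ← mact_mul _ hd hz]
  congr 1
  rw [← mact_one z]
  congr 1
  · ext i j; fin_cases i <;> fin_cases j <;> simp [Matrix.mul_apply, Fin.sum_univ_two]
  · rw [mact_one]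

/-- Right multiplication by a matrix leaving `j₆` invariant. -/
lemma tt_mact_of_mul {M N N' : Mat2} (hN' : 0 < N'.det)
    (h' : ∀ z, 0 < z.im → tt (mact N' z) = tt z) (hNN : N * N' = 1)
    (h : ∀ z, 0 < z.im → tt (mact (M * N) z) = tt z) :
    ∀ z, 0 < z.im → tt (mact M z) = tt z := by
  intro z hz
  have : mact M z = mact (M * N) (mact N' z) := by
    rw [← mact_mul _ hN' hz, Matrix.mul_assoc, hNN, Matrix.mul_one]
  rw [this, h _ (im_mact_pos hN' hz), h' z hz]

lemma exists_abs_add_mul_le (c m : ℤ) (hm : m ≠ 0) : ∃ k : ℤ, 2 * |c + k * m| ≤ |m| := by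
  have h1 := Int.emod_nonneg c hm
  have h2 := Int.emod_lt_abs c hm
  have h3 := Int.emod_add_mul_ediv c m
  by_cases h : 2 * (c % m) ≤ |m|
  · refine ⟨-(c / m), ?_⟩
    have : c + -(c / m) * m = c % m := by linear_combination -h3
    rw [this, abs_of_nonneg h1]; exact h
  · push Not at h
    rcases abs_cases m with ⟨hm1, _⟩ | ⟨hm1, _⟩
    · refine ⟨-(c / m) - 1, ?_⟩
      have : c + (-(c / m) - 1) * m = c % m - m := by linear_combination -h3
      rw [this, abs_of_neg (by omega)]; omega
    · refine ⟨-(c / m) + 1, ?_⟩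
      have : c + (-(c / m) + 1) * m = c % m + m := by linear_combination -h3
      rw [this, abs_of_neg (by omega)]; omega

lemma tt_gamma_aux (N : ℕ) : ∀ M : Mat2, M ∈ R 1 → (M 1 0).natAbs ≤ N →
    ∀ z, 0 < z.im → tt (mact M z) = tt z := by
  induction N with
  | zero =>
    rintro M ⟨hd, -⟩ h z hz
    have h0 : M 1 0 = 0 := by omega
    rw [det_fin_two, h0, mul_zero, sub_zero] at hd
    rcases Int.mul_eq_one_iff_eq_one_or_neg_one.1 hd with ⟨h1, h2⟩ | ⟨h1, h2⟩
    · rw [mact, h0, h1, h2, ← tt_add_int hz (M 0 1)]; simp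
    · rw [mact, h0, h1, h2, ← tt_add_int hz (-M 0 1)]; simp [div_neg, add_comm]
  | succ N ih =>
    have step : ∀ M : Mat2, M ∈ R 1 → (M 1 0).natAbs ≤ N + 1 → 2 * (M 1 1).natAbs ≤ (M 1 0).natAbs →
        ∀ z, 0 < z.im → tt (mact M z) = tt z := by
      rintro M hM h hcd
      obtain ⟨hd, c, hc⟩ := id hM
      rw [det_fin_two] at hd
      have hd2 : M 1 1 % 2 ≠ 0 := by
        intro h0
        obtain ⟨d, hd'⟩ := Int.dvd_of_emod_eq_zero h0
        have : 2 * (M 0 0 * d - M 0 1 * (3 * c)) = 1 := by rw [← hd, hd', hc]; ring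
        omega
      have hd3 : M 1 1 % 3 ≠ 0 := by
        intro h0
        obtain ⟨d, hd'⟩ := Int.dvd_of_emod_eq_zero h0
        have : 3 * (M 0 0 * d - M 0 1 * (2 * c)) = 1 := by rw [← hd, hd', hc]; ring
        omega
      by_cases hlt : 3 * (M 1 1).natAbs < (M 1 0).natAbs
      · obtain ⟨k, hk⟩ := exists_abs_add_mul_le (M 1 0) (6 * M 1 1) (by omega)
        refine tt_mact_of_mul (N := !![1, 0; 6 * k, 1]) (N' := !![1, 0; 6 * (-k), 1]) (by simp)
          (fun z hz => tt_lower hz _) ?_ (ih _ (by simpa using R_mul hM ⟨by simp, by simp⟩) ?_)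
        · ext i j; fin_cases i <;> fin_cases j <;> simp [Matrix.mul_apply, Fin.sum_univ_two]
        · simp only [Matrix.mul_apply, Fin.sum_univ_two]
          simp
          have : M 1 0 + M 1 1 * (6 * k) = M 1 0 + k * (6 * M 1 1) := by ring
          rw [this]
          generalize M 1 0 + k * (6 * M 1 1) = x at *
          simp only [Int.abs_eq_natAbs] at hk
          omega
      · by_cases hs : 0 ≤ M 1 0 ∧ 0 ≤ M 1 1 ∨ M 1 0 ≤ 0 ∧ M 1 1 ≤ 0
        · refine tt_mact_of_mul (N := !![5, -2; -12, 5]) (N' := !![5, 2; 12, 5]) (by simp)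
            (fun z hz => tt_third hz) ?_ (ih _ (by simpa using R_mul hM ⟨by simp, by simp⟩) ?_)
          · ext i j; fin_cases i <;> fin_cases j <;> simp [Matrix.mul_apply, Fin.sum_univ_two]
          · simp only [Matrix.mul_apply, Fin.sum_univ_two]
            simp
            omega
        · refine tt_mact_of_mul (N' := !![5, -2; -12, 5]) (N := !![5, 2; 12, 5]) (by simp)
            (fun z hz => tt_third' hz) ?_ (ih _ (by simpa using R_mul hM ⟨by simp, by simp⟩) ?_)
          · ext i j; fin_cases i <;> fin_cases j <;> simp [Matrix.mul_apply, Fin.sum_univ_two]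
          · simp only [Matrix.mul_apply, Fin.sum_univ_two]
            simp
            omega
    intro M hM h
    by_cases h0 : M 1 0 = 0
    · exact ih M hM (by simp [h0])
    obtain ⟨k, hk⟩ := exists_abs_add_mul_le (M 1 1) (M 1 0) h0
    refine tt_mact_of_mul (N := !![1, k; 0, 1]) (N' := !![1, -k; 0, 1]) (by simp)
      (fun z hz => tt_upper hz _) ?_ (step _ (by simpa using R_mul hM ⟨by simp, by simp⟩) ?_ ?_)
    · ext i j; fin_cases i <;> fin_cases j <;> simp [Matrix.mul_apply, Fin.sum_univ_two]
    · simpa [Matrix.mul_apply, Fin.sum_univ_two] using h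
    · simp only [Matrix.mul_apply, Fin.sum_univ_two]
      simp
      have : M 1 0 * k + M 1 1 = M 1 1 + k * M 1 0 := by ring
      rw [this]
      generalize M 1 1 + k * M 1 0 = x at *
      simp only [Int.abs_eq_natAbs] at hk
      omega

lemma tt_gamma {M : Mat2} (hM : M ∈ R 1) {z : ℂ} (hz : 0 < z.im) : tt (mact M z) = tt z :=
  tt_gamma_aux _ M hM le_rfl z hz

/-- The exact divisors of `6`. -/
def eSet : Finset ℕ := {1, 2, 3, 6}

lemma mem_eSet {e : ℕ} : e ∈ eSet ↔ e = 1 ∨ e = 2 ∨ e = 3 ∨ e = 6 := by simp [eSet]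

lemma eSet_pos {e : ℕ} (he : e ∈ eSet) : 0 < e := by
  rcases mem_eSet.1 he with rfl | rfl | rfl | rfl <;> norm_num

/-- Integral Atkin–Lehner matrices. -/
def AL (e : ℕ) : Set Mat2 :=
  {M | M.det = e ∧ (e : ℤ) ∣ M 0 0 ∧ (e : ℤ) ∣ M 1 1 ∧ 6 ∣ M 1 0}

/-- A chosen Atkin–Lehner matrix. -/
def W (e : ℕ) : Mat2 :=
  if e = 2 then !![2, -1; 6, -2] else if e = 3 then !![3, 1; 6, 3]
  else if e = 6 then !![0, -1; 6, 0] else 1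

/-- The action of the Atkin–Lehner involutions on the values of `j₆`. -/
noncomputable def te (e : ℕ) (s : ℂ) : ℂ :=
  if e = 2 then -3 + -8 / (s + 3) else if e = 3 then -4 + 9 / (s + 4)
  else if e = 6 then 5 + 72 / (s - 5) else s

lemma W_mem {e : ℕ} (he : e ∈ eSet) : W e ∈ AL e := by
  rcases mem_eSet.1 he with rfl | rfl | rfl | rfl <;> simp [W, AL, det_fin_two]

lemma AL_one : AL 1 = R 1 := by ext M; simp [AL, R]

lemma det_pos_of_AL {e : ℕ} (he : e ∈ eSet) {M : Mat2} (hM : M ∈ AL e) : 0 < M.det :=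
  hM.1 ▸ (by exact_mod_cast eSet_pos he)

lemma AL_decomp {e : ℕ} (he : e ∈ eSet) {M : Mat2} (hM : M ∈ AL e) : ∃ γ ∈ R 1, M = γ * W e := by
  rcases mem_eSet.1 he with rfl | rfl | rfl | rfl
  · exact ⟨M, by rwa [← AL_one], by simp [W]⟩
  all_goals
    obtain ⟨hd, ⟨x, hx⟩, ⟨w, hw⟩, ⟨z, hz⟩⟩ := hM
    obtain ⟨y, hy⟩ : ∃ y, y = M 0 1 := ⟨_, rfl⟩
    rw [det_fin_two, hx, hw, hz, ← hy] at hd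
    push_cast at hd hx hw
  · refine ⟨!![-2 * x - 3 * y, x + y; -6 * z - 6 * w, 3 * z + 2 * w], ⟨?_, ?_⟩, ?_⟩
    · simp; linarith
    · exact ⟨-z - w, by simp; ring⟩
    · ext i j; fin_cases i <;> fin_cases j <;>
        simp [W, Matrix.mul_apply, Fin.sum_univ_two, hx, hw, hz, ← hy] <;> ring
  · refine ⟨!![3 * x - 2 * y, -x + y; 6 * z - 6 * w, -2 * z + 3 * w], ⟨?_, ?_⟩, ?_⟩
    · simp; linarith
    · exact ⟨z - w, by simp; ring⟩
    · ext i j; fin_cases i <;> fin_cases j <;>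
        simp [W, Matrix.mul_apply, Fin.sum_univ_two, hx, hw, hz, ← hy] <;> ring
  · refine ⟨!![-y, x; -6 * w, z], ⟨?_, ?_⟩, ?_⟩
    · simp; linarith
    · exact ⟨-w, by simp⟩
    · ext i j; fin_cases i <;> fin_cases j <;>
        simp [W, Matrix.mul_apply, Fin.sum_univ_two, hx, hw, hz, ← hy] <;> ring

lemma tt_W {e : ℕ} (he : e ∈ eSet) {z : ℂ} (hz : 0 < z.im) : tt (mact (W e) z) = te e (tt z) := by
  rcases mem_eSet.1 he with rfl | rfl | rfl | rfl
  · simp [W, te, mact_one]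
  · have h3 := tt_add_three_ne hz
    have h5 := tt_sub_five_ne hz
    have : mact (W 2) z = w3 (w6 z) := by
      rw [w3_eq, w6_eq, ← mact_mul _ (by simp) hz, ← mact_smul (W 2) (k := 3) (by norm_num)]
      congr 1
      ext i j; fin_cases i <;> fin_cases j <;> simp [W, Matrix.mul_apply, Fin.sum_univ_two]
    have e9 : 5 + 72 / (tt z - 5) + 4 = 9 * (tt z + 3) / (tt z - 5) := by field_simp; ring
    rw [this, tt_w3 (im_w6_pos hz), tt_w6 hz, e9]
    simp only [te, if_true]
    field_simp
    ring
  · simpa [W, te, ← w3_eq] using tt_w3 hz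
  · simpa [W, te, ← w6_eq] using tt_w6 hz

lemma tt_AL {e : ℕ} (he : e ∈ eSet) {M : Mat2} (hM : M ∈ AL e) {z : ℂ} (hz : 0 < z.im) :
    tt (mact M z) = te e (tt z) := by
  obtain ⟨γ, hγ, rfl⟩ := AL_decomp he hM
  have hW := det_pos_of_AL he (W_mem he)
  rw [mact_mul _ hW hz, tt_gamma hγ (im_mact_pos hW hz), tt_W he hz]

lemma gamma_mul_AL {e : ℕ} {γ M : Mat2} (hγ : γ ∈ R 1) (he : e ∈ eSet) (hM : M ∈ AL e) :
    γ * M ∈ AL e := by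
  obtain ⟨h1, c, h2⟩ := hγ
  obtain ⟨hd, hx, hw, hz⟩ := hM
  have he6 : (e : ℤ) ∣ 6 := by
    rcases mem_eSet.1 he with rfl | rfl | rfl | rfl <;> norm_num
  refine ⟨by rw [det_mul, h1, hd, one_mul], ?_, ?_, ?_⟩
  · rw [Matrix.mul_apply, Fin.sum_univ_two]
    exact dvd_add (hx.mul_left _) ((he6.trans hz).mul_left _)
  · rw [Matrix.mul_apply, Fin.sum_univ_two, h2]
    exact dvd_add ((he6.mul_right _).mul_right _) (hw.mul_left _)
  · rw [Matrix.mul_apply, Fin.sum_univ_two, h2]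
    exact dvd_add ((dvd_mul_right _ _).mul_right _) (hz.mul_left _)

lemma adj_mem_AL {e : ℕ} {M : Mat2} (hM : M ∈ AL e) : M.adjugate ∈ AL e := by
  obtain ⟨hd, hx, hw, hz⟩ := hM
  refine ⟨?_, ?_, ?_, ?_⟩
  · rw [← hd, adjugate_fin_two, det_fin_two, det_fin_two]; simp; ring
  all_goals rw [adjugate_fin_two]; simpa

lemma AL_mul {e e' : ℕ} (he : e ∈ eSet) (he' : e' ∈ eSet) {M M' : Mat2} (hM : M ∈ AL e)
    (hM' : M' ∈ AL e') : ∃ e'' ∈ eSet, ∃ k : ℕ, 0 < k ∧ ∃ M'' ∈ AL e'', M * M' = (k : ℤ) • M'' ∧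
      e * e' = k ^ 2 * e'' := by
  obtain ⟨hd, ⟨x, hx⟩, ⟨w, hw⟩, ⟨z, hz⟩⟩ := hM
  obtain ⟨hd', ⟨x', hx'⟩, ⟨w', hw'⟩, ⟨z', hz'⟩⟩ := hM'
  have key : ∀ k f f' e'' l : ℕ, 0 < k → e'' ∈ eSet → e = k * f → e' = k * f' → k * e'' * l = 6 →
      e'' = f * f' → ∃ e'' ∈ eSet, ∃ k : ℕ, 0 < k ∧ ∃ M'' ∈ AL e'', M * M' = (k : ℤ) • M'' ∧
      e * e' = k ^ 2 * e'' := by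
    intro k f f' e'' l hk he'' h1 h2 h3 h4
    have hk0 : (k : ℤ) ≠ 0 := by exact_mod_cast hk.ne'
    have h6 : (6 : ℤ) = k * e'' * l := by exact_mod_cast h3.symm
    have h1' : (e : ℤ) = k * f := by exact_mod_cast h1
    have h2' : (e' : ℤ) = k * f' := by exact_mod_cast h2
    have h4' : (e'' : ℤ) = f * f' := by exact_mod_cast h4
    have hee : (e : ℤ) * e' = k ^ 2 * e'' := by rw [h1', h2', h4']; ring
    have hprod : M * M' = (k : ℤ) • !![e'' * (k * x * x' + l * M 0 1 * z'), f * x * M' 0 1 + f' * M 0 1 * w';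
        6 * (f' * z * x' + f * w * z'), e'' * (l * z * M' 0 1 + k * w * w')] := by
      ext i j
      fin_cases i <;> fin_cases j <;>
        simp [Matrix.mul_apply, Fin.sum_univ_two, hx, hw, hz, hx', hw', hz']
      · linear_combination (x * x') * hee + (M 0 1 * z') * h6
      · rw [h1', h2']; ring
      · rw [h1', h2']; ring
      · linear_combination (w * w') * hee + (M' 0 1 * z) * h6
    refine ⟨e'', he'', k, hk, _, ⟨?_, ?_, ?_, ?_⟩, hprod, by exact_mod_cast hee⟩
    · have := congrArg Matrix.det hprod
      rw [det_mul, hd, hd', det_smul, hee] at this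
      simp only [Fintype.card_fin] at this
      exact (mul_left_cancel₀ (pow_ne_zero 2 hk0) this).symm
    · simp
    · simp
    · simp
  rcases mem_eSet.1 he with rfl | rfl | rfl | rfl <;> rcases mem_eSet.1 he' with rfl | rfl | rfl | rfl
  · exact key 1 1 1 1 6 (by norm_num) (by decide) rfl rfl rfl rfl
  · exact key 1 1 2 2 3 (by norm_num) (by decide) rfl rfl rfl rfl
  · exact key 1 1 3 3 2 (by norm_num) (by decide) rfl rfl rfl rfl
  · exact key 1 1 6 6 1 (by norm_num) (by decide) rfl rfl rfl rfl
  · exact key 1 2 1 2 3 (by norm_num) (by decide) rfl rfl rfl rfl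
  · exact key 2 1 1 1 3 (by norm_num) (by decide) rfl rfl rfl rfl
  · exact key 1 2 3 6 1 (by norm_num) (by decide) rfl rfl rfl rfl
  · exact key 2 1 3 3 1 (by norm_num) (by decide) rfl rfl rfl rfl
  · exact key 1 3 1 3 2 (by norm_num) (by decide) rfl rfl rfl rfl
  · exact key 1 3 2 6 1 (by norm_num) (by decide) rfl rfl rfl rfl
  · exact key 3 1 1 1 2 (by norm_num) (by decide) rfl rfl rfl rfl
  · exact key 3 1 2 2 1 (by norm_num) (by decide) rfl rfl rfl rfl
  · exact key 1 6 1 6 1 (by norm_num) (by decide) rfl rfl rfl rfl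
  · exact key 2 3 1 3 1 (by norm_num) (by decide) rfl rfl rfl rfl
  · exact key 3 2 1 2 1 (by norm_num) (by decide) rfl rfl rfl rfl
  · exact key 6 1 1 1 1 (by norm_num) (by decide) rfl rfl rfl rfl

/-- The real matrix of an integral matrix. -/
def toR (M : Mat2) : Matrix (Fin 2) (Fin 2) ℝ := M.map (Int.cast : ℤ → ℝ)

lemma toR_mul (M N : Mat2) : toR (M * N) = toR M * toR N := by
  ext i j; simp [toR, Matrix.mul_apply]

lemma toR_smul (k : ℤ) (M : Mat2) : toR (k • M) = (k : ℝ) • toR M := by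
  ext i j
  simp only [toR, Matrix.map_apply, Matrix.smul_apply, smul_eq_mul]
  push_cast
  rfl

lemma mem_FrickeGroup {g : SL2R} : g ∈ FrickeGroup 6 ↔
    ∃ e ∈ eSet, ∃ M ∈ AL e, g.1 = (Real.sqrt e)⁻¹ • toR M := by
  constructor
  · intro hg
    have hdiv : ∀ e ∈ {e : ℕ | e ∣ 6 ∧ Nat.Coprime e (6 / e)}, e ∈ eSet := by
      rintro e ⟨he, -⟩
      have := Nat.le_of_dvd (by norm_num) he
      interval_cases e <;> simp_all [eSet]
    induction hg using Subgroup.closure_induction with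
    | mem g hg =>
      rcases hg with hg | hg
      · obtain ⟨γ, hγ, rfl⟩ := hg
        refine ⟨1, by decide, γ.1, ?_, ?_⟩
        · rw [AL_one]
          refine ⟨γ.2, ?_⟩
          have := CongruenceSubgroup.Gamma0_mem.1 hγ
          exact (ZMod.intCast_zmod_eq_zero_iff_dvd _ 6).1 this
        · simp [toR]
      · simp only [Set.mem_iUnion] at hg
        obtain ⟨e, he, x, y, z, w, h⟩ := hg
        have he := hdiv e he
        have hpos : (0 : ℝ) < e := by exact_mod_cast eSet_pos he
        have hM : g.1 = (Real.sqrt e)⁻¹ • toR !![x * e, y; z * 6, w * e] := by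
          rw [h]; congr 1
          ext i j; fin_cases i <;> fin_cases j <;> simp [toR]
        refine ⟨e, he, _, ⟨?_, ?_, ?_, ?_⟩, hM⟩
        · have hd := g.2
          rw [h, det_smul, Fintype.card_fin, inv_pow, Real.sq_sqrt hpos.le,
            inv_mul_eq_iff_eq_mul₀ hpos.ne', mul_one] at hd
          simp only [det_fin_two_of] at hd ⊢
          push_cast at hd
          have : ((x * e * (w * e) - y * (z * 6) : ℤ) : ℝ) = ((e : ℤ) : ℝ) := by
            push_cast; linarith
          exact_mod_cast this
        · simp
        · simp
        · simp
    | one => exact ⟨1, by decide, 1, by rw [AL_one]; exact one_mem_R, by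
        simp [toR]⟩
    | mul g g' _ _ h h' =>
      obtain ⟨e, he, M, hM, h⟩ := h
      obtain ⟨e', he', M', hM', h'⟩ := h'
      obtain ⟨e'', he'', k, hk, M'', hM'', hp, hee⟩ := AL_mul he he' hM hM'
      refine ⟨e'', he'', M'', hM'', ?_⟩
      have hk0 : (k : ℝ) ≠ 0 := by exact_mod_cast hk.ne'
      have hgg : (g * g').1 = g.1 * g'.1 := Matrix.SpecialLinearGroup.coe_mul g g'
      rw [hgg, h, h', smul_mul_smul_comm, ← toR_mul, hp, toR_smul, smul_smul]
      congr 1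
      rw [← mul_inv, ← Real.sqrt_mul (by positivity)]
      have : (e : ℝ) * e' = k ^ 2 * e'' := by exact_mod_cast hee
      rw [this, Real.sqrt_mul (by positivity), Real.sqrt_sq (by positivity)]
      push_cast
      field_simp
    | inv g _ h =>
      obtain ⟨e, he, M, hM, h⟩ := h
      refine ⟨e, he, _, adj_mem_AL hM, ?_⟩
      have hgi : (g⁻¹).1 = g.1.adjugate := Matrix.SpecialLinearGroup.coe_inv g
      rw [hgi, h, adjugate_smul, adjugate_fin_two, adjugate_fin_two]
      simp only [Fintype.card_fin]
      ext i j; fin_cases i <;> fin_cases j <;> simp [toR]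
  · rintro ⟨e, he, M, ⟨hd, ⟨x, hx⟩, ⟨w, hw⟩, ⟨z, hz⟩⟩, h⟩
    refine Subgroup.subset_closure (Or.inr ?_)
    simp only [Set.mem_iUnion]
    refine ⟨e, ?_, x, M 0 1, z, w, ?_⟩
    · rcases mem_eSet.1 he with rfl | rfl | rfl | rfl <;>
        exact ⟨by norm_num, by norm_num⟩
    · rw [h]; congr 1
      ext i j; fin_cases i <;> fin_cases j <;> simp [toR, hx, hw, hz, mul_comm]

lemma eventually_inj {f : ℂ → ℂ} {f' z : ℂ} (h : HasStrictDerivAt f f' z) (hf : f' ≠ 0) :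
    ∀ᶠ p : ℂ × ℂ in 𝓝 (z, z), f p.1 = f p.2 → p.1 = p.2 := by
  have h1 := h.isLittleO.def (c := ‖f'‖ / 2) (by positivity)
  filter_upwards [h1] with p hp heq
  rw [heq, sub_self, zero_sub, norm_neg] at hp
  have : ‖(ContinuousLinearMap.toSpanSingleton ℂ f') (p.1 - p.2)‖ = ‖p.1 - p.2‖ * ‖f'‖ := by
    simp
  rw [this] at hp
  have hp0 : 0 < ‖f'‖ := norm_pos_iff.2 hf
  have : ‖p.1 - p.2‖ ≤ 0 := by nlinarith
  exact sub_eq_zero.1 (norm_le_zero_iff.1 this)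

lemma exists_AL_strip {z : ℂ} (hz : 0 < z.im) : ∃ e ∈ eSet, ∃ M ∈ AL e,
    1 / 5 ≤ (mact M z).im ∧ |(mact M z).re| ≤ 1 / 2 := by
  have step : ∀ z : ℂ, 0 < z.im → ∀ e' ∈ eSet, ∀ M' ∈ AL e', (∃ e ∈ eSet, ∃ M ∈ AL e,
      1 / 5 ≤ (mact M (mact M' z)).im ∧ |(mact M (mact M' z)).re| ≤ 1 / 2) → (∃ e ∈ eSet, ∃ M ∈ AL e,
      1 / 5 ≤ (mact M z).im ∧ |(mact M z).re| ≤ 1 / 2) := by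
    rintro z hz e' he' M' hM' ⟨e, he, M, hM, h⟩
    obtain ⟨e'', he'', k, hk, M'', hM'', hp, -⟩ := AL_mul he he' hM hM'
    refine ⟨e'', he'', M'', hM'', ?_⟩
    have hk0 : (k : ℤ) ≠ 0 := by exact_mod_cast hk.ne'
    rwa [← mact_smul M'' hk0, ← hp, mact_mul _ (det_pos_of_AL he' hM') hz]
  have hT : ∀ n : ℤ, !![1, n; 0, 1] ∈ AL 1 := fun n => by simp [AL]
  refine reduction (fun z => ∃ e ∈ eSet, ∃ M ∈ AL e,
    1 / 5 ≤ (mact M z).im ∧ |(mact M z).re| ≤ 1 / 2) ?_ ?_ ?_ ?_ hz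
  · intro z n hz h
    rw [add_int_eq_mact] at h
    exact step z hz 1 (by decide) _ (hT n) h
  · intro z hz h
    rw [w6_eq] at h
    exact step z hz 6 (by decide) _ (W_mem (e := 6) (by decide)) h
  · intro z hz h
    rw [w3_eq] at h
    exact step z hz 3 (by decide) _ (W_mem (e := 3) (by decide)) h
  · intro z hz
    refine ⟨1, by decide, _, hT (-round z.re), ?_⟩
    rw [← add_int_eq_mact]
    refine ⟨by simpa using hz, ?_⟩
    have := abs_sub_round z.re
    simpa [← sub_eq_add_neg] using this

lemma finite_mats (B : ℤ) : {M : Mat2 | ∀ i j, |M i j| ≤ B}.Finite := by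
  have : (Set.univ.pi fun _ : Fin 2 => Set.univ.pi fun _ : Fin 2 => Set.Icc (-B) B).Finite :=
    Set.Finite.pi fun _ => Set.Finite.pi fun _ => Set.finite_Icc _ _
  exact this.subset fun M hM i _ j _ => abs_le.1 (hM i j)

lemma abs_le_of_norm {x y : ℤ} {w : ℂ} {δ B K : ℝ} (hδ : 0 < δ) (h1 : δ ≤ w.im) (h2 : ‖w‖ ≤ B)
    (h3 : ‖(x : ℂ) * w + y‖ ≤ K) : |(x : ℝ)| ≤ K / δ ∧ |(y : ℝ)| ≤ K + K / δ * B := by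
  have hx : |(x : ℝ)| ≤ K / δ := by
    rw [le_div_iff₀ hδ]
    have := (Complex.abs_im_le_norm ((x : ℂ) * w + y)).trans h3
    have e : ((x : ℂ) * w + y).im = x * w.im := by simp
    rw [e, abs_mul, abs_of_pos (hδ.trans_le h1)] at this
    exact (mul_le_mul_of_nonneg_left h1 (abs_nonneg _)).trans this
  refine ⟨hx, ?_⟩
  have e : (y : ℂ) = ((x : ℂ) * w + y) - x * w := by ring
  have : ‖(y : ℂ)‖ ≤ K + K / δ * B := by
    rw [e]
    refine (norm_sub_le _ _).trans (add_le_add h3 ?_)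
    rw [norm_mul, Complex.norm_intCast]
    exact mul_le_mul hx h2 (norm_nonneg _) ((abs_nonneg _).trans hx)
  rwa [Complex.norm_intCast] at this

/-- The orbit relation of `Γ₀(6)`. -/
def Orb (z z' : ℂ) : Prop := ∃ γ ∈ R 1, mact γ z = z'

lemma finite_of_bounds {δ B : ℝ} (hδ : 0 < δ) : {γ ∈ R 1 | ∃ w : ℂ, δ ≤ w.im ∧ ‖w‖ ≤ B ∧
    δ ≤ (mact γ w).im ∧ ‖mact γ w‖ ≤ B}.Finite := by
  set K : ℝ := B / δ + 1
  set L : ℝ := (K + K / δ + K / δ * B) + (B * K + B * K / δ + B * K / δ * B)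
  refine (finite_mats ⌈L⌉).subset ?_
  rintro γ ⟨hγ, w, h1, h2, h3, h4⟩
  have hd : 0 < γ.det := det_pos_of_mem one_pos hγ
  have hw : 0 < w.im := hδ.trans_le h1
  have hB : 0 ≤ B := (norm_nonneg _).trans h2
  have hne := mden_ne_zero hd hw
  have hn : 0 < normSq (mden γ w) := Complex.normSq_pos.2 hne
  have him := im_mact hd hw
  rw [hγ.1, Int.cast_one, one_mul] at him
  have hK0 : 0 ≤ K := by positivity
  have hK : ‖mden γ w‖ ≤ K := by
    have hsq : ‖mden γ w‖ ^ 2 ≤ B / δ := by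
      rw [← Complex.normSq_eq_norm_sq, le_div_iff₀ hδ]
      have : δ ≤ w.im / normSq (mden γ w) := him ▸ h3
      rw [le_div_iff₀ hn] at this
      have := (this.trans ((le_abs_self _).trans (Complex.abs_im_le_norm w))).trans h2
      linarith
    nlinarith [norm_nonneg (mden γ w), sq_nonneg (‖mden γ w‖ - 1)]
  have hnum : ‖(γ 0 0 : ℂ) * w + γ 0 1‖ ≤ B * K := by
    have : (γ 0 0 : ℂ) * w + γ 0 1 = mact γ w * mden γ w := by
      rw [mact, ← mden, div_mul_cancel₀ _ hne]
    rw [this, norm_mul]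
    exact mul_le_mul h4 hK (norm_nonneg _) hB
  obtain ⟨hc, hd'⟩ := abs_le_of_norm hδ h1 h2 (show ‖(γ 1 0 : ℂ) * w + γ 1 1‖ ≤ K from hK)
  obtain ⟨ha, hb⟩ := abs_le_of_norm hδ h1 h2 hnum
  have p1 : 0 ≤ K / δ := by positivity
  have p2 : 0 ≤ K / δ * B := by positivity
  have p3 : 0 ≤ B * K := by positivity
  have p4 : 0 ≤ B * K / δ := by positivity
  have p5 : 0 ≤ B * K / δ * B := by positivity
  have fin : ∀ x : ℤ, |(x : ℝ)| ≤ L → |x| ≤ ⌈L⌉ := fun x hx => by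
    have : ((|x| : ℤ) : ℝ) ≤ ⌈L⌉ := by push_cast; exact hx.trans (Int.le_ceil _)
    exact_mod_cast this
  intro i j
  fin_cases i <;> fin_cases j <;> apply fin <;> simp only [Fin.zero_eta, Fin.mk_one, Fin.isValue] <;>
    linarith

lemma orb_closed {z z' : ℂ} (hz : 0 < z.im) (hz' : 0 < z'.im) (h : ¬ Orb z z') :
    ∀ᶠ p : ℂ × ℂ in 𝓝 (z, z'), ¬ Orb p.1 p.2 := by
  obtain ⟨δ, hδ, h1, h2⟩ : ∃ δ : ℝ, 0 < δ ∧ δ < z.im ∧ δ < z'.im :=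
    ⟨min z.im z'.im / 2, by positivity, by linarith [min_le_left z.im z'.im, lt_min hz hz'],
      by linarith [min_le_right z.im z'.im, lt_min hz hz']⟩
  have hfin := finite_of_bounds (δ := δ) (B := ‖z‖ + ‖z'‖ + 1) hδ
  have e1 : ∀ᶠ p : ℂ × ℂ in 𝓝 (z, z'), δ < p.1.im :=
    (continuous_im.comp continuous_fst).continuousAt.eventually (lt_mem_nhds h1)
  have e2 : ∀ᶠ p : ℂ × ℂ in 𝓝 (z, z'), δ < p.2.im :=
    (continuous_im.comp continuous_snd).continuousAt.eventually (lt_mem_nhds h2)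
  have e3 : ∀ᶠ p : ℂ × ℂ in 𝓝 (z, z'), ‖p.1‖ < ‖z‖ + ‖z'‖ + 1 :=
    (continuous_norm.comp continuous_fst).continuousAt.eventually
      (gt_mem_nhds (by simp only [Function.comp]; linarith [norm_nonneg z']))
  have e4 : ∀ᶠ p : ℂ × ℂ in 𝓝 (z, z'), ‖p.2‖ < ‖z‖ + ‖z'‖ + 1 :=
    (continuous_norm.comp continuous_snd).continuousAt.eventually
      (gt_mem_nhds (by simp only [Function.comp]; linarith [norm_nonneg z]))
  have e5 := (Filter.eventually_all_finite hfin (l := 𝓝 (z, z'))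
    (p := fun γ p => mact γ p.1 ≠ p.2)).2 (by
      intro γ hγ
      have hc : ContinuousAt (fun p : ℂ × ℂ => mact γ p.1) (z, z') :=
        ContinuousAt.comp (g := mact γ) (f := Prod.fst)
          (hasDerivAt_mact (det_pos_of_mem one_pos hγ.1) hz).continuousAt continuousAt_fst
      exact ((hc.sub continuousAt_snd).eventually_ne
        (sub_ne_zero.2 fun he => h ⟨γ, hγ.1, he⟩)).mono fun p hp => sub_ne_zero.1 hp)
  filter_upwards [e1, e2, e3, e4, e5] with p p1 p2 p3 p4 p5
  rintro ⟨γ, hγ, he⟩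
  exact p5 γ ⟨hγ, p.1, p1.le, p3.le, by rw [he]; exact p2.le, by rw [he]; exact p4.le⟩ he

lemma Orb.symm {z z' : ℂ} (hz : 0 < z.im) (h : Orb z z') : Orb z' z := by
  obtain ⟨γ, hγ, rfl⟩ := h
  exact ⟨_, adj_mem_R hγ, mact_adj hγ hz⟩

lemma Orb.trans {z z' z'' : ℂ} (hz : 0 < z.im) (h : Orb z z') (h' : Orb z' z'') : Orb z z'' := by
  obtain ⟨γ, hγ, rfl⟩ := h
  obtain ⟨γ', hγ', rfl⟩ := h'
  exact ⟨γ' * γ, R_mul hγ' hγ, mact_mul _ (det_pos_of_mem one_pos hγ) hz⟩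

lemma hasStrictDerivAt_tt {z : ℂ} (hz : 0 < z.im) : HasStrictDerivAt tt (deriv tt z) z := by
  have hd : DifferentiableOn ℂ tt {z | 0 < z.im} := fun w hw =>
    (differentiableAt_tt hw).differentiableWithinAt
  exact (hd.analyticAt (isOpen_im_pos.mem_nhds hz)).hasStrictDerivAt

lemma AL_inv {e : ℕ} (he : e ∈ eSet) {M : Mat2} (hM : M ∈ AL e) {z : ℂ} (hz : 0 < z.im) :
    mact M.adjugate (mact M z) = z := by
  have h0 : (e : ℤ) ≠ 0 := by exact_mod_cast (eSet_pos he).ne'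
  rw [← mact_mul _ (det_pos_of_AL he hM) hz, adjugate_mul, hM.1, mact_smul _ h0, mact_one]

lemma AL_inv' {e : ℕ} (he : e ∈ eSet) {M : Mat2} (hM : M ∈ AL e) {z : ℂ} (hz : 0 < z.im) :
    mact M (mact M.adjugate z) = z := by
  have h0 : (e : ℤ) ≠ 0 := by exact_mod_cast (eSet_pos he).ne'
  rw [← mact_mul _ (det_pos_of_AL he (adj_mem_AL hM)) hz, mul_adjugate, hM.1, mact_smul _ h0, mact_one]

/-- Two Atkin–Lehner matrices of the same type differ by an element of `Γ₀(6)`. -/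
lemma orb_AL {e : ℕ} (he : e ∈ eSet) {M M' : Mat2} (hM : M ∈ AL e) (hM' : M' ∈ AL e) {z z' : ℂ}
    (hz : 0 < z.im) (h : Orb z z') : Orb (mact M z) (mact M' z') := by
  obtain ⟨γ, hγ, rfl⟩ := h
  have hd := det_pos_of_AL he hM
  have key : ∀ N ∈ AL e, Orb (mact N z) (mact (W e) z) := by
    intro N hN
    obtain ⟨δ, hδ, rfl⟩ := AL_decomp he hN
    have hW := det_pos_of_AL he (W_mem he)
    rw [mact_mul _ hW hz]
    exact Orb.symm (im_mact_pos hW hz) ⟨δ, hδ, rfl⟩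
  have h2 : M' * γ ∈ AL e := by
    obtain ⟨δ, hδ, rfl⟩ := AL_decomp he hM'
    have : W e * γ ∈ AL e := by
      have := adj_mem_AL (gamma_mul_AL (adj_mem_R hγ) he (adj_mem_AL (W_mem he)))
      rwa [← adjugate_mul_distrib, adjugate_adjugate _ (by simp), Fintype.card_fin, pow_zero, one_smul] at this
    rw [Matrix.mul_assoc]
    exact gamma_mul_AL hδ he this
  rw [← mact_mul _ (det_pos_of_mem one_pos hγ) hz]
  exact (key M hM).trans (im_mact_pos hd hz) ((key _ h2).symm (im_mact_pos (det_pos_of_AL he h2) hz))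

/-- The strip `Im ≥ 1/5`, `|Re| ≤ 1/2`, cut off at height `Y`. -/
def box (Y : ℝ) : Set ℂ := {z | |z.re| ≤ 1 / 2 ∧ 1 / 5 ≤ z.im ∧ z.im ≤ Y}

lemma isCompact_box (Y : ℝ) : IsCompact (box Y) := by
  have : box Y = Set.Icc (-(1 / 2)) (1 / 2) ×ℂ Set.Icc (1 / 5) Y := by
    ext z; simp [box, Complex.mem_reProdIm, abs_le]
  rw [this]
  exact isCompact_Icc.reProdIm isCompact_Icc

lemma exists_bound_disc {f : ℂ → ℂ} (hf : DifferentiableOn ℂ f (Metric.ball 0 1)) {δ : ℝ} (hδ : 0 < δ) :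
    ∃ B : ℝ, 0 < B ∧ ∀ z : ℂ, δ ≤ z.im → ‖f (qc z)‖ ≤ B := by
  have hlt : Real.exp (-(2 * Real.pi * δ)) < 1 := by
    rw [Real.exp_lt_one_iff]; have := Real.pi_pos; nlinarith [mul_pos this hδ]
  have hc : ContinuousOn f (Metric.closedBall 0 (Real.exp (-(2 * Real.pi * δ)))) :=
    hf.continuousOn.mono (Metric.closedBall_subset_ball hlt)
  obtain ⟨B, hB⟩ := (isCompact_closedBall _ _).exists_bound_of_continuousOn hc
  refine ⟨max B 1, by positivity, fun z hz => (hB _ ?_).trans (le_max_left _ _)⟩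
  rw [mem_closedBall_zero_iff, norm_qc, Real.exp_le_exp]
  have := Real.pi_pos
  nlinarith

lemma differentiableOn_logU (a b c d : ℂ) : DifferentiableOn ℂ (logU a b c d) (Metric.ball 0 1) :=
  (hasPS_logU _ _ _ _).differentiableOn

/-- On `Im ≥ δ` the function `j₆` stays away from `-3, -4, 5`. -/
lemma exists_bound_inv {δ : ℝ} (hδ : 0 < δ) : ∃ B : ℝ, 0 < B ∧ ∀ z : ℂ, δ ≤ z.im →
    ‖(tt z + 3)⁻¹‖ ≤ B * ‖qc z‖ ∧ ‖(tt z + 4)⁻¹‖ ≤ B * ‖qc z‖ ∧ ‖(tt z - 5)⁻¹‖ ≤ B * ‖qc z‖ := by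
  obtain ⟨B1, p1, h1⟩ := exists_bound_disc (differentiableOn_logU (-3) 3 9 (-9)).neg.cexp hδ
  obtain ⟨B2, p2, h2⟩ := exists_bound_disc (differentiableOn_logU (-4) 8 4 (-8)).neg.cexp hδ
  obtain ⟨B3, p3, h3⟩ := exists_bound_disc (differentiableOn_logU 5 (-1) 1 (-5)).neg.cexp hδ
  refine ⟨B1 + B2 + B3, by positivity, fun z hz => ?_⟩
  have hz0 := hδ.trans_le hz
  obtain ⟨e1, e2, e3⟩ := u_eq_exp hz0
  rw [← u2_eq, ← u3_eq hz0, ← u6_eq hz0, e1, e2, e3]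
  have n := norm_nonneg (qc z)
  refine ⟨?_, ?_, ?_⟩ <;> rw [mul_inv, inv_inv, ← Complex.exp_neg, norm_mul, mul_comm]
  · exact mul_le_mul_of_nonneg_right ((h1 z hz).trans (by linarith)) n
  · exact mul_le_mul_of_nonneg_right ((h2 z hz).trans (by linarith)) n
  · exact mul_le_mul_of_nonneg_right ((h3 z hz).trans (by linarith)) n

/-- Bounded values of `j₆` in the strip come from bounded height. -/
lemma exists_height (B : ℝ) : ∃ Y : ℝ, ∀ z : ℂ, 1 / 5 ≤ z.im → ‖tt z‖ ≤ B → z.im ≤ Y := by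
  obtain ⟨C, hC, h⟩ := exists_bound_inv (δ := 1 / 5) (by norm_num)
  refine ⟨C * (|B| + 3), fun z hz hB => ?_⟩
  have hz0 : 0 < z.im := by linarith
  have h1 := (h z hz).1
  rw [norm_inv, inv_le_iff_one_le_mul₀ (norm_pos_iff.2 (tt_add_three_ne hz0)), norm_qc] at h1
  have h2 : ‖tt z + 3‖ ≤ |B| + 3 := by
    refine (norm_add_le _ _).trans ?_
    have := hB.trans (le_abs_self B)
    simpa using this
  have h3 : z.im ≤ Real.exp (2 * Real.pi * z.im) := by
    have := Real.add_one_le_exp (2 * Real.pi * z.im)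
    nlinarith [Real.pi_gt_three]
  rw [Real.exp_neg] at h1
  have hE := Real.exp_pos (2 * Real.pi * z.im)
  have h4 : Real.exp (2 * Real.pi * z.im) ≤ C * ‖tt z + 3‖ := by
    have := mul_le_mul_of_nonneg_left h1 hE.le
    have e : Real.exp (2 * Real.pi * z.im) * (C * (Real.exp (2 * Real.pi * z.im))⁻¹ * ‖tt z + 3‖)
      = C * ‖tt z + 3‖ := by field_simp
    linarith
  exact h3.trans (h4.trans (mul_le_mul_of_nonneg_left h2 hC.le))

/-- The points whose `j₆`-fibre is a single orbit. -/
def goodSet : Set ℂ := {z | 0 < z.im ∧ ∀ z' : ℂ, 0 < z'.im → tt z' = tt z → Orb z z'}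

lemma isOpen_goodSet : IsOpen goodSet := by
  rw [isOpen_iff_mem_nhds]
  rintro z ⟨hz, hgood⟩
  by_contra hcon
  have hfr : ∃ᶠ w in 𝓝 z, 0 < w.im ∧ w ∉ goodSet := by
    have : ∃ᶠ w in 𝓝 z, w ∉ goodSet := fun h => hcon (by
      filter_upwards [h] with w hw using not_not.1 hw)
    exact (this.and_eventually (isOpen_im_pos.mem_nhds hz)).mono fun w hw => ⟨hw.2, hw.1⟩
  have hfr2 : ∃ᶠ w in 𝓝 z, ∃ e ∈ eSet, 0 < w.im ∧ ∃ v : ℂ, 1 / 5 ≤ v.im ∧ |v.re| ≤ 1 / 2 ∧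
      tt v = tt (mact (W e) w) ∧ ¬ Orb (mact (W e) w) v := by
    refine hfr.mono ?_
    rintro w ⟨hw, hbad⟩
    simp only [goodSet, Set.mem_ofPred_eq, not_and, not_forall] at hbad
    obtain ⟨w', hw', ht, hno⟩ := hbad hw
    obtain ⟨e, he, M, hM, h1, h2⟩ := exists_AL_strip hw'
    refine ⟨e, he, hw, _, h1, h2, by rw [tt_AL he hM hw', tt_W he hw, ht], fun ho => hno ?_⟩
    have hWw := im_mact_pos (det_pos_of_AL he (W_mem he)) hw
    have := orb_AL he (adj_mem_AL (W_mem he)) (adj_mem_AL hM) hWw ho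
    rwa [AL_inv he (W_mem he) hw, AL_inv he hM hw'] at this
  obtain ⟨e, he, hfr3⟩ : ∃ e ∈ eSet, ∃ᶠ w in 𝓝 z, 0 < w.im ∧ ∃ v : ℂ, 1 / 5 ≤ v.im ∧ |v.re| ≤ 1 / 2 ∧
      tt v = tt (mact (W e) w) ∧ ¬ Orb (mact (W e) w) v := by
    by_contra hno
    push Not at hno
    refine hfr2 ?_
    have := (Filter.eventually_all_finset eSet (l := 𝓝 z)).2 hno
    filter_upwards [this] with w hw
    rintro ⟨e, he, h1, v, h2, h3, h4, h5⟩
    exact h5 (hw e he h1 v h2 h3 h4)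
  have hWd := det_pos_of_AL he (W_mem he)
  set y := mact (W e) z with hy
  have hyim : 0 < y.im := im_mact_pos hWd hz
  have hcW : ContinuousAt (mact (W e)) z := (hasDerivAt_mact hWd hz).continuousAt
  have hcT : ContinuousAt tt y := (differentiableAt_tt hyim).continuousAt
  obtain ⟨Y, hY⟩ := exists_height (‖tt y‖ + 1)
  have hev : ∀ᶠ w in 𝓝 z, ‖tt (mact (W e) w)‖ < ‖tt y‖ + 1 :=
    (ContinuousAt.comp (f := mact (W e)) (g := tt) hcT hcW).norm.eventually
      (gt_mem_nhds (lt_add_one _))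
  obtain ⟨w, hwlim, hw⟩ := Filter.exists_seq_forall_of_frequently (hfr3.and_eventually hev)
  choose hw1 hw2 using hw
  choose hwim v hv1 hv2 hv3 hv4 using hw1
  obtain ⟨v₀, hv₀, φ, hφ, hlim⟩ := (isCompact_box Y).tendsto_subseq (x := v)
    (fun k => ⟨hv2 k, hv1 k, hY _ (hv1 k) (by rw [hv3]; exact (hw2 k).le)⟩)
  have hv₀im : 0 < v₀.im := by linarith [hv₀.2.1]
  have hylim : Filter.Tendsto (fun k => mact (W e) (w (φ k))) Filter.atTop (𝓝 y) :=
    hcW.tendsto.comp (hwlim.comp hφ.tendsto_atTop)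
  have htv : tt v₀ = tt y := by
    refine tendsto_nhds_unique ((differentiableAt_tt hv₀im).continuousAt.tendsto.comp hlim) ?_
    have := hcT.tendsto.comp hylim
    refine this.congr fun k => ?_
    simp [hv3]
  have horb : Orb y v₀ := by
    have h1 := hgood (mact (W e).adjugate v₀)
      (im_mact_pos (det_pos_of_AL he (adj_mem_AL (W_mem he))) hv₀im) (by
        rw [tt_AL he (adj_mem_AL (W_mem he)) hv₀im, htv, ← tt_AL he (adj_mem_AL (W_mem he)) hyim,
          AL_inv he (W_mem he) hz])
    have h2 := orb_AL he (W_mem he) (W_mem he) hz h1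
    rwa [AL_inv' he (W_mem he) hv₀im] at h2
  obtain ⟨γ, hγ, hγv⟩ := horb.symm hyim
  have hγd := det_pos_of_mem one_pos hγ
  have hlim2 : Filter.Tendsto (fun k => mact γ (v (φ k))) Filter.atTop (𝓝 y) := by
    have := (hasDerivAt_mact hγd hv₀im).continuousAt.tendsto.comp hlim
    rwa [hγv] at this
  have hinj := eventually_inj (hasStrictDerivAt_tt hyim) (deriv_tt_ne_zero hyim)
  obtain ⟨k, hk⟩ := ((hlim2.prodMk_nhds hylim).eventually hinj).exists
  have hvim : 0 < (v (φ k)).im := by linarith [hv1 (φ k)]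
  refine hv4 (φ k) ?_
  have hk' : mact γ (v (φ k)) = mact (W e) (w (φ k)) := hk (by simp only [tt_gamma hγ hvim, hv3])
  rw [← hk']
  exact Orb.symm hvim ⟨γ, hγ, rfl⟩

lemma closure_goodSet : closure goodSet ∩ {z : ℂ | 0 < z.im} ⊆ goodSet := by
  rintro z ⟨hcl, hz⟩
  by_contra hbad
  simp only [goodSet, Set.mem_ofPred_eq, not_and, not_forall] at hbad
  obtain ⟨z', hz', ht, hno⟩ := hbad hz
  have hopen : Filter.map tt (𝓝 z') = 𝓝 (tt z') :=
    (hasStrictDerivAt_tt hz').map_nhds_eq (deriv_tt_ne_zero hz')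
  have hev := orb_closed hz hz' hno
  rw [nhds_prod_eq] at hev
  obtain ⟨p, hp, q, hq, hpq⟩ := Filter.eventually_prod_iff.1 hev
  have h1 : tt '' {w | q w ∧ 0 < w.im} ∈ 𝓝 (tt z) := by
    rw [← ht, ← hopen]
    exact Filter.image_mem_map (hq.and (isOpen_im_pos.mem_nhds hz'))
  have h2 := (differentiableAt_tt hz).continuousAt.eventually h1
  obtain ⟨w, hw, hwg⟩ := (mem_closure_iff_nhds.1 hcl _ (Filter.inter_mem hp h2))
  obtain ⟨hw1, w', ⟨hw', hw'im⟩, htw⟩ := hw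
  exact hpq hw1 hw' (hwg.2 w' hw'im htw)

lemma exists_int_of_qc_eq {z w : ℂ} (h : qc z = qc w) : ∃ k : ℤ, z = w + k := by
  rw [qc, qc, Complex.exp_eq_exp_iff_exists_int] at h
  obtain ⟨k, hk⟩ := h
  refine ⟨k, ?_⟩
  have h0 : (2 * Real.pi * I : ℂ) ≠ 0 := Complex.two_pi_I_ne_zero
  exact mul_left_cancel₀ h0 (by linear_combination hk)

lemma exists_norm_qc_lt {ε : ℝ} (hε : 0 < ε) : ∃ z : ℂ, 1 / 5 ≤ z.im ∧ ‖qc z‖ < ε := by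
  refine ⟨((1 + |Real.log ε|  : ℝ) : ℂ) * I, ?_, ?_⟩
  · simp; linarith [abs_nonneg (Real.log ε)]
  · rw [norm_qc, ← Real.lt_log_iff_exp_lt hε]
    simp only [Complex.mul_im, ofReal_re, ofReal_im, I_re, I_im, mul_zero, mul_one, add_zero]
    nlinarith [neg_abs_le (Real.log ε), abs_nonneg (Real.log ε), Real.pi_gt_three]

lemma goodSet_nonempty : ({z : ℂ | 0 < z.im} ∩ goodSet).Nonempty := by
  set L := logU (-3) 3 9 (-9)
  have hLd : DifferentiableOn ℂ L (Metric.ball 0 1) := differentiableOn_logU _ _ _ _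
  set h : ℂ → ℂ := fun x => x * cexp (-L x) with hh
  have hh0 : ∀ z : ℂ, 0 < z.im → h (qc z) = (tt z + 3)⁻¹ := by
    intro z hz
    rw [← u2_eq, (u_eq_exp hz).1, mul_inv, inv_inv, ← Complex.exp_neg]
  have hhd : DifferentiableOn ℂ h (Metric.ball 0 1) := differentiableOn_id.mul hLd.neg.cexp
  have hs : HasStrictDerivAt h (deriv h 0) 0 :=
    (hhd.analyticAt (Metric.ball_mem_nhds 0 one_pos)).hasStrictDerivAt
  have hd0 : deriv h 0 ≠ 0 := by
    have h1 : HasDerivAt L (deriv L 0) 0 :=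
      (hLd.differentiableAt (Metric.ball_mem_nhds 0 one_pos)).hasDerivAt
    have h2 := ((hasDerivAt_id (0 : ℂ)).mul h1.neg.cexp).deriv
    change deriv h 0 = _ at h2
    rw [h2]
    simp [Complex.exp_ne_zero]
  have hinj := eventually_inj hs hd0
  obtain ⟨ε, hε, hinj⟩ := Metric.eventually_nhds_iff.1 hinj
  obtain ⟨B, hB, hb⟩ := exists_bound_inv (δ := 1 / 5) (by norm_num)
  obtain ⟨B', hB', hb'⟩ := exists_bound_disc hLd.cexp (δ := 1 / 5) (by norm_num)
  obtain ⟨z, hz, hq⟩ := exists_norm_qc_lt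
    (ε := min (min ε (ε / (B' * B))) (1 / (72 * B ^ 2))) (by positivity)
  have hz0 : 0 < z.im := by linarith
  have hq1 : ‖qc z‖ < ε := hq.trans_le ((min_le_left _ _).trans (min_le_left _ _))
  have hq2 : B' * B * ‖qc z‖ < ε := by
    have := hq.trans_le ((min_le_left _ _).trans (min_le_right _ _))
    rwa [lt_div_iff₀ (by positivity), mul_comm] at this
  have hq3 : 72 * B ^ 2 * ‖qc z‖ < 1 := by
    have := hq.trans_le (min_le_right _ _)
    rwa [lt_div_iff₀ (by positivity), mul_comm] at this
  have hqz : 0 < ‖qc z‖ := norm_pos_iff.2 (qc_ne_zero z)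
  refine ⟨z, hz0, hz0, fun z' hz' ht => ?_⟩
  obtain ⟨e, he, M, hM, h1, -⟩ := exists_AL_strip hz'
  set v := mact M z' with hv
  have hv0 : 0 < v.im := by linarith
  have htv : tt v = te e (tt z) := by rw [hv, tt_AL he hM hz', ht]
  have hqv : ‖qc v‖ ≤ 1 := (norm_qc_lt_one hv0).le
  have contra : ∀ s K : ℂ, s ≠ 0 → ‖s⁻¹‖ ≤ B * ‖qc z‖ → ‖K‖ ≤ 72 → K ≠ 0 → ‖(K / s)⁻¹‖ ≤ B * ‖qc v‖ →
      False := by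
    intro s K hs h1 h2 hK h3
    have hs' := norm_pos_iff.2 hs
    have hK' := norm_pos_iff.2 hK
    rw [norm_inv, inv_le_iff_one_le_mul₀ hs'] at h1
    rw [norm_inv, norm_div, inv_div, div_le_iff₀ hK'] at h3
    have h4 : ‖s‖ ≤ B * 72 := h3.trans
      (mul_le_mul (mul_le_of_le_one_right hB.le hqv) h2 (norm_nonneg _) hB.le)
    have : B * ‖qc z‖ * ‖s‖ ≤ B * ‖qc z‖ * (B * 72) := mul_le_mul_of_nonneg_left h4 (by positivity)
    nlinarith
  obtain ⟨b1, b2, b3⟩ := hb z hz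
  obtain ⟨c1, c2, c3⟩ := hb v h1
  rcases mem_eSet.1 he with rfl | rfl | rfl | rfl
  · simp only [te] at htv
    norm_num at htv
    have hE : h (qc v) = h (qc z) := by rw [hh0 v hv0, hh0 z hz0, htv]
    have hvs : ‖qc v‖ < ε := by
      have e1 : qc v = h (qc v) * cexp (L (qc v)) := by
        simp only [hh]; rw [mul_assoc, ← Complex.exp_add, neg_add_cancel, Complex.exp_zero, mul_one]
      rw [e1, hE, norm_mul, hh0 z hz0]
      refine lt_of_le_of_lt (mul_le_mul b1 (hb' v h1) (norm_nonneg _) (by positivity)) ?_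
      linarith
    have hqq : qc v = qc z := hinj (y := (qc v, qc z))
      (by simpa [Prod.dist_eq] using ⟨hvs, hq1⟩) hE
    obtain ⟨k, hk⟩ := exists_int_of_qc_eq hqq
    have o1 : Orb z v := ⟨!![1, k; 0, 1], by simp [R], by rw [← add_int_eq_mact, hk]⟩
    rw [AL_one] at hM
    exact o1.trans hz0 (Orb.symm hz' ⟨M, hM, rfl⟩)
  · exact (contra (tt z + 3) (-8) (tt_add_three_ne hz0) b1 (by norm_num) (by norm_num)
      (by rw [htv] at c1; simpa [te] using c1)).elim
  · exact (contra (tt z + 4) 9 (tt_add_four_ne hz0) b2 (by norm_num) (by norm_num)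
      (by rw [htv] at c2; simpa [te] using c2)).elim
  · exact (contra (tt z - 5) 72 (tt_sub_five_ne hz0) b3 (by norm_num) (by norm_num)
      (by rw [htv] at c3; simpa [te] using c3)).elim

/-- `j₆` separates the orbits of `Γ₀(6)`. -/
lemma orb_of_tt_eq {z z' : ℂ} (hz : 0 < z.im) (hz' : 0 < z'.im) (h : tt z' = tt z) : Orb z z' := by
  have hc : IsPreconnected {z : ℂ | 0 < z.im} := (convex_halfSpace_im_gt 0).isPreconnected
  exact (hc.subset_of_closure_inter_subset isOpen_goodSet goodSet_nonempty closure_goodSet hz).2 z' hz' h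

lemma tt_eq_iff {z z' : ℂ} (hz : 0 < z.im) (hz' : 0 < z'.im) : tt z = tt z' ↔ Orb z z' := by
  refine ⟨fun h => orb_of_tt_eq hz hz' h.symm, ?_⟩
  rintro ⟨γ, hγ, rfl⟩
  exact (tt_gamma hγ hz).symm

lemma js_sub {x y : ℂ} (hx : 0 < x.im) (hy : 0 < y.im) :
    js x - js y = (∏ e ∈ eSet, (tt x - te e (tt y))) / Om x := by
  have a1 := tt_add_three_ne hx
  have a2 := tt_add_four_ne hx
  have a3 := tt_sub_five_ne hx
  have b1 := tt_add_three_ne hy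
  have b2 := tt_add_four_ne hy
  have b3 := tt_sub_five_ne hy
  simp only [eSet, js, Om]
  rw [Finset.prod_insert (by simp), Finset.prod_insert (by simp), Finset.prod_insert (by simp),
    Finset.prod_singleton]
  norm_num [te]
  generalize tt x = t at *
  generalize tt y = s at *
  field_simp
  ring

lemma js_eq_iff {z z' : ℂ} (hz : 0 < z.im) (hz' : 0 < z'.im) :
    js z' = js z ↔ ∃ e ∈ eSet, tt z' = te e (tt z) := by
  rw [← sub_eq_zero, js_sub hz' hz, div_eq_zero_iff, or_iff_left (Om_ne_zero hz'), Finset.prod_eq_zero_iff]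
  simp only [sub_eq_zero]

lemma fix_iff {M : Mat2} (hM : 0 < M.det) {z : ℂ} (hz : 0 < z.im) : mact M z = z ↔
    (M 1 1 : ℝ) - M 0 0 = -2 * M 1 0 * z.re ∧ (M 0 1 : ℝ) = -M 1 0 * (z.re ^ 2 + z.im ^ 2) := by
  have hne := mden_ne_zero hM hz
  rw [mact, ← mden, div_eq_iff hne, mden, Complex.ext_iff]
  simp only [add_re, mul_re, intCast_re, intCast_im, zero_mul, sub_zero, add_im, mul_im, add_zero]
  constructor
  · rintro ⟨hre, him⟩
    have hy : (M 1 1 : ℝ) - M 0 0 = -2 * M 1 0 * z.re := by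
      apply mul_right_cancel₀ hz.ne'
      linarith
    refine ⟨hy, ?_⟩
    have e2 : (M 1 1 : ℝ) = M 0 0 - 2 * M 1 0 * z.re := by linarith
    rw [e2] at hre
    linear_combination hre
  · rintro ⟨h1, h2⟩
    exact ⟨by linear_combination h2 - z.re * h1, by linear_combination - z.im * h1⟩

lemma trace_sq_of_fix {M : Mat2} (hM : 0 < M.det) {z : ℂ} (hz : 0 < z.im) (h : mact M z = z) :
    ((M 0 0 : ℝ) + M 1 1) ^ 2 = 4 * M.det - 4 * (M 1 0 : ℝ) ^ 2 * z.im ^ 2 := by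
  obtain ⟨hy, hb⟩ := (fix_iff hM hz).1 h
  rw [det_fin_two]
  push_cast
  linear_combination (M 1 1 - M 0 0 - 2 * M 1 0 * z.re) * hy + 4 * (M 1 0 : ℝ) * hb

/-- `Γ₀(6)/{±1}` acts freely on the upper half-plane. -/
lemma eq_one_of_fix {γ : Mat2} (hγ : γ ∈ R 1) {z : ℂ} (hz : 0 < z.im) (h : mact γ z = z) :
    γ = 1 ∨ γ = -1 := by
  obtain ⟨hd, c, hc⟩ := id hγ
  have hdet := det_pos_of_mem one_pos hγ
  obtain ⟨hy, hb⟩ := (fix_iff hdet hz).1 h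
  have htr := trace_sq_of_fix hdet hz h
  rw [hd] at htr
  rw [det_fin_two] at hd
  push_cast at htr
  by_cases hc0 : γ 1 0 = 0
  · simp only [hc0, Int.cast_zero, mul_zero, zero_mul, neg_zero] at hy hb
    have hb' : γ 0 1 = 0 := by exact_mod_cast hb
    have hda : γ 1 1 = γ 0 0 := by
      have : (γ 1 1 : ℝ) = γ 0 0 := by linarith
      exact_mod_cast this
    rw [hda, hb', zero_mul, sub_zero] at hd
    rcases Int.mul_eq_one_iff_eq_one_or_neg_one.1 hd with ⟨h1, -⟩ | ⟨h1, -⟩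
    · left; ext i j; fin_cases i <;> fin_cases j <;> simp [h1, hda, hb', hc0]
    · right; ext i j; fin_cases i <;> fin_cases j <;> simp [h1, hda, hb', hc0]
  · exfalso
    have hc0' : (γ 1 0 : ℝ) ≠ 0 := by exact_mod_cast hc0
    have hlt : ((γ 0 0 : ℝ) + γ 1 1) ^ 2 < 4 := by
      rw [htr]; have : 0 < (γ 1 0 : ℝ) ^ 2 * z.im ^ 2 := by positivity
      linarith
    have hlt' : (γ 0 0 + γ 1 1) ^ 2 < 4 := by exact_mod_cast hlt
    have h1 : γ 0 0 + γ 1 1 < 2 := by nlinarith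
    have h2 : -2 < γ 0 0 + γ 1 1 := by nlinarith
    rw [hc] at hd
    obtain ⟨s, hs⟩ : ∃ s, s = γ 0 0 + γ 1 1 := ⟨_, rfl⟩
    have hd' : γ 0 0 * (s - γ 0 0) - γ 0 1 * (6 * c) = 1 := by rw [hs]; linarith
    have hm : (γ 0 0 * (s - γ 0 0)) % 6 = 1 := by
      have : γ 0 1 * (6 * c) = 6 * (γ 0 1 * c) := by ring
      omega
    rw [← hs] at h1 h2
    have h6 : γ 0 0 % 6 = 0 ∨ γ 0 0 % 6 = 1 ∨ γ 0 0 % 6 = 2 ∨ γ 0 0 % 6 = 3 ∨ γ 0 0 % 6 = 4 ∨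
      γ 0 0 % 6 = 5 := by omega
    rw [Int.mul_emod, Int.sub_emod] at hm
    have hs3 : s = -1 ∨ s = 0 ∨ s = 1 := by omega
    rcases h6 with h | h | h | h | h | h <;> rw [h] at hm <;> rcases hs3 with rfl | rfl | rfl <;>
      norm_num at hm

lemma e_dvd_six {e : ℕ} (he : e ∈ eSet) : (e : ℤ) ∣ 6 := by
  rcases mem_eSet.1 he with rfl | rfl | rfl | rfl <;> norm_num

lemma AL_mul_gamma {e : ℕ} {γ M : Mat2} (he : e ∈ eSet) (hM : M ∈ AL e) (hγ : γ ∈ R 1) :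
    M * γ ∈ AL e := by
  have := adj_mem_AL (gamma_mul_AL (adj_mem_R hγ) he (adj_mem_AL hM))
  rwa [← adjugate_mul_distrib, adjugate_adjugate _ (by simp), Fintype.card_fin, pow_zero,
    one_smul] at this

/-- Indices `(e, (a, d), b)` for the orbits of `Γ₀(6)` on integral matrices of determinant `n`. -/
abbrev Idx := Σ _ : ℕ, Σ _ : ℕ × ℕ, ℕ

/-- The index set of the orbits of `Γ₀(6)` on `R n`. -/
def idx (n : ℕ) : Finset Idx :=
  eSet.sigma fun e => (if e ∣ n then (n / e).divisorsAntidiagonal else ∅).sigma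
    fun p => Finset.range (e * p.2)

lemma mem_idx {n : ℕ} (hn : 0 < n) {e a d b : ℕ} : (⟨e, (a, d), b⟩ : Idx) ∈ idx n ↔
    e ∈ eSet ∧ e * (a * d) = n ∧ b < e * d := by
  simp only [idx, Finset.mem_sigma, Finset.mem_range]
  refine and_congr_right fun he => and_congr_left fun _ => ?_
  have hpos := eSet_pos he
  by_cases h : e ∣ n
  · obtain ⟨m, rfl⟩ := h
    simp only [dvd_mul_right, if_true, Nat.mem_divisorsAntidiagonal, Nat.mul_div_cancel_left _ hpos]
    have : m ≠ 0 := by rintro rfl; simp at hn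
    constructor
    · rintro ⟨h, -⟩; rw [h]
    · intro h; exact ⟨Nat.eq_of_mul_eq_mul_left hpos h, this⟩
  · simp only [h, if_false, Finset.notMem_empty, false_iff]
    rintro rfl; exact h (dvd_mul_right _ _)

/-- Upper triangular matrices. -/
def upp (e a d b : ℕ) : Mat2 := !![(e : ℤ) * a, (b : ℤ); 0, (e : ℤ) * d]

/-- Representatives of the orbits of `Γ₀(6)` on `R n`. -/
def rep (i : Idx) : Mat2 :=
  let a : ℤ := i.2.1.1
  let d : ℤ := i.2.1.2
  let b : ℤ := i.2.2
  if i.1 = 2 then !![2 * a, b - d; 6 * a, 3 * b - 2 * d]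
  else if i.1 = 3 then !![3 * a, b + d; 6 * a, 2 * b + 3 * d]
  else if i.1 = 6 then !![0, -d; 6 * a, b] else !![a, b; 0, d]

lemma smul_rep {e a d b : ℕ} (he : e ∈ eSet) : (e : ℤ) • rep ⟨e, (a, d), b⟩ = W e * upp e a d b := by
  rcases mem_eSet.1 he with rfl | rfl | rfl | rfl <;> ext i j <;> fin_cases i <;> fin_cases j <;>
    simp [rep, W, upp, Matrix.mul_apply, Fin.sum_univ_two] <;> ring

lemma smul_mat_cancel {k : ℤ} (hk : k ≠ 0) {M N : Mat2} (h : k • M = k • N) : M = N :=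
  smul_right_injective _ hk h

lemma rep_mem {n : ℕ} (hn : 0 < n) {i : Idx} (hi : i ∈ idx n) : rep i ∈ R n := by
  obtain ⟨e, ⟨a, d⟩, b⟩ := i
  obtain ⟨he, h, -⟩ := (mem_idx hn).1 hi
  have h' : (n : ℤ) = e * (a * d) := by exact_mod_cast h.symm
  rw [h']
  rcases mem_eSet.1 he with rfl | rfl | rfl | rfl
  · simp [rep, R]
  · refine ⟨by simp [rep]; ring, by simp [rep]⟩
  · refine ⟨by simp [rep]; ring, by simp [rep]⟩
  · refine ⟨by simp [rep]; ring, by simp [rep]⟩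

lemma exists_rep {n : ℕ} (hn : 0 < n) {M : Mat2} (hM : M ∈ R n) :
    ∃ i ∈ idx n, ∃ γ ∈ R 1, M = γ * rep i := by
  obtain ⟨hdet, y, hy⟩ := hM
  have hn' : (0 : ℤ) < n := by exact_mod_cast hn
  have hgpos : 0 < Int.gcd (M 0 0) (M 1 0) := by
    rw [Int.gcd_pos_iff]
    by_contra hcon
    push Not at hcon
    rw [det_fin_two, hcon.1, hcon.2] at hdet
    simp at hdet
    omega
  obtain ⟨A', C', hcop, hA, hC⟩ := Int.exists_gcd_one hgpos
  set g := Int.gcd (M 0 0) (M 1 0)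
  obtain ⟨e, he, f, hef, C'', hC'', ea, hga, hcop2⟩ : ∃ e ∈ eSet, ∃ f : ℤ, (e : ℤ) * f = 6 ∧
      ∃ C'' : ℤ, C' = f * C'' ∧ ∃ a : ℕ, g = e * a ∧ IsCoprime ((e : ℤ) * A') C' := by
    have hcop' : IsCoprime A' C' := Int.isCoprime_iff_gcd_eq_one.2 hcop
    have hdvd : (6 : ℤ) ∣ C' * g := ⟨y, by rw [← hC, hy]⟩
    have aux : ∀ e ∈ eSet, ∀ f C'' : ℤ, (e : ℤ) * f = 6 → C' = f * C'' → IsCoprime (e : ℤ) C' →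
        ∃ e ∈ eSet, ∃ f : ℤ, (e : ℤ) * f = 6 ∧
      ∃ C'' : ℤ, C' = f * C'' ∧ ∃ a : ℕ, g = e * a ∧ IsCoprime ((e : ℤ) * A') C' := by
      intro e he f C'' h1 h2 h3
      have hd : (e : ℤ) ∣ g := h3.dvd_of_dvd_mul_left ((e_dvd_six he).trans hdvd)
      obtain ⟨a, ha⟩ := Int.natCast_dvd_natCast.1 hd
      exact ⟨e, he, f, h1, C'', h2, a, ha, h3.mul_left hcop'⟩
    have c2 : ∀ {x : ℤ}, ¬ 2 ∣ x → IsCoprime (2 : ℤ) x := fun {x} h =>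
      (Int.prime_two.coprime_iff_not_dvd).2 h
    have c3 : ∀ {x : ℤ}, ¬ 3 ∣ x → IsCoprime (3 : ℤ) x := fun {x} h =>
      (Int.prime_three.coprime_iff_not_dvd).2 h
    by_cases h2 : (2 : ℤ) ∣ C' <;> by_cases h3 : (3 : ℤ) ∣ C'
    · obtain ⟨c, hc⟩ : (6 : ℤ) ∣ C' := by omega
      exact aux 1 (by decide) 6 c (by norm_num) hc (by simpa using isCoprime_one_left)
    · obtain ⟨c, hc⟩ := h2
      exact aux 3 (by decide) 2 c (by norm_num) hc (c3 h3)
    · obtain ⟨c, hc⟩ := h3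
      exact aux 2 (by decide) 3 c (by norm_num) hc (c2 h2)
    · refine aux 6 (by decide) 1 C' (by norm_num) (by ring) ?_
      have := (c2 h2).mul_left (c3 h3)
      norm_num at this
      exact_mod_cast this
  have hepos := eSet_pos he
  have he0 : (e : ℤ) ≠ 0 := by exact_mod_cast hepos.ne'
  obtain ⟨v, u, huv⟩ := hcop2
  set A : Mat2 := !![e * A', -u; 6 * C'', e * v] with hAdef
  have hAmem : A ∈ AL e := by
    refine ⟨?_, by simp [hAdef], by simp [hAdef], by simp [hAdef]⟩
    rw [hAdef, det_fin_two_of, ← hef]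
    rw [hC''] at huv
    linear_combination (e : ℤ) * huv
  have hga' : (g : ℤ) = e * ea := by exact_mod_cast hga
  obtain ⟨δ, hδ⟩ : ∃ δ : ℤ, e * δ = -(6 * C'') * M 0 1 + e * A' * M 1 1 :=
    ⟨-(f * C'') * M 0 1 + A' * M 1 1, by rw [← hef]; ring⟩
  obtain ⟨β, hβ⟩ : ∃ β : ℤ, β = e * v * M 0 1 + u * M 1 1 := ⟨_, rfl⟩
  have h00 : M 0 0 = A' * (e * ea) := by rw [hA, hga']
  have h10 : M 1 0 = f * C'' * (e * ea) := by rw [hC, hga', hC'']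
  rw [hC''] at huv
  have hdetA : (e : ℤ) * (ea * δ) = n := by
    rw [det_fin_two, h00, h10] at hdet
    rw [← hdet]
    linear_combination (ea : ℤ) * hδ + (ea * C'' * M 0 1) * hef
  have hprod : (e : ℤ) • M = A * !![(e : ℤ) * ea, β; 0, e * δ] := by
    ext i j
    fin_cases i <;> fin_cases j <;> simp [hAdef, Matrix.mul_apply, Fin.sum_univ_two]
    · rw [h00]; ring
    · rw [hβ, hδ]; linear_combination (-(e : ℤ) * M 0 1) * huv + (u * C'' * M 0 1) * hef
    · rw [h10]; linear_combination (e * ea * C'' : ℤ) * hef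
    · rw [hβ, hδ]; linear_combination (-(e : ℤ) * M 1 1) * huv + (u * C'' * M 1 1) * hef
  have hδpos : 0 < δ := by
    have h1 : (0 : ℤ) < e * (ea * δ) := hdetA ▸ hn'
    have h2 : (0 : ℤ) < ea * δ := pos_of_mul_pos_right h1 (by positivity)
    exact pos_of_mul_pos_right h2 (by positivity)
  obtain ⟨d, rfl⟩ := Int.eq_ofNat_of_zero_le hδpos.le
  have hed : (0 : ℤ) < e * d := by positivity
  obtain ⟨b, hb⟩ := Int.eq_ofNat_of_zero_le (Int.emod_nonneg β hed.ne')
  have hblt := Int.emod_lt_of_pos β hed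
  rw [hb] at hblt
  obtain ⟨γ, hγ, hγA⟩ := AL_decomp he (AL_mul_gamma he hAmem
    (show !![1, β / (e * d); 0, 1] ∈ R 1 by simp [R]))
  refine ⟨⟨e, (ea, d), b⟩, (mem_idx hn).2 ⟨he, by exact_mod_cast hdetA, by exact_mod_cast hblt⟩,
    γ, hγ, smul_mat_cancel he0 ?_⟩
  rw [← Matrix.mul_smul, smul_rep he, ← Matrix.mul_assoc, ← hγA, hprod, Matrix.mul_assoc]
  congr 1
  have hdm := Int.emod_add_mul_ediv β (e * d)
  rw [hb] at hdm
  ext i j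
  fin_cases i <;> fin_cases j <;> simp [upp, Matrix.mul_apply, Fin.sum_univ_two]
  linear_combination -hdm

lemma eSet_sq {e e' k : ℕ} (he : e ∈ eSet) (he' : e' ∈ eSet) (h : e' * e = k ^ 2) :
    e' = e ∧ k = e := by
  have hk6 : k ≤ 6 := by
    have : k ^ 2 ≤ 36 := by
      rcases mem_eSet.1 he with rfl | rfl | rfl | rfl <;>
        rcases mem_eSet.1 he' with rfl | rfl | rfl | rfl <;> omega
    nlinarith
  rcases mem_eSet.1 he with rfl | rfl | rfl | rfl <;>
    rcases mem_eSet.1 he' with rfl | rfl | rfl | rfl <;> interval_cases k <;> omega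

lemma rep_unique {n : ℕ} (hn : 0 < n) {i j : Idx} (hi : i ∈ idx n) (hj : j ∈ idx n) {γ : Mat2}
    (hγ : γ ∈ R 1) (h : rep j = γ * rep i) : i = j := by
  obtain ⟨e, ⟨a, d⟩, b⟩ := i
  obtain ⟨e', ⟨a', d'⟩, b'⟩ := j
  obtain ⟨he, h1, h2⟩ := (mem_idx hn).1 hi
  obtain ⟨he', h1', h2'⟩ := (mem_idx hn).1 hj
  have hepos := eSet_pos he
  have hepos' := eSet_pos he'
  have he0 : (e : ℤ) ≠ 0 := by exact_mod_cast hepos.ne'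
  have he0' : (e' : ℤ) ≠ 0 := by exact_mod_cast hepos'.ne'
  obtain ⟨e'', he'', k, hk, B, hB, hp, hee⟩ :=
    AL_mul he' he (adj_mem_AL (W_mem he')) (gamma_mul_AL hγ he (W_mem he))
  have hk0 : (k : ℤ) ≠ 0 := by exact_mod_cast hk.ne'
  have hee' : (e' : ℤ) * e = k ^ 2 * e'' := by exact_mod_cast hee
  have apos : 0 < a := Nat.pos_of_ne_zero (by rintro rfl; simp at h1; omega)
  have apos' : 0 < a' := Nat.pos_of_ne_zero (by rintro rfl; simp at h1'; omega)
  have dpos : 0 < d := Nat.pos_of_ne_zero (by rintro rfl; simp at h1; omega)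
  have hkey : (k : ℤ) • (B * upp e a d b) = (e : ℤ) • upp e' a' d' b' := by
    apply smul_mat_cancel he0'
    have h3 : (W e').adjugate * (W e' * upp e' a' d' b') = (e' : ℤ) • upp e' a' d' b' := by
      rw [← Matrix.mul_assoc, adjugate_mul, (W_mem he').1, Matrix.smul_mul, Matrix.one_mul]
    rw [smul_comm (e' : ℤ) (e : ℤ), ← h3, ← smul_rep he', h, ← Matrix.smul_mul, ← hp]
    rw [Matrix.mul_assoc (W e').adjugate, Matrix.mul_assoc γ, ← smul_rep he]
    simp only [Matrix.mul_smul]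
    rw [smul_comm]
  have k00 := congrFun (congrFun hkey 0) 0
  have k01 := congrFun (congrFun hkey 0) 1
  have k10 := congrFun (congrFun hkey 1) 0
  have k11 := congrFun (congrFun hkey 1) 1
  simp [upp, Matrix.mul_apply, Fin.sum_univ_two, hk.ne', hepos.ne', apos.ne'] at k00 k01 k10 k11
  obtain ⟨hBd, ⟨x, hx⟩, ⟨w, hw⟩, -⟩ := hB
  rw [det_fin_two, k10, mul_zero, sub_zero, hx, hw] at hBd
  have he1 : e'' = 1 := by
    have h4 : (e'' : ℤ) * (e'' * (x * w)) = e'' * 1 := by linarith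
    have h0 : (e'' : ℤ) ≠ 0 := by exact_mod_cast (eSet_pos he'').ne'
    have h5 : (e'' : ℤ) ∣ 1 := ⟨_, (mul_left_cancel₀ h0 h4).symm⟩
    exact_mod_cast Int.eq_one_of_dvd_one (by positivity) h5
  subst he1
  have heq := eSet_sq he he' (by simpa using hee)
  obtain ⟨rfl, rfl⟩ := heq
  simp only [Nat.cast_one, one_mul] at hBd hx hw
  have k00' : x * a = a' := by
    have := mul_left_cancel₀ he0 k00
    rw [hx] at this
    exact mul_left_cancel₀ he0 (by linarith)
  have hx1 : x = 1 := by
    rcases Int.mul_eq_one_iff_eq_one_or_neg_one.1 hBd with h | h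
    · exact h.1
    · exfalso; rw [h.1] at k00'; omega
  subst hx1
  have hw1 : w = 1 := by linarith
  subst hw1
  have ha : a = a' := by simpa using k00'
  have hd : d = d' := by
    rw [hw, one_mul, k10, zero_mul, zero_add] at k11
    have := mul_left_cancel₀ he0 (mul_left_cancel₀ he0 k11)
    exact_mod_cast this
  subst ha hd
  have hb : b = b' := by
    have h5 := mul_left_cancel₀ he0 k01
    rw [hx, one_mul] at h5
    have h6 : ((b' : ℤ)) ≡ b [ZMOD ((k * d : ℕ) : ℤ)] := by
      rw [Int.modEq_iff_dvd]
      exact ⟨-B 0 1, by push_cast; linarith⟩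
    have h7 := Int.natCast_modEq_iff.1 h6
    exact (Nat.ModEq.eq_of_lt_of_lt h7 h2' h2).symm
  rw [hb]

/-- The `Γ₀*(6)`-invariant function of two variables vanishing to order four on `x ∈ Γ₀(6) y`. -/
noncomputable def D4 (x y : ℂ) : ℂ := (tt x - tt y) ^ 4 / (Om x * Om y)

lemma D4_W {e : ℕ} (he : e ∈ eSet) {x y : ℂ} (hx : 0 < x.im) (hy : 0 < y.im) :
    D4 (mact (W e) x) (mact (W e) y) = D4 x y := by
  have a1 := tt_add_three_ne hx
  have a2 := tt_add_four_ne hx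
  have a3 := tt_sub_five_ne hx
  have b1 := tt_add_three_ne hy
  have b2 := tt_add_four_ne hy
  have b3 := tt_sub_five_ne hy
  simp only [D4, Om, tt_W he hx, tt_W he hy]
  generalize tt x = s at *
  generalize tt y = t at *
  rcases mem_eSet.1 he with rfl | rfl | rfl | rfl
  · simp [te]
  · have e1 : te 2 s + 3 = -8 / (s + 3) := by simp [te]
    have e2 : te 2 s + 4 = (s - 5) / (s + 3) := by simp [te]; field_simp; ring
    have e3 : te 2 s - 5 = -8 * (s + 4) / (s + 3) := by simp [te]; field_simp; ring
    have e4 : te 2 t + 3 = -8 / (t + 3) := by simp [te]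
    have e5 : te 2 t + 4 = (t - 5) / (t + 3) := by simp [te]; field_simp; ring
    have e6 : te 2 t - 5 = -8 * (t + 4) / (t + 3) := by simp [te]; field_simp; ring
    have e7 : te 2 s - te 2 t = 8 * (s - t) / ((s + 3) * (t + 3)) := by simp [te]; field_simp; ring
    rw [e1, e2, e3, e4, e5, e6, e7]
    field_simp
  · have e1 : te 3 s + 3 = -(s - 5) / (s + 4) := by simp [te]; field_simp; ring
    have e2 : te 3 s + 4 = 9 / (s + 4) := by simp [te]
    have e3 : te 3 s - 5 = -9 * (s + 3) / (s + 4) := by simp [te]; field_simp; ring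
    have e4 : te 3 t + 3 = -(t - 5) / (t + 4) := by simp [te]; field_simp; ring
    have e5 : te 3 t + 4 = 9 / (t + 4) := by simp [te]
    have e6 : te 3 t - 5 = -9 * (t + 3) / (t + 4) := by simp [te]; field_simp; ring
    have e7 : te 3 s - te 3 t = -9 * (s - t) / ((s + 4) * (t + 4)) := by
      simp [te]; field_simp; ring
    rw [e1, e2, e3, e4, e5, e6, e7]
    field_simp
  · have e1 : te 6 s + 3 = 8 * (s + 4) / (s - 5) := by simp [te]; field_simp; ring
    have e2 : te 6 s + 4 = 9 * (s + 3) / (s - 5) := by simp [te]; field_simp; ring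
    have e3 : te 6 s - 5 = 72 / (s - 5) := by simp [te]
    have e4 : te 6 t + 3 = 8 * (t + 4) / (t - 5) := by simp [te]; field_simp; ring
    have e5 : te 6 t + 4 = 9 * (t + 3) / (t - 5) := by simp [te]; field_simp; ring
    have e6 : te 6 t - 5 = 72 / (t - 5) := by simp [te]
    have e7 : te 6 s - te 6 t = -72 * (s - t) / ((s - 5) * (t - 5)) := by
      simp [te]; field_simp; ring
    rw [e1, e2, e3, e4, e5, e6, e7]
    field_simp
    ring

/-- The numerator of `D4 x (W e y)` in terms of `j₆`. -/
noncomputable def fac (e : ℕ) (s t : ℂ) : ℂ :=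
  if e = 2 then ((s + 3) * (t + 3) + 8) ^ 4 / 8 ^ 2
  else if e = 3 then ((s + 4) * (t + 4) - 9) ^ 4 / 9 ^ 2
  else if e = 6 then ((s - 5) * (t - 5) - 72) ^ 4 / 72 ^ 2 else (s - t) ^ 4

lemma D4_right_W {e : ℕ} (he : e ∈ eSet) {x y : ℂ} (hx : 0 < x.im) (hy : 0 < y.im) :
    D4 x (mact (W e) y) = fac e (tt x) (tt y) / (Om x * Om y) := by
  have a1 := Om_ne_zero hx
  have b1 := tt_add_three_ne hy
  have b2 := tt_add_four_ne hy
  have b3 := tt_sub_five_ne hy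
  simp only [D4]
  rw [show Om (mact (W e) y) = (tt (mact (W e) y) + 3) * (tt (mact (W e) y) + 4) *
    (tt (mact (W e) y) - 5) from rfl, show Om y = (tt y + 3) * (tt y + 4) * (tt y - 5) from rfl,
    tt_W he hy]
  generalize tt x = s at *
  generalize Om x = o at *
  generalize tt y = t at *
  rcases mem_eSet.1 he with rfl | rfl | rfl | rfl
  · simp [te, fac]
  · have e4 : te 2 t + 3 = -8 / (t + 3) := by simp [te]
    have e5 : te 2 t + 4 = (t - 5) / (t + 3) := by simp [te]; field_simp; ring
    have e6 : te 2 t - 5 = -8 * (t + 4) / (t + 3) := by simp [te]; field_simp; ring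
    have e7 : s - te 2 t = ((s + 3) * (t + 3) + 8) / (t + 3) := by simp [te]; field_simp; ring
    simp only [e4, e5, e6, e7, fac, if_true]
    field_simp
  · have e4 : te 3 t + 3 = -(t - 5) / (t + 4) := by simp [te]; field_simp; ring
    have e5 : te 3 t + 4 = 9 / (t + 4) := by simp [te]
    have e6 : te 3 t - 5 = -9 * (t + 3) / (t + 4) := by simp [te]; field_simp; ring
    have e7 : s - te 3 t = ((s + 4) * (t + 4) - 9) / (t + 4) := by
      simp [te]; field_simp; ring
    rw [e4, e5, e6, e7, show fac 3 s t = ((s + 4) * (t + 4) - 9) ^ 4 / 9 ^ 2 by simp [fac]]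
    field_simp
  · have e4 : te 6 t + 3 = 8 * (t + 4) / (t - 5) := by simp [te]; field_simp; ring
    have e5 : te 6 t + 4 = 9 * (t + 3) / (t - 5) := by simp [te]; field_simp; ring
    have e6 : te 6 t - 5 = 72 / (t - 5) := by simp [te]
    have e7 : s - te 6 t = ((s - 5) * (t - 5) - 72) / (t - 5) := by
      simp [te]; field_simp; ring
    rw [e4, e5, e6, e7, show fac 6 s t = ((s - 5) * (t - 5) - 72) ^ 4 / 72 ^ 2 by simp [fac]]
    field_simp
    ring

lemma D4_gamma_right {γ : Mat2} (hγ : γ ∈ R 1) {x y : ℂ} (hy : 0 < y.im) :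
    D4 x (mact γ y) = D4 x y := by
  simp only [D4, Om, tt_gamma hγ hy]

lemma D4_gamma_left {γ : Mat2} (hγ : γ ∈ R 1) {x y : ℂ} (hx : 0 < x.im) :
    D4 (mact γ x) y = D4 x y := by
  simp only [D4, Om, tt_gamma hγ hx]

lemma mact_rep {n : ℕ} (hn : 0 < n) {e a d b : ℕ} (hi : (⟨e, (a, d), b⟩ : Idx) ∈ idx n) {z : ℂ}
    (hz : 0 < z.im) : mact (rep ⟨e, (a, d), b⟩) z = mact (W e) (mact (upp e a d b) z) ∧
      0 < (mact (upp e a d b) z).im := by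
  obtain ⟨he, h, hb⟩ := (mem_idx hn).1 hi
  have hd : 0 < (upp e a d b).det := by
    simp only [upp, det_fin_two_of, mul_zero, sub_zero]
    have : 0 < e * a * (e * d) := by
      have : 0 < e * (e * (a * d)) := by rw [h]; exact mul_pos (eSet_pos he) hn
      linarith [show e * a * (e * d) = e * (e * (a * d)) by ring]
    exact_mod_cast this
  refine ⟨?_, im_mact_pos hd hz⟩
  rw [← mact_smul _ (k := e) (by exact_mod_cast (eSet_pos he).ne'), smul_rep he, mact_mul _ hd hz]

/-- The set of non-scalar representatives. -/
noncomputable def idxN (n : ℕ) : Finset Idx := by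
  classical exact (idx n).filter fun i => ¬ ∃ k : ℤ, rep i = k • 1

lemma mem_idxN {n : ℕ} {i : Idx} : i ∈ idxN n ↔ i ∈ idx n ∧ ¬ ∃ k : ℤ, rep i = k • 1 := by
  classical simp [idxN]

/-- The product of `D4` over all non-scalar Hecke translates. -/
noncomputable def Psi (n : ℕ) (z : ℂ) : ℂ := ∏ i ∈ idxN n, D4 z (mact (rep i) z)

lemma mat_cancel_right {M N g : Mat2} (hg : 0 < g.det) (h : M * g = N * g) : M = N := by
  have h' := congrArg (· * g.adjugate) h
  simp only [mul_assoc, mul_adjugate] at h'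
  rw [mul_smul_comm, mul_smul_comm, mul_one, mul_one] at h'
  exact smul_mat_cancel hg.ne' h'

lemma Psi_mact {n : ℕ} (hn : 0 < n) {g : Mat2} (hg : 0 < g.det)
    (h1 : ∀ M ∈ R n, ∃ M' ∈ R n, M * g = g * M') (h2 : ∀ M ∈ R 1, ∃ M' ∈ R 1, g * M = M' * g)
    (h3 : ∀ x y : ℂ, 0 < x.im → 0 < y.im → D4 (mact g x) (mact g y) = D4 x y) {z : ℂ}
    (hz : 0 < z.im) : Psi n (mact g z) = Psi n z := by
  have hn' : (0 : ℤ) < n := by exact_mod_cast hn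
  have key : ∀ i ∈ idx n, ∃ j ∈ idx n, ∃ γ ∈ R 1, rep i * g = g * (γ * rep j) := by
    intro i hi
    obtain ⟨M', hM', e1⟩ := h1 _ (rep_mem hn hi)
    obtain ⟨j, hj, γ, hγ, e2⟩ := exists_rep hn hM'
    exact ⟨j, hj, γ, hγ, by rw [e1, e2]⟩
  choose! s hs γ hγ hsγ using key
  have hinj : ∀ i ∈ idx n, ∀ i' ∈ idx n, s i = s i' → i' = i := by
    intro i hi i' hi' h
    obtain ⟨δ, hδ, e1⟩ := h2 (γ i * (γ i').adjugate) (R_mul (hγ i hi) (adj_mem_R (hγ i' hi')))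
    refine rep_unique hn hi' hi hδ (mat_cancel_right hg ?_)
    rw [hsγ i hi, h, mul_assoc, hsγ i' hi', ← mul_assoc δ g, ← e1]
    simp only [mul_assoc]
    rw [← mul_assoc (γ i').adjugate, adj_mul (hγ i' hi'), one_mul]
  have hmem : ∀ i ∈ idxN n, s i ∈ idxN n := by
    intro i hi
    obtain ⟨hi, hi'⟩ := mem_idxN.1 hi
    refine mem_idxN.2 ⟨hs i hi, ?_⟩
    rintro ⟨k, hk⟩
    obtain ⟨δ, hδ, e1⟩ := h2 _ (hγ i hi)
    apply hi'
    have : rep i = δ * rep (s i) := by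
      apply mat_cancel_right hg
      rw [hsγ i hi, ← mul_assoc, e1, hk]
      simp only [mul_smul_comm, smul_mul_assoc, mul_one]
    rw [← rep_unique hn (hs i hi) hi hδ this]
    exact ⟨k, hk⟩
  unfold Psi
  symm
  have hinjOn : Set.InjOn s (idxN n) := fun i hi i' hi' h =>
    (hinj i (mem_idxN.1 hi).1 i' (mem_idxN.1 hi').1 h).symm
  symm
  refine Finset.prod_nbij s hmem hinjOn
    (Finset.surjOn_of_injOn_of_card_le s hmem hinjOn le_rfl) fun i hi => ?_
  have hi := (mem_idxN.1 hi).1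
  have d1 := det_pos_of_mem hn' (rep_mem hn hi)
  have d2 := det_pos_of_mem hn' (rep_mem hn (hs i hi))
  have d3 := det_pos_of_mem one_pos (hγ i hi)
  rw [← mact_mul _ hg hz, hsγ i hi, mact_mul _ (by rw [det_mul]; positivity) hz,
    h3 _ _ hz (im_mact_pos (by rw [det_mul]; positivity) hz), mact_mul _ d2 hz,
    D4_gamma_right (hγ i hi) (im_mact_pos d2 hz)]

lemma exists_conj_R {n : ℤ} {g : Mat2} (hg : g ∈ R 1) {M : Mat2} (hM : M ∈ R n) :
    (∃ M' ∈ R n, M * g = g * M') ∧ ∃ M' ∈ R n, g * M = M' * g := by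
  refine ⟨⟨g.adjugate * M * g, ?_, ?_⟩, ⟨g * M * g.adjugate, ?_, ?_⟩⟩
  · simpa using R_mul (R_mul (adj_mem_R hg) hM) hg
  · rw [mul_assoc, ← mul_assoc g, mul_adj hg, one_mul]
  · simpa using R_mul (R_mul hg hM) (adj_mem_R hg)
  · rw [mul_assoc, adj_mul hg, mul_one]

lemma exists_conj_W6 {n : ℤ} {M : Mat2} (hM : M ∈ R n) :
    (∃ M' ∈ R n, M * W 6 = W 6 * M') ∧ ∃ M' ∈ R n, W 6 * M = M' * W 6 := by
  obtain ⟨hd, c, hc⟩ := hM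
  rw [det_fin_two, hc] at hd
  refine ⟨⟨!![M 1 1, -c; -6 * M 0 1, M 0 0], ⟨?_, ?_⟩, ?_⟩,
    ⟨!![M 1 1, -c; -6 * M 0 1, M 0 0], ⟨?_, ?_⟩, ?_⟩⟩
  · simp; linarith
  · simp
  · ext i j; fin_cases i <;> fin_cases j <;> simp [W, Matrix.mul_apply, Fin.sum_univ_two, hc, mul_comm]
  · simp; linarith
  · simp
  · ext i j; fin_cases i <;> fin_cases j <;> simp [W, Matrix.mul_apply, Fin.sum_univ_two, hc, mul_comm]

lemma exists_conj_W3 {n : ℤ} {M : Mat2} (hM : M ∈ R n) :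
    (∃ M' ∈ R n, M * W 3 = W 3 * M') ∧ ∃ M' ∈ R n, W 3 * M = M' * W 3 := by
  obtain ⟨hd, c, hc⟩ := hM
  rw [det_fin_two, hc] at hd
  refine ⟨⟨!![3 * M 0 0 + 6 * M 0 1 - 6 * c - 2 * M 1 1, M 0 0 + 3 * M 0 1 - 2 * c - M 1 1;
      -6 * M 0 0 - 12 * M 0 1 + 18 * c + 6 * M 1 1, -2 * M 0 0 - 6 * M 0 1 + 6 * c + 3 * M 1 1],
      ⟨?_, ?_⟩, ?_⟩,
    ⟨!![3 * M 0 0 + 6 * c - 6 * M 0 1 - 2 * M 1 1, -M 0 0 - 2 * c + 3 * M 0 1 + M 1 1;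
      6 * M 0 0 + 18 * c - 12 * M 0 1 - 6 * M 1 1, -2 * M 0 0 - 6 * c + 6 * M 0 1 + 3 * M 1 1],
      ⟨?_, ?_⟩, ?_⟩⟩
  · simp; linarith
  · exact ⟨-M 0 0 - 2 * M 0 1 + 3 * c + M 1 1, by simp; ring⟩
  · ext i j; fin_cases i <;> fin_cases j <;>
      simp [W, Matrix.mul_apply, Fin.sum_univ_two, hc] <;> ring
  · simp; linarith
  · exact ⟨M 0 0 + 3 * c - 2 * M 0 1 - M 1 1, by simp; ring⟩
  · ext i j; fin_cases i <;> fin_cases j <;>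
      simp [W, Matrix.mul_apply, Fin.sum_univ_two, hc] <;> ring

lemma Psi_w6 {n : ℕ} (hn : 0 < n) {z : ℂ} (hz : 0 < z.im) : Psi n (w6 z) = Psi n z := by
  have he : 6 ∈ eSet := by simp [eSet]
  have := Psi_mact hn (det_pos_of_AL he (W_mem he)) (fun M hM => (exists_conj_W6 hM).1)
    (fun M hM => (exists_conj_W6 hM).2) (fun x y hx hy => D4_W he hx hy) hz
  simpa [W, ← w6_eq] using this

lemma Psi_w3 {n : ℕ} (hn : 0 < n) {z : ℂ} (hz : 0 < z.im) : Psi n (w3 z) = Psi n z := by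
  have he : 3 ∈ eSet := by simp [eSet]
  have := Psi_mact hn (det_pos_of_AL he (W_mem he)) (fun M hM => (exists_conj_W3 hM).1)
    (fun M hM => (exists_conj_W3 hM).2) (fun x y hx hy => D4_W he hx hy) hz
  simpa [W, ← w3_eq] using this

lemma Psi_add_int {n : ℕ} (hn : 0 < n) {z : ℂ} (hz : 0 < z.im) (k : ℤ) :
    Psi n (z + k) = Psi n z := by
  have hT : !![1, k; 0, 1] ∈ R 1 := ⟨by simp, by simp⟩
  rw [add_int_eq_mact]
  exact Psi_mact hn (det_pos_of_mem one_pos hT) (fun M hM => (exists_conj_R hT hM).1)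
    (fun M hM => (exists_conj_R hT hM).2)
    (fun x y hx hy => by
      rw [D4_gamma_left hT hx, D4_gamma_right hT hy]) hz

lemma differentiableAt_D4_mact {M : Mat2} (hM : 0 < M.det) {z : ℂ} (hz : 0 < z.im) :
    DifferentiableAt ℂ (fun z => D4 z (mact M z)) z := by
  have h2 := im_mact_pos hM hz
  have d1 := differentiableAt_tt hz
  have d2 : DifferentiableAt ℂ (fun z => tt (mact M z)) z :=
    DifferentiableAt.comp z (differentiableAt_tt h2) (hasDerivAt_mact hM hz).differentiableAt
  have h3 := Om_ne_zero hz
  have h4 := Om_ne_zero h2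
  simp only [Om] at h3 h4
  simp only [D4, Om]
  fun_prop (disch := positivity)

lemma differentiableAt_Psi {n : ℕ} (hn : 0 < n) {z : ℂ} (hz : 0 < z.im) :
    DifferentiableAt ℂ (Psi n) z := by
  have hn' : (0 : ℤ) < n := by exact_mod_cast hn
  have : DifferentiableAt ℂ (fun z => ∏ i ∈ idxN n, D4 z (mact (rep i) z)) z :=
    DifferentiableAt.fun_finsetProd fun i hi =>
      differentiableAt_D4_mact (det_pos_of_mem hn' (rep_mem hn (mem_idxN.1 hi).1)) hz
  exact this

/-- Polynomial growth in `q⁻¹` towards the cusp `∞`. -/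
def PolyGrowth (f : ℂ → ℂ) : Prop :=
  ∃ C : ℝ, 0 ≤ C ∧ ∃ D : ℕ, ∀ z : ℂ, 1 ≤ z.im → ‖f z‖ ≤ C * ‖(qc z)⁻¹‖ ^ D

lemma one_le_norm_qc_inv {z : ℂ} (hz : 0 < z.im) : 1 ≤ ‖(qc z)⁻¹‖ := by
  rw [norm_inv]
  exact (one_le_inv₀ (norm_pos_iff.2 (qc_ne_zero z))).2 (norm_qc_lt_one hz).le

lemma PolyGrowth.const (c : ℂ) : PolyGrowth fun _ => c :=
  ⟨‖c‖, norm_nonneg _, 0, fun z _ => by simp⟩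

lemma PolyGrowth.add {f g : ℂ → ℂ} (hf : PolyGrowth f) (hg : PolyGrowth g) :
    PolyGrowth fun z => f z + g z := by
  obtain ⟨C, hC, D, h⟩ := hf
  obtain ⟨C', hC', D', h'⟩ := hg
  refine ⟨C + C', by positivity, D + D', fun z hz => (norm_add_le _ _).trans ?_⟩
  have h1 := one_le_norm_qc_inv (z := z) (by linarith)
  rw [add_mul]
  gcongr
  · exact (h z hz).trans (by gcongr; omega)
  · exact (h' z hz).trans (by gcongr; omega)

lemma PolyGrowth.mul {f g : ℂ → ℂ} (hf : PolyGrowth f) (hg : PolyGrowth g) :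
    PolyGrowth fun z => f z * g z := by
  obtain ⟨C, hC, D, h⟩ := hf
  obtain ⟨C', hC', D', h'⟩ := hg
  refine ⟨C * C', by positivity, D + D', fun z hz => ?_⟩
  rw [norm_mul, pow_add, mul_mul_mul_comm]
  exact mul_le_mul (h z hz) (h' z hz) (norm_nonneg _) (by positivity)

lemma PolyGrowth.pow {f : ℂ → ℂ} (hf : PolyGrowth f) (k : ℕ) : PolyGrowth fun z => f z ^ k := by
  induction k with
  | zero => simpa using PolyGrowth.const 1
  | succ k ih => simpa only [pow_succ] using ih.mul hf

lemma PolyGrowth.prod {ι : Type*} (s : Finset ι) {f : ι → ℂ → ℂ} (hf : ∀ i ∈ s, PolyGrowth (f i)) :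
    PolyGrowth fun z => ∏ i ∈ s, f i z := by
  classical
  induction s using Finset.induction_on with
  | empty => simpa using PolyGrowth.const 1
  | insert i s hi ih =>
    simp only [Finset.prod_insert hi]
    exact (hf i (by simp)).mul (ih fun j hj => hf j (by simp [hj]))

lemma PolyGrowth.congr {f g : ℂ → ℂ} (hf : PolyGrowth f) (h : ∀ z, 0 < z.im → g z = f z) :
    PolyGrowth g := by
  obtain ⟨C, hC, D, h'⟩ := hf
  exact ⟨C, hC, D, fun z hz => by rw [h z (by linarith)]; exact h' z hz⟩

lemma im_upp {e a d b : ℕ} (he : 0 < e) (hd : 0 < d) (z : ℂ) :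
    (mact (upp e a d b) z).im = a / d * z.im := by
  have h1 : (e : ℂ) ≠ 0 := by exact_mod_cast he.ne'
  have h2 : (d : ℂ) ≠ 0 := by exact_mod_cast hd.ne'
  have : mact (upp e a d b) z = ((a / d : ℝ) : ℂ) * z + ((b / (e * d) : ℝ) : ℂ) := by
    rw [upp, mact_of]
    push_cast
    field_simp
    simp
    ring
  rw [this, add_im, im_ofReal_mul, ofReal_im, add_zero]

lemma polyGrowth_comp_upp {e a d b : ℕ} (he : 0 < e) (ha : 0 < a) (hd : 0 < d) {G : ℂ → ℂ}
    (hG : DifferentiableOn ℂ G (Metric.ball 0 1)) (k : ℕ) {f : ℂ → ℂ}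
    (hf : ∀ z : ℂ, 0 < z.im → f z = (qc z)⁻¹ ^ k * G (qc z)) :
    PolyGrowth fun z => f (mact (upp e a d b) z) := by
  have hd' : (0 : ℝ) < d := by exact_mod_cast hd
  have ha' : (1 : ℝ) ≤ a := by exact_mod_cast ha
  obtain ⟨B, hB, h⟩ := exists_bound_disc hG (δ := 1 / d) (by positivity)
  refine ⟨B, hB.le, a * k, fun z hz => ?_⟩
  have him := im_upp (a := a) (b := b) he hd z
  have h1 : 1 / (d : ℝ) ≤ (mact (upp e a d b) z).im := by
    rw [him, div_mul_eq_mul_div]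
    gcongr
    nlinarith
  have h0 : 0 < (mact (upp e a d b) z).im := lt_of_lt_of_le (by positivity) h1
  beta_reduce
  rw [hf _ h0, norm_mul, norm_pow, mul_comm, pow_mul]
  gcongr
  · exact h _ h1
  · rw [norm_inv, norm_inv, norm_qc, norm_qc, ← Real.exp_neg, ← Real.exp_neg, ← Real.exp_nat_mul,
      Real.exp_le_exp, him]
    have h3 : (a : ℝ) / d ≤ a := div_le_self (by positivity) (by exact_mod_cast hd)
    have h4 : (a : ℝ) / d * z.im ≤ a * z.im := by gcongr
    have := mul_le_mul_of_nonneg_left h4 (show 0 ≤ 2 * Real.pi by positivity)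
    linarith

lemma tt_eq_disc {z : ℂ} (hz : 0 < z.im) :
    tt z = (qc z)⁻¹ ^ 1 * (cexp (logU (-3) 3 9 (-9) (qc z)) - 3 * qc z) := by
  rw [tt_eq hz, pow_one, mul_sub, mul_left_comm, inv_mul_cancel₀ (qc_ne_zero z), mul_one]

lemma Om_inv_eq {z : ℂ} (hz : 0 < z.im) :
    (Om z)⁻¹ = (qc z)⁻¹ ^ 0 * (qc z ^ 3 * cexp (-logU (-2) 10 14 (-22) (qc z))) := by
  rw [Om_eq hz, mul_inv, Complex.exp_neg]
  simp

lemma polyGrowth_tt {e a d b : ℕ} (he : 0 < e) (ha : 0 < a) (hd : 0 < d) :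
    PolyGrowth fun z => tt (mact (upp e a d b) z) := by
  refine polyGrowth_comp_upp he ha hd (G := fun x => cexp (logU (-3) 3 9 (-9) x) - 3 * x) ?_ 1
    fun z hz => tt_eq_disc hz
  have := differentiableOn_expU (-3) 3 9 (-9)
  fun_prop

lemma polyGrowth_Om_inv {e a d b : ℕ} (he : 0 < e) (ha : 0 < a) (hd : 0 < d) :
    PolyGrowth fun z => (Om (mact (upp e a d b) z))⁻¹ := by
  refine polyGrowth_comp_upp he ha hd (G := fun x => x ^ 3 * cexp (-logU (-2) 10 14 (-22) x)) ?_ 0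
    (f := fun z => (Om z)⁻¹) fun z hz => Om_inv_eq hz
  have := (differentiableOn_logU (-2) 10 14 (-22)).neg.cexp
  exact (differentiable_id.pow 3).differentiableOn.mul this

lemma mact_upp_one (z : ℂ) : mact (upp 1 1 1 0) z = z := by simp [upp, mact]

lemma polyGrowth_fac {e : ℕ} {f g : ℂ → ℂ} (hf : PolyGrowth f) (hg : PolyGrowth g) :
    PolyGrowth fun z => fac e (f z) (g z) := by
  have hc := PolyGrowth.const
  unfold fac
  split_ifs
  · exact ((((hf.add (hc 3)).mul (hg.add (hc 3))).add (hc 8)).pow 4).mul (hc (8 ^ 2)⁻¹)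
  · exact ((((hf.add (hc 4)).mul (hg.add (hc 4))).add (hc (-9))).pow 4).mul (hc (9 ^ 2)⁻¹)
  · exact ((((hf.add (hc (-5))).mul (hg.add (hc (-5)))).add (hc (-72))).pow 4).mul (hc (72 ^ 2)⁻¹)
  · refine ((hf.add ((hc (-1)).mul hg)).pow 4).congr fun z _ => by ring

lemma idx_pos {n : ℕ} (hn : 0 < n) {e a d b : ℕ} (hi : (⟨e, (a, d), b⟩ : Idx) ∈ idx n) :
    0 < e ∧ 0 < a ∧ 0 < d := by
  obtain ⟨he, h, -⟩ := (mem_idx hn).1 hi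
  refine ⟨eSet_pos he, ?_, ?_⟩ <;> rw [Nat.pos_iff_ne_zero] <;> rintro rfl <;> simp at h <;> omega

lemma polyGrowth_Psi {n : ℕ} (hn : 0 < n) : PolyGrowth (Psi n) := by
  refine PolyGrowth.prod _ fun i hi => ?_
  have hi := (mem_idxN.1 hi).1
  obtain ⟨e, ⟨a, d⟩, b⟩ := i
  obtain ⟨he, ha, hd⟩ := idx_pos hn hi
  have t1 := polyGrowth_tt (e := 1) (a := 1) (d := 1) (b := 0) one_pos one_pos one_pos
  have o1 := polyGrowth_Om_inv (e := 1) (a := 1) (d := 1) (b := 0) one_pos one_pos one_pos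
  simp only [mact_upp_one] at t1 o1
  refine ((polyGrowth_fac (e := e) t1 (polyGrowth_tt (b := b) he ha hd)).mul
    (o1.mul (polyGrowth_Om_inv (b := b) he ha hd))).congr fun z hz => ?_
  obtain ⟨h1, h2⟩ := mact_rep hn hi hz
  rw [h1, D4_right_W ((mem_idx hn).1 hi).1 hz h2, div_eq_mul_inv, mul_inv]

/-- A holomorphic, `1`-periodic function of polynomial growth is a Laurent polynomial times a
function on the disc. -/
lemma exists_disc_fun {F : ℂ → ℂ} (hF : ∀ z : ℂ, 0 < z.im → DifferentiableAt ℂ F z)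
    (hper : ∀ z : ℂ, 0 < z.im → F (z + 1) = F z) (hg : PolyGrowth F) :
    ∃ (D : ℕ) (G : ℂ → ℂ), DifferentiableOn ℂ G (Metric.ball 0 1) ∧
      ∀ z : ℂ, 0 < z.im → F z = (qc z)⁻¹ ^ D * G (qc z) := by
  obtain ⟨C, hC, D, h⟩ := hg
  have hq : ∀ z, Function.Periodic.qParam 1 z = qc z := fun z => by
    simp [Function.Periodic.qParam, qc]
  set f : ℂ → ℂ := fun z => if 0 < z.im then F z * qc z ^ D else 0 with hf
  have hfz : ∀ z : ℂ, 0 < z.im → f z = F z * qc z ^ D := fun z hz => by simp [hf, hz]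
  have hfp : Function.Periodic f ((1 : ℝ) : ℂ) := by
    intro z
    have hq1 : qc (z + 1) = qc z := by
      rw [qc_add, show qc 1 = 1 by simpa using qc_intCast 1, mul_one]
    simp only [hf, ofReal_one, add_im, one_im, add_zero]
    split_ifs with hz
    · rw [hper z hz, hq1]
    · rfl
  have hd : ∀ z : ℂ, 0 < z.im → DifferentiableAt ℂ f z := by
    intro z hz
    have : f =ᶠ[𝓝 z] fun z => F z * qc z ^ D := by
      filter_upwards [isOpen_im_pos.mem_nhds hz] with w hw using hfz w hw
    exact ((hF z hz).mul ((differentiable_qc z).pow D)).congr_of_eventuallyEq this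
  have hinf : ∀ᶠ z : ℂ in Filter.comap Complex.im Filter.atTop, 1 ≤ z.im :=
    (Filter.eventually_ge_atTop 1).comap _
  refine ⟨D, Function.Periodic.cuspFunction 1 f, ?_, fun z hz => ?_⟩
  · intro x hx
    refine DifferentiableAt.differentiableWithinAt ?_
    by_cases hx0 : x = 0
    · subst hx0
      refine Function.Periodic.differentiableAt_cuspFunction_zero one_pos hfp ?_ ?_
      · filter_upwards [hinf] with z hz using hd z (by linarith)
      · refine Asymptotics.IsBigO.of_bound C ?_
        filter_upwards [hinf] with z hz
        have hz0 : 0 < z.im := by linarith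
        have hpos : 0 < ‖qc z‖ := norm_pos_iff.2 (qc_ne_zero z)
        rw [hfz z hz0, norm_mul, norm_pow]
        have h' := h z hz
        rw [norm_inv, inv_pow, ← div_eq_mul_inv, le_div_iff₀ (by positivity)] at h'
        simpa using h'
    · obtain ⟨z, hz, rfl⟩ := exists_qc_eq hx0 (by simpa using hx)
      rw [← hq]
      exact Function.Periodic.differentiableAt_cuspFunction one_ne_zero hfp (hd z hz)
  · rw [← hq, Function.Periodic.eq_cuspFunction one_ne_zero hfp, hfz z hz, hq]
    rw [mul_comm (F z), ← mul_assoc, ← mul_pow, inv_mul_cancel₀ (qc_ne_zero z), one_pow, one_mul]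

lemma exists_Psi_eq {n : ℕ} (hn : 0 < n) :
    ∃ p : Polynomial ℂ, ∀ z, 0 < z.im → Psi n z = p.eval (js z) := by
  obtain ⟨D, G, hG, h⟩ := exists_disc_fun (F := Psi n) (fun z hz => differentiableAt_Psi hn hz)
    (fun z hz => by simpa using Psi_add_int hn hz 1) (polyGrowth_Psi hn)
  exact exists_polynomial D (Psi n) G hG h (fun z hz => Psi_w6 hn hz) fun z hz => Psi_w3 hn hz

section Asymptotics

open Asymptotics

section

/-- `g s = α sⁿ + β s²ⁿ + o(s²ⁿ)` for some `α`, as `s → 0`. -/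
def EA (n : ℕ) (g : ℂ → ℂ) (β : ℂ) : Prop :=
  ∃ α : ℂ, (fun s => g s - (α * s ^ n + β * s ^ (2 * n))) =o[𝓝[≠] 0] fun s => s ^ (2 * n)

/-- `f s = C s^D exp (g s)` near `0` with `g s = α sⁿ + β s²ⁿ + o(s²ⁿ)`. -/
def LA (n : ℕ) (f : ℂ → ℂ) (β : ℂ) : Prop :=
  ∃ C : ℂ, C ≠ 0 ∧ ∃ D : ℤ, ∃ g : ℂ → ℂ, EA n g β ∧ ∀ᶠ s in 𝓝[≠] 0, f s = C * s ^ D * cexp (g s)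

variable {n : ℕ} {f g h : ℂ → ℂ} {β β' : ℂ}

lemma EA.of_isLittleO (h : g =o[𝓝[≠] 0] fun s => s ^ (2 * n)) : EA n g 0 := ⟨0, by simpa using h⟩

lemma EA.add (hf : EA n f β) (hg : EA n g β') : EA n (fun s => f s + g s) (β + β') := by
  obtain ⟨α, hα⟩ := hf
  obtain ⟨α', hα'⟩ := hg
  refine ⟨α + α', (hα.add hα').congr_left fun s => by ring⟩

lemma EA.const_mul (hf : EA n f β) (c : ℂ) : EA n (fun s => c * f s) (c * β) := by
  obtain ⟨α, hα⟩ := hf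
  refine ⟨c * α, (hα.const_mul_left c).congr_left fun s => by ring⟩

lemma EA.sub (hf : EA n f β) (hg : EA n g β') : EA n (fun s => f s - g s) (β - β') := by
  simpa [sub_eq_add_neg] using hf.add (hg.const_mul (-1))

lemma EA.congr (hf : EA n f β) (h : ∀ᶠ s in 𝓝[≠] 0, f s = g s) : EA n g β := by
  obtain ⟨α, hα⟩ := hf
  refine ⟨α, hα.congr' (h.mono fun s hs => by simp [hs]) (by rfl)⟩

lemma EA.zero : EA n (fun _ => 0) 0 := ⟨0, by simp⟩

lemma tendsto_pow_punctured {k : ℕ} (hk : 0 < k) :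
    Filter.Tendsto (fun s : ℂ => s ^ k) (𝓝[≠] 0) (𝓝 0) := by
  have : Filter.Tendsto (fun s : ℂ => s ^ k) (𝓝 0) (𝓝 (0 ^ k)) := (continuous_pow k).tendsto 0
  rw [zero_pow hk.ne'] at this
  exact this.mono_left nhdsWithin_le_nhds

lemma eventually_punctured_ne : ∀ᶠ s : ℂ in 𝓝[≠] 0, s ≠ 0 := eventually_mem_nhdsWithin

lemma eventually_punctured_norm : ∀ᶠ s : ℂ in 𝓝[≠] 0, ‖s‖ < 1 := by
  refine Filter.Eventually.filter_mono nhdsWithin_le_nhds ?_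
  filter_upwards [Metric.ball_mem_nhds (0 : ℂ) one_pos] with s hs
  simpa using hs

lemma EA.tendsto (hn : 0 < n) (hg : EA n g β) : Filter.Tendsto g (𝓝[≠] 0) (𝓝 0) := by
  obtain ⟨α, hα⟩ := hg
  have h2 := tendsto_pow_punctured (k := 2 * n) (by omega)
  have h1 := hα.isBigO.trans_tendsto h2
  have h3 := h1.add (((tendsto_pow_punctured hn).const_mul α).add (h2.const_mul β))
  simpa using h3

lemma EA.unique (hn : 0 < n) (hg : EA n g β) (hg' : EA n g β') : β = β' := by
  obtain ⟨α, hα⟩ := hg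
  obtain ⟨α', hα'⟩ := hg'
  have h := hα'.sub hα
  have h1 : (fun s : ℂ => (α - α') + (β - β') * s ^ n) =o[𝓝[≠] 0] fun s : ℂ => s ^ n := by
    rw [isLittleO_iff_tendsto' (by filter_upwards [eventually_punctured_ne] with s hs h0; exact absurd h0 (pow_ne_zero _ hs))]
    refine (h.tendsto_div_nhds_zero).congr' ?_
    filter_upwards [eventually_punctured_ne] with s hs
    have := pow_ne_zero n hs
    rw [two_mul, pow_add]
    field_simp
    ring
  have h2 : α - α' = 0 := by
    have h3 := h1.isBigO.trans_tendsto (tendsto_pow_punctured hn)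
    have h4 := ((tendsto_pow_punctured hn).const_mul (β - β')).const_add (α - α')
    simpa using tendsto_nhds_unique h4 h3
  rw [h2] at h1
  have h3 := h1.tendsto_div_nhds_zero
  have h4 : Filter.Tendsto (fun _ : ℂ => β - β') (𝓝[≠] (0 : ℂ)) (𝓝 0) := by
    refine h3.congr' ?_
    filter_upwards [eventually_punctured_ne] with s hs
    have := pow_ne_zero n hs
    field_simp
    ring
  exact sub_eq_zero.1 (tendsto_nhds_unique tendsto_const_nhds h4)

lemma HasPS.exists_taylor {f : ℂ → ℂ} {a : ℕ → ℂ} (hf : HasPS f a) :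
    ∃ r : ℂ → ℂ, HasPS r (fun k => a (k + 3)) ∧
      ∀ x, ‖x‖ < 1 → f x = a 0 + a 1 * x + a 2 * x ^ 2 + x ^ 3 * r x := by
  obtain ⟨r1, h1, e1⟩ := hf.exists_shift
  obtain ⟨r2, h2, e2⟩ := h1.exists_shift
  obtain ⟨r3, h3, e3⟩ := h2.exists_shift
  refine ⟨r3, h3, fun x hx => ?_⟩
  rw [e1 x hx, e2 x hx, e3 x hx]
  ring

lemma HasPS.tendsto_pow {f : ℂ → ℂ} {a : ℕ → ℂ} (hf : HasPS f a) (hn : 0 < n) :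
    Filter.Tendsto (fun s : ℂ => f (s ^ n)) (𝓝[≠] 0) (𝓝 (a 0)) := by
  have := hf.continuousAt_zero.tendsto
  rw [hf.apply_zero] at this
  exact this.comp (tendsto_pow_punctured hn)

lemma HasPS.isLittleO {f : ℂ → ℂ} {a : ℕ → ℂ} (hf : HasPS f a) (hn : 0 < n) :
    (fun s : ℂ => f (s ^ n) - (a 0 + a 1 * s ^ n + a 2 * s ^ (2 * n))) =o[𝓝[≠] 0]
      fun s => s ^ (2 * n) := by
  obtain ⟨r, hr, e⟩ := hf.exists_taylor
  have h1 : (fun s : ℂ => s ^ n * r (s ^ n)) =o[𝓝[≠] 0] fun _ => (1 : ℂ) := by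
    rw [isLittleO_one_iff]
    simpa using (tendsto_pow_punctured hn).mul (hr.tendsto_pow hn)
  have h2 := (isBigO_refl (fun s : ℂ => s ^ (2 * n)) (𝓝[≠] 0)).mul_isLittleO h1
  refine h2.congr' ?_ (by simp)
  filter_upwards [eventually_punctured_norm] with s hs
  rw [e _ (norm_pow_lt_one hs hn.ne')]
  ring

lemma HasPS.ea {f : ℂ → ℂ} {a : ℕ → ℂ} (hf : HasPS f a) (h0 : a 0 = 0) (hn : 0 < n) :
    EA n (fun s => f (s ^ n)) (a 2) :=
  ⟨a 1, by simpa [h0] using hf.isLittleO hn⟩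

lemma LA.congr (hf : LA n f β) (h : ∀ᶠ s in 𝓝[≠] 0, f s = g s) : LA n g β := by
  obtain ⟨C, hC, D, u, hu, e⟩ := hf
  refine ⟨C, hC, D, u, hu, ?_⟩
  filter_upwards [h, e] with s h1 h2
  rw [← h1, h2]

lemma LA.of_exp (hg : EA n g β) : LA n (fun s => cexp (g s)) β :=
  ⟨1, one_ne_zero, 0, g, hg, by simp⟩

lemma LA.monomial {C : ℂ} (hC : C ≠ 0) (D : ℤ) : LA n (fun s => C * s ^ D) 0 :=
  ⟨C, hC, D, _, EA.zero, by simp⟩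

lemma LA.mul (hf : LA n f β) (hg : LA n g β') : LA n (fun s => f s * g s) (β + β') := by
  obtain ⟨C, hC, D, u, hu, e⟩ := hf
  obtain ⟨C', hC', D', u', hu', e'⟩ := hg
  refine ⟨C * C', mul_ne_zero hC hC', D + D', _, hu.add hu', ?_⟩
  filter_upwards [e, e', eventually_punctured_ne] with s h1 h2 h3
  rw [h1, h2, zpow_add₀ h3, Complex.exp_add]
  ring

lemma LA.one : LA n (fun _ => 1) 0 := by simpa using LA.monomial (n := n) one_ne_zero 0

lemma LA.prod {ι : Type*} (S : Finset ι) {F : ι → ℂ → ℂ} {b : ι → ℂ} (hF : ∀ i ∈ S, LA n (F i) (b i)) :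
    LA n (fun s => ∏ i ∈ S, F i s) (∑ i ∈ S, b i) := by
  classical
  induction S using Finset.induction_on with
  | empty => simpa using LA.one
  | insert i S hi ih =>
    simp only [Finset.sum_insert hi, Finset.prod_insert hi]
    exact (hF i (by simp)).mul (ih fun j hj => hF j (by simp [hj]))

lemma LA.pow (hf : LA n f β) (k : ℕ) : LA n (fun s => f s ^ k) (k * β) := by
  simpa using LA.prod (Finset.range k) (F := fun _ => f) (b := fun _ => β) fun _ _ => hf

lemma LA.inv (hf : LA n f β) : LA n (fun s => (f s)⁻¹) (-β) := by
  obtain ⟨C, hC, D, u, hu, e⟩ := hf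
  refine ⟨C⁻¹, inv_ne_zero hC, -D, fun s => -1 * u s, by simpa using hu.const_mul (-1), ?_⟩
  filter_upwards [e] with s h1
  rw [h1, mul_inv, mul_inv, _root_.zpow_neg, neg_one_mul, Complex.exp_neg]

lemma LA.eq_zero_of_one (hn : 0 < n) (h : LA n (fun _ => 1) β) : β = 0 := by
  obtain ⟨C, hC, D, u, hu, e⟩ := h
  have hu0 := hu.tendsto hn
  have hexp : Filter.Tendsto (fun s => C * cexp (u s)) (𝓝[≠] 0) (𝓝 C) := by
    have := (Complex.continuous_exp.tendsto 0).comp hu0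
    simpa using this.const_mul C
  have hD : D = 0 := by
    rcases lt_trichotomy D 0 with hD | hD | hD
    · exfalso
      obtain ⟨k, rfl⟩ : ∃ k : ℕ, D = -(k : ℤ) := ⟨D.natAbs, by omega⟩
      have h1 := tendsto_pow_punctured (k := k) (by omega)
      have h2 : Filter.Tendsto (fun s : ℂ => s ^ k) (𝓝[≠] 0) (𝓝 C) := by
        refine hexp.congr' ?_
        filter_upwards [e, eventually_punctured_ne] with s h h0
        have := pow_ne_zero k h0
        simp only [_root_.zpow_neg, zpow_natCast] at h
        field_simp at h
        exact h.symm
      exact hC (tendsto_nhds_unique h2 h1)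
    · exact hD
    · exfalso
      obtain ⟨k, rfl⟩ : ∃ k : ℕ, D = (k : ℤ) := ⟨D.natAbs, by omega⟩
      have h1 := (tendsto_pow_punctured (k := k) (by omega)).mul hexp
      rw [zero_mul] at h1
      have h2 : Filter.Tendsto (fun _ : ℂ => (1 : ℂ)) (𝓝[≠] (0 : ℂ)) (𝓝 0) := by
        refine h1.congr' ?_
        filter_upwards [e] with s h
        simp only [zpow_natCast] at h
        rw [h]
        ring
      exact one_ne_zero (tendsto_nhds_unique tendsto_const_nhds h2)
  subst hD
  have hC1 : C = 1 := by
    refine tendsto_nhds_unique hexp (tendsto_const_nhds.congr' ?_)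
    filter_upwards [e] with s h
    simpa using h
  subst hC1
  have hu1 : ∀ᶠ s in 𝓝[≠] 0, u s = 0 := by
    filter_upwards [e, hu0.eventually (Metric.ball_mem_nhds (0 : ℂ) one_pos)] with s h hs
    have h1 : cexp (u s) = 1 := by simpa using h.symm
    have hs' : ‖u s‖ < 1 := by simpa using hs
    have him : |(u s).im| < 1 := (Complex.abs_im_le_norm _).trans_lt hs'
    obtain ⟨hl, hr⟩ := abs_lt.1 him
    rw [← Complex.log_exp (x := u s) (by linarith [Real.pi_gt_three]) (by linarith [Real.pi_gt_three]),
      h1, Complex.log_one]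
  exact (hu.congr hu1).unique hn EA.zero

lemma LA.unique (hn : 0 < n) (hf : LA n f β) (hf' : LA n f β') : β = β' := by
  have h := hf.mul hf'.inv
  obtain ⟨C, hC, D, u, -, e⟩ := hf
  refine sub_eq_zero.1 ((sub_eq_add_neg β β').trans (LA.eq_zero_of_one hn (h.congr ?_)))
  filter_upwards [e, eventually_punctured_ne] with s h1 h2
  refine mul_inv_cancel₀ ?_
  rw [h1]
  exact mul_ne_zero (mul_ne_zero hC (zpow_ne_zero _ h2)) (Complex.exp_ne_zero _)

/-- `log (1 + v) = v - v²/2 + O(v³)`. -/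
lemma LA.one_add {α γ : ℂ} (hn : 0 < n)
    (hf : (fun s => f s - (α * s ^ n + γ * s ^ (2 * n))) =o[𝓝[≠] 0] fun s : ℂ => s ^ (2 * n)) :
    LA n (fun s => 1 + f s) (γ - α ^ 2 / 2) := by
  have hf0 := EA.tendsto (g := f) hn ⟨α, hf⟩
  have hO : f =O[𝓝[≠] 0] fun s : ℂ => s ^ n := by
    have h2 : (fun s : ℂ => s ^ (2 * n)) =O[𝓝[≠] 0] fun s : ℂ => s ^ n := by
      have := (isBigO_refl (fun s : ℂ => s ^ n) (𝓝[≠] 0)).mul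
        ((tendsto_pow_punctured hn).isBigO_one ℂ)
      refine this.congr (fun s => by ring) (fun s => by ring)
    refine ((hf.isBigO.trans h2).add
      (((isBigO_refl _ _).const_mul_left α).add (h2.const_mul_left γ))).congr_left fun s => by ring
  have h1 : (fun s => f s - α * s ^ n) =O[𝓝[≠] 0] fun s : ℂ => s ^ (2 * n) :=
    (hf.isBigO.add ((isBigO_refl _ _).const_mul_left γ)).congr_left fun s => by ring
  have h0 : (fun s : ℂ => s ^ n) =o[𝓝[≠] 0] fun _ => (1 : ℂ) :=
    (isLittleO_one_iff ℂ).2 (tendsto_pow_punctured hn)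
  have hsq : (fun s => f s ^ 2 - α ^ 2 * s ^ (2 * n)) =o[𝓝[≠] 0] fun s : ℂ => s ^ (2 * n) := by
    have h3 : (fun s => f s + α * s ^ n) =O[𝓝[≠] 0] fun s : ℂ => s ^ n :=
      hO.add ((isBigO_refl _ _).const_mul_left α)
    refine ((h1.mul_isLittleO (h3.trans_isLittleO h0))).congr (fun s => by ring) fun s => by ring
  have hlog : (fun s => Complex.log (1 + f s) - (f s - f s ^ 2 / 2)) =o[𝓝[≠] 0]
      fun s : ℂ => s ^ (2 * n) := by
    have hb : (fun s => Complex.log (1 + f s) - (f s - f s ^ 2 / 2)) =O[𝓝[≠] 0]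
        fun s => f s ^ 3 := by
      refine IsBigO.of_bound 1 ?_
      filter_upwards [hf0.eventually (Metric.ball_mem_nhds (0 : ℂ) (half_pos one_pos))] with s hs
      have hs' : ‖f s‖ < 1 / 2 := by simpa using hs
      have := Complex.norm_log_sub_logTaylor_le 2 (z := f s) (by linarith)
      simp only [Complex.logTaylor, Finset.sum_range_succ, Finset.sum_range_zero] at this
      have e1 : Complex.log (1 + f s) - (f s - f s ^ 2 / 2) = Complex.log (1 + f s) -
        (0 + (-1) ^ (0 + 1) * f s ^ 0 / (0 : ℕ) + (-1) ^ (1 + 1) * f s ^ 1 / (1 : ℕ)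
          + (-1) ^ (2 + 1) * f s ^ 2 / (2 : ℕ)) := by norm_num; ring
      rw [e1]
      refine this.trans ?_
      rw [norm_pow, one_mul]
      have h5 : (1 - ‖f s‖)⁻¹ ≤ 2 := by
        rw [inv_le_comm₀ (by linarith) two_pos]; linarith
      have h6 : 0 ≤ ‖f s‖ ^ 3 := by positivity
      have h7 : ‖f s‖ ^ 3 * (1 - ‖f s‖)⁻¹ ≤ ‖f s‖ ^ 3 * 2 := mul_le_mul_of_nonneg_left h5 h6
      norm_num
      linarith
    refine hb.trans_isLittleO ?_
    have h4 : (fun s => f s ^ 2) =O[𝓝[≠] 0] fun s : ℂ => s ^ (2 * n) :=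
      (hsq.isBigO.add ((isBigO_refl _ _).const_mul_left (α ^ 2))).congr_left fun s => by ring
    refine (h4.mul_isLittleO (hO.trans_isLittleO h0)).congr (fun s => by ring) fun s => by ring
  have hEA : EA n (fun s => Complex.log (1 + f s)) (γ - α ^ 2 / 2) := by
    refine ⟨α, ?_⟩
    refine ((hlog.add hf).sub (hsq.const_mul_left (1 / 2))).congr_left fun s => by ring
  refine (LA.of_exp hEA).congr ?_
  filter_upwards [hf0.eventually (Metric.ball_mem_nhds (0 : ℂ) one_pos)] with s hs
  refine Complex.exp_log fun h => ?_
  have : f s = -1 := by linear_combination h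
  simp [this] at hs

lemma exists_log_one_sub (hn : 0 < n) (hf : (fun s => f s) =O[𝓝[≠] 0] fun s : ℂ => s ^ (n + 1)) :
    (fun s => Complex.log (1 - f s) + f s) =o[𝓝[≠] 0] (fun s : ℂ => s ^ (2 * n)) ∧
      ∀ᶠ s in 𝓝[≠] 0, cexp (Complex.log (1 - f s)) = 1 - f s := by
  have hf0 : Filter.Tendsto f (𝓝[≠] 0) (𝓝 0) :=
    hf.trans_tendsto (tendsto_pow_punctured (by omega))
  constructor
  · have hb : (fun s => Complex.log (1 - f s) + f s) =O[𝓝[≠] 0] fun s => f s ^ 2 := by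
      refine IsBigO.of_bound 1 ?_
      filter_upwards [hf0.eventually (Metric.ball_mem_nhds (0 : ℂ) (half_pos one_pos))] with s hs
      have hs' : ‖f s‖ < 1 / 2 := by simpa using hs
      have := Complex.norm_log_one_add_sub_self_le (z := -f s) (by rw [norm_neg]; linarith)
      rw [norm_neg, ← sub_eq_add_neg, sub_neg_eq_add] at this
      refine this.trans ?_
      rw [norm_pow, one_mul]
      have h5 : (1 - ‖f s‖)⁻¹ ≤ 2 := by
        rw [inv_le_comm₀ (by linarith) two_pos]; linarith
      have h6 : 0 ≤ ‖f s‖ ^ 2 := by positivity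
      have h7 : ‖f s‖ ^ 2 * (1 - ‖f s‖)⁻¹ ≤ ‖f s‖ ^ 2 * 2 := mul_le_mul_of_nonneg_left h5 h6
      linarith
    refine hb.trans_isLittleO ((hf.pow 2).trans_isLittleO ?_)
    have h0 : (fun s : ℂ => s ^ 2) =o[𝓝[≠] 0] fun _ => (1 : ℂ) :=
      (isLittleO_one_iff ℂ).2 (tendsto_pow_punctured two_pos)
    refine ((isBigO_refl (fun s : ℂ => s ^ (2 * n)) _).mul_isLittleO h0).congr
      (fun s => by ring) (fun s => by ring)
  · filter_upwards [hf0.eventually (Metric.ball_mem_nhds (0 : ℂ) one_pos)] with s hs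
    refine Complex.exp_log fun h => ?_
    have : f s = 1 := by linear_combination -h
    simp [this] at hs

end

/-- The standard primitive `D`-th root of unity. -/
noncomputable def zt (D : ℕ) : ℂ := cexp (2 * Real.pi * I / D)

lemma zt_prim {D : ℕ} (hD : 0 < D) : IsPrimitiveRoot (zt D) D := Complex.isPrimitiveRoot_exp D hD.ne'

lemma norm_zt_pow {D : ℕ} (hD : 0 < D) (b : ℕ) : ‖zt D ^ b‖ = 1 := by
  rw [norm_pow, (zt_prim hD).norm'_eq_one hD.ne', one_pow]

lemma zt_pow_ne {D : ℕ} (b : ℕ) : zt D ^ b ≠ 0 := pow_ne_zero _ (Complex.exp_ne_zero _)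

lemma sum_zt {D : ℕ} (hD : 0 < D) (k : ℕ) :
    ∑ b ∈ Finset.range D, (zt D ^ b) ^ k = if D ∣ k then (D : ℂ) else 0 := by
  have hz := zt_prim hD
  have h1 : ∀ b, (zt D ^ b) ^ k = (zt D ^ k) ^ b := fun b => by rw [← pow_mul, ← pow_mul, mul_comm]
  simp only [h1]
  split_ifs with h
  · simp [(hz.pow_eq_one_iff_dvd k).2 h]
  · have hne : zt D ^ k ≠ 1 := fun h' => h ((hz.pow_eq_one_iff_dvd k).1 h')
    rw [geom_sum_eq hne, ← pow_mul, mul_comm, pow_mul, hz.pow_eq_one]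
    simp

lemma HasPS.section {h : ℂ → ℂ} {c : ℕ → ℂ} (hh : HasPS h c) {D : ℕ} (hD : 0 < D) :
    ∃ H : ℂ → ℂ, HasPS H (fun k => D * c (D * k)) ∧
      ∀ y : ℂ, ‖y‖ < 1 → ∑ b ∈ Finset.range D, h (zt D ^ b * y) = H (y ^ D) := by
  have key : ∀ y : ℂ, ‖y‖ < 1 → HasSum (fun k => D * c (D * k) * (y ^ D) ^ k)
      (∑ b ∈ Finset.range D, h (zt D ^ b * y)) := by
    intro y hy
    have h1 : HasSum (fun k => ∑ b ∈ Finset.range D, c k * (zt D ^ b * y) ^ k)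
        (∑ b ∈ Finset.range D, h (zt D ^ b * y)) :=
      hasSum_sum fun b _ => hh _ (by rw [norm_mul, norm_zt_pow hD, one_mul]; exact hy)
    have h2 : ∀ k, ∑ b ∈ Finset.range D, c k * (zt D ^ b * y) ^ k
        = if D ∣ k then D * c k * y ^ k else 0 := by
      intro k
      have : ∀ b, c k * (zt D ^ b * y) ^ k = c k * y ^ k * (zt D ^ b) ^ k := fun b => by
        rw [mul_pow]; ring
      simp only [this]
      rw [← Finset.mul_sum, sum_zt hD]
      split_ifs <;> ring
    simp only [h2] at h1
    have hinj : Function.Injective fun k : ℕ => D * k := fun a b h => Nat.eq_of_mul_eq_mul_left hD h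
    rw [← hinj.hasSum_iff] at h1
    · refine h1.congr_fun ?_ |> fun h => h
      intro k
      simp [pow_mul]
    · intro k hk
      rw [if_neg]
      rintro ⟨l, rfl⟩
      exact hk ⟨l, rfl⟩
  refine ⟨fun x => ∑' k, D * c (D * k) * x ^ k, fun x hx => ?_, fun y hy => (key y hy).tsum_eq.symm⟩
  obtain ⟨y, rfl⟩ := IsAlgClosed.exists_pow_nat_eq x hD
  refine (key y ?_).summable.hasSum
  rw [norm_pow] at hx
  exact (pow_lt_one_iff_of_nonneg (norm_nonneg _) hD.ne').1 hx

/-- The second coefficient of `x ↦ D ∑ c(Dk) x^{κk}`. -/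
noncomputable def sec (κ D : ℕ) (c : ℕ → ℂ) : ℂ := if κ ∣ 2 then D * c (D * (2 / κ)) else 0

lemma HasPS.section_pow {h : ℂ → ℂ} {c : ℕ → ℂ} (hh : HasPS h c) {n m D κ : ℕ}
    (hm : 0 < m) (hD : 0 < D) (hκ : 0 < κ) (e : m * D = n * κ) :
    ∃ H : ℂ → ℂ, HasPS H (fun k => if κ ∣ k then D * c (D * (k / κ)) else 0) ∧
      ∀ s : ℂ, ‖s‖ < 1 → ∑ b ∈ Finset.range D, h (zt D ^ b * s ^ m) = H (s ^ n) := by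
  obtain ⟨H, hH, e1⟩ := hh.section hD
  refine ⟨_, hH.comp_pow hκ, fun s hs => ?_⟩
  rw [e1 _ (norm_pow_lt_one hs hm.ne'), ← pow_mul, e, pow_mul]

lemma HasPS.sec_ea {h : ℂ → ℂ} {c : ℕ → ℂ} (hh : HasPS h c) (h0 : c 0 = 0) {n m D κ : ℕ} (hn : 0 < n)
    (hm : 0 < m) (hD : 0 < D) (hκ : 0 < κ) (e : m * D = n * κ) :
    EA n (fun s => ∑ b ∈ Finset.range D, h (zt D ^ b * s ^ m)) (sec κ D c) := by
  obtain ⟨H, hH, e1⟩ := hh.section_pow hm hD hκ e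
  refine (hH.ea (by simp [h0]) hn).congr ?_
  filter_upwards [eventually_punctured_norm] with s hs
  rw [e1 s hs]

lemma hasPS_of_differentiableOn {f : ℂ → ℂ} (hf : DifferentiableOn ℂ f (Metric.ball 0 1)) :
    ∃ c : ℕ → ℂ, HasPS f c := by
  refine ⟨fun k => (k.factorial : ℂ)⁻¹ * iteratedDeriv k f 0, fun x hx => ?_⟩
  have h := Complex.hasSum_taylorSeries_on_ball (r := 1) (c := (0 : ℂ)) (f := f)
    (by simpa using hf) (z := x) (by simpa using hx)
  refine h.congr_fun ?_ |> fun h => h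
  intro k
  simp
  ring

lemma isBigO_pow_pow {a b : ℕ} (h : b ≤ a) :
    (fun s : ℂ => s ^ a) =O[𝓝[≠] 0] fun s : ℂ => s ^ b := by
  obtain ⟨k, rfl⟩ := Nat.exists_eq_add_of_le h
  have h1 : (fun s : ℂ => s ^ k) =O[𝓝[≠] 0] fun _ => (1 : ℂ) := by
    have : Filter.Tendsto (fun s : ℂ => s ^ k) (𝓝 0) (𝓝 (0 ^ k)) := (continuous_pow k).tendsto 0
    exact (this.mono_left nhdsWithin_le_nhds).isBigO_one ℂ
  refine ((isBigO_refl (fun s : ℂ => s ^ b) _).mul h1).congr (fun s => by ring) (fun s => by ring)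

lemma isLittleO_pow_pow {a b : ℕ} (h : b < a) :
    (fun s : ℂ => s ^ a) =o[𝓝[≠] 0] fun s : ℂ => s ^ b := by
  obtain ⟨k, rfl⟩ := Nat.exists_eq_add_of_le h
  have h1 : (fun s : ℂ => s ^ (k + 1)) =o[𝓝[≠] 0] fun _ => (1 : ℂ) :=
    (isLittleO_one_iff ℂ).2 (tendsto_pow_punctured k.succ_pos)
  refine ((isBigO_refl (fun s : ℂ => s ^ b) _).mul_isLittleO h1).congr
    (fun s => by rw [← pow_add]; congr 1; omega) (fun s => by ring)

lemma LA_fac {U ω : ℂ → ℂ} {u w : ℕ → ℂ} (hU : HasPS U u) (hω : HasPS ω w) (hu : u 0 = 0)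
    (hw : w 0 = 0) {K : ℂ} (hK : K ≠ 0) {n m D κ : ℕ} (hn : 0 < n)
    (hm : 0 < m) (hD : 0 < D) (hκ : 2 ≤ κ) (e : m * D = n * κ) :
    LA n (fun s => ∏ b ∈ Finset.range D,
      (((s ^ n)⁻¹ * cexp (U (s ^ n))) * ((zt D ^ b * s ^ m)⁻¹ * cexp (U (zt D ^ b * s ^ m))) - K) ^ 4
        / K ^ 2 / (((s ^ n)⁻¹ ^ 3 * cexp (ω (s ^ n))) *
          ((zt D ^ b * s ^ m)⁻¹ ^ 3 * cexp (ω (zt D ^ b * s ^ m)))))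
      (4 * (D * u 2 + sec κ D u) - (D * w 2 + sec κ D w)) := by
  set y : ℕ → ℂ → ℂ := fun b s => zt D ^ b * s ^ m with hy
  set v : ℕ → ℂ → ℂ := fun b s => K * s ^ n * y b s * cexp (-U (s ^ n) - U (y b s)) with hv
  have hx1 : (fun s : ℂ => cexp (-U (s ^ n))) =O[𝓝[≠] 0] fun _ => (1 : ℂ) := by
    have := (Complex.continuous_exp.tendsto _).comp (hU.tendsto_pow hn).neg
    exact this.isBigO_one ℂ
  obtain ⟨c', hc'⟩ := hasPS_of_differentiableOn (f := fun x => x * cexp (-U x))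
    (by have := hU.differentiableOn; fun_prop)
  have hc0 : c' 0 = 0 := by simpa using hc'.apply_zero.symm
  have hvO : ∀ b, (v b) =O[𝓝[≠] 0] fun s : ℂ => s ^ (n + 1) := by
    intro b
    have h1 : (fun s : ℂ => cexp (-U (y b s))) =O[𝓝[≠] 0] fun _ => (1 : ℂ) := by
      have h1 : Filter.Tendsto (fun s : ℂ => zt D ^ b * s ^ m) (𝓝[≠] 0) (𝓝 0) := by
        simpa using (tendsto_pow_punctured hm).const_mul (zt D ^ b)
      have := (Complex.continuous_exp.tendsto _).comp (hU.continuousAt_zero.tendsto.comp h1).neg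
      exact this.isBigO_one ℂ
    have h2 := (((isBigO_pow_pow (a := n + m) (b := n + 1) (by omega)).const_mul_left
      (K * zt D ^ b)).mul hx1).mul h1
    refine h2.congr (fun s => ?_) (fun s => by simp)
    simp only [hv, hy, sub_eq_add_neg, Complex.exp_add]
    ring
  have hvs : (fun s => ∑ b ∈ Finset.range D, v b s) =o[𝓝[≠] 0] fun s : ℂ => s ^ (2 * n) := by
    obtain ⟨H, hH, e1⟩ := hc'.section_pow hm hD (by omega) e
    have hH2 : (fun s : ℂ => H (s ^ n)) =o[𝓝[≠] 0] fun s : ℂ => s ^ n := by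
      have h2 := (hH.isLittleO hn).trans (isLittleO_pow_pow (a := 2 * n) (b := n) (by omega))
      have h3 : ¬ κ ∣ 1 := fun h => by have := Nat.le_of_dvd one_pos h; omega
      simp only [h3, if_false, zero_mul, add_zero, Nat.zero_div, mul_zero, hc0, ite_self,
        zero_add] at h2
      have h4 := (isLittleO_pow_pow (a := 2 * n) (b := n) (by omega)).const_mul_left
        (if κ ∣ 2 then D * c' (D * (2 / κ)) else 0)
      refine (h2.add h4).congr_left fun s => by ring
    have h2 := (((isBigO_refl (fun s : ℂ => s ^ n) (𝓝[≠] 0)).const_mul_left K).mul hx1).mul_isLittleO hH2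
    refine h2.congr' ?_ (.of_forall fun s => by ring)
    filter_upwards [eventually_punctured_norm] with s hs
    rw [← e1 s hs, Finset.mul_sum]
    refine Finset.sum_congr rfl fun b _ => ?_
    simp only [hv, hy, sub_eq_add_neg, Complex.exp_add]
    ring
  have hlog : ∀ b, (fun s => Complex.log (1 - v b s) + v b s) =o[𝓝[≠] 0] (fun s : ℂ => s ^ (2 * n)) ∧
      ∀ᶠ s in 𝓝[≠] 0, cexp (Complex.log (1 - v b s)) = 1 - v b s :=
    fun b => exists_log_one_sub hn (hvO b)
  have hlogs : EA n (fun s => ∑ b ∈ Finset.range D, Complex.log (1 - v b s)) 0 := by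
    refine EA.of_isLittleO ?_
    have h1 := IsLittleO.fun_sum (s := Finset.range D) fun b _ => (hlog b).1
    refine (h1.sub hvs).congr_left fun s => ?_
    rw [← Finset.sum_sub_distrib]
    simp
  have hEA := ((((hU.ea hu hn).const_mul D).add (hU.sec_ea hu hn hm hD (by omega) e)).const_mul 4).sub
    (((hω.ea hw hn).const_mul D).add (hω.sec_ea hw hn hm hD (by omega) e))
  have hEA' := hEA.add (hlogs.const_mul 4)
  have hmon : LA n (fun s => ∏ b ∈ Finset.range D, K⁻¹ ^ 2 * (zt D ^ b)⁻¹ * s ^ (-(n + m : ℤ)))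
      (∑ b ∈ Finset.range D, 0) :=
    LA.prod _ fun b _ => LA.monomial
      (mul_ne_zero (pow_ne_zero _ (inv_ne_zero hK)) (inv_ne_zero (zt_pow_ne b))) _
  have := hmon.mul (LA.of_exp hEA')
  rw [Finset.sum_const_zero, mul_zero, add_zero, zero_add] at this
  refine this.congr ?_
  filter_upwards [eventually_punctured_ne, Filter.eventually_all_finset (Finset.range D) |>.2
    fun b _ => (hlog b).2] with s hs hl
  have e2 : 4 * (↑D * U (s ^ n) + ∑ b ∈ Finset.range D, U (zt D ^ b * s ^ m)) -
      (↑D * ω (s ^ n) + ∑ b ∈ Finset.range D, ω (zt D ^ b * s ^ m)) +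
      4 * ∑ b ∈ Finset.range D, Complex.log (1 - v b s) = ∑ b ∈ Finset.range D,
        (4 * U (s ^ n) + 4 * U (y b s) - ω (s ^ n) - ω (y b s) + 4 * Complex.log (1 - v b s)) := by
    simp only [Finset.sum_add_distrib, Finset.sum_sub_distrib, ← Finset.mul_sum, hy]
    simp
    ring
  rw [e2, Complex.exp_sum, ← Finset.prod_mul_distrib]
  refine Finset.prod_congr rfl fun b hb => ?_
  have hyb : y b s ≠ 0 := mul_ne_zero (zt_pow_ne b) (pow_ne_zero _ hs)
  have hxs : s ^ n ≠ 0 := pow_ne_zero _ hs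
  have e3 : K⁻¹ ^ 2 * (zt D ^ b)⁻¹ * s ^ (-(n + m : ℤ)) = K⁻¹ ^ 2 * (s ^ n)⁻¹ * (y b s)⁻¹ := by
    simp only [hy]
    rw [_root_.zpow_neg, zpow_add₀ hs, zpow_natCast, zpow_natCast]
    simp only [mul_inv]
    ring
  have e4 : cexp (4 * U (s ^ n) + 4 * U (y b s) - ω (s ^ n) - ω (y b s) + 4 * Complex.log (1 - v b s))
      = cexp (U (s ^ n)) ^ 4 * cexp (U (y b s)) ^ 4 * (cexp (ω (s ^ n)))⁻¹ * (cexp (ω (y b s)))⁻¹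
        * (1 - v b s) ^ 4 := by
    have hl' : (1 - v b s) ^ 4 = cexp (Complex.log (1 - v b s)) ^ 4 := by rw [hl b hb]
    rw [hl']
    simp only [← Complex.exp_nat_mul, ← Complex.exp_neg, ← Complex.exp_add]
    congr 1
  have e5 : v b s = K * s ^ n * y b s * ((cexp (U (s ^ n)))⁻¹ * (cexp (U (y b s)))⁻¹) := by
    simp only [hv]
    rw [sub_eq_add_neg, Complex.exp_add, Complex.exp_neg, Complex.exp_neg]
  rw [e3, e4, e5]
  change _ = ((s ^ n)⁻¹ * cexp (U (s ^ n)) * ((y b s)⁻¹ * cexp (U (y b s))) - K) ^ 4 / K ^ 2 /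
    ((s ^ n)⁻¹ ^ 3 * cexp (ω (s ^ n)) * ((y b s)⁻¹ ^ 3 * cexp (ω (y b s))))
  have n1 := Complex.exp_ne_zero (U (s ^ n))
  have n2 := Complex.exp_ne_zero (U (y b s))
  have n3 := Complex.exp_ne_zero (ω (s ^ n))
  have n4 := Complex.exp_ne_zero (ω (y b s))
  generalize cexp (U (s ^ n)) = A1 at *
  generalize cexp (U (y b s)) = A2 at *
  generalize cexp (ω (s ^ n)) = A3 at *
  generalize cexp (ω (y b s)) = A4 at *
  generalize y b s = Y at *
  generalize s ^ n = X at *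
  clear e2 e3 e4 e5 hl this hmon hEA hEA' hlogs hlog hvs hvO hx1
  field_simp

lemma LA.eventually_ne {n : ℕ} {f : ℂ → ℂ} {β : ℂ} (hf : LA n f β) : ∀ᶠ s in 𝓝[≠] 0, f s ≠ 0 := by
  obtain ⟨C, hC, D, u, -, e⟩ := hf
  filter_upwards [e, eventually_punctured_ne] with s h1 h2
  rw [h1]
  exact mul_ne_zero (mul_ne_zero hC (zpow_ne_zero _ h2)) (Complex.exp_ne_zero _)

lemma HasPS.isBigO_slope {g : ℂ → ℂ} {c : ℕ → ℂ} (hg : HasPS g c) {x y : ℂ → ℂ}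
    (hx : Filter.Tendsto x (𝓝[≠] 0) (𝓝 0)) (hy : Filter.Tendsto y (𝓝[≠] 0) (𝓝 0)) :
    (fun s => (g (x s) - g (y s)) / (x s - y s)) =O[𝓝[≠] (0 : ℂ)] fun _ => (1 : ℂ) := by
  have hs : HasStrictDerivAt g (deriv g 0) 0 := by
    have := (hg.differentiableOn.analyticAt (Metric.ball_mem_nhds (0 : ℂ) one_pos))
    exact this.hasStrictDerivAt
  have h1 := (hs.hasStrictFDerivAt.isBigO_sub).comp_tendsto (hx.prodMk_nhds hy)
  have h2 := h1.mul (isBigO_refl (fun s => (x s - y s)⁻¹) (𝓝[≠] (0 : ℂ)))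
  have h3 : (fun s => (x s - y s) * (x s - y s)⁻¹) =O[𝓝[≠] (0 : ℂ)] fun _ => (1 : ℂ) := by
    refine IsBigO.of_bound 1 (.of_forall fun s => ?_)
    rcases eq_or_ne (x s - y s) 0 with h | h
    · simp [h]
    · simp [mul_inv_cancel₀ h]
  exact (h2.trans h3).congr_left fun s => by simp [div_eq_mul_inv]

lemma LA_diff {g ω : ℂ → ℂ} {c w : ℕ → ℂ} (hg : HasPS g c) (hω : HasPS ω w) (hc : c 0 = 0)
    (hw : w 0 = 0) {n m D : ℕ} (hn : 0 < n) (hm : 0 < m) (S : Finset ℕ) {pβ ωβ gβ : ℂ}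
    (hp : LA n (fun s => ∏ b ∈ S, ((s ^ n)⁻¹ - (zt D ^ b * s ^ m)⁻¹)) pβ)
    (hωs : EA n (fun s => ∑ b ∈ S, ω (zt D ^ b * s ^ m)) ωβ)
    (hgs : EA n (fun s => ∑ b ∈ S, s ^ n * g (zt D ^ b * s ^ m)) gβ) :
    LA n (fun s => ∏ b ∈ S,
      ((s ^ n)⁻¹ + g (s ^ n) - ((zt D ^ b * s ^ m)⁻¹ + g (zt D ^ b * s ^ m))) ^ 4 /
        (((s ^ n)⁻¹ ^ 3 * cexp (ω (s ^ n))) *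
          ((zt D ^ b * s ^ m)⁻¹ ^ 3 * cexp (ω (zt D ^ b * s ^ m)))))
      (4 * (pβ - gβ) - (S.card * w 2 + ωβ)) := by
  obtain ⟨G, hG, eG⟩ := hg.exists_shift
  simp only [hc, zero_add] at eG
  set y : ℕ → ℂ → ℂ := fun b s => zt D ^ b * s ^ m with hy
  set v : ℕ → ℂ → ℂ := fun b s => s ^ n * y b s * ((g (s ^ n) - g (y b s)) / (s ^ n - y b s)) with hv
  have hx0 := tendsto_pow_punctured hn
  have hy0 : ∀ b, Filter.Tendsto (y b) (𝓝[≠] 0) (𝓝 0) := fun b => by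
    simpa using (tendsto_pow_punctured hm).const_mul (zt D ^ b)
  have hne : ∀ᶠ s : ℂ in 𝓝[≠] 0, ∀ b ∈ S, s ^ n - y b s ≠ 0 := by
    filter_upwards [hp.eventually_ne] with s hs b hb h0
    refine hs (Finset.prod_eq_zero hb ?_)
    rw [sub_eq_zero.1 h0, sub_self]
  have hvO : ∀ b, (v b) =O[𝓝[≠] 0] fun s : ℂ => s ^ (n + 1) := by
    intro b
    have h2 := (((isBigO_pow_pow (a := n + m) (b := n + 1) (by omega)).const_mul_left
      (zt D ^ b)).mul (hg.isBigO_slope hx0 (hy0 b)))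
    refine h2.congr (fun s => ?_) (fun s => by simp)
    simp only [hv, hy]
    ring
  have hvs : ∀ b ∈ S, (fun s => v b s - s ^ n * g (y b s)) =o[𝓝[≠] 0] fun s : ℂ => s ^ (2 * n) := by
    intro b hb
    have h2 := (((isLittleO_pow_pow (a := 2 * n + m) (b := 2 * n) (by omega)).const_mul_left
      (zt D ^ b)).mul_isBigO (hG.isBigO_slope hx0 (hy0 b)))
    refine h2.congr' ?_ (.of_forall fun s => by simp)
    filter_upwards [hne, eventually_punctured_norm, (hy0 b).eventually
      (Metric.ball_mem_nhds (0 : ℂ) one_pos)] with s h1 h3 h4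
    have h1 := h1 b hb
    have e1 : zt D ^ b * s ^ (2 * n + m) = s ^ n * s ^ n * y b s := by simp only [hy]; ring
    simp only [hv]
    rw [e1, eG _ (norm_pow_lt_one h3 hn.ne'), eG (y b s) (by simpa using h4)]
    generalize G (s ^ n) = A1 at *
    generalize G (y b s) = A2 at *
    generalize y b s = Y at *
    generalize s ^ n = X at *
    clear hvO e1 hne
    field_simp
    ring
  have hlog : ∀ b, (fun s => Complex.log (1 - v b s) + v b s) =o[𝓝[≠] 0] (fun s : ℂ => s ^ (2 * n)) ∧
      ∀ᶠ s in 𝓝[≠] 0, cexp (Complex.log (1 - v b s)) = 1 - v b s :=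
    fun b => exists_log_one_sub hn (hvO b)
  have hlogs : EA n (fun s => ∑ b ∈ S, Complex.log (1 - v b s)) (-gβ) := by
    have h1 := IsLittleO.fun_sum (s := S) fun b hb => (hlog b).1.sub (hvs b hb)
    have h2 := (EA.of_isLittleO h1).sub hgs
    rw [zero_sub] at h2
    refine h2.congr (.of_forall fun s => ?_)
    rw [← Finset.sum_sub_distrib]
    refine Finset.sum_congr rfl fun b _ => ?_
    simp only [hy]
    ring
  have hEA := (hlogs.const_mul 4).sub (((hω.ea hw hn).const_mul S.card).add hωs)
  have hmon : LA n (fun s => ∏ b ∈ S, (zt D ^ b) ^ 3 * s ^ ((3 * n + 3 * m : ℕ) : ℤ))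
      (∑ b ∈ S, 0) :=
    LA.prod _ fun b _ => LA.monomial (pow_ne_zero _ (zt_pow_ne b)) _
  have := ((hp.pow 4).mul hmon).mul (LA.of_exp hEA)
  rw [Finset.sum_const_zero, add_zero] at this
  have e0 : ((4 : ℕ) : ℂ) * pβ + (4 * -gβ - (S.card * w 2 + ωβ)) = 4 * (pβ - gβ) - (S.card * w 2 + ωβ) := by
    push_cast; ring
  rw [e0] at this
  refine this.congr ?_
  filter_upwards [eventually_punctured_ne, hne, Filter.eventually_all_finset S |>.2
    fun b _ => (hlog b).2] with s hs hxy hl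
  have e2 : 4 * ∑ b ∈ S, Complex.log (1 - v b s) -
      (S.card * ω (s ^ n) + ∑ b ∈ S, ω (zt D ^ b * s ^ m)) = ∑ b ∈ S,
        (4 * Complex.log (1 - v b s) - ω (s ^ n) - ω (y b s)) := by
    simp only [Finset.sum_sub_distrib, ← Finset.mul_sum, hy]
    simp
    ring
  rw [e2, Complex.exp_sum, ← Finset.prod_pow, ← Finset.prod_mul_distrib, ← Finset.prod_mul_distrib]
  refine Finset.prod_congr rfl fun b hb => ?_
  have hyb : y b s ≠ 0 := mul_ne_zero (zt_pow_ne b) (pow_ne_zero _ hs)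
  have hxs : s ^ n ≠ 0 := pow_ne_zero _ hs
  have hxyb := hxy b hb
  have e3 : (zt D ^ b) ^ 3 * s ^ ((3 * n + 3 * m : ℕ) : ℤ) = (s ^ n) ^ 3 * (y b s) ^ 3 := by
    simp only [hy]
    rw [zpow_natCast]
    ring
  have e4 : cexp (4 * Complex.log (1 - v b s) - ω (s ^ n) - ω (y b s))
      = (1 - v b s) ^ 4 * (cexp (ω (s ^ n)))⁻¹ * (cexp (ω (y b s)))⁻¹ := by
    have hl' : (1 - v b s) ^ 4 = cexp (Complex.log (1 - v b s)) ^ 4 := by rw [hl b hb]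
    rw [hl']
    simp only [← Complex.exp_nat_mul, ← Complex.exp_neg, ← Complex.exp_add]
    congr 1
  rw [e3, e4]
  change ((s ^ n)⁻¹ - (y b s)⁻¹) ^ 4 * _ * _ = ((s ^ n)⁻¹ + g (s ^ n) - ((y b s)⁻¹ + g (y b s))) ^ 4 /
    ((s ^ n)⁻¹ ^ 3 * cexp (ω (s ^ n)) * ((y b s)⁻¹ ^ 3 * cexp (ω (y b s))))
  simp only [hv]
  have n3 := Complex.exp_ne_zero (ω (s ^ n))
  have n4 := Complex.exp_ne_zero (ω (y b s))
  have key : ((s ^ n)⁻¹ - (y b s)⁻¹) *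
      (1 - s ^ n * y b s * ((g (s ^ n) - g (y b s)) / (s ^ n - y b s)))
      = (s ^ n)⁻¹ + g (s ^ n) - ((y b s)⁻¹ + g (y b s)) := by
    generalize g (s ^ n) = A1 at *
    generalize g (y b s) = A2 at *
    generalize y b s = Y at *
    generalize s ^ n = X at *
    clear e2 e3 e4 hl this hmon hEA hlogs hlog hvs hvO hxy hne
    field_simp
    ring
  rw [← key]
  generalize (1 - s ^ n * y b s * ((g (s ^ n) - g (y b s)) / (s ^ n - y b s))) = B
  generalize cexp (ω (s ^ n)) = A3 at *
  generalize cexp (ω (y b s)) = A4 at *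
  generalize y b s = Y at *
  generalize s ^ n = X at *
  clear e2 e3 e4 hl this hmon hEA hlogs hlog hvs hvO hxy hne key
  field_simp

lemma prod_sub_zt {D : ℕ} (hD : 0 < D) (X Y : ℂ) :
    ∏ b ∈ Finset.range D, (X - (zt D ^ b)⁻¹ * Y) = X ^ D - Y ^ D := by
  have hz := (zt_prim hD).inv
  have : NeZero D := ⟨hD.ne'⟩
  rw [hz.pow_sub_pow_eq_prod_sub_mul X Y hD]
  refine Finset.prod_nbij (fun b => (zt D)⁻¹ ^ b) ?_ ?_ ?_ ?_
  · intro b _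
    rw [Polynomial.mem_nthRootsFinset hD, ← pow_mul, mul_comm, pow_mul, hz.pow_eq_one, one_pow]
  · intro b hb b' hb' h
    simp only [Finset.coe_range, Set.mem_Iio] at hb hb'
    exact hz.pow_inj hb hb' h
  · intro ξ hξ
    have h1 : ξ ^ D = 1 := (Polynomial.mem_nthRootsFinset hD (1 : ℂ)).1 (by simpa using hξ)
    obtain ⟨b, hb, rfl⟩ := hz.eq_pow_of_pow_eq_one h1
    exact ⟨b, by simpa using hb, rfl⟩
  · intro b _
    rw [inv_pow]

/-- The `q²`-coefficient of `log (1 - q^|a-d|)`. -/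
noncomputable def pB (a d : ℕ) : ℂ :=
  if d = a + 1 ∨ a = d + 1 then -1 / 2 else if d = a + 2 ∨ a = d + 2 then -1 else 0

lemma LA_one_sub_pow {n k : ℕ} (hn : 0 < n) (hk : 0 < k) :
    LA n (fun s => 1 + -s ^ (n * k)) (if k = 1 then -1 / 2 else if k = 2 then -1 else 0) := by
  rcases (by omega : k = 1 ∨ k = 2 ∨ 3 ≤ k) with rfl | rfl | h
  · have := LA.one_add (f := fun s => -s ^ (n * 1)) (α := -1) (γ := 0) hn (by simp)
    simpa [neg_div] using this
  · have := LA.one_add (f := fun s => -s ^ (n * 2)) (α := 0) (γ := -1) hn (by simp [mul_comm])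
    simpa using this
  · have := LA.one_add (f := fun s => -s ^ (n * k)) (α := 0) (γ := 0) hn (by
      simp only [zero_mul, add_zero, sub_zero]
      refine (isLittleO_pow_pow ?_).neg_left
      nlinarith)
    simpa [show k ≠ 1 by omega, show k ≠ 2 by omega] using this

lemma LA_pole {a d : ℕ} (ha : 0 < a) (hd : 0 < d) (h : a ≠ d) :
    LA (a * d) (fun s => ∏ b ∈ Finset.range d, ((s ^ (a * d))⁻¹ - (zt d ^ b * s ^ (a ^ 2))⁻¹))
      (pB a d) := by
  have hn : 0 < a * d := Nat.mul_pos ha hd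
  have e : ∀ s : ℂ, ∏ b ∈ Finset.range d, ((s ^ (a * d))⁻¹ - (zt d ^ b * s ^ (a ^ 2))⁻¹)
      = (s ^ (a * d * d))⁻¹ - (s ^ (a * d * a))⁻¹ := by
    intro s
    simp only [mul_inv]
    rw [prod_sub_zt hd, inv_pow, inv_pow, ← pow_mul, ← pow_mul]
    congr 3
    ring
  simp only [e]
  rcases lt_or_gt_of_ne h with hlt | hlt
  · obtain ⟨k, rfl⟩ := Nat.exists_eq_add_of_le hlt.le
    have hk : 0 < k := by omega
    have h1 := (LA.monomial (n := a * (a + k)) one_ne_zero (-((a * (a + k) * (a + k) : ℕ) : ℤ))).mul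
      (LA_one_sub_pow hn hk)
    have e2 : (0 : ℂ) + (if k = 1 then -1 / 2 else if k = 2 then -1 else 0) = pB a (a + k) := by
      simp only [pB, zero_add]
      congr 1
      · simp; omega
      · congr 1; simp; omega
    rw [e2] at h1
    refine h1.congr ?_
    filter_upwards [eventually_punctured_ne] with s hs
    rw [_root_.zpow_neg, zpow_natCast, show a * (a + k) * (a + k) = a * (a + k) * a + a * (a + k) * k by ring,
      pow_add]
    have := pow_ne_zero (a * (a + k) * a) hs
    have := pow_ne_zero (a * (a + k) * k) hs
    generalize s ^ (a * (a + k) * a) = A at *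
    generalize s ^ (a * (a + k) * k) = B at *
    field_simp
    ring
  · obtain ⟨k, rfl⟩ := Nat.exists_eq_add_of_le hlt.le
    have hk : 0 < k := by omega
    have h1 := (LA.monomial (n := (d + k) * d) (C := -1) (by norm_num)
      (-(((d + k) * d * (d + k) : ℕ) : ℤ))).mul (LA_one_sub_pow hn hk)
    have e2 : (0 : ℂ) + (if k = 1 then -1 / 2 else if k = 2 then -1 else 0) = pB (d + k) d := by
      simp only [pB, zero_add]
      congr 1
      · simp; omega
      · congr 1; simp; omega
    rw [e2] at h1
    refine h1.congr ?_
    filter_upwards [eventually_punctured_ne] with s hs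
    rw [_root_.zpow_neg, zpow_natCast,
      show (d + k) * d * (d + k) = (d + k) * d * d + (d + k) * d * k by ring, pow_add]
    have := pow_ne_zero ((d + k) * d * d) hs
    have := pow_ne_zero ((d + k) * d * k) hs
    generalize s ^ ((d + k) * d * d) = A at *
    generalize s ^ ((d + k) * d * k) = B at *
    field_simp
    ring

lemma LA_pole_diag {d : ℕ} (hd : 0 < d) :
    LA (d * d) (fun s => ∏ b ∈ (Finset.range d).erase 0,
      ((s ^ (d * d))⁻¹ - (zt d ^ b * s ^ (d ^ 2))⁻¹)) 0 := by
  have h1 := LA.prod (n := d * d) ((Finset.range d).erase 0) (b := fun _ => 0)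
    (F := fun b s => (1 - (zt d ^ b)⁻¹) * s ^ (-((d * d : ℕ) : ℤ))) fun b hb => by
      refine LA.monomial (sub_ne_zero.2 fun h => ?_) _
      have hb' : b ≠ 0 ∧ b < d := by simpa using hb
      have h2 : zt d ^ b = 1 := by rw [eq_comm, inv_eq_one] at h; exact h
      have := Nat.le_of_dvd (by omega) (((zt_prim hd).pow_eq_one_iff_dvd b).1 h2)
      omega
  rw [Finset.sum_const_zero] at h1
  refine h1.congr (.of_forall fun s => Finset.prod_congr rfl fun b _ => ?_)
  rw [_root_.zpow_neg, zpow_natCast, mul_inv, ← pow_two]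
  ring

lemma HasPS.ea_mul {g : ℂ → ℂ} {c : ℕ → ℂ} (hg : HasPS g c) (hc : c 0 = 0) {n : ℕ} (hn : 0 < n) :
    EA n (fun s => s ^ n * g (s ^ n)) (c 1) := by
  have h1 := ((hg.isLittleO hn).isBigO.add
    ((isBigO_refl (fun s : ℂ => s ^ (2 * n)) (𝓝[≠] 0)).const_mul_left (c 2)))
  have h0 : (fun s : ℂ => s ^ n) =o[𝓝[≠] 0] fun _ => (1 : ℂ) :=
    (isLittleO_one_iff ℂ).2 (tendsto_pow_punctured hn)
  refine ⟨0, (h0.mul_isBigO h1).congr (fun s => ?_) fun s => by ring⟩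
  rw [hc]
  ring

lemma HasPS.sec_ea_mul {g : ℂ → ℂ} {c : ℕ → ℂ} (hg : HasPS g c) (hc : c 0 = 0) {a d : ℕ}
    (ha : 0 < a) (hd : 0 < d) :
    EA (a * d) (fun s => ∑ b ∈ Finset.range d, s ^ (a * d) * g (zt d ^ b * s ^ (a ^ 2)))
      (if a = 1 then d * c d else 0) := by
  have hn : 0 < a * d := Nat.mul_pos ha hd
  obtain ⟨H, hH, e1⟩ := hg.section_pow (n := a * d) (m := a ^ 2) (by positivity) hd ha (by ring)
  have h1 := hH.ea_mul (by simp [hc]) hn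
  have e2 : (if a ∣ 1 then (d : ℂ) * c (d * (1 / a)) else 0) = if a = 1 then d * c d else 0 := by
    by_cases h : a = 1
    · simp [h]
    · simp [h]
  rw [e2] at h1
  refine h1.congr ?_
  filter_upwards [eventually_punctured_norm] with s hs
  rw [← e1 s hs, Finset.mul_sum]

lemma LA_one_off {g ω : ℂ → ℂ} {c w : ℕ → ℂ} (hg : HasPS g c) (hω : HasPS ω w) (hc : c 0 = 0)
    (hw : w 0 = 0) {a d : ℕ} (ha : 0 < a) (hd : 0 < d) (h : a ≠ d) :
    LA (a * d) (fun s => ∏ b ∈ Finset.range d,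
      ((s ^ (a * d))⁻¹ + g (s ^ (a * d)) -
        ((zt d ^ b * s ^ (a ^ 2))⁻¹ + g (zt d ^ b * s ^ (a ^ 2)))) ^ 4 /
        (((s ^ (a * d))⁻¹ ^ 3 * cexp (ω (s ^ (a * d)))) *
          ((zt d ^ b * s ^ (a ^ 2))⁻¹ ^ 3 * cexp (ω (zt d ^ b * s ^ (a ^ 2))))))
      (4 * (pB a d - if a = 1 then d * c d else 0) - (d * w 2 + sec a d w)) := by
  have hn : 0 < a * d := Nat.mul_pos ha hd
  have := LA_diff hg hω hc hw hn (m := a ^ 2) (by positivity) (Finset.range d) (LA_pole ha hd h)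
    (hω.sec_ea hw hn (by positivity) hd ha (by ring)) (hg.sec_ea_mul hc ha hd)
  simpa using this

lemma LA_one_diag {g ω : ℂ → ℂ} {c w : ℕ → ℂ} (hg : HasPS g c) (hω : HasPS ω w) (hc : c 0 = 0)
    (hw : w 0 = 0) {d : ℕ} (hd : 0 < d) :
    LA (d * d) (fun s => ∏ b ∈ (Finset.range d).erase 0,
      ((s ^ (d * d))⁻¹ + g (s ^ (d * d)) -
        ((zt d ^ b * s ^ (d ^ 2))⁻¹ + g (zt d ^ b * s ^ (d ^ 2)))) ^ 4 /
        (((s ^ (d * d))⁻¹ ^ 3 * cexp (ω (s ^ (d * d)))) *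
          ((zt d ^ b * s ^ (d ^ 2))⁻¹ ^ 3 * cexp (ω (zt d ^ b * s ^ (d ^ 2))))))
      (4 * (c 1 - if d = 1 then d * c d else 0) - (d * w 2 + sec d d w - 2 * w 2)) := by
  have hn : 0 < d * d := Nat.mul_pos hd hd
  have h0 : 0 ∈ Finset.range d := by simpa using hd
  have h1 : EA (d * d) (fun s => ∑ b ∈ (Finset.range d).erase 0, ω (zt d ^ b * s ^ (d ^ 2)))
      (sec d d w - w 2) := by
    refine ((hω.sec_ea hw hn (m := d ^ 2) (by positivity) hd hd (by ring)).sub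
      (hω.ea hw hn)).congr (.of_forall fun s => ?_)
    rw [← Finset.add_sum_erase _ _ h0]
    simp [pow_two]
  have h2 : EA (d * d) (fun s => ∑ b ∈ (Finset.range d).erase 0,
      s ^ (d * d) * g (zt d ^ b * s ^ (d ^ 2))) ((if d = 1 then d * c d else 0) - c 1) := by
    refine ((hg.sec_ea_mul hc hd hd).sub (hg.ea_mul hc hn)).congr (.of_forall fun s => ?_)
    rw [← Finset.add_sum_erase _ _ h0]
    simp [pow_two]
  have := LA_diff hg hω hc hw hn (m := d ^ 2) (by positivity) _ (LA_pole_diag hd) h1 h2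
  have e : 4 * (0 - ((if d = 1 then (d : ℂ) * c d else 0) - c 1)) -
      (((Finset.range d).erase 0).card * w 2 + (sec d d w - w 2)) =
      4 * (c 1 - if d = 1 then d * c d else 0) - (d * w 2 + sec d d w - 2 * w 2) := by
    rw [Finset.card_erase_of_mem h0, Finset.card_range, Nat.cast_sub hd]
    push_cast
    ring
  rwa [e] at this

/-- `j₆` as a function of `q`. -/
noncomputable def tq (x : ℂ) : ℂ := x⁻¹ * cexp (logU (-3) 3 9 (-9) x) - 3

/-- `Om` as a function of `q`. -/
noncomputable def oq (x : ℂ) : ℂ := x⁻¹ ^ 3 * cexp (logU (-2) 10 14 (-22) x)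

lemma tt_eq_tq {z : ℂ} (hz : 0 < z.im) : tt z = tq (qc z) := tt_eq hz
lemma Om_eq_oq {z : ℂ} (hz : 0 < z.im) : Om z = oq (qc z) := Om_eq hz

lemma tq_add {x : ℂ} (h0 : x ≠ 0) (hx : ‖x‖ < 1) :
    tq x + 3 = x⁻¹ * cexp (logU (-3) 3 9 (-9) x) ∧ tq x + 4 = x⁻¹ * cexp (logU (-4) 8 4 (-8) x) ∧
      tq x - 5 = x⁻¹ * cexp (logU 5 (-1) 1 (-5) x) := by
  obtain ⟨z, hz, rfl⟩ := exists_qc_eq h0 hx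
  rw [← tt_eq_tq hz, ← u3_eq hz, ← u2_eq, ← u6_eq hz]
  exact u_eq_exp hz

/-- The coefficients of `log (q (j₆ - C_e))`. -/
noncomputable def ue (e : ℕ) : ℕ → ℂ :=
  if e = 2 then logUc (-3) 3 9 (-9) else if e = 3 then logUc (-4) 8 4 (-8) else logUc 5 (-1) 1 (-5)

/-- The coefficients of `log (q³ Om)`. -/
noncomputable def om : ℕ → ℂ := logUc (-2) 10 14 (-22)

/-- The contribution of the matrices with parameters `e, a, d` to the second log-coefficient. -/
noncomputable def beta (c : ℕ → ℂ) (e a d : ℕ) : ℂ :=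
  if e = 1 then
    4 * ((if a = d then c 1 else pB a d) - if a = 1 then d * c d else 0) -
      (d * om 2 + sec a d om - if a = d then 2 * om 2 else 0)
  else 4 * (((e * d : ℕ) : ℂ) * ue e 2 + sec (e * a) (e * d) (ue e)) -
    (((e * d : ℕ) : ℂ) * om 2 + sec (e * a) (e * d) om)

/-- The range of the upper right entry among the non-scalar representatives. -/
def bSet (e : ℕ) (p : ℕ × ℕ) : Finset ℕ :=
  if e = 1 ∧ p.1 = p.2 then (Finset.range p.2).erase 0 else Finset.range (e * p.2)

/-- The factor of `Psi` as a function of `s = q^{1/n}`. -/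
noncomputable def phi (n e a d b : ℕ) (s : ℂ) : ℂ :=
  fac e (tq (s ^ n)) (tq (zt (e * d) ^ b * s ^ (e * a ^ 2))) /
    (oq (s ^ n) * oq (zt (e * d) ^ b * s ^ (e * a ^ 2)))

lemma logUc_zero (r₁ r₂ r₃ r₆ : ℂ) : logUc r₁ r₂ r₃ r₆ 0 = 0 := by simp [logUc]

lemma LA_phi {g : ℂ → ℂ} {c : ℕ → ℂ} (hg : HasPS g c) (hc : c 0 = 0)
    (hgt : ∀ x : ℂ, x ≠ 0 → ‖x‖ < 1 → tq x = x⁻¹ + g x) {n e a d : ℕ} (hn : 0 < n) (he : e ∈ eSet)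
    (h : e * (a * d) = n) :
    LA n (fun s => ∏ b ∈ bSet e (a, d), phi n e a d b s) (beta c e a d) := by
  have hpos := eSet_pos he
  have had : 0 < a * d := Nat.pos_of_ne_zero fun h0 => by rw [h0] at h; omega
  have ha : 0 < a := Nat.pos_of_mul_pos_right had
  have hd : 0 < d := Nat.pos_of_mul_pos_left had
  have hω := hasPS_logU (-2) 10 14 (-22)
  by_cases he1 : e = 1
  · subst he1
    rw [one_mul] at h
    have h1 : ∀ᶠ s : ℂ in 𝓝[≠] 0, ∀ b, phi n 1 a d b s = ((s ^ (a * d))⁻¹ + g (s ^ (a * d)) -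
        ((zt d ^ b * s ^ (a ^ 2))⁻¹ + g (zt d ^ b * s ^ (a ^ 2)))) ^ 4 /
        (((s ^ (a * d))⁻¹ ^ 3 * cexp (logU (-2) 10 14 (-22) (s ^ (a * d)))) *
          ((zt d ^ b * s ^ (a ^ 2))⁻¹ ^ 3 * cexp (logU (-2) 10 14 (-22) (zt d ^ b * s ^ (a ^ 2))))) := by
      filter_upwards [eventually_punctured_ne, eventually_punctured_norm] with s hs hs' b
      rw [phi, one_mul, one_mul, ← h]
      have e1 := hgt _ (pow_ne_zero (a * d) hs) (norm_pow_lt_one hs' had.ne')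
      have e2 := hgt (zt d ^ b * s ^ a ^ 2) (mul_ne_zero (zt_pow_ne b) (pow_ne_zero _ hs))
        (by rw [norm_mul, norm_zt_pow hd, one_mul]; exact norm_pow_lt_one hs' (by positivity))
      simp only [fac, oq, e1, e2, show (1 : ℕ) ≠ 2 by norm_num, show (1 : ℕ) ≠ 3 by norm_num,
        show (1 : ℕ) ≠ 6 by norm_num, if_false]
    by_cases had' : a = d
    · subst had'
      have h2 := LA_one_diag hg hω hc (logUc_zero _ _ _ _) ha
      rw [← h]
      have e3 : beta c 1 a a = (4 * (c 1 - if a = 1 then a * c a else 0) -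
        (a * logUc (-2) 10 14 (-22) 2 + sec a a (logUc (-2) 10 14 (-22)) -
          2 * logUc (-2) 10 14 (-22) 2)) := by
        simp [beta, om]
      rw [e3]
      refine h2.congr ?_
      filter_upwards [h1] with s hs
      rw [← h] at hs
      simp only [bSet, and_self, if_true]
      exact Finset.prod_congr rfl fun b _ => (hs b).symm
    · have h2 := LA_one_off hg hω hc (logUc_zero _ _ _ _) ha hd had'
      rw [← h]
      have e3 : beta c 1 a d = (4 * (pB a d - if a = 1 then d * c d else 0) -
        (d * logUc (-2) 10 14 (-22) 2 + sec a d (logUc (-2) 10 14 (-22)))) := by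
        simp [beta, om, had']
      rw [e3]
      refine h2.congr ?_
      filter_upwards [h1] with s hs
      rw [← h] at hs
      simp only [bSet, had', and_false, if_false, one_mul]
      exact Finset.prod_congr rfl fun b _ => (hs b).symm
  · have hD : 0 < e * d := Nat.mul_pos hpos hd
    have key : ∀ {r₁ r₂ r₃ r₆ K : ℂ}, K ≠ 0 → ue e = logUc r₁ r₂ r₃ r₆ →
        (∀ x y : ℂ, x ≠ 0 → ‖x‖ < 1 → y ≠ 0 → ‖y‖ < 1 → fac e (tq x) (tq y) =
          ((x⁻¹ * cexp (logU r₁ r₂ r₃ r₆ x)) * (y⁻¹ * cexp (logU r₁ r₂ r₃ r₆ y)) - K) ^ 4 / K ^ 2) →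
        LA n (fun s => ∏ b ∈ bSet e (a, d), phi n e a d b s) (beta c e a d) := by
      intro r₁ r₂ r₃ r₆ K hK hue hfac
      have h2 := LA_fac (hasPS_logU r₁ r₂ r₃ r₆) hω (logUc_zero _ _ _ _) (logUc_zero _ _ _ _) hK hn
        (m := e * a ^ 2) (D := e * d) (κ := e * a) (by positivity) hD (by nlinarith [show 2 ≤ e by omega])
        (by rw [← h]; ring)
      have e3 : beta c e a d = _ := if_neg he1
      rw [e3, hue]
      refine h2.congr ?_
      filter_upwards [eventually_punctured_ne, eventually_punctured_norm] with s hs hs'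
      simp only [bSet, he1, false_and, if_false]
      refine Finset.prod_congr rfl fun b _ => ?_
      rw [phi, hfac _ _ (pow_ne_zero _ hs) (norm_pow_lt_one hs' hn.ne')
        (mul_ne_zero (zt_pow_ne b) (pow_ne_zero _ hs))
        (by rw [norm_mul, norm_zt_pow hD, one_mul]; exact norm_pow_lt_one hs' (by positivity))]
      rfl
    rcases mem_eSet.1 he with rfl | rfl | rfl | rfl
    · exact absurd rfl he1
    · refine key (K := -8) (by norm_num) (by simp [ue]; rfl) fun x y hx hx' hy hy' => ?_
      rw [← (tq_add hx hx').1, ← (tq_add hy hy').1]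
      simp only [fac, if_true]
      norm_num
    · refine key (K := 9) (by norm_num) (by simp [ue]; rfl) fun x y hx hx' hy hy' => ?_
      rw [← (tq_add hx hx').2.1, ← (tq_add hy hy').2.1]
      simp [fac]
    · refine key (K := 72) (by norm_num) (by simp [ue]; rfl) fun x y hx hx' hy hy' => ?_
      rw [← (tq_add hx hx').2.2, ← (tq_add hy hy').2.2]
      simp [fac]

/-- Pairs `(a, d)` with `e a d = n`. -/
def pairs (n e : ℕ) : Finset (ℕ × ℕ) := if e ∣ n then (n / e).divisorsAntidiagonal else ∅

lemma mem_pairs {n e : ℕ} (hn : 0 < n) (he : e ∈ eSet) {p : ℕ × ℕ} :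
    p ∈ pairs n e ↔ e * (p.1 * p.2) = n := by
  have hpos := eSet_pos he
  unfold pairs
  by_cases h : e ∣ n
  · obtain ⟨m, rfl⟩ := h
    have : m ≠ 0 := by rintro rfl; simp at hn
    simp only [dvd_mul_right, if_true, Nat.mem_divisorsAntidiagonal, Nat.mul_div_cancel_left _ hpos]
    rw [Nat.mul_right_inj hpos.ne']
    exact and_iff_left this
  · simp only [h, if_false, Finset.notMem_empty, false_iff]
    rintro rfl
    exact h (dvd_mul_right _ _)

lemma idxN_eq {n : ℕ} (hn : 0 < n) :
    idxN n = eSet.sigma fun e => (pairs n e).sigma fun p => bSet e p := by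
  ext ⟨e, ⟨a, d⟩, b⟩
  rw [mem_idxN, mem_idx hn]
  simp only [Finset.mem_sigma]
  constructor
  · rintro ⟨⟨he, h, hb⟩, hs⟩
    refine ⟨he, (mem_pairs hn he).2 h, ?_⟩
    unfold bSet
    split_ifs with h1
    · simp only at h1
      obtain ⟨rfl, rfl⟩ := h1
      refine Finset.mem_erase.2 ⟨?_, by simpa using hb⟩
      rintro rfl
      refine hs ⟨a, ?_⟩
      ext i j
      fin_cases i <;> fin_cases j <;> simp [rep]
    · simpa using hb
  · rintro ⟨he, h, hb⟩
    have h' := (mem_pairs hn he).1 h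
    have ha : a ≠ 0 := by rintro rfl; simp at h'; omega
    refine ⟨⟨he, h', ?_⟩, ?_⟩
    · unfold bSet at hb
      split_ifs at hb with h1
      · simp only at h1
        obtain ⟨rfl, rfl⟩ := h1
        simpa using (Finset.mem_erase.1 hb).2
      · simpa using hb
    · rintro ⟨k, hk⟩
      have h00 := congrFun (congrFun hk 0) 0
      have h01 := congrFun (congrFun hk 0) 1
      have h10 := congrFun (congrFun hk 1) 0
      have h11 := congrFun (congrFun hk 1) 1
      rcases mem_eSet.1 he with rfl | rfl | rfl | rfl
      · simp [rep] at h00 h01 h11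
        have had : a = d := by omega
        subst had
        subst h01
        simp [bSet] at hb
      · simp [rep, ha] at h10
      · simp [rep, ha] at h10
      · simp [rep, ha] at h10

lemma qc_upp {e a d b n : ℕ} (he : 0 < e) (hd : 0 < d) (h : e * (a * d) = n) (w : ℂ) :
    qc (mact (upp e a d b) (n * w)) = zt (e * d) ^ b * qc w ^ (e * a ^ 2) := by
  have h1 : (e : ℂ) ≠ 0 := by exact_mod_cast he.ne'
  have h2 : (d : ℂ) ≠ 0 := by exact_mod_cast hd.ne'
  have e1 : mact (upp e a d b) (n * w) = ((e * a ^ 2 : ℕ) : ℂ) * w + b / ((e * d : ℕ) : ℂ) := by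
    rw [upp, mact_of, ← h]
    push_cast
    field_simp
    ring
  rw [e1, qc_add, qc_natCast_mul, mul_comm]
  congr 1
  rw [qc, zt, ← Complex.exp_nat_mul]
  congr 1
  ring

lemma Psi_eq_prod {n : ℕ} (hn : 0 < n) {w : ℂ} (hw : 0 < w.im) :
    Psi n (n * w) = ∏ e ∈ eSet, ∏ p ∈ pairs n e, ∏ b ∈ bSet e p, phi n e p.1 p.2 b (qc w) := by
  have hz : 0 < ((n : ℂ) * w).im := by
    have : ((n : ℂ) * w).im = n * w.im := by simp
    rw [this]
    have : (0 : ℝ) < n := by exact_mod_cast hn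
    positivity
  have hmem : ∀ i ∈ idxN n, i ∈ idx n := fun i hi => (mem_idxN.1 hi).1
  rw [Psi]
  have : ∀ i ∈ idxN n, D4 (n * w) (mact (rep i) (n * w)) = phi n i.1 i.2.1.1 i.2.1.2 i.2.2 (qc w) := by
    rintro ⟨e, ⟨a, d⟩, b⟩ hi
    have hi := hmem _ hi
    obtain ⟨he, h, hb⟩ := (mem_idx hn).1 hi
    obtain ⟨m1, m2⟩ := mact_rep hn hi hz
    obtain ⟨p1, p2, p3⟩ := idx_pos hn hi
    rw [m1, D4_right_W he hz m2, tt_eq_tq hz, tt_eq_tq m2, Om_eq_oq hz, Om_eq_oq m2, qc_upp p1 p3 h,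
      qc_natCast_mul]
    rfl
  rw [Finset.prod_congr rfl this, idxN_eq hn, Finset.prod_sigma]
  refine Finset.prod_congr rfl fun e _ => ?_
  rw [Finset.prod_sigma]

lemma LA_Psi {g : ℂ → ℂ} {c : ℕ → ℂ} (hg : HasPS g c) (hc : c 0 = 0)
    (hgt : ∀ x : ℂ, x ≠ 0 → ‖x‖ < 1 → tq x = x⁻¹ + g x) {n : ℕ} (hn : 0 < n) :
    LA n (fun s => ∏ e ∈ eSet, ∏ p ∈ pairs n e, ∏ b ∈ bSet e p, phi n e p.1 p.2 b s)
      (∑ e ∈ eSet, ∑ p ∈ pairs n e, beta c e p.1 p.2) :=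
  LA.prod _ fun _ he => LA.prod _ fun _ hp => LA_phi hg hc hgt hn he ((mem_pairs hn he).1 hp)

lemma exists_hasPS_of_hasQExp {f : ℂ → ℂ} {a : ℤ → ℂ} {n₀ : ℤ} (h : HasQExp f a n₀) :
    ∃ F : ℂ → ℂ, HasPS F (fun m => a (n₀ + m)) ∧
      ∀ z : ℂ, 0 < z.im → f z = qc z ^ n₀ * F (qc z) := by
  have key : ∀ z : ℂ, 0 < z.im →
      HasSum (fun m : ℕ => a (n₀ + m) * qc z ^ m) (qc z ^ (-n₀) * f z) := by
    intro z hz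
    refine ((h.2 z hz).mul_left (qc z ^ (-n₀))).congr_fun ?_ |> fun h => h
    intro m
    rw [mul_left_comm, ← zpow_add₀ (qc_ne_zero z), neg_add_cancel_left, zpow_natCast]
  refine ⟨fun x => ∑' m : ℕ, a (n₀ + m) * x ^ m, fun x hx => ?_, fun z hz => ?_⟩
  · rcases eq_or_ne x 0 with rfl | h0
    · refine (summable_of_ne_finset_zero (s := {0}) ?_).hasSum
      intro b hb
      simp at hb
      simp [hb]
    · obtain ⟨z, hz, rfl⟩ := exists_qc_eq h0 hx
      exact (key z hz).summable.hasSum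
  · simp only
    rw [(key z hz).tsum_eq, ← mul_assoc, ← zpow_add₀ (qc_ne_zero z), add_neg_cancel, zpow_zero, one_mul]

lemma tq_expansion {c : ℤ → ℂ} (hc : HasQExp (jn 6) c (-1)) :
    c (-1) = 1 ∧ c 0 = 0 ∧ c 1 = 6 ∧ ∃ g : ℂ → ℂ, HasPS g (fun k => c k) ∧
      ∀ x : ℂ, x ≠ 0 → ‖x‖ < 1 → tq x = x⁻¹ + g x := by
  obtain ⟨F, hF, hFz⟩ := exists_hasPS_of_hasQExp hc
  have hU := hasPS_logU (-3) 3 9 (-9)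
  have h1 : ∀ x : ℂ, x ≠ 0 → ‖x‖ < 1 → F x = cexp (logU (-3) 3 9 (-9) x) - 3 * x := by
    intro x h0 hx
    obtain ⟨z, hz, rfl⟩ := exists_qc_eq h0 hx
    have := hFz z hz
    rw [jn_six, ← tt, tt_eq hz, _root_.zpow_neg_one] at this
    have hq := qc_ne_zero z
    generalize cexp (logU (-3) 3 9 (-9) (qc z)) = A at *
    generalize F (qc z) = B at *
    field_simp at this
    linear_combination -this
  have hcont : Filter.Tendsto (fun x => cexp (logU (-3) 3 9 (-9) x) - 3 * x) (𝓝[≠] 0) (𝓝 1) := by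
    have h2 := (Complex.continuous_exp.tendsto _).comp hU.continuousAt_zero.tendsto
    have h3 : Filter.Tendsto (fun x : ℂ => 3 * x) (𝓝 0) (𝓝 (3 * 0)) :=
      (continuous_const.mul continuous_id).tendsto 0
    have := h2.sub h3
    rw [logU_zero, Complex.exp_zero, mul_zero, sub_zero] at this
    exact this.mono_left nhdsWithin_le_nhds
  have hev : ∀ᶠ x in 𝓝[≠] 0, F x = cexp (logU (-3) 3 9 (-9) x) - 3 * x := by
    filter_upwards [eventually_punctured_ne, eventually_punctured_norm] with x h0 hx using h1 x h0 hx
  have hm1 : c (-1) = 1 := by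
    have h2 := hF.continuousAt_zero.tendsto.mono_left (nhdsWithin_le_nhds (s := {0}ᶜ))
    rw [hF.apply_zero] at h2
    have := tendsto_nhds_unique h2 (hcont.congr' (hev.mono fun x h => h.symm))
    simpa using this
  have hev0 : ∀ᶠ x in 𝓝 0, F x = cexp (logU (-3) 3 9 (-9) x) - 3 * x := by
    filter_upwards [Metric.ball_mem_nhds (0 : ℂ) one_pos] with x hx
    rcases eq_or_ne x 0 with rfl | h0
    · rw [hF.apply_zero, logU_zero]
      simp [hm1]
    · exact h1 x h0 (by simpa using hx)
  have h0 : c 0 = 0 := by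
    have h2 := hF.hasDerivAt_zero
    have h3 := (hU.hasDerivAt_zero.cexp.sub ((hasDerivAt_id (0 : ℂ)).const_mul 3))
    have h4 := h2.unique (h3.congr_of_eventuallyEq hev0)
    rw [logUc_one, logU_zero] at h4
    norm_num at h4
    exact h4
  have hc1 : c 1 = 6 := by
    have h2 := hF.isLittleO (n := 1) one_pos
    have h3 : (fun s : ℂ => (3 * s + (F s - 1)) - (3 * s ^ 1 + c 1 * s ^ (2 * 1))) =o[𝓝[≠] 0]
        fun s => s ^ (2 * 1) := by
      refine h2.congr_left fun s => ?_
      have e0 : c (-1 + ((0 : ℕ) : ℤ)) = 1 := by simpa using hm1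
      have e1 : c (-1 + ((1 : ℕ) : ℤ)) = 0 := by simpa using h0
      have e2 : c (-1 + ((2 : ℕ) : ℤ)) = c 1 := by norm_num
      rw [e0, e1, e2]
      simp only [pow_one]
      ring
    have h4 := LA.one_add one_pos h3
    have h5 := LA.of_exp (hU.ea (logUc_zero _ _ _ _) (n := 1) one_pos)
    have h6 := h4.unique one_pos (h5.congr (by
      filter_upwards [hev] with x hx
      rw [hx, pow_one]
      ring))
    rw [logUc_two] at h6
    linear_combination h6
  refine ⟨hm1, h0, hc1, ?_⟩
  obtain ⟨g, hg, hFg⟩ := hF.exists_shift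
  refine ⟨g, ?_, fun x hx0 hx => ?_⟩
  · have : (fun k : ℕ => c (-1 + ((k + 1 : ℕ) : ℤ))) = fun k : ℕ => c k := by
      funext k
      congr 1
      push_cast
      ring
    rw [← this]
    exact hg
  · have h2 := h1 x hx0 hx
    rw [hFg x hx] at h2
    have e0 : c (-1 + ((0 : ℕ) : ℤ)) = 1 := by simpa using hm1
    rw [e0] at h2
    rw [tq, show cexp (logU (-3) 3 9 (-9) x) = 1 + x * g x + 3 * x by linear_combination -h2]
    generalize g x = A
    field_simp
    ring

lemma LA_js_sub {J : ℕ → ℂ} (hJ : HasPS jd J) (X : ℂ) {n : ℕ} (hn : 0 < n) :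
    LA n (fun s => (s ^ n)⁻¹ * jd (s ^ n) - X) (J 2 - (J 1 - X) ^ 2 / 2) := by
  have hJ0 : J 0 = 1 := by rw [← hJ.apply_zero, jd_zero]
  have h1 := LA.one_add (f := fun s => jd (s ^ n) - 1 - X * s ^ n) (α := J 1 - X) (γ := J 2) hn (by
    refine (hJ.isLittleO hn).congr_left fun s => ?_
    rw [hJ0]
    ring)
  have h2 := (LA.monomial (n := n) one_ne_zero (-(n : ℤ))).mul h1
  rw [zero_add] at h2
  refine h2.congr ?_
  filter_upwards [eventually_punctured_ne] with s hs
  have := pow_ne_zero n hs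
  rw [_root_.zpow_neg, zpow_natCast]
  generalize jd (s ^ n) = A
  field_simp
  ring

lemma tendsto_js : Filter.Tendsto (fun s : ℂ => ‖s⁻¹ * jd s‖) (𝓝[≠] 0) Filter.atTop := by
  have h1 : Filter.Tendsto jd (𝓝[≠] 0) (𝓝 1) := by
    have := (differentiableOn_jd.differentiableAt
      (Metric.ball_mem_nhds (0 : ℂ) one_pos)).continuousAt.tendsto
    rw [jd_zero] at this
    exact this.mono_left nhdsWithin_le_nhds
  simp only [norm_mul]
  refine Filter.Tendsto.atTop_mul_pos (C := ‖(1 : ℂ)‖) (by simp) ?_ h1.norm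
  exact tendsto_norm_cobounded_atTop.comp Filter.tendsto_inv₀_nhdsNE_zero

lemma eval_P {J : ℕ → ℂ} (hJ : HasPS jd J) {P : Polynomial ℂ} {e : ℤ → ℂ}
    (hP : HasQExp (fun z => P.eval (jnStar 6 z)) e (-2)) (he2 : e (-2) = 1) (he1 : e (-1) = 0)
    (he0 : e 0 = 0) (X : ℂ) : P.eval X = -2 * (J 2 - (J 1 - X) ^ 2 / 2) := by
  have hJ0 : J 0 = 1 := by rw [← hJ.apply_zero, jd_zero]
  obtain ⟨F, hF, hFz⟩ := exists_hasPS_of_hasQExp hP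
  obtain ⟨r, hr, eF⟩ := hF.exists_taylor
  obtain ⟨ρ, hρ, eJ⟩ := hJ.exists_taylor
  set Q : Polynomial ℂ := P - ((Polynomial.X - Polynomial.C (J 1)) ^ 2 - Polynomial.C (2 * J 2)) with hQ
  have hlim : Filter.Tendsto (fun s : ℂ => Q.eval (s⁻¹ * jd s)) (𝓝[≠] 0) (𝓝 0) := by
    have hs0 : Filter.Tendsto (fun s : ℂ => s) (𝓝[≠] 0) (𝓝 0) := nhdsWithin_le_nhds
    have hr0 := hr.continuousAt_zero.tendsto.mono_left (nhdsWithin_le_nhds (s := {0}ᶜ))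
    have hρ0 := hρ.continuousAt_zero.tendsto.mono_left (nhdsWithin_le_nhds (s := {0}ᶜ))
    have h2 := (hs0.mul hr0).sub (((hs0.mul hρ0).const_mul 2).add
      (((hs0.const_mul (J 2)).add ((hs0.pow 2).mul hρ0)).pow 2))
    simp only [zero_mul, mul_zero, add_zero, ne_eq, OfNat.ofNat_ne_zero, not_false_eq_true,
      zero_pow, sub_zero] at h2
    refine h2.congr' ?_
    filter_upwards [eventually_punctured_ne, eventually_punctured_norm] with s h0 hs
    obtain ⟨z, hz, rfl⟩ := exists_qc_eq h0 hs
    have h3 := hFz z hz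
    rw [jnStar_eq_js hz, js_eq hz, eF _ hs] at h3
    norm_num [he2, he1, he0] at h3
    simp only [hQ, Polynomial.eval_sub, Polynomial.eval_pow, Polynomial.eval_X, Polynomial.eval_C]
    rw [h3, eJ _ hs, hJ0]
    generalize r (qc z) = A
    generalize ρ (qc z) = B
    generalize qc z = q at *

    field_simp
    ring
  have hdeg : ¬ 0 < Q.degree := fun h => by
    have h1 := Polynomial.tendsto_norm_atTop Q h tendsto_js
    exact not_tendsto_nhds_of_tendsto_atTop h1 _ hlim.norm
  have hQC := Polynomial.eq_C_of_degree_le_zero (not_lt.1 hdeg)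
  have hQ0 : Q = 0 := by
    rw [hQC] at hlim
    simp only [Polynomial.eval_C] at hlim
    rw [hQC, tendsto_nhds_unique tendsto_const_nhds hlim, Polynomial.C_0]
  have h3 : P = (Polynomial.X - Polynomial.C (J 1)) ^ 2 - Polynomial.C (2 * J 2) := sub_eq_zero.1 hQ0
  rw [h3]
  simp
  ring

lemma sum_roots {c : ℤ → ℂ} (hc : HasQExp (jn 6) c (-1)) {P : Polynomial ℂ} {e : ℤ → ℂ}
    (hP : HasQExp (fun z => P.eval (jnStar 6 z)) e (-2)) (he2 : e (-2) = 1) (he1 : e (-1) = 0)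
    (he0 : e 0 = 0) {n : ℕ} (hn : 0 < n) {p : Polynomial ℂ}
    (hp : ∀ z : ℂ, 0 < z.im → Psi n z = p.eval (js z)) : p ≠ 0 ∧
    (p.roots.map fun X => P.eval X).sum =
      -2 * ∑ e ∈ eSet, ∑ q ∈ pairs n e, beta (fun k => c k) e q.1 q.2 := by
  obtain ⟨-, hc0, -, g, hg, hgt⟩ := tq_expansion hc
  obtain ⟨J, hJ⟩ := hasPS_of_differentiableOn differentiableOn_jd
  have hΨ := LA_Psi hg (by simpa using hc0) hgt hn
  have hev : ∀ᶠ s : ℂ in 𝓝[≠] 0,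
      (∏ e ∈ eSet, ∏ q ∈ pairs n e, ∏ b ∈ bSet e q, phi n e q.1 q.2 b s)
        = p.eval ((s ^ n)⁻¹ * jd (s ^ n)) := by
    filter_upwards [eventually_punctured_ne, eventually_punctured_norm] with s h0 hs
    obtain ⟨w, hw, rfl⟩ := exists_qc_eq h0 hs
    have hz : 0 < ((n : ℂ) * w).im := by
      have : ((n : ℂ) * w).im = n * w.im := by simp
      rw [this]
      have : (0 : ℝ) < n := by exact_mod_cast hn
      positivity
    rw [← Psi_eq_prod hn hw, hp _ hz, js_eq hz, qc_natCast_mul]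
  have hp0 : p ≠ 0 := by
    rintro rfl
    obtain ⟨s, h1, h2⟩ := (hΨ.eventually_ne.and hev).exists
    rw [h2] at h1
    simp at h1
  refine ⟨hp0, ?_⟩
  have hroots : ∀ S : Multiset ℂ, LA n (fun s => (S.map fun X => (s ^ n)⁻¹ * jd (s ^ n) - X).prod)
      (S.map fun X => J 2 - (J 1 - X) ^ 2 / 2).sum := by
    intro S
    induction S using Multiset.induction_on with
    | empty => simpa using LA.one
    | cons X S ih => simpa using (LA_js_sub hJ X hn).mul ih
  have hlead : LA n (fun s => p.leadingCoeff * s ^ (0 : ℤ)) 0 :=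
    LA.monomial (Polynomial.leadingCoeff_ne_zero.2 hp0) 0
  have h1 := hlead.mul (hroots p.roots)
  rw [zero_add] at h1
  have h2 := h1.unique hn (hΨ.congr (by
    filter_upwards [hev] with s hs
    rw [hs]
    conv_lhs => rw [(IsAlgClosed.splits p).eq_prod_roots]
    rw [Polynomial.eval_mul, Polynomial.eval_C, Polynomial.eval_multiset_prod]
    simp))
  rw [← h2, ← Multiset.sum_map_mul_left]
  simp only [eval_P hJ hP he2 he1 he0]

end Asymptotics

lemma sig_two_pow_mul (k u : ℕ) (hu : Odd u) : sig (2 ^ k * u) = (2 ^ (k + 1) - 1) * sig u := by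
  have h : Nat.Coprime (2 ^ k) u := (Nat.coprime_two_left.2 hu).pow_left k
  have h1 : ∀ m : ℕ, sig m = ((ArithmeticFunction.sigma 1 m : ℕ) : ℂ) := fun m => by
    simp [sig, ArithmeticFunction.sigma_one_apply]
  rw [h1, h1, ArithmeticFunction.isMultiplicative_sigma.map_mul_of_coprime h, Nat.cast_mul,
    ArithmeticFunction.sigma_one_apply_prime_pow Nat.prime_two]
  congr 1
  push_cast
  rw [geom_sum_eq (by norm_num)]
  norm_num

lemma sig_two_mul (m : ℕ) : sig (2 * m) = 3 * sig m - 2 * sigd 2 m := by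
  rcases Nat.eq_zero_or_pos m with rfl | hm
  · simp [sig, sigd]
  obtain ⟨k, u, hu, rfl⟩ := Nat.exists_eq_two_pow_mul_odd hm.ne'
  rw [← mul_assoc, ← pow_succ', sig_two_pow_mul _ _ hu, sig_two_pow_mul _ _ hu, sigd]
  rcases k with - | k
  · rw [if_neg]
    · norm_num
    · simpa [← even_iff_two_dvd] using hu
  · rw [if_pos (Dvd.dvd.mul_right (dvd_pow_self 2 (by omega)) u),
      show 2 ^ (k + 1) * u / 2 = 2 ^ k * u by rw [pow_succ', mul_assoc]; simp,
      sig_two_pow_mul _ _ hu]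
    ring

lemma sigd_two_mul (m : ℕ) : sigd 2 (2 * m) = sig m := by simp [sigd]

lemma sigd_six_two_mul (m : ℕ) : sigd 6 (2 * m) = sigd 3 m := by
  have h : 6 ∣ 2 * m ↔ 3 ∣ m := by omega
  simp only [sigd, h]
  rw [show 2 * m / 6 = m / 3 by omega]

lemma sigd_three_two_mul (m : ℕ) : sigd 3 (2 * m) = 3 * sigd 3 m - 2 * sigd 6 m := by
  by_cases h : 3 ∣ m
  · obtain ⟨k, rfl⟩ := h
    have h6 : sigd 6 (3 * k) = sigd 2 k := by
      have h : 6 ∣ 3 * k ↔ 2 ∣ k := by omega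
      simp only [sigd, h]
      rw [show 3 * k / 6 = k / 2 by omega]
    rw [h6]
    have := sig_two_mul k
    simp only [sigd] at this ⊢
    rw [if_pos (by omega), if_pos (by omega), show 2 * (3 * k) / 3 = 2 * k by omega,
      show 3 * k / 3 = k by omega]
    exact this
  · simp only [sigd]
    rw [if_neg (by omega), if_neg h, if_neg (by omega)]
    ring

lemma natCast_mul_logUc {k : ℕ} (hk : 0 < k) (r₁ r₂ r₃ r₆ : ℂ) : (k : ℂ) * logUc r₁ r₂ r₃ r₆ k =
    -(r₁ * sig k + 2 * r₂ * sigd 2 k + 3 * r₃ * sigd 3 k + 6 * r₆ * sigd 6 k) := by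
  have : (k : ℂ) ≠ 0 := by exact_mod_cast hk.ne'
  rw [logUc]
  field_simp

lemma sum_pairs_snd {n : ℕ} (e : ℕ) : ∑ p ∈ pairs n e, (p.2 : ℂ) = sigd e n := by
  rw [pairs, sigd]
  split_ifs
  · rw [Nat.sum_divisorsAntidiagonal' (f := fun _ d => (d : ℂ)), sig]
  · simp

lemma sum_pairs_fst {n e k : ℕ} (hn : 0 < n) (he : e ∈ eSet) (hk : 0 < k) (f : ℕ → ℂ) :
    (∑ p ∈ pairs n e, if p.1 = k then f p.2 else 0) = if e * k ∣ n then f (n / (e * k)) else 0 := by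
  have he0 := eSet_pos he
  split_ifs with h
  · obtain ⟨m, rfl⟩ := h
    rw [Finset.sum_eq_single_of_mem (k, m) ((mem_pairs hn he).2 (by ring))]
    · simp [Nat.mul_div_cancel_left m (Nat.mul_pos he0 hk)]
    · rintro ⟨a, d⟩ h1 h2
      rw [mem_pairs hn he] at h1
      rw [if_neg]
      rintro rfl
      apply h2
      simp only [Prod.mk.injEq, true_and]
      refine Nat.eq_of_mul_eq_mul_left (Nat.mul_pos he0 hk) ?_
      rw [← h1]; ring
  · refine Finset.sum_eq_zero fun p hp => if_neg ?_
    rintro rfl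
    rw [mem_pairs hn he] at hp
    exact h ⟨p.2, by rw [← hp]; ring⟩

lemma sec_eq {κ D : ℕ} (hκ : 0 < κ) (f : ℕ → ℂ) :
    sec κ D f = (if κ = 1 then (D : ℂ) * f (2 * D) else 0) + if κ = 2 then (D : ℂ) * f D else 0 := by
  rw [sec]
  rcases (by omega : κ = 1 ∨ κ = 2 ∨ 3 ≤ κ) with rfl | rfl | h
  · simp [mul_comm]
  · simp
  · rw [if_neg (fun h' => by have := Nat.le_of_dvd two_pos h'; omega), if_neg (by omega),
      if_neg (by omega)]
    ring

lemma om_two : om 2 = -7 := by rw [om, logUc_two]; norm_num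

lemma sum_beta_one {n : ℕ} (hn : 0 < n) {c : ℕ → ℂ} (h1 : c 1 = 6) :
    ∑ q ∈ pairs n 1, beta c 1 q.1 q.2 = -4 * (n * c n) +
      ∑ p ∈ n.divisorsAntidiagonal, ((if p.1 = p.2 then 10 else 0) + 4 * pB p.1 p.2) + 7 * sig n -
      n * om (2 * n) - if 2 ∣ n then ((n / 2 : ℕ) : ℂ) * om (n / 2) else 0 := by
  have he : 1 ∈ eSet := by simp [eSet]
  have hp : pairs n 1 = n.divisorsAntidiagonal := by simp [pairs]
  have e1 : ∀ q ∈ pairs n 1, beta c 1 q.1 q.2 =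
      ((if q.1 = q.2 then 10 else 0) + 4 * pB q.1 q.2) + 7 * (q.2 : ℂ)
      - 4 * (if q.1 = 1 then (fun d : ℕ => (d : ℂ) * c d) q.2 else 0)
      - (if q.1 = 1 then (fun d : ℕ => (d : ℂ) * om (2 * d)) q.2 else 0)
      - (if q.1 = 2 then (fun d : ℕ => (d : ℂ) * om d) q.2 else 0) := by
    rintro ⟨a, d⟩ hq
    rw [mem_pairs hn he] at hq
    have ha : 0 < a := Nat.pos_of_ne_zero (by rintro rfl; simp at hq; omega)
    simp only [beta, if_true, om_two, sec_eq ha, h1]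
    by_cases had : a = d
    · subst had
      have hB : pB a a = 0 := by
        rw [pB, if_neg (by omega), if_neg (by omega)]
      simp only [if_true, hB]
      split_ifs <;> ring
    · simp only [if_neg had]
      split_ifs <;> ring
  rw [Finset.sum_congr rfl e1]
  simp only [Finset.sum_sub_distrib, Finset.sum_add_distrib, ← Finset.mul_sum]
  rw [sum_pairs_fst hn he one_pos (fun d : ℕ => (d : ℂ) * c d),
    sum_pairs_fst hn he one_pos (fun d : ℕ => (d : ℂ) * om (2 * d)),
    sum_pairs_fst hn he two_pos (fun d : ℕ => (d : ℂ) * om d), sum_pairs_snd, hp]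
  simp [sigd]
  ring

lemma sum_beta_of_ne_one {n e : ℕ} (hn : 0 < n) (he : e ∈ eSet) (h1 : e ≠ 1) (c : ℕ → ℂ) :
    ∑ q ∈ pairs n e, beta c e q.1 q.2 = e * (4 * ue e 2 + 7) * sigd e n +
      if e = 2 ∧ 2 ∣ n then (n : ℂ) * (4 * ue 2 n - om n) else 0 := by
  have he0 := eSet_pos he
  have e1 : ∀ q ∈ pairs n e, beta c e q.1 q.2 = e * (4 * ue e 2 + 7) * (q.2 : ℂ) +
      (if e = 2 then if q.1 = 1 then
        (fun d : ℕ => ((2 * d : ℕ) : ℂ) * (4 * ue 2 (2 * d) - om (2 * d))) q.2 else 0 else 0) := by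
    rintro ⟨a, d⟩ hq
    rw [mem_pairs hn he] at hq
    have ha : 0 < a := Nat.pos_of_ne_zero (by rintro rfl; simp at hq; omega)
    simp only [beta, if_neg h1, om_two, sec_eq (Nat.mul_pos he0 ha)]
    have h2 : e * a ≠ 1 := fun h => h1 (Nat.eq_one_of_mul_eq_one_right h)
    simp only [if_neg h2]
    by_cases h : e = 2
    · subst h
      have h3 : 2 * a = 2 ↔ a = 1 := by omega
      simp only [h3, if_true]
      split_ifs <;> push_cast <;> ring
    · have h3 : e * a ≠ 2 := by
        rcases mem_eSet.1 he with rfl | rfl | rfl | rfl <;> omega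
      simp only [if_neg h3, if_neg h]
      push_cast; ring
  rw [Finset.sum_congr rfl e1, Finset.sum_add_distrib, ← Finset.mul_sum, sum_pairs_snd]
  congr 1
  by_cases h : e = 2
  · subst h
    simp only [if_true, true_and]
    rw [sum_pairs_fst hn he one_pos
      (fun d : ℕ => ((2 * d : ℕ) : ℂ) * (4 * ue 2 (2 * d) - om (2 * d)))]
    simp only [mul_one]
    split_ifs with h
    · rw [Nat.mul_div_cancel' h]
    · rfl
  · simp [h]

lemma sum_beta {n : ℕ} (hn : 0 < n) {c : ℕ → ℂ} (h1 : c 1 = 6) :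
    ∑ e ∈ eSet, ∑ q ∈ pairs n e, beta c e q.1 q.2 = -4 * (n * c n) +
      ∑ p ∈ n.divisorsAntidiagonal, ((if p.1 = p.2 then 10 else 0) + 4 * pB p.1 p.2) +
      2 * (7 * sig n + 26 * sigd 2 n - 3 * sigd 3 n - 114 * sigd 6 n) := by
  have hs : ∀ F : ℕ → ℂ, ∑ e ∈ eSet, F e = F 1 + F 2 + F 3 + F 6 := fun F => by
    simp [eSet]; ring
  rw [hs, sum_beta_one hn h1, sum_beta_of_ne_one hn (by simp [eSet]) (by norm_num),
    sum_beta_of_ne_one hn (by simp [eSet]) (by norm_num),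
    sum_beta_of_ne_one hn (by simp [eSet]) (by norm_num)]
  have e2 : ue 2 2 = 3 / 2 := by simp only [ue, if_true]; rw [logUc_two]; norm_num
  have e3 : ue 3 2 = -2 := by simp [ue]; rw [logUc_two]; norm_num
  have e6 : ue 6 2 = -13 / 2 := by simp [ue]; rw [logUc_two]; norm_num
  rw [e2, e3, e6]
  simp only [show ¬ (3 = 2) by norm_num, show ¬ (6 = 2) by norm_num, false_and, true_and, if_false]
  have h2n := natCast_mul_logUc (k := 2 * n) (by omega) (-2) 10 14 (-22)
  rw [sig_two_mul, sigd_two_mul, sigd_three_two_mul, sigd_six_two_mul] at h2n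
  rw [← om] at h2n
  push_cast at h2n
  by_cases h : 2 ∣ n
  · obtain ⟨m, rfl⟩ := h
    have hm : 0 < m := by omega
    have hA := natCast_mul_logUc (k := m) (by omega) (-2) 10 14 (-22)
    have hB := natCast_mul_logUc (k := 2 * m) (by omega) (-2) 10 14 (-22)
    have hC := natCast_mul_logUc (k := 2 * m) (by omega) (-3) 3 9 (-9)
    rw [← om] at hA hB
    rw [sig_two_mul, sigd_two_mul, sigd_three_two_mul, sigd_six_two_mul] at hB hC h2n
    simp only [dvd_mul_right, if_true, ue, Nat.mul_div_cancel_left m two_pos, sig_two_mul,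
      sigd_two_mul, sigd_three_two_mul, sigd_six_two_mul]
    push_cast at *
    linear_combination (-1 / 2 : ℂ) * h2n - hA + 4 * hC - hB
  · have z2 : sigd 2 n = 0 := if_neg h
    have z6 : sigd 6 n = 0 := if_neg (by omega)
    rw [if_neg h, if_neg h, z2, z6]
    rw [z2, z6] at h2n
    push_cast at *
    linear_combination (-1 / 2 : ℂ) * h2n

/-- `f` is analytic at `z` and vanishes there to order exactly `k`. -/
def VanishOrder (f : ℂ → ℂ) (z : ℂ) (k : ℕ) : Prop :=
  AnalyticAt ℂ f z ∧ analyticOrderAt f z = k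

lemma VanishOrder.mul {f g : ℂ → ℂ} {z : ℂ} {k l : ℕ} (hf : VanishOrder f z k) (hg : VanishOrder g z l) :
    VanishOrder (fun w => f w * g w) z (k + l) :=
  ⟨hf.1.mul hg.1, (analyticOrderAt_mul hf.1 hg.1).trans (by rw [hf.2, hg.2]; push_cast; rfl)⟩

lemma VanishOrder.of_ne {f : ℂ → ℂ} {z : ℂ} (hf : AnalyticAt ℂ f z) (h : f z ≠ 0) : VanishOrder f z 0 :=
  ⟨hf, by rw [Nat.cast_zero, hf.analyticOrderAt_eq_zero]; exact h⟩

lemma VanishOrder.prod {ι : Type*} {s : Finset ι} {f : ι → ℂ → ℂ} {k : ι → ℕ} {z : ℂ}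
    (h : ∀ i ∈ s, VanishOrder (f i) z (k i)) :
    VanishOrder (fun w => ∏ i ∈ s, f i w) z (∑ i ∈ s, k i) := by
  classical
  induction s using Finset.induction_on with
  | empty => simpa using VanishOrder.of_ne (f := fun _ => 1) analyticAt_const one_ne_zero
  | insert i s hi ih =>
    simp only [Finset.prod_insert hi, Finset.sum_insert hi]
    exact (h i (Finset.mem_insert_self i s)).mul (ih fun j hj => h j (Finset.mem_insert_of_mem hj))

lemma VanishOrder.pow {f : ℂ → ℂ} {z : ℂ} {k : ℕ} (hf : VanishOrder f z k) (m : ℕ) :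
    VanishOrder (fun w => f w ^ m) z (m * k) := by
  simpa using VanishOrder.prod (s := Finset.range m) (f := fun _ => f) (k := fun _ => k) fun _ _ => hf

lemma VanishOrder.congr {f g : ℂ → ℂ} {z : ℂ} {k : ℕ} (hf : VanishOrder f z k) (h : f =ᶠ[𝓝 z] g) :
    VanishOrder g z k :=
  ⟨hf.1.congr h, (analyticOrderAt_congr h).symm.trans hf.2⟩

lemma VanishOrder.unique {f : ℂ → ℂ} {z : ℂ} {k l : ℕ} (h : VanishOrder f z k) (h' : VanishOrder f z l) :
    k = l := by
  exact_mod_cast h.2.symm.trans h'.2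

lemma VanishOrder.of_deriv {f : ℂ → ℂ} {f' z : ℂ} (hf : AnalyticAt ℂ f z) (h0 : f z = 0)
    (h : HasDerivAt f f' z) (h1 : f' ≠ 0) : VanishOrder f z 1 :=
  ⟨hf, by
    rw [Nat.cast_one]
    exact hf.analyticOrderAt_eq_one_of_zero_deriv_ne_zero h0 (by rwa [h.deriv])⟩

lemma analyticAt_of_upper {f : ℂ → ℂ} (hf : ∀ z : ℂ, 0 < z.im → DifferentiableAt ℂ f z) {z : ℂ}
    (hz : 0 < z.im) : AnalyticAt ℂ f z :=
  DifferentiableOn.analyticAt (s := {z : ℂ | 0 < z.im})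
    (fun w hw => (hf w hw).differentiableWithinAt) (isOpen_im_pos.mem_nhds hz)

lemma analyticAt_tt {z : ℂ} (hz : 0 < z.im) : AnalyticAt ℂ tt z :=
  analyticAt_of_upper (fun _ h => differentiableAt_tt h) hz

lemma analyticAt_mact {M : Mat2} (hM : 0 < M.det) {z : ℂ} (hz : 0 < z.im) : AnalyticAt ℂ (mact M) z :=
  analyticAt_of_upper (fun _ h => (hasDerivAt_mact hM h).differentiableAt) hz

lemma analyticAt_Om {z : ℂ} (hz : 0 < z.im) : AnalyticAt ℂ Om z := by
  have := analyticAt_tt hz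
  unfold Om
  fun_prop

lemma rep_scalar {n : ℕ} (hn : 0 < n) {i : Idx} (hi : i ∈ idx n) {γ : Mat2} (hγ : γ ∈ R 1) {k : ℤ}
    (h : γ * rep i = k • 1) : ∃ k : ℤ, rep i = k • 1 := by
  have hk : k * k = n := by
    have h1 := congrArg Matrix.det h
    rw [det_mul, hγ.1, (rep_mem hn hi).1, one_mul, det_smul, det_one,
      Fintype.card_fin, mul_one] at h1
    rw [h1, pow_two]
  have hm : k.natAbs * k.natAbs = n := by
    have := Int.natAbs_mul_self (a := k)
    rw [hk] at this
    exact_mod_cast this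
  have hpos : 0 < k.natAbs := Nat.pos_of_ne_zero fun h => by rw [h] at hm; omega
  have hj : (⟨1, (k.natAbs, k.natAbs), 0⟩ : Idx) ∈ idx n :=
    (mem_idx hn).2 ⟨by simp [eSet], by rw [one_mul, hm], by rwa [one_mul]⟩
  have hrep : rep ⟨1, (k.natAbs, k.natAbs), 0⟩ = (k.natAbs : ℤ) • 1 := by
    ext i j; fin_cases i <;> fin_cases j <;> simp [rep]
  have hi' : rep i = k • γ.adjugate := by
    have := congrArg (γ.adjugate * ·) h
    simpa only [← mul_assoc, adj_mul hγ, one_mul, mul_smul_comm, mul_one] using this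
  have hγ' := adj_mem_R hγ
  rcases Int.natAbs_eq k with h1 | h1
  · have := rep_unique hn hj hi hγ' (by rw [hrep, mul_smul_comm, mul_one, ← h1, hi'])
    exact ⟨_, this ▸ hrep⟩
  · have := rep_unique hn hj hi (neg_mem_R hγ') (by
      rw [hrep, mul_smul_comm, mul_one, smul_neg, ← neg_smul, ← h1, hi'])
    exact ⟨_, this ▸ hrep⟩

lemma lower_ne_zero_of_fix {M : Mat2} (hM : 0 < M.det) {z : ℂ} (hz : 0 < z.im) (h : mact M z = z)
    (hs : ¬ ∃ k : ℤ, M = k • 1) : M 1 0 ≠ 0 := by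
  intro h0
  obtain ⟨h1, h2⟩ := (fix_iff hM hz).1 h
  rw [h0] at h1 h2
  simp only [Int.cast_zero, mul_zero, zero_mul, neg_zero] at h1 h2
  have h3 : M 0 1 = 0 := by exact_mod_cast h2
  have h4 : M 1 1 = M 0 0 := by
    have : (M 1 1 : ℝ) = M 0 0 := by linarith
    exact_mod_cast this
  apply hs
  refine ⟨M 0 0, ?_⟩
  ext i j; fin_cases i <;> fin_cases j <;> simp [h0, h3, h4]

lemma mden_sq_ne {M : Mat2} (hM : 0 < M.det) {z : ℂ} (hz : 0 < z.im) (h0 : M 1 0 ≠ 0) :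
    mden M z ^ 2 ≠ (M.det : ℂ) := by
  intro h
  have hd : (0 : ℝ) < M.det := by exact_mod_cast hM
  have h0' : (M 1 0 : ℝ) ≠ 0 := by exact_mod_cast h0
  have him : (mden M z).im = M 1 0 * z.im := by simp [mden]
  have e1 := congrArg Complex.im h
  have e2 := congrArg Complex.re h
  simp only [pow_two, mul_re, mul_im, intCast_re, intCast_im] at e1 e2
  have h3 : (mden M z).im ≠ 0 := by rw [him]; exact mul_ne_zero h0' hz.ne'
  have h4 : (mden M z).re = 0 := by
    have : (mden M z).re * (mden M z).im = 0 := by linarith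
    exact (mul_eq_zero.1 this).resolve_right h3
  rw [h4] at e2
  nlinarith [sq_nonneg (mden M z).im]

open Classical in
lemma vanishOrder_D4 {n : ℕ} (hn : 0 < n) {i : Idx} (hi : i ∈ idxN n) {z : ℂ} (hz : 0 < z.im) :
    VanishOrder (fun w => D4 w (mact (rep i) w)) z (if Orb z (mact (rep i) z) then 4 else 0) := by
  obtain ⟨hi, hs⟩ := mem_idxN.1 hi
  have hn' : (0 : ℤ) < n := by exact_mod_cast hn
  have hM := rep_mem hn hi
  have hd := det_pos_of_mem hn' hM
  have hz' := im_mact_pos hd hz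
  split_ifs with ho
  · obtain ⟨γ, hγ, hγz⟩ := Orb.symm hz ho
    have hγd := det_pos_of_mem one_pos hγ
    have hd' : 0 < (γ * rep i).det := by rw [det_mul]; positivity
    have hfix : mact (γ * rep i) z = z := by rw [mact_mul _ hd hz, hγz]
    have h0 := lower_ne_zero_of_fix hd' hz hfix fun ⟨k, hk⟩ => hs (rep_scalar hn hi hγ hk)
    have hne := mden_sq_ne hd' hz h0
    have hmd := mden_ne_zero hd' hz
    have hA : AnalyticAt ℂ (fun w => tt w - tt (mact (γ * rep i) w)) z := by
      have h1 : AnalyticAt ℂ (fun w => tt (mact (γ * rep i) w)) z :=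
        AnalyticAt.comp (g := tt) (f := mact (γ * rep i)) (by rw [hfix]; exact analyticAt_tt hz)
          (analyticAt_mact hd' hz)
      exact (analyticAt_tt hz).sub h1
    have hD : HasDerivAt (fun w => tt w - tt (mact (γ * rep i) w))
        (deriv tt z - deriv tt z * ((γ * rep i).det / mden (γ * rep i) z ^ 2)) z := by
      refine (differentiableAt_tt hz).hasDerivAt.sub ?_
      refine HasDerivAt.comp z (h₂ := tt) ?_ (hasDerivAt_mact hd' hz)
      rw [hfix]
      exact (differentiableAt_tt hz).hasDerivAt
    have h1 : VanishOrder (fun w => tt w - tt (mact (γ * rep i) w)) z 1 := by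
      refine VanishOrder.of_deriv hA (by simp [hfix]) hD ?_
      have h2 := deriv_tt_ne_zero hz
      rw [← mul_one_sub]
      refine mul_ne_zero h2 (sub_ne_zero.2 fun h => hne ?_)
      field_simp at h
      exact h
    have h2 : VanishOrder (fun w => (Om w * Om (mact (rep i) w))⁻¹) z 0 := by
      have h3 : AnalyticAt ℂ (fun w => Om (mact (rep i) w)) z :=
        AnalyticAt.comp (g := Om) (f := mact (rep i)) (analyticAt_Om hz') (analyticAt_mact hd hz)
      have h4 := mul_ne_zero (Om_ne_zero hz) (Om_ne_zero hz')
      exact VanishOrder.of_ne (((analyticAt_Om hz).mul h3).inv h4) (inv_ne_zero h4)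
    refine ((h1.pow 4).mul h2).congr ?_
    filter_upwards [isOpen_im_pos.mem_nhds hz] with w hw
    rw [D4, mact_mul _ hd hw, tt_gamma hγ (im_mact_pos hd hw), div_eq_mul_inv]
  · refine VanishOrder.of_ne (analyticAt_of_upper (fun w hw => differentiableAt_D4_mact hd hw) hz) ?_
    rw [← tt_eq_iff hz hz', ← sub_eq_zero] at ho
    exact div_ne_zero (pow_ne_zero 4 ho) (mul_ne_zero (Om_ne_zero hz) (Om_ne_zero hz'))

open Classical in
/-- The order of the stabilizer of `z` in the Fricke group modulo `±1`. -/
noncomputable def eps (z : ℂ) : ℕ := (eSet.filter fun e => tt z = te e (tt z)).card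

lemma eps_pos (z : ℂ) : 0 < eps z := by
  classical
  refine Finset.card_pos.2 ⟨1, Finset.mem_filter.2 ⟨by simp [eSet], by simp [te]⟩⟩

lemma vanishOrder_js {z : ℂ} (hz : 0 < z.im) : VanishOrder (fun w => js w - js z) z (eps z) := by
  classical
  have h1 : VanishOrder (fun w => ∏ e ∈ eSet, (tt w - te e (tt z))) z
      (∑ e ∈ eSet, if tt z = te e (tt z) then 1 else 0) := by
    refine VanishOrder.prod fun e _ => ?_
    have hA : AnalyticAt ℂ (fun w => tt w - te e (tt z)) z := (analyticAt_tt hz).sub analyticAt_const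
    split_ifs with h
    · exact VanishOrder.of_deriv hA (sub_eq_zero.2 h)
        ((differentiableAt_tt hz).hasDerivAt.sub_const _) (deriv_tt_ne_zero hz)
    · exact VanishOrder.of_ne hA (sub_ne_zero.2 h)
  have h2 : VanishOrder (fun w => (Om w)⁻¹) z 0 :=
    VanishOrder.of_ne ((analyticAt_Om hz).inv (Om_ne_zero hz)) (inv_ne_zero (Om_ne_zero hz))
  rw [eps, Finset.card_filter]
  refine (h1.mul h2).congr ?_
  filter_upwards [isOpen_im_pos.mem_nhds hz] with w hw
  rw [js_sub hw hz, div_eq_mul_inv]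

open Classical in
/-- The Hecke translates fixing the class of `z`. -/
noncomputable def idxFix (n : ℕ) (z : ℂ) : Finset Idx :=
  (idxN n).filter fun i => Orb z (mact (rep i) z)

lemma rootMultiplicity_mul_eps {n : ℕ} (hn : 0 < n) {p : Polynomial ℂ} (hp0 : p ≠ 0)
    (hp : ∀ z : ℂ, 0 < z.im → Psi n z = p.eval (js z)) {z : ℂ} (hz : 0 < z.im) :
    p.rootMultiplicity (js z) * eps z = 4 * (idxFix n z).card := by
  classical
  have h1 : VanishOrder (Psi n) z (∑ i ∈ idxN n, if Orb z (mact (rep i) z) then 4 else 0) :=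
    VanishOrder.prod fun i hi => vanishOrder_D4 hn hi hz
  obtain ⟨q, hq, hq0⟩ := p.exists_eq_pow_rootMultiplicity_mul_and_not_dvd hp0 (js z)
  rw [Polynomial.dvd_iff_isRoot, Polynomial.IsRoot.def] at hq0
  have hjs : AnalyticAt ℂ js z := by
    have := (vanishOrder_js hz).1.add (analyticAt_const (v := js z))
    exact this.congr (by filter_upwards with w; simp)
  have h2 : VanishOrder (fun w => q.eval (js w)) z 0 := by
    refine VanishOrder.of_ne ?_ hq0
    have := hjs.aeval_polynomial q
    simpa [Polynomial.coe_aeval_eq_eval] using this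
  have h3 := ((vanishOrder_js hz).pow (p.rootMultiplicity (js z))).mul h2
  have h4 := h3.unique (h1.congr (by
    filter_upwards [isOpen_im_pos.mem_nhds hz] with w hw
    rw [hp w hw]
    conv_lhs => rw [hq]
    simp))
  rw [add_zero] at h4
  rw [h4, idxFix, Finset.card_filter, Finset.mul_sum]
  simp

/-- Matrices of determinant `n` fixing `z`, normalised to have positive lower left entry. -/
def fixSet (n : ℕ) (z : ℂ) : Set Mat2 := {M | M ∈ R n ∧ mact M z = z ∧ 0 < M 1 0}

/-- The traces of the matrices in `fixSet n z`. -/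
def trSet (n : ℕ) (z : ℂ) : Set ℤ := (fun M : Mat2 => M 0 0 + M 1 1) '' fixSet n z

lemma injOn_trace {n : ℕ} (hn : 0 < n) {z : ℂ} (hz : 0 < z.im) :
    Set.InjOn (fun M : Mat2 => M 0 0 + M 1 1) (fixSet n z) := by
  have hn' : (0 : ℤ) < n := by exact_mod_cast hn
  rintro M ⟨hM, hMz, hM0⟩ N ⟨hN, hNz, hN0⟩ (h : M 0 0 + M 1 1 = N 0 0 + N 1 1)
  have dM := det_pos_of_mem hn' hM
  have dN := det_pos_of_mem hn' hN
  obtain ⟨m1, m2⟩ := (fix_iff dM hz).1 hMz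
  obtain ⟨n1, n2⟩ := (fix_iff dN hz).1 hNz
  have m3 := trace_sq_of_fix dM hz hMz
  have n3 := trace_sq_of_fix dN hz hNz
  have h' : (M 0 0 : ℝ) + M 1 1 = N 0 0 + N 1 1 := by exact_mod_cast h
  rw [hM.1, h'] at m3
  rw [hN.1] at n3
  have hM0' : (0 : ℝ) < M 1 0 := by exact_mod_cast hM0
  have hN0' : (0 : ℝ) < N 1 0 := by exact_mod_cast hN0
  have h10 : (M 1 0 : ℝ) = N 1 0 := by
    have h1 : ((M 1 0 : ℝ) * z.im) ^ 2 = (N 1 0 * z.im) ^ 2 := by linarith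
    have h2 := (sq_eq_sq₀ (by positivity) (by positivity)).1 h1
    exact mul_right_cancel₀ hz.ne' h2
  rw [h10] at m1 m2
  have h01 : (M 0 1 : ℝ) = N 0 1 := by rw [m2, n2]
  have h00 : (M 0 0 : ℝ) = N 0 0 := by linarith
  have h11 : (M 1 1 : ℝ) = N 1 1 := by linarith
  ext i j
  fin_cases i <;> fin_cases j
  · exact_mod_cast h00
  · exact_mod_cast h01
  · exact_mod_cast h10
  · exact_mod_cast h11

lemma trSet_sq_lt {n : ℕ} (hn : 0 < n) {z : ℂ} (hz : 0 < z.im) {r : ℤ} (hr : r ∈ trSet n z) :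
    r ^ 2 < 4 * n := by
  have hn' : (0 : ℤ) < n := by exact_mod_cast hn
  obtain ⟨M, ⟨hM, hMz, hM0⟩, rfl⟩ := hr
  have h := trace_sq_of_fix (det_pos_of_mem hn' hM) hz hMz
  rw [hM.1] at h
  have hM0' : (0 : ℝ) < M 1 0 := by exact_mod_cast hM0
  have h2 : ((M 0 0 : ℝ) + M 1 1) ^ 2 < 4 * n := by
    rw [h]; push_cast; have : 0 < (M 1 0 : ℝ) ^ 2 * z.im ^ 2 := by positivity
    linarith
  exact_mod_cast h2

lemma card_idxFix {n : ℕ} (hn : 0 < n) {z : ℂ} (hz : 0 < z.im) :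
    (idxFix n z).card = (trSet n z).ncard := by
  classical
  have hn' : (0 : ℤ) < n := by exact_mod_cast hn
  rw [trSet, (injOn_trace hn hz).ncard_image, ← Set.ncard_coe_finset]
  have key : ∀ M ∈ fixSet n z, ∃ i ∈ idx n, ∃ γ ∈ R 1, M = γ * rep i := fun M hM => exists_rep hn hM.1
  choose! f hf γ hγ hfγ using key
  have himg : (idxFix n z : Set Idx) = f '' fixSet n z := by
    ext i
    simp only [idxFix, Finset.coe_filter, mem_idxN, Set.mem_ofPred_eq, Set.mem_image]
    constructor
    · rintro ⟨⟨hi, hs⟩, ho⟩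
      have hd := det_pos_of_mem hn' (rep_mem hn hi)
      obtain ⟨δ, hδ, hδz⟩ := Orb.symm hz ho
      have hδR : δ * rep i ∈ R n := by simpa using R_mul hδ (rep_mem hn hi)
      have hfix : mact (δ * rep i) z = z := by rw [mact_mul _ hd hz, hδz]
      have h0 := lower_ne_zero_of_fix (det_pos_of_mem hn' hδR) hz hfix
        fun ⟨k, hk⟩ => hs (rep_scalar hn hi hδ hk)
      have : ∃ ε ∈ R 1, ε * rep i ∈ fixSet n z := by
        rcases lt_or_gt_of_ne h0 with h1 | h1
        · refine ⟨-δ, neg_mem_R hδ, ?_⟩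
          rw [neg_mul]
          exact ⟨neg_mem_R hδR, by rw [mact_neg, hfix], by simpa using h1⟩
        · exact ⟨δ, hδ, hδR, hfix, h1⟩
      obtain ⟨ε, hε, hM⟩ := this
      refine ⟨_, hM, rep_unique hn (hf _ hM) hi
        (by simpa using R_mul (adj_mem_R hε) (hγ _ hM)) ?_⟩
      rw [mul_assoc, ← hfγ _ hM, ← mul_assoc, adj_mul hε, one_mul]
    · rintro ⟨M, hM, rfl⟩
      have hd := det_pos_of_mem hn' (rep_mem hn (hf M hM))
      have hfix : mact (γ M) (mact (rep (f M)) z) = z := by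
        rw [← mact_mul _ hd hz, ← hfγ M hM, hM.2.1]
      refine ⟨⟨hf M hM, ?_⟩, Orb.symm (im_mact_pos hd hz) ⟨γ M, hγ M hM, hfix⟩⟩
      rintro ⟨k, hk⟩
      have hk0 : k ≠ 0 := by
        rintro rfl
        rw [hk] at hd
        simp at hd
      rw [hk, mact_smul _ hk0, mact_one] at hfix
      have h0 := hM.2.2
      rw [hfγ M hM, hk, mul_smul_comm, mul_one] at h0
      rcases eq_one_of_fix (hγ M hM) hz hfix with h1 | h1 <;> rw [h1] at h0 <;> simp at h0
  rw [himg]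
  refine Set.InjOn.ncard_image ?_
  intro M hM N hN h
  have hδ : γ N * (γ M).adjugate ∈ R 1 := by simpa using R_mul (hγ N hN) (adj_mem_R (hγ M hM))
  have e1 : N = γ N * (γ M).adjugate * M := by
    calc N = γ N * rep (f N) := hfγ N hN
      _ = γ N * ((γ M).adjugate * (γ M * rep (f M))) := by
        rw [← mul_assoc (γ M).adjugate, adj_mul (hγ M hM), one_mul, h]
      _ = γ N * (γ M).adjugate * M := by rw [← hfγ M hM, mul_assoc]
  have hfix : mact (γ N * (γ M).adjugate) z = z := by
    have := hN.2.1
    rw [e1, mact_mul _ (det_pos_of_mem hn' hM.1) hz, hM.2.1] at this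
    exact this
  rcases eq_one_of_fix hδ hz hfix with h1 | h1
  · rw [e1, h1, one_mul]
  · rw [h1, neg_mul, one_mul] at e1
    have h2 := hN.2.2
    rw [e1] at h2
    have h3 := hM.2.2
    simp at h2
    omega

lemma exists_conj_AL {e : ℕ} (he : e ∈ eSet) {g : Mat2} (hg : g ∈ AL e) {n : ℤ} {M : Mat2}
    (hM : M ∈ R n) : ∃ M' ∈ R n, g * M = M' * g ∧ M' 0 0 + M' 1 1 = M 0 0 + M 1 1 := by
  have he0 : (e : ℤ) ≠ 0 := by exact_mod_cast (eSet_pos he).ne'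
  obtain ⟨f, hf⟩ := e_dvd_six he
  obtain ⟨hd, ⟨α, hα⟩, ⟨δ, hδ⟩, ⟨γ, hγ⟩⟩ := hg
  obtain ⟨hMd, ⟨C, hC⟩⟩ := hM
  have hd' := hd
  rw [det_fin_two, hα, hδ, hγ] at hd'
  rw [det_fin_two, hC] at hMd
  set β := g 0 1 with hβ
  have hd2 : e * α * δ - f * β * γ = 1 := by
    apply mul_left_cancel₀ he0
    linear_combination hd' + β * γ * hf
  have hgm : g = !![e * α, β; 6 * γ, e * δ] := by
    rw [eta_fin_two g, hα, hδ, hγ]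
  have hMm : M = !![M 0 0, M 0 1; 6 * C, M 1 1] := by
    conv_lhs => rw [eta_fin_two M, hC]
  set A := M 0 0
  set B := M 0 1
  set D := M 1 1
  set M' : Mat2 := !![δ * (e * α * A + 6 * β * C) - 6 * γ * α * B - f * γ * β * D,
    -β * α * A - f * β ^ 2 * C + α * (e * α * B + β * D);
    6 * (δ * (γ * A + e * δ * C) - f * γ ^ 2 * B - γ * δ * D),
    -f * γ * β * A - 6 * β * δ * C + α * (6 * γ * B + e * δ * D)] with hM'
  have hmul : g * M = M' * g := by
    rw [hgm, hMm, hM']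
    ext i j
    fin_cases i <;> fin_cases j <;> simp [Matrix.mul_apply, Fin.sum_univ_two]
    · rw [hf]
      linear_combination -(e * α * A + e * f * β * C) * hd2
    · rw [hf]
      linear_combination -(e * α * B + β * D) * hd2
    · rw [hf]
      linear_combination -(e * f * γ * A + e * δ * (e * f * C)) * hd2
    · rw [hf]
      linear_combination -(e * f * γ * B + e * δ * D) * hd2
  refine ⟨M', ⟨?_, ?_⟩, hmul, ?_⟩
  · have := congrArg Matrix.det hmul
    rw [det_mul, det_mul, hd] at this
    apply mul_left_cancel₀ he0
    rw [mul_comm (e : ℤ) M'.det, ← this, det_fin_two M, hC, hMd]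
  · simp [hM']
  · simp only [hM', of_apply, cons_val', cons_val_zero, cons_val_one, empty_val', cons_val_fin_one]
    linear_combination (A + D) * hd2

lemma exists_AL_of_js_eq {z z' : ℂ} (hz : 0 < z.im) (hz' : 0 < z'.im) (h : js z' = js z) :
    ∃ e ∈ eSet, ∃ g ∈ AL e, mact g z = z' := by
  obtain ⟨e, he, h1⟩ := (js_eq_iff hz hz').1 h
  have hd := det_pos_of_AL he (W_mem he)
  rw [← tt_W he hz] at h1
  obtain ⟨γ, hγ, h2⟩ := orb_of_tt_eq (im_mact_pos hd hz) hz' h1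
  exact ⟨e, he, γ * W e, gamma_mul_AL hγ he (W_mem he), by rw [mact_mul _ hd hz, h2]⟩

lemma trSet_subset_of_js_eq {n : ℕ} (hn : 0 < n) {z z' : ℂ} (hz : 0 < z.im) (hz' : 0 < z'.im)
    (h : js z' = js z) : trSet n z ⊆ trSet n z' := by
  have hn' : (0 : ℤ) < n := by exact_mod_cast hn
  obtain ⟨e, he, g, hg, rfl⟩ := exists_AL_of_js_eq hz hz' h
  rintro - ⟨M, ⟨hM, hMz, hM0⟩, rfl⟩
  obtain ⟨M', hM', h1, h2⟩ := exists_conj_AL he hg hM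
  have dg := det_pos_of_AL he hg
  have dM := det_pos_of_mem hn' hM
  have e1 := mact_mul g dM hz
  have e2 := mden_mul g dM hz
  rw [h1, hMz] at e1 e2
  rw [mact_mul _ dg hz] at e1
  rw [mden_mul _ dg hz] at e2
  refine ⟨M', ⟨hM', e1, ?_⟩, h2⟩
  have hne := mden_ne_zero dg hz
  have e3 : mden M' (mact g z) = mden M z := mul_right_cancel₀ hne (by rw [e2, mul_comm])
  have e4 := congrArg Complex.im e3
  simp only [mden, add_im, mul_im, intCast_re, intCast_im, zero_mul, add_zero] at e4
  have h5 : (0 : ℝ) < M' 1 0 * (mact g z).im := by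
    rw [e4]
    have : (0 : ℝ) < M 1 0 := by exact_mod_cast hM0
    positivity
  have h6 := (pos_iff_pos_of_mul_pos h5).2 hz'
  exact_mod_cast h6

lemma trSet_of_js_eq {n : ℕ} (hn : 0 < n) {z z' : ℂ} (hz : 0 < z.im) (hz' : 0 < z'.im)
    (h : js z' = js z) : trSet n z = trSet n z' :=
  (trSet_subset_of_js_eq hn hz hz' h).antisymm (trSet_subset_of_js_eq hn hz' hz h.symm)

/-- Gram matrices of positive definite binary quadratic forms. -/
def PD (Q : Matrix (Fin 2) (Fin 2) ℝ) : Prop := Q 1 0 = Q 0 1 ∧ 0 < Q 0 0 ∧ 0 < Q.det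

/-- The dehomogenised quadratic form with Gram matrix `Q`. -/
noncomputable def qf (Q : Matrix (Fin 2) (Fin 2) ℝ) (z : ℂ) : ℂ := Q 0 0 * z ^ 2 + 2 * Q 0 1 * z + Q 1 1

lemma PD.cm_spec {Q : Matrix (Fin 2) (Fin 2) ℝ} (hQ : PD Q) :
    Q 0 0 * (cmPointC Q).re = -Q 0 1 ∧ Q 0 0 * (cmPointC Q).im = √Q.det := by
  have h : (Q 0 0 : ℂ) * cmPointC Q = ((-(Q 0 1) : ℝ) : ℂ) + I * √Q.det := by
    rw [cmPointC, mul_div_cancel₀]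
    exact_mod_cast hQ.2.1.ne'
  have h1 := congrArg Complex.re h
  have h2 := congrArg Complex.im h
  simp at h1 h2
  exact ⟨h1, h2⟩

lemma PD.im_pos {Q : Matrix (Fin 2) (Fin 2) ℝ} (hQ : PD Q) : 0 < (cmPointC Q).im :=
  (pos_iff_pos_of_mul_pos (by rw [hQ.cm_spec.2]; exact Real.sqrt_pos.2 hQ.2.2)).1 hQ.2.1

lemma PD.qf_eq_zero_iff {Q : Matrix (Fin 2) (Fin 2) ℝ} (hQ : PD Q) {z : ℂ} (hz : 0 < z.im) :
    qf Q z = 0 ↔ cmPointC Q = z := by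
  obtain ⟨h1, h2⟩ := hQ.cm_spec
  have hsq := Real.sq_sqrt hQ.2.2.le
  have hs := Real.sqrt_nonneg Q.det
  have hA := hQ.2.1
  have hdet : Q.det = Q 0 0 * Q 1 1 - Q 0 1 ^ 2 := by rw [det_fin_two, hQ.1]; ring
  rw [qf, Complex.ext_iff]
  simp only [pow_two, add_re, add_im, mul_re, mul_im, ofReal_re, ofReal_im, zero_re, zero_im,
    re_ofNat, im_ofNat]
  constructor
  · rintro ⟨e1, e2⟩
    have e3 : Q 0 0 * z.re = -Q 0 1 := by
      apply mul_right_cancel₀ hz.ne'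
      linarith
    have e4 : Q 0 0 * z.im = √Q.det := by
      refine (sq_eq_sq₀ (by positivity) hs).1 ?_
      rw [hsq, hdet]
      linear_combination - Q 0 0 * e1 + (Q 0 0 * z.re + Q 0 1) * e3
    apply Complex.ext
    · exact mul_left_cancel₀ hA.ne' (h1.trans e3.symm)
    · exact mul_left_cancel₀ hA.ne' (h2.trans e4.symm)
  · rintro rfl
    constructor
    · apply mul_left_cancel₀ hA.ne'
      rw [← h2, hdet] at hsq
      linear_combination (Q 0 0 * (cmPointC Q).re + Q 0 1) * h1 - hsq
    · linear_combination 2 * (cmPointC Q).im * h1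

lemma PD.eq_of_cm_eq {Q Q' : Matrix (Fin 2) (Fin 2) ℝ} (hQ : PD Q) (hQ' : PD Q')
    (hd : Q.det = Q'.det) (h : cmPointC Q = cmPointC Q') : Q = Q' := by
  obtain ⟨h1, h2⟩ := hQ.cm_spec
  obtain ⟨h1', h2'⟩ := hQ'.cm_spec
  have him := hQ.im_pos
  rw [h] at h1 h2 him
  have h00 : Q 0 0 = Q' 0 0 := mul_right_cancel₀ him.ne' (by rw [h2, h2', hd])
  have h01 : Q 0 1 = Q' 0 1 := by rw [h00] at h1; linarith
  have h10 : Q 1 0 = Q' 1 0 := by rw [hQ.1, hQ'.1, h01]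
  have h11 : Q 1 1 = Q' 1 1 := by
    rw [det_fin_two, det_fin_two, h00, h01, h10] at hd
    exact mul_left_cancel₀ hQ'.2.1.ne' (by linarith)
  ext i j
  fin_cases i <;> fin_cases j <;> assumption

lemma SL2R_det (g : SL2R) : g.1 0 0 * g.1 1 1 - g.1 0 1 * g.1 1 0 = 1 := by
  rw [← det_fin_two]; exact g.2

lemma moebius_den_ne_zero (g : SL2R) {z : ℂ} (hz : 0 < z.im) :
    ((g.1 1 0 : ℝ) * z + ((g.1 1 1 : ℝ) : ℂ)) ≠ 0 := by
  intro h
  have h1 := congrArg Complex.im h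
  have h2 := congrArg Complex.re h
  simp at h1 h2
  have h3 := h1.resolve_right hz.ne'
  have := SL2R_det g
  rw [h3] at this h2
  simp at h2
  rw [h2] at this
  simp at this

lemma PD.congr {Q : Matrix (Fin 2) (Fin 2) ℝ} (hQ : PD Q) (g : SL2R) :
    PD ((g.1)ᵀ * Q * g.1) ∧ ((g.1)ᵀ * Q * g.1).det = Q.det := by
  have hd : ((g.1)ᵀ * Q * g.1).det = Q.det := by
    rw [det_mul, det_mul, det_transpose, g.2]; ring
  refine ⟨⟨?_, ?_, by rw [hd]; exact hQ.2.2⟩, hd⟩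
  · simp [Matrix.mul_apply, Fin.sum_univ_two, hQ.1]; ring
  · simp only [Matrix.mul_apply, Fin.sum_univ_two, transpose_apply, hQ.1]
    have h1 := SL2R_det g
    have h2 := hQ.2.2
    have h3 := hQ.2.1
    rw [det_fin_two, hQ.1] at h2
    set a := g.1 0 0
    set c := g.1 1 0
    have h5 : 0 < Q 0 0 * ((a * Q 0 0 + c * Q 0 1) * a + (a * Q 0 1 + c * Q 1 1) * c) := by
      have e : Q 0 0 * ((a * Q 0 0 + c * Q 0 1) * a + (a * Q 0 1 + c * Q 1 1) * c)
          = (Q 0 0 * a + Q 0 1 * c) ^ 2 + (Q 0 0 * Q 1 1 - Q 0 1 * Q 0 1) * c ^ 2 := by ring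
      rw [e]
      by_cases hc : c = 0
      · have ha : a ≠ 0 := fun ha => by rw [ha, hc] at h1; simp at h1
        rw [hc]
        have : 0 < (Q 0 0 * a) ^ 2 := by positivity
        linarith
      · have : 0 < c ^ 2 := by positivity
        have := mul_pos h2 this
        nlinarith [sq_nonneg (Q 0 0 * a + Q 0 1 * c)]
    exact (pos_iff_pos_of_mul_pos h5).1 h3

lemma qf_congr {Q : Matrix (Fin 2) (Fin 2) ℝ} (hQ : PD Q) (g : SL2R) {z : ℂ} (hz : 0 < z.im) :
    qf ((g.1)ᵀ * Q * g.1) z =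
      ((g.1 1 0 : ℝ) * z + ((g.1 1 1 : ℝ) : ℂ)) ^ 2 * qf Q (moebius g z) := by
  have h := moebius_den_ne_zero g hz
  rw [qf, qf, moebius]
  simp only [Matrix.mul_apply, Fin.sum_univ_two, transpose_apply, hQ.1]
  push_cast
  field_simp
  ring

/-- An element of the Fricke group from an Atkin–Lehner matrix. -/
noncomputable def mkG {e : ℕ} (he : e ∈ eSet) {M : Mat2} (hM : M ∈ AL e) : SL2R :=
  ⟨(√(e : ℝ))⁻¹ • toR M, by
    have he0 : (0 : ℝ) < e := by exact_mod_cast eSet_pos he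
    have h1 : (toR M).det = e := by
      have := hM.1
      rw [det_fin_two] at this
      simp only [toR, det_fin_two, map_apply]
      exact_mod_cast this
    rw [det_smul, h1, Fintype.card_fin, inv_pow, Real.sq_sqrt he0.le, inv_mul_cancel₀ he0.ne']⟩

lemma mkG_mem {e : ℕ} (he : e ∈ eSet) {M : Mat2} (hM : M ∈ AL e) : mkG he hM ∈ FrickeGroup 6 :=
  mem_FrickeGroup.2 ⟨e, he, M, hM, rfl⟩

lemma moebius_eq_mact {e : ℕ} (he : e ∈ eSet) {M : Mat2} {g : SL2R}
    (hg : g.1 = (√(e : ℝ))⁻¹ • toR M) (z : ℂ) : moebius g z = mact M z := by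
  have he0 : (0 : ℝ) < e := by exact_mod_cast eSet_pos he
  have h : ((√(e : ℝ) : ℝ) : ℂ) ≠ 0 := by exact_mod_cast (Real.sqrt_pos.2 he0).ne'
  rw [moebius, mact, hg]
  simp only [Matrix.smul_apply, toR, map_apply, smul_eq_mul]
  push_cast
  conv_rhs => rw [← mul_div_mul_left _ _ (inv_ne_zero h)]
  congr 1 <;> ring

lemma AL_eq_of_smul {e e' : ℕ} (he : e ∈ eSet) (he' : e' ∈ eSet) {M M' : Mat2} (hM' : M' ∈ AL e')
    (h : (√(e : ℝ))⁻¹ • toR M = (√(e' : ℝ))⁻¹ • toR M') : e' = e ∧ M' = M := by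
  have he0 : (0 : ℝ) < e := by exact_mod_cast eSet_pos he
  have he0' : (0 : ℝ) < e' := by exact_mod_cast eSet_pos he'
  have hs := Real.sqrt_pos.2 he0
  have hs' := Real.sqrt_pos.2 he0'
  have h1 := congrArg (· * toR M'.adjugate) h
  simp only [smul_mul_assoc, ← toR_mul, mul_adjugate, hM'.1, toR_smul] at h1
  have h2 := congrFun (congrFun h1 0) 0
  simp [toR] at h2
  set k := (M * M'.adjugate) 0 0
  have h3 : (k : ℝ) = √e * √e' := by
    have : (k : ℝ) = √e * ((√(e : ℝ))⁻¹ * k) := by field_simp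
    rw [this, h2]
    congr 1
    nth_rewrite 2 [← Real.mul_self_sqrt he0'.le]
    field_simp
  have h4 : (k : ℝ) ^ 2 = e' * e := by
    rw [h3, mul_pow, Real.sq_sqrt he0.le, Real.sq_sqrt he0'.le, mul_comm]
  have h5 : e' * e = k.natAbs ^ 2 := by
    have : k ^ 2 = e' * e := by exact_mod_cast h4
    zify
    rw [sq_abs, this]
  obtain ⟨rfl, -⟩ := eSet_sq he he' h5
  refine ⟨rfl, ?_⟩
  have h6 := smul_right_injective _ (inv_ne_zero hs.ne') h
  ext i j
  have := congrFun (congrFun h6 i) j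
  simp [toR] at this
  exact this.symm

lemma exists_AL_fix {e : ℕ} (he : e ∈ eSet) {z : ℂ} (hz : 0 < z.im) (h : tt z = te e (tt z)) :
    ∃ M ∈ AL e, mact M z = z := by
  have hd := det_pos_of_AL he (W_mem he)
  rw [← tt_W he hz] at h
  obtain ⟨γ, hγ, h2⟩ := orb_of_tt_eq (im_mact_pos hd hz) hz h
  exact ⟨γ * W e, gamma_mul_AL hγ he (W_mem he), by rw [mact_mul _ hd hz, h2]⟩

lemma AL_fix_unique {e : ℕ} (he : e ∈ eSet) {M M' : Mat2} (hM : M ∈ AL e) (hM' : M' ∈ AL e) {z : ℂ}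
    (hz : 0 < z.im) (h : mact M z = z) (h' : mact M' z = z) : M' = M ∨ M' = -M := by
  obtain ⟨γ, hγ, e1⟩ := AL_decomp he hM
  obtain ⟨γ', hγ', e2⟩ := AL_decomp he hM'
  have hδ : γ' * γ.adjugate ∈ R 1 := by simpa using R_mul hγ' (adj_mem_R hγ)
  have e3 : M' = γ' * γ.adjugate * M := by
    rw [e1, mul_assoc, ← mul_assoc γ.adjugate, adj_mul hγ, one_mul, e2]
  have hfix : mact (γ' * γ.adjugate) z = z := by
    rw [e3, mact_mul _ (det_pos_of_AL he hM) hz, h] at h'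
    exact h'
  rcases eq_one_of_fix hδ hz hfix with h1 | h1
  · left; rw [e3, h1, one_mul]
  · right; rw [e3, h1, neg_mul, one_mul]

lemma neg_mem_AL {e : ℕ} {M : Mat2} (hM : M ∈ AL e) : -M ∈ AL e := by
  obtain ⟨h1, h2, h3, h4⟩ := hM
  exact ⟨by rw [det_neg, h1]; simp, by simpa using h2, by simpa using h3, by simpa using h4⟩

lemma moebius_im_pos {g : SL2R} (hg : g ∈ FrickeGroup 6) {z : ℂ} (hz : 0 < z.im) :
    0 < (moebius g z).im := by
  obtain ⟨e, he, M, hM, h⟩ := mem_FrickeGroup.1 hg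
  rw [moebius_eq_mact he h]
  exact im_mact_pos (det_pos_of_AL he hM) hz

lemma PD.cm_congr {Q : Matrix (Fin 2) (Fin 2) ℝ} (hQ : PD Q) {g : SL2R} (hg : g ∈ FrickeGroup 6) :
    moebius g (cmPointC ((g.1)ᵀ * Q * g.1)) = cmPointC Q := by
  obtain ⟨h1, -⟩ := hQ.congr g
  have hz := h1.im_pos
  have h2 := (h1.qf_eq_zero_iff hz).2 rfl
  rw [qf_congr hQ g hz] at h2
  have h3 := (mul_eq_zero.1 h2).resolve_left (pow_ne_zero 2 (moebius_den_ne_zero g hz))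
  exact ((hQ.qf_eq_zero_iff (moebius_im_pos hg hz)).1 h3).symm

lemma PD.congr_eq {Q Q' : Matrix (Fin 2) (Fin 2) ℝ} (hQ : PD Q) (hQ' : PD Q')
    (hd : Q.det = Q'.det) (g : SL2R) (h : moebius g (cmPointC Q') = cmPointC Q) :
    (g.1)ᵀ * Q * g.1 = Q' := by
  obtain ⟨h1, h2⟩ := hQ.congr g
  refine h1.eq_of_cm_eq hQ' (h2.trans hd) ?_
  rw [(h1.qf_eq_zero_iff hQ'.im_pos).1]
  rw [qf_congr hQ g hQ'.im_pos, h, (hQ.qf_eq_zero_iff hQ.im_pos).2 rfl, mul_zero]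

lemma stabOrder_eq {Q : Matrix (Fin 2) (Fin 2) ℝ} (hQ : PD Q) :
    stabOrder (FrickeGroup 6) Q = eps (cmPointC Q) := by
  classical
  set z := cmPointC Q with hzdef
  have hz : 0 < z.im := hQ.im_pos
  have hstab : ∀ g ∈ FrickeGroup 6, (g.1)ᵀ * Q * g.1 = Q ↔ moebius g z = z := by
    intro g hg
    constructor
    · intro h
      have := hQ.cm_congr hg
      rwa [h] at this
    · exact hQ.congr_eq hQ rfl g
  set S := eSet.filter (fun e => tt z = te e (tt z)) with hS
  have hSe : ∀ e : S, (e : ℕ) ∈ eSet := fun e => (Finset.mem_filter.1 e.2).1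
  have hex : ∀ e : S, ∃ M, M ∈ AL e ∧ mact M z = z := fun e =>
    exists_AL_fix (hSe e) hz (Finset.mem_filter.1 e.2).2
  choose M hM hfix using hex
  let Ms : S × Bool → Mat2 := fun p => bif p.2 then M p.1 else -M p.1
  have hMs : ∀ p, Ms p ∈ AL p.1 := by
    rintro ⟨e, _ | _⟩
    · exact neg_mem_AL (hM e)
    · exact hM e
  have hfixs : ∀ p, mact (Ms p) z = z := by
    rintro ⟨e, _ | _⟩
    · exact (mact_neg _ _).trans (hfix e)
    · exact hfix e
  let f : S × Bool → { g : SL2R // g ∈ FrickeGroup 6 ∧ (g.1)ᵀ * Q * g.1 = Q } := fun p =>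
    ⟨mkG (hSe p.1) (hMs p), mkG_mem _ _, (hstab _ (mkG_mem _ _)).2
      ((moebius_eq_mact (hSe p.1) rfl z).trans (hfixs p))⟩
  have hf : Function.Bijective f := by
    constructor
    · rintro ⟨e, s⟩ ⟨e', s'⟩ h
      have h1 : (mkG (hSe e) (hMs (e, s))).1 = (mkG (hSe e') (hMs (e', s'))).1 :=
        congrArg (fun g => g.1.1) h
      obtain ⟨h2, h3⟩ := AL_eq_of_smul (hSe e) (hSe e') (hMs (e', s')) h1
      obtain rfl : e' = e := Subtype.ext h2
      have hne : M e' ≠ -M e' := by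
        intro h4
        have h5 := det_pos_of_AL (hSe e') (hM e')
        have h6 : M e' = 0 := by
          ext i j
          have := congrFun (congrFun h4 i) j
          rw [Matrix.neg_apply] at this
          rw [Matrix.zero_apply]
          omega
        rw [h6, det_fin_two] at h5
        simp at h5
      rcases s with _ | _ <;> rcases s' with _ | _
      · rfl
      · exact absurd h3 hne
      · exact absurd h3.symm hne
      · rfl
    · rintro ⟨g, hg, hgQ⟩
      obtain ⟨e, he, N, hN, h⟩ := mem_FrickeGroup.1 hg
      have h1 := (hstab g hg).1 hgQ
      rw [moebius_eq_mact he h] at h1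
      have h2 := tt_AL he hN hz
      rw [h1] at h2
      have heS : e ∈ S := Finset.mem_filter.2 ⟨he, h2⟩
      rcases AL_fix_unique he (hM ⟨e, heS⟩) hN hz (hfix _) h1 with h3 | h3
      · refine ⟨(⟨e, heS⟩, true), ?_⟩
        apply Subtype.ext
        apply Subtype.ext
        change (√(e : ℝ))⁻¹ • toR (M ⟨e, heS⟩) = g.1
        rw [h, h3]
      · refine ⟨(⟨e, heS⟩, false), ?_⟩
        apply Subtype.ext
        apply Subtype.ext
        change (√(e : ℝ))⁻¹ • toR (-M ⟨e, heS⟩) = g.1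
        rw [h, h3]
  rw [stabOrder, ← Nat.card_eq_of_bijective f hf, Nat.card_prod]
  simp only [Nat.card_eq_fintype_card, Fintype.card_coe, Fintype.card_bool, eps]
  rw [Nat.mul_div_cancel _ (by norm_num)]

lemma PD_of_mem_QdN {d : ℤ} (hd : 0 < d) {Q : Matrix (Fin 2) (Fin 2) ℝ} (hQ : Q ∈ QdN d 6) :
    PD Q ∧ Q.det = d / 4 := by
  obtain ⟨a, b, c, rfl, ha, hb, -⟩ := hQ
  have h1 : (formMat a b c).det = d / 4 := by
    have : (b : ℝ) ^ 2 - 4 * a * c = -d := by exact_mod_cast hb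
    rw [formMat, det_fin_two]
    simp
    linarith
  refine ⟨⟨by simp [formMat], by simpa [formMat] using ha, ?_⟩, h1⟩
  rw [h1]
  have : (0 : ℝ) < d := by exact_mod_cast hd
  positivity

lemma js_cm_congr {Q : Matrix (Fin 2) (Fin 2) ℝ} (hQ : PD Q) {g : SL2R} (hg : g ∈ FrickeGroup 6) :
    js (cmPointC ((g.1)ᵀ * Q * g.1)) = js (cmPointC Q) := by
  have h := hQ.cm_congr hg
  obtain ⟨e, he, M, hM, h1⟩ := mem_FrickeGroup.1 hg
  rw [moebius_eq_mact he h1] at h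
  refine ((js_eq_iff (hQ.congr g).1.im_pos hQ.im_pos).2 ⟨e, he, ?_⟩).symm
  rw [← h]
  exact tt_AL he hM (hQ.congr g).1.im_pos

lemma mem_trSet_iff {n : ℕ} (hn : 0 < n) {z : ℂ} (hz : 0 < z.im) {r : ℤ} (hr : r ^ 2 < 4 * n) :
    r ∈ trSet n z ↔ ∃ Q ∈ QdN (4 * n - r ^ 2) 6, cmPointC Q = z := by
  have hd : 0 < 4 * (n : ℤ) - r ^ 2 := by linarith
  have hn' : (0 : ℤ) < n := by exact_mod_cast hn
  have key : ∀ M : Mat2, 0 < M.det → (mact M z = z ↔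
      qf (formMat (M 1 0) (M 1 1 - M 0 0) (-M 0 1)) z = 0) := by
    intro M hM
    rw [mact, ← mden, div_eq_iff (mden_ne_zero hM hz), qf, mden]
    simp only [formMat, of_apply, cons_val_zero, cons_val_one, cons_val', cons_val_fin_one]
    push_cast
    constructor <;> intro h <;> linear_combination -h
  constructor
  · rintro ⟨M, ⟨⟨h1, h2⟩, h3, h4⟩, rfl⟩
    have hmem : formMat (M 1 0) (M 1 1 - M 0 0) (-M 0 1) ∈
        QdN (4 * n - (M 0 0 + M 1 1) ^ 2) 6 := by
      refine ⟨_, _, _, rfl, h4, ?_, h2⟩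
      rw [← h1, det_fin_two]
      ring
    refine ⟨_, hmem, ?_⟩
    rw [← (PD_of_mem_QdN hd hmem).1.qf_eq_zero_iff hz, ← key M (by rw [h1]; exact hn')]
    exact h3
  · rintro ⟨Q, hQ, h⟩
    have hPD := (PD_of_mem_QdN hd hQ).1
    obtain ⟨a, b, c, rfl, ha, hb, h6⟩ := hQ
    obtain ⟨x, hx⟩ : (2 : ℤ) ∣ r - b := by
      have h1 : (2 : ℤ) ∣ (r - b) ^ 2 :=
        ⟨2 * n - 2 * a * c - b * r + b ^ 2, by linear_combination - hb⟩
      exact Int.prime_two.dvd_of_dvd_pow h1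
    have hr : r = b + 2 * x := by linarith
    subst hr
    have hdet : (!![x, -c; a, x + b] : Mat2).det = n := by
      rw [det_fin_two]
      simp only [of_apply, cons_val_zero, cons_val_one, cons_val', cons_val_fin_one]
      linarith
    refine ⟨!![x, -c; a, x + b], ⟨⟨hdet, by simpa using h6⟩, ?_, by simpa using ha⟩, ?_⟩
    · rw [key _ (by rw [hdet]; exact hn')]
      rw [← hPD.qf_eq_zero_iff hz] at h
      simpa using h
    · simp
      ring

lemma trSet_finite {n : ℕ} (hn : 0 < n) {z : ℂ} (hz : 0 < z.im) : (trSet n z).Finite :=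
  (Set.finite_Icc (-(2 * n : ℤ)) (2 * n)).subset fun r hr => by
    have h := trSet_sq_lt hn hz hr
    have hn' : (0 : ℤ) < n := by exact_mod_cast hn
    constructor <;> nlinarith

/-- Preimages of points under `js`. -/
noncomputable def jsInv (X : ℂ) : ℂ := (exists_js_eq X).choose

lemma jsInv_im (X : ℂ) : 0 < (jsInv X).im := (exists_js_eq X).choose_spec.1

lemma js_jsInv (X : ℂ) : js (jsInv X) = X := (exists_js_eq X).choose_spec.2

lemma rootMultiplicity_mul_eps_eq {n : ℕ} (hn : 0 < n) {p : Polynomial ℂ} (hp0 : p ≠ 0)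
    (hp : ∀ z : ℂ, 0 < z.im → Psi n z = p.eval (js z)) {z : ℂ} (hz : 0 < z.im) :
    p.rootMultiplicity (js z) * eps z = 4 * (trSet n (jsInv (js z))).ncard := by
  rw [rootMultiplicity_mul_eps hn hp0 hp hz, card_idxFix hn hz,
    trSet_of_js_eq hn hz (jsInv_im _) (js_jsInv _)]

open Classical in
lemma t2Star_eq_sum {n : ℕ} (hn : 0 < n) {p : Polynomial ℂ} (hp0 : p ≠ 0)
    (hp : ∀ z : ℂ, 0 < z.im → Psi n z = p.eval (js z)) (P : Polynomial ℂ) {r : ℤ}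
    (hr : r ^ 2 < 4 * n) :
    t2Star 6 P (4 * n - r ^ 2) =
      ∑ X ∈ p.roots.toFinset.filter (fun X => r ∈ trSet n (jsInv X)),
        P.eval X / eps (jsInv X) := by
  have hd : 0 < 4 * (n : ℤ) - r ^ 2 := by linarith
  rw [t2Star, if_pos hd, classTrace]
  set S := QdN (4 * n - r ^ 2) 6
  have hPD : ∀ Q : S, PD Q.1 ∧ Q.1.det = ((4 * n - r ^ 2 : ℤ) : ℝ) / 4 :=
    fun Q => PD_of_mem_QdN hd Q.2
  have hlift : ∀ Q Q' : S, formRel (FrickeGroup 6) S Q Q' →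
      js (cmPointC Q.1) = js (cmPointC Q'.1) := by
    rintro Q Q' ⟨g, hg, h⟩
    rw [h, js_cm_congr (hPD Q).1 hg]
  let F : Quot (formRel (FrickeGroup 6) S) → ℂ := Quot.lift (fun Q => js (cmPointC Q.1)) hlift
  have hF : ∀ O, js (cmPointC (Quot.out O).1) = F O := fun O => by
    conv_rhs => rw [← Quot.out_eq O]
  have hinj : Function.Injective F := by
    intro O O' h
    rw [← hF, ← hF] at h
    obtain ⟨e, he, g, hg, h1⟩ :=
      exists_AL_of_js_eq (hPD O'.out).1.im_pos (hPD O.out).1.im_pos h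
    rw [← moebius_eq_mact he (g := mkG he hg) rfl] at h1
    have h2 := (hPD O.out).1.congr_eq (hPD O'.out).1
      ((hPD O.out).2.trans (hPD O'.out).2.symm) _ h1
    rw [← Quot.out_eq O, ← Quot.out_eq O']
    exact Quot.sound ⟨_, mkG_mem he hg, h2.symm⟩
  have htr : ∀ Q : S, r ∈ trSet n (jsInv (js (cmPointC Q.1))) := fun Q => by
    rw [← trSet_of_js_eq hn (hPD Q).1.im_pos (jsInv_im _) (js_jsInv _)]
    exact (mem_trSet_iff hn (hPD Q).1.im_pos hr).2 ⟨Q.1, Q.2, rfl⟩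
  have hmult : ∀ X : ℂ, r ∈ trSet n (jsInv X) → 0 < p.rootMultiplicity X := by
    intro X hX
    have h1 := rootMultiplicity_mul_eps_eq hn hp0 hp (jsInv_im X)
    rw [js_jsInv] at h1
    have h2 : 0 < (trSet n (jsInv X)).ncard :=
      (Set.ncard_pos (trSet_finite hn (jsInv_im X))).2 ⟨r, hX⟩
    exact Nat.pos_of_ne_zero fun h => by rw [h] at h1; omega
  have hrange : Set.range F =
      ↑(p.roots.toFinset.filter (fun X => r ∈ trSet n (jsInv X))) := by
    ext X
    rw [Finset.mem_coe, Finset.mem_filter, Multiset.mem_toFinset]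
    constructor
    · rintro ⟨O, rfl⟩
      rw [← hF]
      refine ⟨?_, htr _⟩
      rw [← Multiset.count_pos, Polynomial.count_roots]
      exact hmult _ (htr _)
    · rintro ⟨-, hX⟩
      obtain ⟨Q, hQ, h⟩ := (mem_trSet_iff hn (jsInv_im X) hr).1 hX
      refine ⟨Quot.mk _ ⟨Q, hQ⟩, ?_⟩
      change js (cmPointC Q) = X
      rw [h, js_jsInv]
  have hterm : ∀ O : Quot (formRel (FrickeGroup 6) S),
      P.eval (jnStar 6 (cmPointC (Quot.out O).1)) /
        (stabOrder (FrickeGroup 6) (Quot.out O).1 : ℂ) =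
      P.eval (F O) / eps (jsInv (F O)) := by
    intro O
    have hz := (hPD O.out).1.im_pos
    have h1 := rootMultiplicity_mul_eps_eq hn hp0 hp hz
    have h2 := rootMultiplicity_mul_eps_eq hn hp0 hp (jsInv_im (F O))
    rw [js_jsInv] at h2
    rw [hF] at h1
    have h3 := hmult (F O) (by rw [← hF]; exact htr _)
    rw [stabOrder_eq (hPD O.out).1, jnStar_eq_js hz, hF,
      Nat.eq_of_mul_eq_mul_left h3 (h1.trans h2.symm)]
  rw [finsum_congr hterm, ← finsum_mem_range (f := fun X => P.eval X / (eps (jsInv X) : ℂ)) hinj,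
    hrange, finsum_mem_coe_finset]

/-- The sum of `P` over the roots of the polynomial representing `Psi n`, in terms of traces. -/
lemma sum_roots_eq_t2Star {n : ℕ} (hn : 0 < n) {p : Polynomial ℂ} (hp0 : p ≠ 0)
    (hp : ∀ z : ℂ, 0 < z.im → Psi n z = p.eval (js z)) (P : Polynomial ℂ) :
    (p.roots.map fun X => P.eval X).sum =
      4 * ∑ r ∈ (Finset.Icc (-(2 * n : ℤ)) (2 * n)).filter (fun r => r ^ 2 < 4 * (n : ℤ)),
        t2Star 6 P (4 * n - r ^ 2) := by
  classical
  set I := (Finset.Icc (-(2 * n : ℤ)) (2 * n)).filter (fun r => r ^ 2 < 4 * (n : ℤ))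
  have hn' : (0 : ℤ) < n := by exact_mod_cast hn
  have hI : ∀ X, trSet n (jsInv X) = ↑(I.filter fun r => r ∈ trSet n (jsInv X)) := by
    intro X
    ext r
    simp only [I, Finset.coe_filter, Finset.mem_filter, Finset.mem_Icc, Set.mem_ofPred_eq]
    constructor
    · intro hr
      have h := trSet_sq_lt hn (jsInv_im X) hr
      exact ⟨⟨⟨by nlinarith, by nlinarith⟩, h⟩, hr⟩
    · exact fun h => h.2
  have h1 : ∀ r ∈ I, t2Star 6 P (4 * n - r ^ 2) = ∑ X ∈ p.roots.toFinset,
      if r ∈ trSet n (jsInv X) then P.eval X / (eps (jsInv X) : ℂ) else 0 := by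
    intro r hr
    rw [t2Star_eq_sum hn hp0 hp P (Finset.mem_filter.1 hr).2, Finset.sum_filter]
  rw [Finset.sum_congr rfl h1, Finset.sum_comm, Finset.sum_multiset_map_count, Finset.mul_sum]
  refine Finset.sum_congr rfl fun X _ => ?_
  have h2 := rootMultiplicity_mul_eps_eq hn hp0 hp (jsInv_im X)
  rw [js_jsInv, hI X, Set.ncard_coe_finset] at h2
  have h3 : ((eps (jsInv X) : ℕ) : ℂ) ≠ 0 := by exact_mod_cast (eps_pos _).ne'
  rw [← Finset.sum_filter, Finset.sum_const, Polynomial.count_roots, nsmul_eq_mul, nsmul_eq_mul]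
  have h4 : (p.rootMultiplicity X : ℂ) * eps (jsInv X) =
      4 * (I.filter fun r => r ∈ trSet n (jsInv X)).card := by exact_mod_cast h2
  rw [← mul_assoc, ← h4]
  field_simp

lemma t2Star_neg (P : Polynomial ℂ) {k : ℤ} (hk : 0 ≤ k) :
    t2Star 6 P (-k) = if k = 0 then 5 / 2 else if k = 1 then -1 else if k = 4 then -2 else 0 := by
  rw [t2Star, if_neg (by omega)]
  simp only [neg_eq_zero, neg_inj]
  norm_num

lemma sum_t2Star_nonpos (P : Polynomial ℂ) {n : ℕ} (hn : 0 < n) :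
    ∑ p ∈ n.divisorsAntidiagonal, ((if p.1 = p.2 then 10 else 0) + 4 * pB p.1 p.2) =
      2 * ∑ r ∈ Finset.Icc (-(2 * n + 2 : ℕ) : ℤ) (2 * n + 2 : ℕ),
        if r ^ 2 < 4 * (n : ℤ) then 0 else t2Star 6 P (4 * n - r ^ 2) := by
  set f : ℤ → ℂ := fun r => if r ^ 2 < 4 * (n : ℤ) then 0 else t2Star 6 P (4 * n - r ^ 2) with hf
  have heven : f.Even := fun r => by simp [hf]
  have hf0 : f 0 = 0 := by simp [hf, hn]
  rw [Finset.sum_Icc_of_even_eq_range heven, hf0, sub_zero]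
  set u : ℕ × ℕ → ℂ := fun p => if p.1 ≤ p.2 then t2Star 6 P (-((p.2 : ℤ) - p.1) ^ 2) else 0 with hu
  have hval : ∀ p : ℕ × ℕ, p.1 ≤ p.2 → t2Star 6 P (-((p.2 : ℤ) - p.1) ^ 2) =
      if p.1 = p.2 then 5 / 2 else if p.2 = p.1 + 1 then -1 else if p.2 = p.1 + 2 then -2 else 0 := by
    rintro ⟨a, d⟩ h
    simp only at h ⊢
    obtain ⟨k, rfl⟩ := Nat.exists_eq_add_of_le h
    rw [t2Star_neg P (sq_nonneg _)]
    push_cast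
    rw [add_sub_cancel_left]
    rcases k with _ | _ | _ | k
    · simp
    · simp
    · simp
    · have h1 : (9 : ℤ) ≤ ((k + 1 + 1 + 1 : ℕ) : ℤ) ^ 2 := by push_cast; nlinarith
      rw [if_neg (by omega), if_neg (by omega), if_neg (by omega), if_neg (by omega),
        if_neg (by omega), if_neg (by omega)]
  have hsplit : ∀ p : ℕ × ℕ, (if p.1 = p.2 then (10 : ℂ) else 0) + 4 * pB p.1 p.2 =
      2 * (u p + u p.swap) := by
    rintro ⟨a, d⟩
    simp only [hu, Prod.fst_swap, Prod.snd_swap]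
    have h1 := hval (a, d)
    have h2 := hval (d, a)
    simp only at h1 h2
    rcases lt_trichotomy a d with h | rfl | h
    · rw [if_pos h.le, if_neg (by omega : ¬ d ≤ a), h1 h.le, pB]
      split_ifs <;> first | omega | norm_num
    · rw [if_pos le_rfl, h1 le_rfl, pB]
      split_ifs <;> first | omega | norm_num
    · rw [if_neg (by omega : ¬ a ≤ d), if_pos h.le, h2 h.le, pB]
      split_ifs <;> first | omega | norm_num
  have hswap : ∑ p ∈ n.divisorsAntidiagonal, u p.swap = ∑ p ∈ n.divisorsAntidiagonal, u p :=
    Finset.sum_nbij' Prod.swap Prod.swap (fun p hp => Nat.swap_mem_divisorsAntidiagonal.2 hp)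
      (fun p hp => Nat.swap_mem_divisorsAntidiagonal.2 hp) (by simp) (by simp) (by simp)
  have hmain : ∑ p ∈ n.divisorsAntidiagonal.filter (fun p => p.1 ≤ p.2), u p =
      ∑ k ∈ Finset.range (2 * n + 2 + 1), f k := by
    refine Finset.sum_of_injOn (fun p : ℕ × ℕ => p.1 + p.2) ?_ ?_ ?_ ?_
    · rintro ⟨a, d⟩ hp ⟨a', d'⟩ hp' h
      simp only [Finset.coe_filter, Nat.mem_divisorsAntidiagonal, Set.mem_ofPred_eq] at hp hp' h
      obtain ⟨⟨h1, -⟩, h2⟩ := hp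
      obtain ⟨⟨h1', -⟩, h2'⟩ := hp'
      have h3 : a = a' := by
        have hd : (d : ℤ) = a' + d' - a := by omega
        have h4 : (a : ℤ) * d = a' * d' := by exact_mod_cast h1.trans h1'.symm
        rw [hd] at h4
        have h5 : ((a : ℤ) - a') * (a - d') = 0 := by linear_combination -h4
        rcases mul_eq_zero.1 h5 with h6 | h6 <;> omega
      simp only [Prod.mk.injEq]
      omega
    · rintro ⟨a, d⟩ hp
      simp only [Finset.coe_filter, Nat.mem_divisorsAntidiagonal, Set.mem_ofPred_eq] at hp
      obtain ⟨⟨h1, -⟩, h2⟩ := hp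
      have ha : a ≤ n := Nat.le_of_dvd hn ⟨d, h1.symm⟩
      have hd : d ≤ n := Nat.le_of_dvd hn ⟨a, by rw [mul_comm]; exact h1.symm⟩
      simp only [Finset.coe_range, Set.mem_Iio]
      omega
    · intro k hk hk'
      by_contra hne
      apply hk'
      simp only [hf] at hne
      have h1 : ¬ (k : ℤ) ^ 2 < 4 * n := fun h => hne (if_pos h)
      rw [if_neg h1, show 4 * (n : ℤ) - (k : ℤ) ^ 2 = -((k : ℤ) ^ 2 - 4 * n) by ring,
        t2Star_neg P (by omega)] at hne
      obtain ⟨s, hs⟩ : ∃ s : ℕ, (k : ℤ) ^ 2 - 4 * n = s ^ 2 := by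
        by_cases e0 : (k : ℤ) ^ 2 - 4 * n = 0
        · exact ⟨0, by simpa using e0⟩
        by_cases e1 : (k : ℤ) ^ 2 - 4 * n = 1
        · exact ⟨1, by simpa using e1⟩
        by_cases e4 : (k : ℤ) ^ 2 - 4 * n = 4
        · exact ⟨2, by simpa using e4⟩
        rw [if_neg e0, if_neg e1, if_neg e4] at hne
        exact absurd rfl hne
      have hsk : s < k := by
        have : (s : ℤ) ^ 2 < (k : ℤ) ^ 2 := by omega
        exact_mod_cast lt_of_pow_lt_pow_left₀ 2 (by positivity) this
      obtain ⟨m, rfl⟩ := Nat.exists_eq_add_of_lt hsk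
      obtain ⟨a, ha⟩ : 2 ∣ m + 1 := by
        have h2 : (2 : ℤ) ∣ ((m : ℤ) + 1) ^ 2 := by
          refine ⟨2 * n - s * (m + 1), ?_⟩
          push_cast at hs
          linear_combination hs
        exact_mod_cast Int.prime_two.dvd_of_dvd_pow h2
      refine ⟨(a, s + a), ?_, ?_⟩
      · simp only [Finset.coe_filter, Nat.mem_divisorsAntidiagonal, Set.mem_ofPred_eq]
        refine ⟨⟨?_, hn.ne'⟩, by omega⟩
        have h3 : ((m : ℤ) + 1) = 2 * a := by exact_mod_cast ha
        push_cast at hs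
        have h4 : (a : ℤ) * (s + a) = n := by
          rw [add_assoc, h3] at hs
          linarith
        exact_mod_cast h4
      · simp only
        omega
    · rintro ⟨a, d⟩ hp
      simp only [Nat.mem_divisorsAntidiagonal, Finset.mem_filter] at hp
      obtain ⟨⟨h1, -⟩, h2⟩ := hp
      have h3 : ((a : ℤ) + d) ^ 2 - 4 * n = (d - a) ^ 2 := by
        rw [← h1]; push_cast; ring
      simp only [hu, hf]
      push_cast
      rw [if_pos h2, if_neg (by nlinarith [sq_nonneg ((d : ℤ) - a)])]
      congr 1
      linarith
  have hu' : ∑ p ∈ n.divisorsAntidiagonal, u p =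
      ∑ p ∈ n.divisorsAntidiagonal.filter (fun p => p.1 ≤ p.2), u p := by
    rw [Finset.sum_filter]
    refine Finset.sum_congr rfl fun p _ => ?_
    simp only [hu]
    split_ifs <;> rfl
  rw [Finset.sum_congr rfl fun p _ => hsplit p, ← Finset.mul_sum, Finset.sum_add_distrib, hswap,
    hu', hmain, nsmul_eq_mul]
  push_cast
  ring

lemma finsum_t2Star (P : Polynomial ℂ) {n : ℕ} (hn : 0 < n) :
    ∑ᶠ r : ℤ, t2Star 6 P (4 * n - r ^ 2) =
      ∑ r ∈ (Finset.Icc (-(2 * n : ℤ)) (2 * n)).filter (fun r => r ^ 2 < 4 * (n : ℤ)),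
        t2Star 6 P (4 * n - r ^ 2) +
      ∑ r ∈ Finset.Icc (-(2 * n + 2 : ℕ) : ℤ) (2 * n + 2 : ℕ),
        if r ^ 2 < 4 * (n : ℤ) then 0 else t2Star 6 P (4 * n - r ^ 2) := by
  have hn' : (0 : ℤ) < n := by exact_mod_cast hn
  rw [finsum_eq_sum_of_support_subset (s := Finset.Icc (-(2 * n + 2 : ℕ) : ℤ) (2 * n + 2 : ℕ))]
  · have h1 : (Finset.Icc (-(2 * n : ℤ)) (2 * n)).filter (fun r => r ^ 2 < 4 * (n : ℤ)) =
        (Finset.Icc (-(2 * n + 2 : ℕ) : ℤ) (2 * n + 2 : ℕ)).filter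
          (fun r => r ^ 2 < 4 * (n : ℤ)) := by
      ext r
      simp only [Finset.mem_filter, Finset.mem_Icc]
      push_cast
      constructor
      · rintro ⟨⟨h1, h2⟩, h3⟩
        exact ⟨⟨by omega, by omega⟩, h3⟩
      · rintro ⟨-, h3⟩
        exact ⟨⟨by nlinarith, by nlinarith⟩, h3⟩
    rw [h1, Finset.sum_filter, ← Finset.sum_add_distrib]
    refine Finset.sum_congr rfl fun r _ => ?_
    split_ifs <;> simp
  · intro r hr
    rw [Function.mem_support] at hr
    simp only [Finset.coe_Icc, Set.mem_Icc]
    push_cast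
    by_contra hcon
    apply hr
    have h2 : 4 * (n : ℤ) + 4 < r ^ 2 := by
      by_contra! h3
      exact hcon ⟨by nlinarith, by nlinarith⟩
    rw [show 4 * (n : ℤ) - r ^ 2 = -(r ^ 2 - 4 * n) by ring, t2Star_neg P (by omega),
      if_neg (by omega), if_neg (by omega), if_neg (by omega)]

lemma sigmaN_natCast {N : ℕ} (hN : 0 < N) {k : ℕ} (hk : 0 < k) :
    sigmaN N (k : ℚ) = sig k - N * sigd N k := by
  have hk' : (k : ℚ) ≠ 0 := by exact_mod_cast hk.ne'
  have hmul : ∑ d ∈ k.divisors.filter (fun d => N ∣ d), (d : ℂ) = N * sigd N k := by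
    rw [sigd]
    split_ifs with h
    · obtain ⟨m, rfl⟩ := h
      rw [Nat.mul_div_cancel_left _ hN, sig, Finset.mul_sum]
      symm
      refine Finset.sum_of_injOn (fun d => N * d) (fun a _ b _ h => Nat.eq_of_mul_eq_mul_left hN h)
        ?_ ?_ (fun d _ => by push_cast; rfl)
      · intro d hd
        have := Nat.mem_divisors.1 (Finset.mem_coe.1 hd)
        simp only [Finset.coe_filter, Nat.mem_divisors, Set.mem_ofPred_eq]
        exact ⟨⟨Nat.mul_dvd_mul_left N this.1, hk.ne'⟩, dvd_mul_right _ _⟩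
      · intro d hd hd'
        obtain ⟨h1, x, rfl⟩ := Finset.mem_filter.1 hd
        refine absurd ⟨x, ?_, rfl⟩ hd'
        have h2 := (Nat.mem_divisors.1 h1).1
        exact Nat.mem_divisors.2 ⟨Nat.dvd_of_mul_dvd_mul_left hN h2,
          fun h => by simp [h] at hk⟩
    · rw [mul_zero, Finset.sum_eq_zero]
      intro d hd
      obtain ⟨h1, h2⟩ := Finset.mem_filter.1 hd
      exact absurd (h2.trans (Nat.mem_divisors.1 h1).1) h
  rw [sigmaN, if_neg hk', if_pos ⟨by positivity, Rat.den_natCast k⟩, Rat.num_natCast,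
    Int.toNat_natCast, ← hmul, sig, eq_sub_iff_add_eq, add_comm]
  exact Finset.sum_filter_add_sum_filter_not _ _ _

lemma sigmaN_div {N m : ℕ} (hN : 0 < N) (hm : 0 < m) {k : ℕ} (hk : 0 < k) :
    sigmaN N ((k : ℚ) / m) = sigd m k - N * sigd (m * N) k := by
  have hm' : (m : ℚ) ≠ 0 := by exact_mod_cast hm.ne'
  by_cases h : m ∣ k
  · obtain ⟨l, rfl⟩ := h
    rw [Nat.cast_mul, mul_div_cancel_left₀ _ hm', sigmaN_natCast hN (Nat.pos_of_mul_pos_left hk)]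
    rw [sigd, sigd, sigd, if_pos (dvd_mul_right m l), Nat.mul_div_cancel_left _ hm,
      Nat.mul_div_mul_left _ _ hm]
    simp only [Nat.mul_dvd_mul_iff_left hm]
  · have h1 : ¬ m * N ∣ k := fun h' => h ((dvd_mul_right m N).trans h')
    have h2 : (k : ℚ) / m ≠ 0 := by
      have : (k : ℚ) ≠ 0 := by exact_mod_cast hk.ne'
      positivity
    rw [sigd, sigd, if_neg h, if_neg h1, sigmaN, if_neg h2, if_neg]
    · simp
    · rintro ⟨-, h3⟩
      apply h
      have h4 := Rat.coe_int_num_of_den_eq_one h3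
      rw [eq_div_iff hm'] at h4
      have h5 : ((k : ℚ) / m).num * (m : ℤ) = k := by exact_mod_cast h4
      exact_mod_cast (Dvd.intro_left _ h5 : (m : ℤ) ∣ k)

lemma sigmaN_of_neg (N : ℕ) {x : ℚ} (hx : x < 0) : sigmaN N x = 0 := by
  rw [sigmaN, if_neg hx.ne, if_neg fun h => absurd h.1 hx.not_gt]

lemma finsum_t2Star_neg_one (P : Polynomial ℂ) : ∑ᶠ r : ℤ, t2Star 6 P (4 * (-1) - r ^ 2) = -2 := by
  rw [finsum_eq_single _ 0]
  · rw [show (4 * (-1) - 0 ^ 2 : ℤ) = -4 by norm_num, t2Star_neg P (by norm_num)]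
    norm_num
  · intro r hr
    have : 0 < r ^ 2 := by positivity
    rw [show (4 * (-1) - r ^ 2 : ℤ) = -(r ^ 2 + 4) by ring, t2Star_neg P (by omega),
      if_neg (by omega), if_neg (by omega), if_neg (by omega)]

lemma finsum_t2Star_zero (P : Polynomial ℂ) : ∑ᶠ r : ℤ, t2Star 6 P (4 * 0 - r ^ 2) = -7 / 2 := by
  have h : ∀ r : ℤ, t2Star 6 P (4 * 0 - r ^ 2) =
      if r ^ 2 = 0 then 5 / 2 else if r ^ 2 = 1 then -1 else if r ^ 2 = 4 then -2 else 0 := by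
    intro r
    rw [mul_zero, zero_sub, t2Star_neg P (sq_nonneg r)]
  rw [finsum_congr h, finsum_eq_sum_of_support_subset (s := {-2, -1, 0, 1, 2})]
  · norm_num
  · intro r hr
    rw [Function.mem_support] at hr
    by_contra hcon
    simp only [Finset.coe_insert, Finset.coe_singleton, Set.mem_insert_iff,
      Set.mem_singleton_iff] at hcon
    have h2 : 9 ≤ r ^ 2 := by
      rcases (by omega : r ≤ -3 ∨ 3 ≤ r) with h | h <;> nlinarith
    rw [if_neg (by omega), if_neg (by omega), if_neg (by omega)] at hr
    exact hr rfl

end FrickeSix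

/-- **Theorem 1.1, level 6, part 1.**
For any `n ≥ -1`,
`2n c_n^{(6)} = Σ_{r ∈ ℤ} t₂^{(6*)}(4n - r²) + 7σ₁^{(6)}(n) + 26σ₁^{(3)}(n/2) - 3σ₁^{(2)}(n/3)`. -/
theorem trace_formula_jn_six
    (c : ℤ → ℂ) (hc : HasQExp (jn 6) c (-1))
    (P : Polynomial ℂ) (e : ℤ → ℂ)
    (hP : HasQExp (fun z => Polynomial.eval (jnStar 6 z) P) e (-2))
    (he2 : e (-2) = 1) (he1 : e (-1) = 0) (he0 : e 0 = 0)
    (n : ℤ) (hn : -1 ≤ n) :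
    2 * (n : ℂ) * c n =
      (∑ᶠ r : ℤ, t2Star 6 P (4 * n - r ^ 2)) +
        7 * sigmaN 6 (n : ℚ) + 26 * sigmaN 3 ((n : ℚ) / 2) - 3 * sigmaN 2 ((n : ℚ) / 3) := by
  obtain ⟨hc1, -, hc6, -⟩ := FrickeSix.tq_expansion hc
  rcases (by omega : n = -1 ∨ n = 0 ∨ 0 < n) with rfl | rfl | hpos
  · rw [FrickeSix.finsum_t2Star_neg_one, hc1, FrickeSix.sigmaN_of_neg _ (by norm_num),
      FrickeSix.sigmaN_of_neg _ (by norm_num), FrickeSix.sigmaN_of_neg _ (by norm_num)]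
    norm_num
  · rw [FrickeSix.finsum_t2Star_zero]
    norm_num [sigmaN]
  · lift n to ℕ using hpos.le
    have hn0 : 0 < n := by exact_mod_cast hpos
    obtain ⟨p, hp⟩ := FrickeSix.exists_Psi_eq hn0
    obtain ⟨hp0, hsum⟩ := FrickeSix.sum_roots hc hP he2 he1 he0 hn0 hp
    rw [FrickeSix.sum_roots_eq_t2Star hn0 hp0 hp P, FrickeSix.sum_beta hn0 (by simpa using hc6),
      FrickeSix.sum_t2Star_nonpos P hn0] at hsum
    have h6 := FrickeSix.sigmaN_natCast (N := 6) (by norm_num) hn0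
    have h3 := FrickeSix.sigmaN_div (N := 3) (m := 2) (by norm_num) (by norm_num) hn0
    have h2 := FrickeSix.sigmaN_div (N := 2) (m := 3) (by norm_num) (by norm_num) hn0
    norm_num only at h6 h3 h2
    rw [FrickeSix.finsum_t2Star P hn0, Int.cast_natCast, Int.cast_natCast, h6, h3, h2]
    linear_combination -hsum / 4
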